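/- (Positivity, Lee–Schiffler) Assume the initial exchange matrix B is skew-symmetric. Then every cluster variable obtained from the initial seed ((X_1,…,X_r), B) by a finite sequence of mutations is a Laurent polynomial in X_1,…,X_r with non-negative integer coefficients, i.e. it lies in ℤ_{≥0}[X_1^{±1},…,X_r^{±1}]. -/

import Mathlib

namespace Cluster

/-- The ambient field `F = ℚ(X_1, …, X_r)` of rational functions. -/
abbrev F (r : ℕ) : Type := FractionRing (MvPolynomial (Fin r) ℚ)

/-- The initial cluster variables `X_i ∈ F`. -/
noncomputable def Xvar (r : ℕ) (i : Fin r) : F r :=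
  algebraMap (MvPolynomial (Fin r) ℚ) (F r) (MvPolynomial.X i)

/-- Matrix mutation `μ_k(B)`. -/
def mutateB (r : ℕ) (B : Matrix (Fin r) (Fin r) ℤ) (kk : Fin r) :
    Matrix (Fin r) (Fin r) ℤ :=
  fun i j =>
    if i = kk ∨ j = kk then -B i j
    else B i j + (if B i kk < 0 then -1 else 1) * max (B i kk * B kk j) 0

/-- The exchange relation: the new cluster variable produced by mutation
in direction `kk`. -/
noncomputable def mutateVar (r : ℕ) (u : Fin r → F r)
    (B : Matrix (Fin r) (Fin r) ℤ) (kk : Fin r) : F r :=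
  ((∏ i ∈ Finset.univ.filter fun i => 0 < B i kk, u i ^ (B i kk).toNat) +
      ∏ i ∈ Finset.univ.filter fun i => B i kk < 0, u i ^ (-B i kk).toNat) /
    u kk

/-- Cluster mutation `μ_kk` on the tuple of cluster variables. -/
noncomputable def mutateU (r : ℕ) (u : Fin r → F r)
    (B : Matrix (Fin r) (Fin r) ℤ) (kk : Fin r) : Fin r → F r :=
  Function.update u kk (mutateVar r u B kk)

/-- `B` is skew-symmetrizable: `D B` is skew-symmetric for some diagonal `D`
with positive integer entries. -/
def IsSkewSymmetrizable (r : ℕ) (B : Matrix (Fin r) (Fin r) ℤ) : Prop :=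
  ∃ d : Fin r → ℤ, (∀ i, 0 < d i) ∧ ∀ i j, d i * B i j = -(d j * B j i)

/-- The seeds obtained from the initial seed `((X_1, …, X_r), B0)` by finite
sequences of mutations. -/
inductive IsSeed (r : ℕ) (B0 : Matrix (Fin r) (Fin r) ℤ) :
    (Fin r → F r) → Matrix (Fin r) (Fin r) ℤ → Prop where
  | init : IsSeed r B0 (Xvar r) B0
  | mutate {u : Fin r → F r} {B : Matrix (Fin r) (Fin r) ℤ} (kk : Fin r) :
      IsSeed r B0 u B → IsSeed r B0 (mutateU r u B kk) (mutateB r B kk)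

/-- `v ∈ F` is a cluster variable of the cluster algebra with initial seed
`((X_1, …, X_r), B0)`. -/
def IsClusterVariable (r : ℕ) (B0 : Matrix (Fin r) (Fin r) ℤ) (v : F r) : Prop :=
  ∃ u B, IsSeed r B0 u B ∧ ∃ i, v = u i

/-- `v ∈ F` is a cluster monomial: a monomial in the cluster variables of a
single cluster. -/
def IsClusterMonomial (r : ℕ) (B0 : Matrix (Fin r) (Fin r) ℤ) (v : F r) : Prop :=
  ∃ u B, IsSeed r B0 u B ∧ ∃ e : Fin r → ℕ, v = ∏ i, u i ^ e i

end Cluster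

open Cluster


set_option linter.unusedSectionVars false
set_option linter.unusedSimpArgs false
set_option linter.unusedVariables false
set_option linter.unusedDecidableInType false
set_option linter.unusedFintypeInType false


namespace Cluster

noncomputable section PartOne

variable {ι : Type} [Fintype ι] [DecidableEq ι]

/-- the pairing of an exponent with a rational vector -/
def pr (n : ι →₀ ℕ) (m : ι → ℚ) : ℚ := ∑ i, (n i : ℚ) * m i

/-- the vector attached to an exponent -/
def ps (B : Matrix ι ι ℤ) (n : ι →₀ ℕ) : ι → ℚ := fun i => ∑ j, (B i j : ℚ) * n j

/-- the bilinear form -/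
def om (B : Matrix ι ι ℤ) (a b : ι →₀ ℕ) : ℚ := pr a (ps B b)

theorem pr_add (a b : ι →₀ ℕ) (m : ι → ℚ) : pr (a + b) m = pr a m + pr b m := by
  simp [pr, add_mul, Finset.sum_add_distrib]

theorem pr_add_right (a : ι →₀ ℕ) (m m' : ι → ℚ) : pr a (m + m') = pr a m + pr a m' := by
  simp [pr, mul_add, Finset.sum_add_distrib]

theorem pr_smul_right (a : ι →₀ ℕ) (c : ℚ) (m : ι → ℚ) : pr a (c • m) = c * pr a m := by
  simp only [pr, Pi.smul_apply, smul_eq_mul, Finset.mul_sum]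
  exact Finset.sum_congr rfl fun i _ => by ring

@[simp] theorem pr_zero (m : ι → ℚ) : pr (0 : ι →₀ ℕ) m = 0 := by simp [pr]

theorem pr_nsmul (k : ℕ) (a : ι →₀ ℕ) (m : ι → ℚ) : pr (k • a) m = k * pr a m := by
  simp [pr, Finset.mul_sum, mul_assoc]

theorem ps_add (B : Matrix ι ι ℤ) (a b : ι →₀ ℕ) : ps B (a + b) = ps B a + ps B b := by
  ext i; simp [ps, mul_add, Finset.sum_add_distrib]

@[simp] theorem ps_zero (B : Matrix ι ι ℤ) : ps B 0 = 0 := by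
  ext i; simp [ps]

theorem ps_nsmul (B : Matrix ι ι ℤ) (k : ℕ) (a : ι →₀ ℕ) : ps B (k • a) = (k : ℚ) • ps B a := by
  ext i; simp only [ps, Finsupp.smul_apply, smul_eq_mul, Pi.smul_apply, Finset.mul_sum]
  exact Finset.sum_congr rfl fun j _ => by push_cast; ring

theorem om_add (B : Matrix ι ι ℤ) (a b c : ι →₀ ℕ) : om B (a + b) c = om B a c + om B b c :=
  pr_add _ _ _

theorem om_add_right (B : Matrix ι ι ℤ) (a b c : ι →₀ ℕ) : om B c (a + b) = om B c a + om B c b := by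
  simp [om, ps_add, pr_add_right]

@[simp] theorem om_zero (B : Matrix ι ι ℤ) (a : ι →₀ ℕ) : om B 0 a = 0 := by simp [om]

@[simp] theorem om_zero_right (B : Matrix ι ι ℤ) (a : ι →₀ ℕ) : om B a 0 = 0 := by simp [om, pr]

theorem om_nsmul (B : Matrix ι ι ℤ) (k : ℕ) (a b : ι →₀ ℕ) : om B (k • a) b = k * om B a b :=
  pr_nsmul _ _ _

theorem om_nsmul_right (B : Matrix ι ι ℤ) (k : ℕ) (a b : ι →₀ ℕ) : om B b (k • a) = k * om B b a := by
  simp [om, ps_nsmul, pr_smul_right]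

/-- skew symmetric matrices -/
class Skew (B : Matrix ι ι ℤ) : Prop where
  skew : ∀ i j, B i j = - B j i

theorem om_skew (B : Matrix ι ι ℤ) [Skew B] (a b : ι →₀ ℕ) : om B a b = - om B b a := by
  simp only [om, pr, ps, Finset.mul_sum]
  rw [Finset.sum_comm, ← Finset.sum_neg_distrib]
  refine Finset.sum_congr rfl fun j _ => ?_
  rw [← Finset.sum_neg_distrib]
  refine Finset.sum_congr rfl fun i _ => ?_
  rw [Skew.skew (B := B) i j]; push_cast; ring

theorem om_self (B : Matrix ι ι ℤ) [Skew B] (a : ι →₀ ℕ) : om B a a = 0 := by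
  have := om_skew B a a; linarith

/-- the algebra -/
structure Alg (B : Matrix ι ι ℤ) : Type where
  /-- the coefficients -/
  f : (ι →₀ ℕ) → (ι → ℚ) → ℚ

variable (B : Matrix ι ι ℤ)

instance : CoeFun (Alg B) (fun _ => (ι →₀ ℕ) → (ι → ℚ) → ℚ) := ⟨Alg.f⟩

/-- elements as functions -/
def algEquiv : Alg B ≃ ((ι →₀ ℕ) → (ι → ℚ) → ℚ) := ⟨Alg.f, Alg.mk, fun _ => rfl, fun _ => rfl⟩

instance : AddCommGroup (Alg B) := (algEquiv B).addCommGroup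

instance : Module ℚ (Alg B) := (algEquiv B).module ℚ

variable {B}

@[ext] theorem Alg.ext2 {S T : Alg B} (h : ∀ n m, S n m = T n m) : S = T := by
  cases S; cases T; congr; funext n m; exact h n m

@[simp] theorem add_ap (S T : Alg B) (n : ι →₀ ℕ) (m : ι → ℚ) : (S + T) n m = S n m + T n m := rfl
@[simp] theorem sub_ap (S T : Alg B) (n : ι →₀ ℕ) (m : ι → ℚ) : (S - T) n m = S n m - T n m := rfl
@[simp] theorem neg_ap (S : Alg B) (n : ι →₀ ℕ) (m : ι → ℚ) : (-S) n m = -S n m := rfl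
@[simp] theorem zero_ap (n : ι →₀ ℕ) (m : ι → ℚ) : (0 : Alg B) n m = 0 := rfl
@[simp] theorem zero_ap' (n : ι →₀ ℕ) : (0 : Alg B) n = 0 := rfl
@[simp] theorem smul_ap (c : ℚ) (S : Alg B) (n : ι →₀ ℕ) (m : ι → ℚ) : (c • S) n m = c * S n m := rfl

theorem sum_ap {α : Type*} (s : Finset α) (f : α → Alg B) (n : ι →₀ ℕ) (m : ι → ℚ) :
    (∑ i ∈ s, f i) n m = ∑ i ∈ s, f i n m := by
  classical
  induction s using Finset.induction_on with
  | empty => simp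
  | insert a s ha ih => simp [Finset.sum_insert ha, ih]

instance : Mul (Alg B) :=
  ⟨fun S T => ⟨fun n m => ∑ p ∈ Finset.HasAntidiagonal.antidiagonal n, S p.1 (m + ps B p.2) * T p.2 m⟩⟩

instance : One (Alg B) := ⟨⟨fun n _ => if n = 0 then 1 else 0⟩⟩

theorem mul_ap (S T : Alg B) (n : ι →₀ ℕ) (m : ι → ℚ) :
    (S * T) n m = ∑ p ∈ Finset.HasAntidiagonal.antidiagonal n, S p.1 (m + ps B p.2) * T p.2 m := rfl

theorem one_ap (n : ι →₀ ℕ) (m : ι → ℚ) : (1 : Alg B) n m = if n = 0 then 1 else 0 := rfl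

theorem alg_mul_assoc (S T U : Alg B) : S * T * U = S * (T * U) := by
  ext n m
  simp only [mul_ap, Finset.sum_mul, Finset.mul_sum, Finset.sum_sigma']
  apply Finset.sum_nbij' (fun ⟨⟨_i, j⟩, ⟨k, l⟩⟩ ↦ ⟨(k, l + j), (l, j)⟩)
    (fun ⟨⟨i, _j⟩, ⟨k, l⟩⟩ ↦ ⟨(i + k, l), (i, k)⟩) <;>
  simp only [Finset.HasAntidiagonal.mem_antidiagonal, Finset.mem_sigma, Sigma.forall, Prod.forall, and_imp]
  · rintro a b c d rfl rfl; simp [add_assoc]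
  · rintro a b c d rfl rfl; simp [add_assoc]
  · rintro a b c d rfl rfl; simp
  · rintro a b c d rfl rfl; simp
  · rintro a b c d rfl rfl
    rw [ps_add, mul_assoc, add_comm (ps B d), add_assoc]

theorem alg_one_mul (S : Alg B) : 1 * S = S := by
  ext n m
  rw [mul_ap, Finset.sum_eq_single (0, n)]
  · simp [one_ap]
  · rintro ⟨a, b⟩ h hne
    rw [Finset.HasAntidiagonal.mem_antidiagonal] at h
    simp only at h
    have : a ≠ 0 := by rintro rfl; apply hne; simp at h; simp [h]
    simp [one_ap, this]
  · intro h; simp at h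

theorem alg_mul_one (S : Alg B) : S * 1 = S := by
  ext n m
  rw [mul_ap, Finset.sum_eq_single (n, 0)]
  · simp [one_ap]
  · rintro ⟨a, b⟩ h hne
    rw [Finset.HasAntidiagonal.mem_antidiagonal] at h
    simp only at h
    have : b ≠ 0 := by rintro rfl; apply hne; simp at h; simp [h]
    simp [one_ap, this]
  · intro h; simp at h

instance : Ring (Alg B) :=
  { (inferInstance : AddCommGroup (Alg B)), (inferInstance : Mul (Alg B)),
    (inferInstance : One (Alg B)) with
    mul_assoc := alg_mul_assoc
    one_mul := alg_one_mul
    mul_one := alg_mul_one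
    left_distrib := fun S T U => by
      ext n m; simp [mul_ap, mul_add, Finset.sum_add_distrib]
    right_distrib := fun S T U => by
      ext n m; simp [mul_ap, add_mul, Finset.sum_add_distrib]
    zero_mul := fun S => by ext n m; simp [mul_ap]
    mul_zero := fun S => by ext n m; simp [mul_ap]
    zsmul := fun k S => k • S
    zsmul_zero' := fun S => by simp
    zsmul_succ' := fun k S => SubNegMonoid.zsmul_succ' k S
    zsmul_neg' := fun k S => SubNegMonoid.zsmul_neg' k S }

theorem smul_mul_alg (c : ℚ) (S T : Alg B) : (c • S) * T = c • (S * T) := by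
  ext n m; simp only [mul_ap, smul_ap, Finset.mul_sum, mul_assoc]

theorem mul_smul_alg (c : ℚ) (S T : Alg B) : S * (c • T) = c • (S * T) := by
  ext n m; simp only [mul_ap, smul_ap, Finset.mul_sum]
  exact Finset.sum_congr rfl fun p _ => by ring

theorem deg_le_of_mem {n : ι →₀ ℕ} {p : (ι →₀ ℕ) × (ι →₀ ℕ)} (h : p ∈ Finset.HasAntidiagonal.antidiagonal n) :
    p.1.degree + p.2.degree = n.degree := by
  rw [Finset.HasAntidiagonal.mem_antidiagonal] at h
  rw [← h, map_add]

theorem deg_pos {n : ι →₀ ℕ} (h : n ≠ 0) : 0 < n.degree := by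
  rw [Nat.pos_iff_ne_zero]; simpa [Finsupp.degree_eq_zero_iff] using h

theorem ne_zero_of_deg {n : ι →₀ ℕ} (h : 0 < n.degree) : n ≠ 0 := by
  rintro rfl; simp at h

/-- agreement up to degree `K` -/
def EqK (K : ℕ) (S T : Alg B) : Prop := ∀ n : ι →₀ ℕ, n.degree ≤ K → S n = T n

theorem EqK.mul {K : ℕ} {S S' T T' : Alg B} (h : EqK K S S') (h' : EqK K T T') :
    EqK K (S * T) (S' * T') := by
  intro n hn
  funext m
  simp only [mul_ap]
  refine Finset.sum_congr rfl fun p hp => ?_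
  have := deg_le_of_mem hp
  rw [h _ (by omega), h' _ (by omega)]

/-- congruence modulo degree `> K` -/
def conK (B : Matrix ι ι ℤ) (K : ℕ) : RingCon (Alg B) where
  r := EqK K
  iseqv := ⟨fun _ _ _ => rfl, fun h n hn => (h n hn).symm, fun h h' n hn => (h n hn).trans (h' n hn)⟩
  add' := fun {a b c d} h h' n hn => by
    funext m; simp [h n hn, h' n hn]
  mul' := fun h h' => h.mul h'

/-- the truncated algebra -/
abbrev AlgK (B : Matrix ι ι ℤ) (K : ℕ) := (conK B K).Quotient

/-- truncation -/
def q (K : ℕ) : Alg B →+* AlgK B K := (conK B K).mk'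

theorem q_eq {K : ℕ} {S T : Alg B} : q K S = q K T ↔ EqK K S T := RingCon.eq _

theorem eq_of_q {S T : Alg B} (h : ∀ K, q K S = q K T) : S = T := by
  ext n m; rw [q_eq.1 (h n.degree) n le_rfl]

theorem q_surj {K : ℕ} (x : AlgK B K) : ∃ S, q K S = x := RingCon.mk'_surjective _ x

theorem EqK.mono {K K' : ℕ} {S T : Alg B} (h : EqK K S T) (hk : K' ≤ K) : EqK K' S T :=
  fun n hn => h n (hn.trans hk)

/-- recursion on the degree -/
theorem exists_rec {V : Type*} [Inhabited V] (Φ : ((ι →₀ ℕ) → V) → (ι →₀ ℕ) → V)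
    (h : ∀ S T n, (∀ a : ι →₀ ℕ, a.degree < n.degree → S a = T a) → Φ S n = Φ T n) :
    ∃ T, ∀ n, T n = Φ T n := by
  let S : ℕ → (ι →₀ ℕ) → V := fun k => Φ^[k] (fun _ => default)
  have key : ∀ k, ∀ n : ι →₀ ℕ, n.degree < k → S k n = S (k + 1) n := by
    intro k
    induction k with
    | zero => intro n hn; omega
    | succ k ih =>
      intro n hn
      simp only [S, Function.iterate_succ_apply'] at ih ⊢
      apply h
      intro a ha
      exact ih a (by omega)
  have key2 : ∀ k, ∀ n : ι →₀ ℕ, n.degree < k → S (n.degree + 1) n = S k n := by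
    intro k n hn
    induction k, hn using Nat.le_induction with
    | base => rfl
    | succ k hk ih => rw [ih]; exact key k n hk
  refine ⟨fun n => S (n.degree + 1) n, fun n => ?_⟩
  show S (n.degree + 1) n = _
  rw [show S (n.degree + 1) n = Φ (S n.degree) n by simp only [S, Function.iterate_succ_apply']]
  apply h
  intro a ha
  exact (key2 _ _ ha).symm

/-- both factors nonzero part of a product -/
def mid (S T : Alg B) : Alg B := ⟨fun n m =>
  ∑ p ∈ (Finset.HasAntidiagonal.antidiagonal n).filter (fun p => p.1 ≠ 0 ∧ p.2 ≠ 0), S p.1 (m + ps B p.2) * T p.2 m⟩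

theorem mid_congr {S S' T T' : Alg B} {n : ι →₀ ℕ}
    (h : ∀ a : ι →₀ ℕ, a.degree < n.degree → S a = S' a)
    (h' : ∀ a : ι →₀ ℕ, a.degree < n.degree → T a = T' a) : mid S T n = mid S' T' n := by
  funext m
  refine Finset.sum_congr rfl fun p hp => ?_
  rw [Finset.mem_filter] at hp
  have := deg_le_of_mem hp.1
  have h1 := deg_pos hp.2.1
  have h2 := deg_pos hp.2.2
  rw [h _ (by omega), h' _ (by omega)]

theorem mul_zero_ap (S T : Alg B) (m : ι → ℚ) : (S * T) 0 m = S 0 m * T 0 m := by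
  simp [mul_ap]

theorem mul_mid (S T : Alg B) {n : ι →₀ ℕ} (hn : n ≠ 0) (m : ι → ℚ) :
    (S * T) n m = S n m * T 0 m + S 0 (m + ps B n) * T n m + mid S T n m := by
  rw [mul_ap]
  change _ = _ + ∑ p ∈ (Finset.HasAntidiagonal.antidiagonal n).filter (fun p => p.1 ≠ 0 ∧ p.2 ≠ 0), S p.1 (m + ps B p.2) * T p.2 m
  rw [Finset.sum_filter]
  have h1 : (n, (0 : ι →₀ ℕ)) ∈ Finset.HasAntidiagonal.antidiagonal n := by simp
  have h2 : ((0 : ι →₀ ℕ), n) ∈ (Finset.HasAntidiagonal.antidiagonal n).erase (n, 0) := by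
    simp [Finset.mem_erase, hn]
  rw [← Finset.add_sum_erase _ _ h1, ← Finset.add_sum_erase _ _ h2,
    ← Finset.add_sum_erase (a := (n, (0 : ι →₀ ℕ))) _ _ h1,
    ← Finset.add_sum_erase (a := ((0 : ι →₀ ℕ), n)) _ _ h2]
  simp only [ps_zero, add_zero, ne_eq, not_true_eq_false, and_false, if_false, false_and, zero_add]
  rw [← add_assoc]
  congr 1
  refine Finset.sum_congr rfl fun p hp => ?_
  rw [Finset.mem_erase, Finset.mem_erase, Finset.HasAntidiagonal.mem_antidiagonal] at hp
  obtain ⟨a, b⟩ := p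
  obtain ⟨h3, h4, h5⟩ := hp
  simp only at h5
  rw [if_pos]
  constructor
  · rintro rfl; simp at h5; simp [h5] at h3
  · rintro rfl; simp at h5; simp [h5] at h4

/-- unipotent elements -/
def Uni (T : Alg B) : Prop := T 0 = 1

theorem Uni.mul {S T : Alg B} (h : Uni S) (h' : Uni T) : Uni (S * T) := by
  funext m; rw [mul_zero_ap, h, h']; simp

theorem uni_one : Uni (1 : Alg B) := by funext m; simp [one_ap]

theorem Uni.ap {T : Alg B} (h : Uni T) (m : ι → ℚ) : T 0 m = 1 := by rw [h]; rfl

theorem exists_rinv {T : Alg B} (h : Uni T) : ∃ S, Uni S ∧ T * S = 1 := by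
  obtain ⟨S, hS⟩ := exists_rec (V := (ι → ℚ) → ℚ)
    (fun S n => if n = 0 then 1 else - T n - mid T (⟨S⟩ : Alg B) n) (by
      intro S S' n hn
      split_ifs with h0
      · rfl
      · rw [mid_congr (fun _ _ => rfl) hn])
  have h0 : Uni (⟨S⟩ : Alg B) := by show S 0 = 1; rw [hS]; simp
  refine ⟨⟨S⟩, h0, ?_⟩
  ext n m
  by_cases hn : n = 0
  · subst hn; rw [mul_zero_ap, h.ap, h0.ap]; simp [one_ap]
  · rw [mul_mid _ _ hn, h.ap, h0.ap, one_ap, if_neg hn]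
    have : S n m = - T n m - mid T (⟨S⟩ : Alg B) n m := by
      have := congrFun (hS n) m
      rw [if_neg hn] at this
      exact this
    change T n m * 1 + 1 * S n m + _ = 0
    rw [this]; ring

theorem Uni.isUnit {T : Alg B} (h : Uni T) : IsUnit T := by
  obtain ⟨S, hS, h1⟩ := exists_rinv h
  obtain ⟨U, hU, h2⟩ := exists_rinv hS
  have : T = U := by
    calc T = T * (S * U) := by rw [h2, mul_one]
      _ = U := by rw [← mul_assoc, h1, one_mul]
  subst this
  exact ⟨⟨T, S, h1, h2⟩, rfl⟩

/-- inverse -/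
noncomputable def iv (T : Alg B) : Alg B := Ring.inverse T

theorem Uni.mul_iv {T : Alg B} (h : Uni T) : T * iv T = 1 := Ring.mul_inverse_cancel _ h.isUnit
theorem Uni.iv_mul {T : Alg B} (h : Uni T) : iv T * T = 1 := Ring.inverse_mul_cancel _ h.isUnit

theorem Uni.iv {T : Alg B} (h : Uni T) : Uni (iv T) := by
  obtain ⟨S, hS, h1⟩ := exists_rinv h
  have : Cluster.iv T = S := by
    calc Cluster.iv T = Cluster.iv T * (T * S) := by rw [h1, mul_one]
      _ = S := by rw [← mul_assoc, h.iv_mul, one_mul]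
  rw [this]; exact hS

theorem Uni.cancel_left {T X Y : Alg B} (h : Uni T) (e : T * X = T * Y) : X = Y := by
  calc X = Cluster.iv T * (T * X) := by rw [← mul_assoc, h.iv_mul, one_mul]
    _ = Y := by rw [e, ← mul_assoc, h.iv_mul, one_mul]

theorem Uni.cancel_right {T X Y : Alg B} (h : Uni T) (e : X * T = Y * T) : X = Y := by
  calc X = X * T * Cluster.iv T := by rw [mul_assoc, h.mul_iv, mul_one]
    _ = Y := by rw [e, mul_assoc, h.mul_iv, mul_one]

theorem Uni.iv_eq {T S : Alg B} (h : Uni T) (e : T * S = 1) : Cluster.iv T = S :=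
  h.cancel_left (by rw [h.mul_iv, e])

/-- elements supported in a monoid of exponents -/
def supp (B : Matrix ι ι ℤ) (P : AddSubmonoid (ι →₀ ℕ)) : Subring (Alg B) where
  carrier := {T | ∀ n, n ∉ P → T n = 0}
  mul_mem' := by
    intro S T hS hT n hn
    funext m
    rw [mul_ap]
    refine Finset.sum_eq_zero fun p hp => ?_
    rw [Finset.HasAntidiagonal.mem_antidiagonal] at hp
    by_cases h1 : p.1 ∈ P
    · have h2 : p.2 ∉ P := fun h2 => hn (hp ▸ P.add_mem h1 h2)
      rw [hT _ h2]; simp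
    · rw [hS _ h1]; simp
  one_mem' := by
    intro n hn
    have : n ≠ 0 := by rintro rfl; exact hn P.zero_mem
    funext m; simp [one_ap, this]
  add_mem' := by
    intro S T hS hT n hn
    funext m; simp [hS n hn, hT n hn]
  zero_mem' := fun _ _ => rfl
  neg_mem' := by
    intro S hS n hn
    funext m; simp [hS n hn]

theorem mem_supp {P : AddSubmonoid (ι →₀ ℕ)} {T : Alg B} : T ∈ supp B P ↔ ∀ n, n ∉ P → T n = 0 :=
  Iff.rfl

theorem supp_mono {P Q : AddSubmonoid (ι →₀ ℕ)} (h : P ≤ Q) : supp B P ≤ supp B Q :=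
  fun _ hT n hn => hT n fun hp => hn (h hp)

theorem mid_eq_zero {P : AddSubmonoid (ι →₀ ℕ)} {S T : Alg B} {n : ι →₀ ℕ} (hn : n ∉ P)
    (hS : ∀ a : ι →₀ ℕ, a.degree < n.degree → a ∉ P → S a = 0)
    (hT : ∀ a : ι →₀ ℕ, a.degree < n.degree → a ∉ P → T a = 0) : mid S T n = 0 := by
  funext m
  refine Finset.sum_eq_zero fun p hp => ?_
  rw [Finset.mem_filter] at hp
  have := deg_le_of_mem hp.1
  have h1 := deg_pos hp.2.1
  have h2 := deg_pos hp.2.2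
  have h3 := Finset.HasAntidiagonal.mem_antidiagonal.1 hp.1
  by_cases h1 : p.1 ∈ P
  · have h2 : p.2 ∉ P := fun h2 => hn (h3 ▸ P.add_mem h1 h2)
    rw [hT _ (by omega) h2]; simp
  · rw [hS _ (by omega) h1]; simp

theorem iv_mem_supp {P : AddSubmonoid (ι →₀ ℕ)} {T : Alg B} (h : Uni T) (hT : T ∈ supp B P) :
    iv T ∈ supp B P := by
  have key : ∀ d, ∀ n : ι →₀ ℕ, n.degree < d → n ∉ P → iv T n = 0 := by
    intro d
    induction d with
    | zero => intro n hn; omega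
    | succ d ih =>
      intro n hn hP
      have h0 : n ≠ 0 := by rintro rfl; exact hP P.zero_mem
      funext m
      have e := congrArg (fun T : Alg B => T n m) h.mul_iv
      rw [mul_mid _ _ h0, h.ap, h.iv.ap, mid_eq_zero hP (fun a _ => hT a)
        (fun a ha hp => ih a (by omega) hp), hT n hP] at e
      simpa [one_ap, h0] using e
  exact fun n hn => key _ n (Nat.lt_succ_self _) hn

/-- the Euler derivation attached to an additive functional -/
def Eu (l : (ι →₀ ℕ) →+ ℚ) (T : Alg B) : Alg B := ⟨fun n m => l n * T n m⟩

theorem Eu_ap (l : (ι →₀ ℕ) →+ ℚ) (T : Alg B) (n : ι →₀ ℕ) (m : ι → ℚ) :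
    Eu l T n m = l n * T n m := rfl

theorem Eu_mul (l : (ι →₀ ℕ) →+ ℚ) (S T : Alg B) : Eu l (S * T) = Eu l S * T + S * Eu l T := by
  ext n m
  simp only [Eu_ap, add_ap, mul_ap, Finset.mul_sum]
  rw [← Finset.sum_add_distrib]
  refine Finset.sum_congr rfl fun p hp => ?_
  rw [Finset.HasAntidiagonal.mem_antidiagonal] at hp
  rw [← hp, map_add]; ring

theorem Eu_add (l : (ι →₀ ℕ) →+ ℚ) (S T : Alg B) : Eu l (S + T) = Eu l S + Eu l T := by
  ext n m; simp [Eu_ap, mul_add]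

theorem Eu_one (l : (ι →₀ ℕ) →+ ℚ) : Eu l (1 : Alg B) = 0 := by
  ext n m; by_cases h : n = 0 <;> simp [Eu_ap, one_ap, h]

theorem Eu_comm (l l' : (ι →₀ ℕ) →+ ℚ) (T : Alg B) : Eu l (Eu l' T) = Eu l' (Eu l T) := by
  ext n m; simp only [Eu_ap]; ring

theorem Eu_iv (l : (ι →₀ ℕ) →+ ℚ) {T : Alg B} (h : Uni T) :
    Eu l (iv T) = - (iv T * Eu l T * iv T) := by
  apply h.cancel_left
  have := Eu_mul l T (iv T)
  rw [h.mul_iv, Eu_one] at this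
  rw [mul_neg, ← mul_assoc, ← mul_assoc, h.mul_iv, one_mul]
  exact (neg_eq_of_add_eq_zero_right this.symm).symm

theorem Eu_mem (l : (ι →₀ ℕ) →+ ℚ) {P : AddSubmonoid (ι →₀ ℕ)} {T : Alg B} (h : T ∈ supp B P) :
    Eu l T ∈ supp B P := fun n hn => by funext m; simp [Eu_ap, h n hn]

/-- hamiltonian elements -/
def ham (B : Matrix ι ι ℤ) (x : (ι →₀ ℕ) → ℚ) : Alg B := ⟨fun n m => x n * pr n m⟩

theorem ham_ap (x : (ι →₀ ℕ) → ℚ) (n : ι →₀ ℕ) (m : ι → ℚ) : ham B x n m = x n * pr n m := rfl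

theorem ham_add (x y : (ι →₀ ℕ) → ℚ) : ham B (x + y) = ham B x + ham B y := by
  ext n m; simp [ham_ap, add_mul]

theorem ham_sub (x y : (ι →₀ ℕ) → ℚ) : ham B (x - y) = ham B x - ham B y := by
  ext n m; simp [ham_ap, sub_mul]

theorem ham_neg (x : (ι →₀ ℕ) → ℚ) : ham B (-x) = - ham B x := by
  ext n m; simp [ham_ap]

/-- the bracket -/
def br (B : Matrix ι ι ℤ) (x y : (ι →₀ ℕ) → ℚ) : (ι →₀ ℕ) → ℚ := fun n =>
  ∑ p ∈ Finset.HasAntidiagonal.antidiagonal n, om B p.1 p.2 * x p.1 * y p.2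

theorem sum_swap (n : ι →₀ ℕ) (f : (ι →₀ ℕ) × (ι →₀ ℕ) → ℚ) :
    ∑ p ∈ Finset.HasAntidiagonal.antidiagonal n, f p =
      ∑ p ∈ Finset.HasAntidiagonal.antidiagonal n, f p.swap := by
  refine Finset.sum_nbij' Prod.swap Prod.swap ?_ ?_ ?_ ?_ ?_ <;>
    simp [Finset.HasAntidiagonal.mem_antidiagonal, add_comm]

theorem ham_br [Skew B] (x y : (ι →₀ ℕ) → ℚ) :
    ham B x * ham B y - ham B y * ham B x = ham B (br B x y) := by
  ext n m
  simp only [sub_ap, mul_ap, ham_ap, br]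
  rw [sum_swap n (fun p => y p.1 * pr p.1 (m + ps B p.2) * (x p.2 * pr p.2 m)),
    ← Finset.sum_sub_distrib, Finset.sum_mul]
  refine Finset.sum_congr rfl fun p hp => ?_
  rw [Finset.HasAntidiagonal.mem_antidiagonal] at hp
  simp only [Prod.fst_swap, Prod.snd_swap, pr_add_right, ← hp, pr_add]
  change x p.1 * (pr p.1 m + om B p.1 p.2) * (y p.2 * pr p.2 m) -
    y p.2 * (pr p.2 m + om B p.2 p.1) * (x p.1 * pr p.1 m) = _
  rw [om_skew B p.2 p.1]; ring

theorem exists_pr_ne {n : ι →₀ ℕ} (h : n ≠ 0) : ∃ m, pr n m ≠ 0 := by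
  classical
  obtain ⟨i, hi⟩ := Finsupp.ne_iff.1 h
  refine ⟨Pi.single i 1, ?_⟩
  simp [pr, Pi.single_apply] at hi ⊢
  exact hi

theorem ham_inj {x y : (ι →₀ ℕ) → ℚ} {n : ι →₀ ℕ} (hn : n ≠ 0)
    (h : ham B x n = ham B y n) : x n = y n := by
  obtain ⟨m, hm⟩ := exists_pr_ne hn
  have := congrFun h m
  exact mul_right_cancel₀ hm this

theorem ham_mem {P : AddSubmonoid (ι →₀ ℕ)} {x : (ι →₀ ℕ) → ℚ} (h : ∀ n, n ∉ P → x n = 0) :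
    ham B x ∈ supp B P := fun n hn => by funext m; simp [ham_ap, h n hn]

theorem of_ham_mem {P : AddSubmonoid (ι →₀ ℕ)} {x : (ι →₀ ℕ) → ℚ} (h : ham B x ∈ supp B P) 
    (n : ι →₀ ℕ) (hn : n ∉ P) : x n = 0 := by
  have : n ≠ 0 := by rintro rfl; exact hn P.zero_mem
  obtain ⟨m, hm⟩ := exists_pr_ne this
  have := congrFun (h n hn) m
  simpa [ham_ap, hm] using this

end PartOne

end Cluster


namespace Cluster

noncomputable section PartTwo

variable {ι : Type} [Fintype ι] [DecidableEq ι] {B : Matrix ι ι ℤ}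

/-- the degree as a rational functional -/
def dg (ι : Type) : (ι →₀ ℕ) →+ ℚ := (Nat.castAddMonoidHom ℚ).comp Finsupp.degree

theorem dg_ap (n : ι →₀ ℕ) : dg ι n = n.degree := rfl

theorem dg_ne {n : ι →₀ ℕ} (h : n ≠ 0) : dg ι n ≠ 0 := by
  rw [dg_ap]; exact_mod_cast (deg_pos h).ne'

/-- hamiltonian coefficient -/
def InG (Z : Alg B) (n : ι →₀ ℕ) : Prop := ∃ z : ℚ, ∀ m, Z n m = z * pr n m

open Classical in
/-- hamiltonian function -/
def gp (Z : Alg B) (n : ι →₀ ℕ) : ℚ := if h : n ≠ 0 ∧ InG Z n then h.2.choose else 0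

theorem gp_zero (Z : Alg B) : gp Z 0 = 0 := by simp [gp]

theorem InG.eq {Z : Alg B} {n : ι →₀ ℕ} (h : InG Z n) : Z n = ham B (gp Z) n := by
  funext m
  rw [ham_ap]
  by_cases hn : n = 0
  · subst hn
    obtain ⟨z, hz⟩ := h
    simp [hz, gp_zero]
  · rw [gp, dif_pos ⟨hn, h⟩]
    exact h.choose_spec m

theorem inG_iff {Z : Alg B} {n : ι →₀ ℕ} {x : (ι →₀ ℕ) → ℚ} (h : Z n = ham B x n) : InG Z n :=
  ⟨x n, fun m => by rw [h, ham_ap]⟩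

theorem inG_ham (x : (ι →₀ ℕ) → ℚ) (n : ι →₀ ℕ) : InG (ham B x) n := inG_iff rfl

theorem gp_of {Z : Alg B} {n : ι →₀ ℕ} (hn : n ≠ 0) {x : (ι →₀ ℕ) → ℚ} (h : Z n = ham B x n) :
    gp Z n = x n := by
  apply ham_inj (B := B) hn
  rw [← (inG_iff h).eq, h]

theorem gp_congr {Z W : Alg B} {n : ι →₀ ℕ} (h : Z n = W n) : gp Z n = gp W n := by
  by_cases h0 : n ≠ 0 ∧ InG W n
  · exact gp_of h0.1 (h.trans h0.2.eq)
  · rw [gp, gp, dif_neg h0, dif_neg]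
    rintro ⟨h1, z, hz⟩
    exact h0 ⟨h1, z, fun m => by rw [← h, hz]⟩

theorem InG.congr {Z W : Alg B} {n : ι →₀ ℕ} (h : InG Z n) (e : W n = Z n) : InG W n := by
  obtain ⟨z, hz⟩ := h; exact ⟨z, fun m => by rw [e, hz]⟩

theorem InG.add {Z W : Alg B} {n : ι →₀ ℕ} (h : InG Z n) (h' : InG W n) : InG (Z + W) n := by
  obtain ⟨z, hz⟩ := h
  obtain ⟨w, hw⟩ := h'
  exact ⟨z + w, fun m => by simp [hz, hw, add_mul]⟩

theorem InG.smul {Z : Alg B} {n : ι →₀ ℕ} (h : InG Z n) (c : ℚ) : InG (c • Z) n := by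
  obtain ⟨z, hz⟩ := h
  exact ⟨c * z, fun m => by simp [hz, mul_assoc]⟩

theorem InG.neg {Z : Alg B} {n : ι →₀ ℕ} (h : InG Z n) : InG (-Z) n := by
  obtain ⟨z, hz⟩ := h
  exact ⟨- z, fun m => by simp [hz]⟩

theorem inG_zero (n : ι →₀ ℕ) : InG (0 : Alg B) n := ⟨0, fun m => by simp⟩

theorem inG_of_zero {Z : Alg B} {n : ι →₀ ℕ} (h : Z n = 0) : InG Z n := ⟨0, fun m => by simp [h]⟩

theorem inG_sum {α : Type*} (s : Finset α) (f : α → Alg B) (n : ι →₀ ℕ) (h : ∀ a ∈ s, InG (f a) n) :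
    InG (∑ a ∈ s, f a) n := by
  classical
  induction s using Finset.induction_on with
  | empty => simpa using inG_zero n
  | insert a s ha ih =>
    rw [Finset.sum_insert ha]
    exact (h a (by simp)).add (ih fun b hb => h b (by simp [hb]))

theorem eq_ham {Z : Alg B} (h : ∀ n, InG Z n) : Z = ham B (gp Z) := by
  ext n m; rw [← (h n).eq]

theorem ham_zero_ap (x : (ι →₀ ℕ) → ℚ) : ham B x 0 = 0 := by
  funext m; simp [ham_ap]

theorem prod_ham {Y Z : Alg B} {n : ι →₀ ℕ} (hn : n ≠ 0) (hY0 : InG Y 0) (hZ0 : Z 0 = 0)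
    (hY : ∀ a : ι →₀ ℕ, a.degree < n.degree → InG Y a)
    (hZ : ∀ a : ι →₀ ℕ, a.degree < n.degree → InG Z a) :
    (Y * Z) n = (ham B (gp Y) * ham B (gp Z)) n ∧ (Z * Y) n = (ham B (gp Z) * ham B (gp Y)) n := by
  have hY0' : Y 0 = 0 := by rw [hY0.eq, ham_zero_ap]
  constructor
  · funext m
    rw [mul_mid _ _ hn, mul_mid _ _ hn, hZ0, hY0', ham_zero_ap, ham_zero_ap,
      mid_congr (fun a ha => (hY a ha).eq) (fun a ha => (hZ a ha).eq)]
    simp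
  · funext m
    rw [mul_mid _ _ hn, mul_mid _ _ hn, hZ0, hY0', ham_zero_ap, ham_zero_ap,
      mid_congr (fun a ha => (hZ a ha).eq) (fun a ha => (hY a ha).eq)]
    simp

theorem KL [Skew B] (l : (ι →₀ ℕ) →+ ℚ) (e : ℚ) {Z Y F : Alg B} (d : ℕ)
    (h : Eu l Z - e • Z = Y * Z - Z * Y + F) (hZ0 : Z 0 = 0) (hZe : ∀ n, l n = e → InG Z n)
    (hY : ∀ a : ι →₀ ℕ, a.degree < d → InG Y a) (hF : ∀ a : ι →₀ ℕ, a.degree ≤ d → InG F a) :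
    ∀ n : ι →₀ ℕ, n.degree ≤ d → InG Z n := by
  have key : ∀ k, ∀ n : ι →₀ ℕ, n.degree < k → n.degree ≤ d → InG Z n := by
    intro k
    induction k with
    | zero => intro n hn; omega
    | succ k ih =>
      intro n hn hd
      by_cases h0 : n = 0
      · subst h0; exact inG_of_zero hZ0
      by_cases he : l n = e
      · exact hZe n he
      have hp := deg_pos h0
      obtain ⟨h1, h2⟩ := prod_ham h0 (hY 0 (by simp; omega)) hZ0 (fun a ha => hY a (by omega))
        (fun a ha => ih a (by omega) (by omega))
      obtain ⟨f, hf⟩ := hF n hd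
      refine ⟨(l n - e)⁻¹ * (br B (gp Y) (gp Z) n + f), fun m => ?_⟩
      have h3 := congrArg (fun T : Alg B => T n m) h
      have h4 := congrArg (fun T : Alg B => T n m) (ham_br (B := B) (gp Y) (gp Z))
      simp only [sub_ap, add_ap, smul_ap, Eu_ap, hf, h1, h2, ham_ap] at h3 h4
      have : l n - e ≠ 0 := sub_ne_zero.2 he
      rw [h4] at h3
      field_simp
      linarith
  exact fun n hn => key _ n (Nat.lt_succ_self _) hn

theorem mul_low {V h : Alg B} (hV : Uni V) (e : ℕ) (hh : ∀ a : ι →₀ ℕ, a.degree < e → h a = 0)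
    {n : ι →₀ ℕ} (hn : n.degree ≤ e) : (V * h) n = h n ∧ (h * V) n = h n := by
  by_cases h0 : n = 0
  · subst h0
    constructor <;> (funext m; rw [mul_zero_ap, hV.ap]; simp)
  · have := deg_pos h0
    have hz : h 0 = 0 := hh 0 (by simp; omega)
    have m1 : mid V h n = 0 := by
      rw [mid_congr (S' := V) (T' := 0) (fun _ _ => rfl) (fun a ha => hh a (by omega))]
      funext m; simp [mid]
    have m2 : mid h V n = 0 := by
      rw [mid_congr (S' := 0) (T' := V) (fun a ha => hh a (by omega)) (fun _ _ => rfl)]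
      funext m; simp [mid]
    constructor
    · funext m; rw [mul_mid _ _ h0, m1, hz, hV.ap]; simp
    · funext m; rw [mul_mid _ _ h0, m2, hz, hV.ap]; simp

theorem iv_iv {V : Alg B} (h : Uni V) : iv (iv V) = V := h.iv.iv_eq h.iv_mul

theorem Eu_single (b : ι →₀ ℕ) :
    Eu (dg ι) (ham B (Pi.single b 1)) = dg ι b • ham B (Pi.single b 1) := by
  ext n m
  simp only [Eu_ap, smul_ap, ham_ap]
  by_cases h : n = b
  · subst h; rfl
  · simp [h]

theorem conj_single {V Y : Alg B} (hV : Uni V) (hE : Eu (dg ι) V = Y * V) (b : ι →₀ ℕ) :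
    Eu (dg ι) (V * ham B (Pi.single b 1) * iv V) - dg ι b • (V * ham B (Pi.single b 1) * iv V)
      = Y * (V * ham B (Pi.single b 1) * iv V) - (V * ham B (Pi.single b 1) * iv V) * Y + 0 := by
  have e1 : Eu (dg ι) (iv V) = - (iv V * Y) := by
    rw [Eu_iv _ hV, hE, mul_assoc, mul_assoc, hV.mul_iv, mul_one]
  rw [Eu_mul, Eu_mul, e1, hE, Eu_single, mul_smul_alg, add_mul, smul_mul_alg]
  noncomm_ring

theorem single_low (b : ι →₀ ℕ) (a : ι →₀ ℕ) (h : a.degree < b.degree) :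
    ham B (Pi.single b 1) a = 0 := by
  have : a ≠ b := by rintro rfl; omega
  funext m; simp [ham_ap, this]

theorem conj_low {V : Alg B} (hV : Uni V) (b : ι →₀ ℕ) {n : ι →₀ ℕ} (hn : n.degree ≤ b.degree) :
    (V * ham B (Pi.single b 1) * iv V) n = ham B (Pi.single b 1) n := by
  have h1 : ∀ a : ι →₀ ℕ, a.degree ≤ b.degree → (V * ham B (Pi.single b 1)) a = ham B (Pi.single b 1) a :=
    fun a ha => (mul_low hV b.degree (single_low b) ha).1
  rw [(mul_low hV.iv b.degree (fun a ha => (h1 a ha.le).trans (single_low b a ha)) hn).2, h1 n hn]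

/-- exponents of degree at most `K` -/
def le_deg (ι : Type) [Fintype ι] (K : ℕ) : Finset (ι →₀ ℕ) := (Finsupp.finite_of_degree_le (σ := ι) K).toFinset

theorem mem_le_deg {K : ℕ} {n : ι →₀ ℕ} : n ∈ le_deg ι K ↔ n.degree ≤ K := by
  simp [le_deg]

theorem ham_decomp (K : ℕ) (x : (ι →₀ ℕ) → ℚ) :
    EqK K (ham B x) (∑ b ∈ le_deg ι K, x b • ham B (Pi.single b 1)) := by
  intro n hn
  funext m
  rw [sum_ap, Finset.sum_eq_single n]
  · simp [ham_ap]
  · intro b _ hb; simp [ham_ap, Ne.symm hb]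
  · intro h; exact absurd (mem_le_deg.2 hn) h

theorem EqK.refl (K : ℕ) (S : Alg B) : EqK K S S := fun _ _ => rfl

theorem EqK.symm {K : ℕ} {S T : Alg B} (h : EqK K S T) : EqK K T S := fun n hn => (h n hn).symm

theorem EqK.trans {K : ℕ} {S T U : Alg B} (h : EqK K S T) (h' : EqK K T U) : EqK K S U :=
  fun n hn => (h n hn).trans (h' n hn)

theorem conj_decomp (K : ℕ) (V V' : Alg B) (x : (ι →₀ ℕ) → ℚ) :
    EqK K (V * ham B x * V') (∑ b ∈ le_deg ι K, x b • (V * ham B (Pi.single b 1) * V')) := by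
  have := ((EqK.refl K V).mul (ham_decomp (B := B) K x)).mul (EqK.refl K V')
  rw [Finset.mul_sum, Finset.sum_mul] at this
  simpa only [mul_smul_alg, smul_mul_alg] using this

theorem AdK [Skew B] {V Y : Alg B} (hV : Uni V) (hE : Eu (dg ι) V = Y * V) (d : ℕ)
    (hY : ∀ a : ι →₀ ℕ, a.degree < d → InG Y a) (x : (ι →₀ ℕ) → ℚ) (n : ι →₀ ℕ) (hn : n.degree ≤ d) :
    InG (V * ham B x * iv V) n := by
  refine InG.congr ?_ (conj_decomp n.degree V (iv V) x n le_rfl)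
  refine inG_sum _ _ _ fun b _ => InG.smul ?_ _
  refine KL (dg ι) (dg ι b) d (conj_single hV hE b) ?_ ?_ hY (fun a _ => inG_zero a) n hn
  · funext m; rw [mul_zero_ap, mul_zero_ap, ham_zero_ap]; simp
  · intro a ha
    have : a.degree = b.degree := by
      simp only [dg_ap] at ha; exact_mod_cast ha
    exact (inG_ham _ a).congr (conj_low hV b this.le)

/-- the group of hamiltonian elements -/
def GG (T : Alg B) : Prop := Uni T ∧ ∀ n, InG (Eu (dg ι) T * iv T) n

/-- logarithmic derivative -/
def xl (l : (ι →₀ ℕ) →+ ℚ) (T : Alg B) : (ι →₀ ℕ) → ℚ := gp (Eu l T * iv T)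

theorem GG.uni {T : Alg B} (h : GG T) : Uni T := h.1

theorem GG.of {T : Alg B} (h : Uni T) {x : (ι →₀ ℕ) → ℚ} (e : Eu (dg ι) T = ham B x * T) : GG T :=
  ⟨h, fun n => by rw [e, mul_assoc, h.mul_iv, mul_one]; exact inG_ham x n⟩

theorem GG.E {T : Alg B} (h : GG T) : Eu (dg ι) T = ham B (xl (dg ι) T) * T := by
  rw [xl, ← eq_ham h.2, mul_assoc, h.1.iv_mul, mul_one]

theorem xl_eq {T : Alg B} (h : Uni T) {l : (ι →₀ ℕ) →+ ℚ} {x : (ι →₀ ℕ) → ℚ}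
    (e : Eu l T = ham B x * T) {n : ι →₀ ℕ} (hn : n ≠ 0) : xl l T n = x n := by
  rw [xl, e, mul_assoc, h.mul_iv, mul_one]; exact gp_of hn rfl

theorem xl_zero (T : Alg B) (l : (ι →₀ ℕ) →+ ℚ) : xl l T 0 = 0 := gp_zero _

theorem gg_one : GG (1 : Alg B) :=
  GG.of uni_one (x := 0) (by rw [Eu_one]; ext n m; simp [ham_ap])

theorem Eu_zero_ap (l : (ι →₀ ℕ) →+ ℚ) (T : Alg B) : Eu l T 0 = 0 := by
  funext m; simp [Eu_ap]

theorem GG.El [Skew B] {T : Alg B} (h : GG T) (l : (ι →₀ ℕ) →+ ℚ) : Eu l T = ham B (xl l T) * T := by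
  have key : ∀ n, InG (Eu l T * iv T) n := by
    intro n
    refine KL (dg ι) 0 (Y := ham B (xl (dg ι) T)) (F := Eu l (ham B (xl (dg ι) T))) n.degree
      ?_ ?_ ?_ (fun a _ => inG_ham _ a) ?_ n le_rfl
    · have e1 : Eu (dg ι) (iv T) = - (iv T * ham B (xl (dg ι) T)) := by
        rw [Eu_iv _ h.uni, h.E, mul_assoc, mul_assoc, h.uni.mul_iv, mul_one]
      rw [Eu_mul, Eu_comm, h.E, Eu_mul, e1, zero_smul]
      have e2 : Eu l (ham B (xl (dg ι) T)) * T * iv T = Eu l (ham B (xl (dg ι) T)) := by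
        rw [mul_assoc, h.uni.mul_iv, mul_one]
      rw [add_mul, e2]
      noncomm_ring
    · funext m; rw [mul_zero_ap, Eu_zero_ap]; simp
    · intro a ha
      have : a = 0 := by by_contra h0; exact dg_ne h0 ha
      subst this
      exact inG_of_zero (by funext m; rw [mul_zero_ap, Eu_zero_ap]; simp)
    · intro a _
      exact ⟨l a * xl (dg ι) T a, fun m => by rw [Eu_ap, ham_ap, mul_assoc]⟩
  rw [xl, ← eq_ham key, mul_assoc, h.1.iv_mul, mul_one]

/-- membership can be tested with another grading -/
theorem GG.of_l [Skew B] {T : Alg B} (h : Uni T) {l : (ι →₀ ℕ) →+ ℚ} {x : (ι →₀ ℕ) → ℚ}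
    (e : Eu l T = ham B x * T) {P : AddSubmonoid (ι →₀ ℕ)} (hP : ∀ n ∈ P, l n = 0 → n = 0)
    (hT : T ∈ supp B P) : GG T := by
  refine ⟨h, fun n => ?_⟩
  have hs : Eu (dg ι) T * iv T ∈ supp B P := (supp B P).mul_mem (Eu_mem _ hT) (iv_mem_supp h hT)
  have z0 : (Eu (dg ι) T * iv T) 0 = 0 := by funext m; rw [mul_zero_ap, Eu_zero_ap]; simp
  refine KL l 0 (Y := ham B x) (F := Eu (dg ι) (ham B x)) n.degree
      ?_ z0 ?_ (fun a _ => inG_ham _ a) ?_ n le_rfl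
  · have e1 : Eu l (iv T) = - (iv T * ham B x) := by
      rw [Eu_iv _ h, e, mul_assoc, mul_assoc, h.mul_iv, mul_one]
    rw [Eu_mul, Eu_comm, e, Eu_mul, e1, zero_smul]
    have e2 : Eu (dg ι) (ham B x) * T * iv T = Eu (dg ι) (ham B x) := by
      rw [mul_assoc, h.mul_iv, mul_one]
    rw [add_mul, e2]
    noncomm_ring
  · intro a ha
    by_cases hp : a ∈ P
    · rw [hP a hp ha]; exact inG_of_zero z0
    · exact inG_of_zero (hs a hp)
  · intro a _
    exact ⟨dg ι a * x a, fun m => by rw [Eu_ap, ham_ap, mul_assoc]⟩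

/-- adjoint action -/
def Ad (S : Alg B) (y : (ι →₀ ℕ) → ℚ) : (ι →₀ ℕ) → ℚ := gp (S * ham B y * iv S)

theorem GG.ham_Ad [Skew B] {S : Alg B} (h : GG S) (y : (ι →₀ ℕ) → ℚ) :
    ham B (Ad S y) = S * ham B y * iv S :=
  (eq_ham fun n => AdK h.uni h.E n.degree (fun a _ => inG_ham _ a) y n le_rfl).symm

theorem Ad_zero (S : Alg B) (y : (ι →₀ ℕ) → ℚ) : Ad S y 0 = 0 := gp_zero _

theorem GG.mul [Skew B] {S T : Alg B} (h : GG S) (h' : GG T) : GG (S * T) := by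
  apply GG.of (h.uni.mul h'.uni) (x := xl (dg ι) S + Ad S (xl (dg ι) T))
  rw [ham_add, h.ham_Ad, Eu_mul, h.E, h'.E, add_mul]
  have : S * ham B (xl (dg ι) T) * iv S * (S * T) = S * ham B (xl (dg ι) T) * (iv S * S) * T := by
    noncomm_ring
  rw [this, h.uni.iv_mul]
  noncomm_ring

theorem xl_mul [Skew B] {S T : Alg B} (h : GG S) (h' : GG T) (l : (ι →₀ ℕ) →+ ℚ) :
    xl l (S * T) = xl l S + Ad S (xl l T) := by
  have e : Eu l (S * T) = ham B (xl l S + Ad S (xl l T)) * (S * T) := by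
    rw [ham_add, h.ham_Ad, Eu_mul, h.El, h'.El, add_mul]
    have : S * ham B (xl l T) * iv S * (S * T) = S * ham B (xl l T) * (iv S * S) * T := by
      noncomm_ring
    rw [this, h.uni.iv_mul]
    noncomm_ring
  funext n
  by_cases hn : n = 0
  · subst hn; simp [xl_zero, Ad_zero]
  · exact xl_eq (h.uni.mul h'.uni) e hn

theorem gg_of_left [Skew B] {V Y : Alg B} (hV : Uni V) (hE : Eu (dg ι) V = V * Y)
    (hY : ∀ n, InG Y n) : GG V := by
  have e : Eu (dg ι) V * iv V = V * ham B (gp Y) * iv V := by rw [hE, ← eq_ham hY]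
  have e2 : Eu (dg ι) V = (Eu (dg ι) V * iv V) * V := by rw [mul_assoc, hV.iv_mul, mul_one]
  refine ⟨hV, ?_⟩
  have key : ∀ k, ∀ n : ι →₀ ℕ, n.degree < k → InG (Eu (dg ι) V * iv V) n := by
    intro k
    induction k with
    | zero => intro n hn; omega
    | succ k ih =>
      intro n hn
      refine InG.congr (AdK hV e2 k ih (gp Y) n (by omega)) (by rw [e])
  exact fun n => key _ n (Nat.lt_succ_self _)

theorem GG.iv [Skew B] {S : Alg B} (h : GG S) : GG (iv S) := by
  refine gg_of_left h.uni.iv (Y := - ham B (xl (dg ι) S)) ?_ fun n => (inG_ham _ n).neg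
  rw [Eu_iv _ h.uni, h.E, mul_assoc, mul_assoc, h.uni.mul_iv, mul_one, mul_neg]

theorem factor_gg [Skew B] {P Q : AddSubmonoid (ι →₀ ℕ)} (hPQ : ∀ n, n ∈ P → n ∈ Q → n = 0)
    {F G : Alg B} (hF : Uni F) (hG : Uni G) (hFP : F ∈ supp B P) (hGQ : G ∈ supp B Q)
    (h : GG (F * G)) : GG F ∧ GG G := by
  set X := ham B (xl (dg ι) (F * G)) with hX
  set Y := iv F * Eu (dg ι) F with hY
  set Z := Eu (dg ι) G * iv G with hZ
  have hYs : Y ∈ supp B P := (supp B P).mul_mem (iv_mem_supp hF hFP) (Eu_mem _ hFP)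
  have hZs : Z ∈ supp B Q := (supp B Q).mul_mem (Eu_mem _ hGQ) (iv_mem_supp hG hGQ)
  have e := h.E
  rw [← hX, Eu_mul] at e
  have e1 : Y + Z = iv F * X * F := by
    have : iv F * (Eu (dg ι) F * G + F * Eu (dg ι) G) * iv G = iv F * (X * (F * G)) * iv G := by rw [e]
    have l1 : iv F * (Eu (dg ι) F * G + F * Eu (dg ι) G) * iv G =
      iv F * Eu (dg ι) F * (G * iv G) + (iv F * F) * (Eu (dg ι) G * iv G) := by noncomm_ring
    have l2 : iv F * (X * (F * G)) * iv G = iv F * X * F * (G * iv G) := by noncomm_ring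
    rw [l1, l2, hG.mul_iv, hF.iv_mul, mul_one, mul_one, one_mul] at this
    exact this
  have e2 : Eu (dg ι) (iv F) = (-Y) * iv F := by rw [Eu_iv _ hF, neg_mul]
  have key : ∀ k, ∀ n : ι →₀ ℕ, n.degree < k → InG Y n ∧ InG Z n := by
    intro k
    induction k with
    | zero => intro n hn; omega
    | succ k ih =>
      intro n hn
      have hW := AdK hF.iv e2 k (fun a ha => (ih a ha).1.neg) (xl (dg ι) (F * G)) n (by omega)
      rw [iv_iv hF, ← hX, ← e1] at hW
      by_cases hp : n ∈ P
      · by_cases hq : n ∈ Q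
        · rw [hPQ n hp hq]
          exact ⟨inG_of_zero (by funext m; rw [hY, mul_zero_ap, Eu_zero_ap]; simp),
            inG_of_zero (by funext m; rw [hZ, mul_zero_ap, Eu_zero_ap]; simp)⟩
        · have : Z n = 0 := hZs n hq
          exact ⟨hW.congr (by funext m; simp [this]), inG_of_zero this⟩
      · have : Y n = 0 := hYs n hp
        exact ⟨inG_of_zero this, hW.congr (by funext m; simp [this])⟩
  refine ⟨gg_of_left hF (Y := Y) ?_ fun n => (key _ n (Nat.lt_succ_self _)).1,
    hG, fun n => (key _ n (Nat.lt_succ_self _)).2⟩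
  rw [hY, ← mul_assoc, hF.mul_iv, one_mul]

theorem exists_expo (x : (ι →₀ ℕ) → ℚ) : ∃ T : Alg B, Uni T ∧ Eu (dg ι) T = ham B x * T := by
  obtain ⟨S, hS⟩ := exists_rec (V := (ι → ℚ) → ℚ)
    (fun S n => if n = 0 then 1 else (dg ι n)⁻¹ • (ham B x n + mid (ham B x) (⟨S⟩ : Alg B) n)) (by
      intro S S' n hn
      split_ifs with h0
      · rfl
      · rw [mid_congr (fun _ _ => rfl) hn])
  have h0 : Uni (⟨S⟩ : Alg B) := by show S 0 = 1; rw [hS]; simp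
  refine ⟨⟨S⟩, h0, ?_⟩
  ext n m
  by_cases hn : n = 0
  · subst hn; rw [mul_zero_ap, Eu_zero_ap, ham_zero_ap]; simp
  · rw [mul_mid _ _ hn, h0.ap, Eu_ap, ham_zero_ap]
    have : S n m = (dg ι n)⁻¹ * (ham B x n m + mid (ham B x) (⟨S⟩ : Alg B) n m) := by
      have := congrFun (hS n) m
      rw [if_neg hn] at this
      exact this
    change dg ι n * S n m = _
    have hd := dg_ne hn
    rw [this]; field_simp; simp

theorem expo_unique {S T : Alg B} (hS : Uni S) (hT : Uni T) {x y : (ι →₀ ℕ) → ℚ}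
    (e : Eu (dg ι) S = ham B x * S) (e' : Eu (dg ι) T = ham B y * T) (K : ℕ)
    (hxy : ∀ n : ι →₀ ℕ, n ≠ 0 → n.degree ≤ K → x n = y n) : EqK K S T := by
  have key : ∀ k, ∀ n : ι →₀ ℕ, n.degree < k → n.degree ≤ K → S n = T n := by
    intro k
    induction k with
    | zero => intro n hn; omega
    | succ k ih =>
      intro n hn hK
      by_cases h0 : n = 0
      · subst h0; rw [hS, hT]
      funext m
      have h1 := congrArg (fun T : Alg B => T n m) e
      have h2 := congrArg (fun T : Alg B => T n m) e'
      rw [mul_mid _ _ h0, ham_zero_ap, Eu_ap, hS.ap] at h1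
      rw [mul_mid _ _ h0, ham_zero_ap, Eu_ap, hT.ap] at h2
      have h3 : ∀ a : ι →₀ ℕ, a.degree ≤ K → ham B x a = ham B y a := by
        intro a ha
        by_cases h0 : a = 0
        · subst h0; rw [ham_zero_ap, ham_zero_ap]
        · funext m; rw [ham_ap, ham_ap, hxy a h0 ha]
      rw [mid_congr (S' := ham B y) (T' := T) (fun a ha => h3 a (by omega))
        (fun a ha => ih a (by omega) (by omega)), h3 n hK] at h1
      refine mul_left_cancel₀ (dg_ne h0) ?_
      rw [h1, h2]; simp
  exact fun n hn => key _ n (Nat.lt_succ_self _) hn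

theorem EqK.iv {K : ℕ} {S T : Alg B} (h : EqK K S T) (hS : Uni S) (hT : Uni T) :
    EqK K (iv S) (iv T) := by
  rw [← q_eq] at h ⊢
  calc q K (Cluster.iv S) = q K (Cluster.iv S) * (q K T * q K (Cluster.iv T)) := by
        rw [← map_mul, hT.mul_iv, map_one, mul_one]
    _ = (q K (Cluster.iv S) * q K S) * q K (Cluster.iv T) := by rw [h, mul_assoc]
    _ = q K (Cluster.iv T) := by rw [← map_mul, hS.iv_mul, map_one, one_mul]

theorem EqK.Eu {K : ℕ} {S T : Alg B} (h : EqK K S T) (l : (ι →₀ ℕ) →+ ℚ) :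
    EqK K (Eu l S) (Eu l T) := fun n hn => by funext m; rw [Eu_ap, Eu_ap, h n hn]

theorem xl_congr {K : ℕ} {S T : Alg B} (h : EqK K S T) (hS : Uni S) (hT : Uni T)
    (l : (ι →₀ ℕ) →+ ℚ) (n : ι →₀ ℕ) (hn : n.degree ≤ K) : xl l S n = xl l T n :=
  gp_congr (((h.Eu l).mul (h.iv hS hT)) n hn)

theorem eqK_of_xl {K : ℕ} {S T : Alg B} (hS : GG S) (hT : GG T)
    (h : ∀ n : ι →₀ ℕ, n ≠ 0 → n.degree ≤ K → xl (dg ι) S n = xl (dg ι) T n) : EqK K S T :=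
  expo_unique hS.uni hT.uni hS.E hT.E K h

theorem eq_of_xl {S T : Alg B} (hS : GG S) (hT : GG T)
    (h : ∀ n : ι →₀ ℕ, n ≠ 0 → xl (dg ι) S n = xl (dg ι) T n) : S = T :=
  eq_of_q fun K => q_eq.2 (eqK_of_xl hS hT fun n h0 _ => h n h0)

theorem LL {S T : Alg B} (hS : GG S) (hT : GG T) {n : ι →₀ ℕ} (h0 : n ≠ 0)
    (h : ∀ a : ι →₀ ℕ, a.degree < n.degree → S a = T a) (m : ι → ℚ) :
    dg ι n * (S n m - T n m) = (xl (dg ι) S n - xl (dg ι) T n) * pr n m := by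
  have h1 := congrArg (fun T : Alg B => T n m) hS.E
  have h2 := congrArg (fun T : Alg B => T n m) hT.E
  rw [mul_mid _ _ h0, ham_zero_ap, Eu_ap, hS.uni.ap] at h1
  rw [mul_mid _ _ h0, ham_zero_ap, Eu_ap, hT.uni.ap] at h2
  have h3 : ∀ a : ι →₀ ℕ, a.degree < n.degree →
      ham B (xl (dg ι) S) a = ham B (xl (dg ι) T) a := by
    intro a ha
    funext m
    rw [ham_ap, ham_ap, xl_congr (K := a.degree) (fun b hb => h b (by omega)) hS.uni hT.uni _ a le_rfl]
  rw [mid_congr h3 h] at h1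
  rw [mul_sub, h1, h2, ham_ap, ham_ap]; simp; ring

theorem xl_mem [Skew B] {S : Alg B} (h : GG S) {P : AddSubmonoid (ι →₀ ℕ)} (hP : S ∈ supp B P)
    (l : (ι →₀ ℕ) →+ ℚ) (n : ι →₀ ℕ) (hn : n ∉ P) : xl l S n = 0 := by
  refine of_ham_mem (B := B) (P := P) ?_ n hn
  have : ham B (xl l S) = Eu l S * iv S := by rw [h.El, mul_assoc, h.uni.mul_iv, mul_one]
  rw [this]
  exact (supp B P).mul_mem (Eu_mem _ hP) (iv_mem_supp h.uni hP)

theorem mem_of_xl {S : Alg B} (h : GG S) {P : AddSubmonoid (ι →₀ ℕ)}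
    (hP : ∀ n, n ∉ P → xl (dg ι) S n = 0) : S ∈ supp B P := by
  have key : ∀ k, ∀ n : ι →₀ ℕ, n.degree < k → n ∉ P → S n = 0 := by
    intro k
    induction k with
    | zero => intro n hn; omega
    | succ k ih =>
      intro n hn hp
      have h0 : n ≠ 0 := by rintro rfl; exact hp P.zero_mem
      funext m
      have h1 := congrArg (fun T : Alg B => T n m) h.E
      rw [mul_mid _ _ h0, ham_zero_ap, Eu_ap, ham_ap, hP n hp, mid_eq_zero hp
        (fun a _ ha => ham_mem hP a ha) (fun a ha hap => ih a (by omega) hap)] at h1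
      have := dg_ne h0
      simpa [this] using h1
  exact fun n hn => key _ n (Nat.lt_succ_self _) hn

theorem Ad_central [Skew B] {S : Alg B} (h : GG S) {P : AddSubmonoid (ι →₀ ℕ)} (hS : S ∈ supp B P)
    {y : (ι →₀ ℕ) → ℚ} (hy : ∀ n, n ∉ P → y n = 0) {n : ι →₀ ℕ} (h0 : n ≠ 0)
    (hn : ∀ a ∈ P, om B a n = 0) : Ad S y n = y n := by
  apply gp_of h0
  have key : ∀ b ∈ P, (S * ham B (Pi.single b 1) * iv S) n = ham B (Pi.single b 1) n := by
    intro b hb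
    by_cases hbn : n.degree = b.degree
    · exact conj_low h.uni b hbn.le
    have hne : dg ι n - dg ι b ≠ 0 := by
      rw [sub_ne_zero, dg_ap, dg_ap]; exact_mod_cast hbn
    have hne' : n ≠ b := by rintro rfl; exact hbn rfl
    have e := conj_single h.uni h.E b
    rw [← h.ham_Ad, ham_br] at e
    rw [← h.ham_Ad]
    funext m
    have e1 := congrArg (fun T : Alg B => T n m) e
    simp only [sub_ap, add_ap, smul_ap, Eu_ap, zero_ap, ham_ap] at e1
    have hsA : ∀ a, a ∉ P → Ad S (Pi.single b 1) a = 0 := by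
      apply of_ham_mem (B := B)
      rw [h.ham_Ad]
      refine (supp B P).mul_mem ((supp B P).mul_mem hS (ham_mem ?_)) (iv_mem_supp h.uni hS)
      intro a ha
      have : a ≠ b := by rintro rfl; exact ha hb
      simp [this]
    have hbr : br B (xl (dg ι) S) (Ad S (Pi.single b 1)) n = 0 := by
      refine Finset.sum_eq_zero fun p hp => ?_
      rw [Finset.HasAntidiagonal.mem_antidiagonal] at hp
      by_cases h1 : p.1 ∈ P
      · have : om B p.1 p.2 = 0 := by
          have := hn _ h1
          rw [← hp, om_add_right, om_self, zero_add] at this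
          exact this
        rw [this]; ring
      · rw [xl_mem h hS _ _ h1]; ring
    rw [hbr] at e1
    have : (dg ι n - dg ι b) * (Ad S (Pi.single b 1) n * pr n m) = 0 := by linarith
    rw [ham_ap, ham_ap]
    simp only [Pi.single_apply, hne', if_false, zero_mul]
    exact (mul_eq_zero.1 this).resolve_left hne
  rw [conj_decomp n.degree S (iv S) y n le_rfl, ham_decomp n.degree y n le_rfl]
  funext m
  rw [sum_ap, sum_ap]
  refine Finset.sum_congr rfl fun b _ => ?_
  by_cases hb : b ∈ P
  · rw [smul_ap, smul_ap, key b hb]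
  · simp [hy b hb]

theorem xl_mul_central [Skew B] {S T : Alg B} (h : GG S) (h' : GG T) {P : AddSubmonoid (ι →₀ ℕ)}
    (hS : S ∈ supp B P) (hT : T ∈ supp B P) (l : (ι →₀ ℕ) →+ ℚ) {n : ι →₀ ℕ} (h0 : n ≠ 0)
    (hn : ∀ a ∈ P, om B a n = 0) : xl l (S * T) n = xl l S n + xl l T n := by
  rw [xl_mul h h', Pi.add_apply, Ad_central h hS (xl_mem h' hT l) h0 hn]

end PartTwo

end Cluster


namespace Cluster

noncomputable section PartThree

variable {ι : Type} [Fintype ι] [DecidableEq ι] {B : Matrix ι ι ℤ}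

open Classical in
/-- restriction of the support -/
def restr (P : AddSubmonoid (ι →₀ ℕ)) (T : Alg B) : Alg B := ⟨fun n => if n ∈ P then T n else 0⟩

theorem restr_of_mem {P : AddSubmonoid (ι →₀ ℕ)} (T : Alg B) {n : ι →₀ ℕ} (h : n ∈ P) :
    restr P T n = T n := if_pos h

theorem restr_of_not {P : AddSubmonoid (ι →₀ ℕ)} (T : Alg B) {n : ι →₀ ℕ} (h : n ∉ P) :
    restr P T n = 0 := if_neg h

theorem restr_congr {P : AddSubmonoid (ι →₀ ℕ)} {T T' : Alg B} {n : ι →₀ ℕ} (h : T n = T' n) :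
    restr P T n = restr P T' n := by
  simp only [restr, h]

theorem exists_fac (P Q : AddSubmonoid (ι →₀ ℕ)) (hPQ : ∀ n, n ≠ 0 → (n ∈ P ↔ n ∉ Q))
    (T : Alg B) (hT : Uni T) :
    ∃ F G : Alg B, Uni F ∧ Uni G ∧ F ∈ supp B P ∧ G ∈ supp B Q ∧ T = F * G := by
  obtain ⟨S, hS⟩ := exists_rec (V := (ι → ℚ) → ℚ)
    (fun S n => if n = 0 then 1 else T n - mid (restr P (⟨S⟩ : Alg B)) (restr Q (⟨S⟩ : Alg B)) n) (by
      intro S S' n hn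
      split_ifs with h0
      · rfl
      · rw [mid_congr (S' := restr P (⟨S'⟩ : Alg B)) (T' := restr Q (⟨S'⟩ : Alg B))
          (fun a ha => restr_congr (hn a ha)) (fun a ha => restr_congr (hn a ha))])
  have h0 : S 0 = 1 := by rw [hS]; simp
  have u1 : Uni (restr P (⟨S⟩ : Alg B)) := by rw [Uni, restr_of_mem _ P.zero_mem]; exact h0
  have u2 : Uni (restr Q (⟨S⟩ : Alg B)) := by rw [Uni, restr_of_mem _ Q.zero_mem]; exact h0
  refine ⟨restr P ⟨S⟩, restr Q ⟨S⟩, u1, u2, fun n hn => restr_of_not _ hn,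
    fun n hn => restr_of_not _ hn, ?_⟩
  ext n m
  by_cases hn : n = 0
  · subst hn; rw [mul_zero_ap, u1.ap, u2.ap, hT.ap]; simp
  · rw [mul_mid _ _ hn, u1.ap, u2.ap]
    have : S n m = T n m - mid (restr P (⟨S⟩ : Alg B)) (restr Q (⟨S⟩ : Alg B)) n m := by
      have := congrFun (hS n) m
      rw [if_neg hn] at this
      exact this
    by_cases hp : n ∈ P
    · rw [restr_of_mem _ hp, restr_of_not _ ((hPQ n hn).1 hp)]
      change _ = S n m * 1 + 1 * 0 + _
      rw [this]; ring
    · have hq : n ∈ Q := by by_contra hq; exact hp ((hPQ n hn).2 hq)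
      rw [restr_of_not _ hp, restr_of_mem _ hq]
      change _ = 0 * 1 + 1 * S n m + _
      rw [this]; ring

theorem fac_unique {P Q : AddSubmonoid (ι →₀ ℕ)} {K : ℕ}
    (hPQ : ∀ n : ι →₀ ℕ, n.degree ≤ K → n ∈ P → n ∈ Q → n = 0) {F G F' G' : Alg B}
    (uF : Uni F) (uG : Uni G) (uF' : Uni F') (uG' : Uni G')
    (hF : F ∈ supp B P) (hF' : F' ∈ supp B P) (hG : G ∈ supp B Q) (hG' : G' ∈ supp B Q)
    (h : EqK K (F * G) (F' * G')) : EqK K F F' ∧ EqK K G G' := by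
  have e1 : EqK K (iv F' * F) (G' * iv G) := by
    rw [← q_eq] at h ⊢
    calc q K (iv F' * F) = q K (iv F' * F * (G * iv G)) := by rw [uG.mul_iv, mul_one]
      _ = q K (iv F') * q K (F * G) * q K (iv G) := by
        rw [← map_mul, ← map_mul]; congr 1; noncomm_ring
      _ = q K (iv F' * F' * (G' * iv G)) := by
        rw [h, ← map_mul, ← map_mul]; congr 1; noncomm_ring
      _ = _ := by rw [uF'.iv_mul, one_mul]
  have s1 : iv F' * F ∈ supp B P := (supp B P).mul_mem (iv_mem_supp uF' hF') hF
  have s2 : G' * iv G ∈ supp B Q := (supp B Q).mul_mem hG' (iv_mem_supp uG hG)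
  have e2 : EqK K (iv F' * F) 1 := by
    intro n hn
    by_cases h0 : n = 0
    · subst h0; rw [(uF'.iv.mul uF : Uni _), (uni_one : Uni (1 : Alg B))]
    have : (1 : Alg B) n = 0 := by funext m; simp [one_ap, h0]
    rw [this]
    by_cases hp : n ∈ P
    · rw [e1 n hn]
      exact s2 n fun hq => h0 (hPQ n hn hp hq)
    · exact s1 n hp
  have e3 := e1.symm.trans e2
  rw [← q_eq] at e2 e3
  constructor
  · rw [← q_eq]
    calc q K F = q K F' * q K (iv F' * F) := by
          rw [← map_mul, ← mul_assoc, uF'.mul_iv, one_mul]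
      _ = _ := by rw [e2, map_one, mul_one]
  · rw [← q_eq]
    calc q K G = q K 1 * q K G := by rw [map_one, one_mul]
      _ = _ := by rw [← e3, ← map_mul, mul_assoc, uG.iv_mul, mul_one]

theorem fac_supp {P Q R : AddSubmonoid (ι →₀ ℕ)}
    (hPQ : ∀ n : ι →₀ ℕ, n ∈ P → n ∈ Q → n = 0) {F G : Alg B}
    (uF : Uni F) (uG : Uni G) (hF : F ∈ supp B P) (hG : G ∈ supp B Q) (h : F * G ∈ supp B R) :
    F ∈ supp B R ∧ G ∈ supp B R := by
  have key : ∀ k, ∀ n : ι →₀ ℕ, n.degree < k → n ∉ R → F n = 0 ∧ G n = 0 := by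
    intro k
    induction k with
    | zero => intro n hn; omega
    | succ k ih =>
      intro n hn hr
      have h0 : n ≠ 0 := by rintro rfl; exact hr R.zero_mem
      have e : ∀ m, F n m + G n m = 0 := by
        intro m
        have := congrFun (h n hr) m
        rw [mul_mid _ _ h0, uF.ap, uG.ap, mid_eq_zero hr (fun a ha hp => (ih a (by omega) hp).1)
          (fun a ha hp => (ih a (by omega) hp).2)] at this
        simpa using this
      by_cases hp : n ∈ P
      · have : G n = 0 := hG n fun hq => h0 (hPQ n hp hq)
        exact ⟨by funext m; simpa [this] using e m, this⟩
      · have : F n = 0 := hF n hp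
        exact ⟨this, by funext m; simpa [this] using e m⟩
  exact ⟨fun n hn => (key _ n (Nat.lt_succ_self _) hn).1, fun n hn => (key _ n (Nat.lt_succ_self _) hn).2⟩

/-- positive part -/
def posS (t : (ι →₀ ℕ) →+ ℚ) : AddSubmonoid (ι →₀ ℕ) where
  carrier := {n | n = 0 ∨ 0 < t n}
  zero_mem' := Or.inl rfl
  add_mem' := by
    rintro a b (rfl | ha) (rfl | hb)
    · left; simp
    · right; simpa using hb
    · right; simpa using ha
    · right; rw [map_add]; exact add_pos ha hb

/-- kernel -/
def zerS (t : (ι →₀ ℕ) →+ ℚ) : AddSubmonoid (ι →₀ ℕ) where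
  carrier := {n | t n = 0}
  zero_mem' := map_zero t
  add_mem' := by
    intro a b ha hb
    simp only [Set.mem_ofPred_eq] at *
    rw [map_add, ha, hb, add_zero]

/-- nonnegative part -/
def nnS (t : (ι →₀ ℕ) →+ ℚ) : AddSubmonoid (ι →₀ ℕ) where
  carrier := {n | 0 ≤ t n}
  zero_mem' := (map_zero t).ge
  add_mem' := by
    intro a b ha hb
    simp only [Set.mem_ofPred_eq] at *
    rw [map_add]; exact add_nonneg ha hb

theorem mem_posS {t : (ι →₀ ℕ) →+ ℚ} {n : ι →₀ ℕ} : n ∈ posS t ↔ n = 0 ∨ 0 < t n := Iff.rfl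
theorem mem_zerS {t : (ι →₀ ℕ) →+ ℚ} {n : ι →₀ ℕ} : n ∈ zerS t ↔ t n = 0 := Iff.rfl
theorem mem_nnS {t : (ι →₀ ℕ) →+ ℚ} {n : ι →₀ ℕ} : n ∈ nnS t ↔ 0 ≤ t n := Iff.rfl

theorem posS_le (t : (ι →₀ ℕ) →+ ℚ) : posS t ≤ nnS t := by
  rintro n (rfl | h)
  · exact (nnS t).zero_mem
  · exact h.le

theorem zerS_le (t : (ι →₀ ℕ) →+ ℚ) : zerS t ≤ nnS t := fun n h => (mem_zerS.1 h).ge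

theorem zerS_le' (t : (ι →₀ ℕ) →+ ℚ) : zerS t ≤ nnS (-t) := fun n h => by
  rw [mem_nnS, AddMonoidHom.neg_apply, mem_zerS.1 h]; simp

theorem pos_nn_compl (t : (ι →₀ ℕ) →+ ℚ) (n : ι →₀ ℕ) (h0 : n ≠ 0) : n ∈ posS t ↔ n ∉ nnS (-t) := by
  rw [mem_posS, mem_nnS, AddMonoidHom.neg_apply]; simp [h0]

theorem nn_pos_compl (t : (ι →₀ ℕ) →+ ℚ) (n : ι →₀ ℕ) (h0 : n ≠ 0) : n ∈ nnS t ↔ n ∉ posS (-t) := by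
  rw [mem_posS, mem_nnS, AddMonoidHom.neg_apply]; simp [h0]

theorem pos_nn_disj (t : (ι →₀ ℕ) →+ ℚ) (n : ι →₀ ℕ) (h : n ∈ posS t) (h' : n ∈ nnS (-t)) : n = 0 := by
  by_contra h0; exact (pos_nn_compl t n h0).1 h h'

theorem nn_pos_disj (t : (ι →₀ ℕ) →+ ℚ) (n : ι →₀ ℕ) (h : n ∈ nnS t) (h' : n ∈ posS (-t)) : n = 0 := by
  by_contra h0; exact (nn_pos_compl t n h0).1 h h'

/-- triple factorization data -/
structure Fac (t : (ι →₀ ℕ) →+ ℚ) (A Z C : Alg B) : Prop where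
  uA : Uni A
  uZ : Uni Z
  uC : Uni C
  hA : A ∈ supp B (posS t)
  hZ : Z ∈ supp B (zerS t)
  hC : C ∈ supp B (posS (-t))

theorem exists_fac3 (t : (ι →₀ ℕ) →+ ℚ) (T : Alg B) (hT : Uni T) :
    ∃ A Z C : Alg B, Fac t A Z C ∧ T = A * Z * C := by
  obtain ⟨A, G, uA, uG, hA, hG, rfl⟩ := exists_fac (posS t) (nnS (-t)) (pos_nn_compl t) T hT
  obtain ⟨Z, C, uZ, uC, hZ, hC, rfl⟩ := exists_fac (nnS t) (posS (-t)) (nn_pos_compl t) G uG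
  refine ⟨A, Z, C, ⟨uA, uZ, uC, hA, ?_, hC⟩, by rw [mul_assoc]⟩
  have := (fac_supp (nn_pos_disj t) uZ uC hZ hC hG).1
  intro n hn
  by_cases h1 : n ∈ nnS t
  · apply this
    rw [mem_nnS, AddMonoidHom.neg_apply]
    rw [mem_nnS] at h1
    rw [mem_zerS] at hn
    intro h; exact hn (le_antisymm (by linarith) h1)
  · exact hZ n h1

theorem fac3_unique {t : (ι →₀ ℕ) →+ ℚ} {A Z C A' Z' C' : Alg B} (h : Fac t A Z C)
    (h' : Fac t A' Z' C') {K : ℕ} (e : EqK K (A * Z * C) (A' * Z' * C')) :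
    EqK K A A' ∧ EqK K Z Z' ∧ EqK K C C' := by
  have s1 : Z * C ∈ supp B (nnS (-t)) := (supp B _).mul_mem (supp_mono (zerS_le' t) h.hZ)
    (supp_mono (posS_le _) h.hC)
  have s2 : Z' * C' ∈ supp B (nnS (-t)) := (supp B _).mul_mem (supp_mono (zerS_le' t) h'.hZ)
    (supp_mono (posS_le _) h'.hC)
  rw [mul_assoc, mul_assoc] at e
  obtain ⟨e1, e2⟩ := fac_unique (fun n _ => pos_nn_disj t n) h.uA (h.uZ.mul h.uC) h'.uA
    (h'.uZ.mul h'.uC) h.hA h'.hA s1 s2 e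
  obtain ⟨e3, e4⟩ := fac_unique (fun n _ => nn_pos_disj t n) h.uZ h.uC h'.uZ h'.uC
    (supp_mono (zerS_le t) h.hZ) (supp_mono (zerS_le t) h'.hZ) h.hC h'.hC e2
  exact ⟨e1, e3, e4⟩

open Classical in
/-- middle factor -/
def Zp (t : (ι →₀ ℕ) →+ ℚ) (T : Alg B) : Alg B :=
  if h : Uni T then (exists_fac3 t T h).choose_spec.choose else 1

theorem Zp_spec (t : (ι →₀ ℕ) →+ ℚ) {T : Alg B} (h : Uni T) :
    ∃ A C, Fac t A (Zp t T) C ∧ T = A * Zp t T * C := by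
  rw [Zp, dif_pos h]
  exact ⟨_, (exists_fac3 t T h).choose_spec.choose_spec⟩

theorem Zp_unique {t : (ι →₀ ℕ) →+ ℚ} {T : Alg B} (h : Uni T) {A Z C : Alg B} (hf : Fac t A Z C)
    {K : ℕ} (e : EqK K T (A * Z * C)) : EqK K (Zp t T) Z := by
  obtain ⟨A', C', h', e'⟩ := Zp_spec t h
  rw [e'] at e
  exact (fac3_unique h' hf e).2.1

theorem Zp_eq {t : (ι →₀ ℕ) →+ ℚ} {T : Alg B} {A Z C : Alg B} (hf : Fac t A Z C)
    (e : T = A * Z * C) : Zp t T = Z := by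
  have h : Uni T := by rw [e]; exact (hf.uA.mul hf.uZ).mul hf.uC
  exact eq_of_q fun K => q_eq.2 (Zp_unique h hf (by rw [e]; exact EqK.refl _ _))

theorem Zp_uni (t : (ι →₀ ℕ) →+ ℚ) {T : Alg B} (h : Uni T) : Uni (Zp t T) := by
  obtain ⟨A, C, h, e⟩ := Zp_spec t h; exact h.uZ

theorem Zp_mem (t : (ι →₀ ℕ) →+ ℚ) {T : Alg B} (h : Uni T) : Zp t T ∈ supp B (zerS t) := by
  obtain ⟨A, C, h, e⟩ := Zp_spec t h; exact h.hZ

theorem Zp_congr {t : (ι →₀ ℕ) →+ ℚ} {T T' : Alg B} (h : Uni T) (h' : Uni T') {K : ℕ}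
    (e : EqK K T T') : EqK K (Zp t T) (Zp t T') := by
  obtain ⟨A, C, hf, e'⟩ := Zp_spec t h'
  exact Zp_unique h hf (by rw [← e']; exact e)

theorem fac3_gg [Skew B] {t : (ι →₀ ℕ) →+ ℚ} {A Z C : Alg B} (h : Fac t A Z C)
    (hg : GG (A * Z * C)) : GG A ∧ GG Z ∧ GG C := by
  have s1 : Z * C ∈ supp B (nnS (-t)) := (supp B _).mul_mem (supp_mono (zerS_le' t) h.hZ)
    (supp_mono (posS_le _) h.hC)
  rw [mul_assoc] at hg
  obtain ⟨g1, g2⟩ := factor_gg (pos_nn_disj t) h.uA (h.uZ.mul h.uC) h.hA s1 hg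
  obtain ⟨g3, g4⟩ := factor_gg (nn_pos_disj t) h.uZ h.uC (supp_mono (zerS_le t) h.hZ) h.hC g2
  exact ⟨g1, g3, g4⟩

theorem fac3_supp {t : (ι →₀ ℕ) →+ ℚ} {A Z C : Alg B} (h : Fac t A Z C) {R : AddSubmonoid (ι →₀ ℕ)}
    (hg : A * Z * C ∈ supp B R) : A ∈ supp B R ∧ Z ∈ supp B R ∧ C ∈ supp B R := by
  have s1 : Z * C ∈ supp B (nnS (-t)) := (supp B _).mul_mem (supp_mono (zerS_le' t) h.hZ)
    (supp_mono (posS_le _) h.hC)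
  rw [mul_assoc] at hg
  obtain ⟨g1, g2⟩ := fac_supp (pos_nn_disj t) h.uA (h.uZ.mul h.uC) h.hA s1 hg
  obtain ⟨g3, g4⟩ := fac_supp (nn_pos_disj t) h.uZ h.uC (supp_mono (zerS_le t) h.hZ) h.hC g2
  exact ⟨g1, g3, g4⟩

theorem GG.Zp [Skew B] {T : Alg B} (h : GG T) (t : (ι →₀ ℕ) →+ ℚ) : GG (Zp t T) := by
  obtain ⟨A, C, hf, e⟩ := Zp_spec t h.uni
  rw [e] at h
  exact (fac3_gg hf h).2.1

theorem Zp_supp (t : (ι →₀ ℕ) →+ ℚ) {T : Alg B} (h : Uni T) {R : AddSubmonoid (ι →₀ ℕ)}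
    (hT : T ∈ supp B R) : Zp t T ∈ supp B R := by
  obtain ⟨A, C, hf, e⟩ := Zp_spec t h
  rw [e] at hT
  exact (fac3_supp hf hT).2.1

/-- the submonoid with everything of large degree added -/
def upK (K : ℕ) (P : AddSubmonoid (ι →₀ ℕ)) : AddSubmonoid (ι →₀ ℕ) where
  carrier := {n | n ∈ P ∨ K < n.degree}
  zero_mem' := Or.inl P.zero_mem
  add_mem' := by
    rintro a b (ha | ha) (hb | hb)
    · exact Or.inl (P.add_mem ha hb)
    all_goals right; rw [map_add]; omega

theorem mem_upK {K : ℕ} {P : AddSubmonoid (ι →₀ ℕ)} {n : ι →₀ ℕ} :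
    n ∈ upK K P ↔ n ∈ P ∨ K < n.degree := Iff.rfl

/-- the middle factor modulo degree `> K` only depends on the signs in degree at most `K` -/
theorem Zp_uniqueK {t : (ι →₀ ℕ) →+ ℚ} {T : Alg B} (hT : Uni T) {K : ℕ} {A Z C : Alg B}
    (uA : Uni A) (uZ : Uni Z) (uC : Uni C)
    (hA : ∀ n : ι →₀ ℕ, n.degree ≤ K → n ∉ posS t → A n = 0)
    (hZ : ∀ n : ι →₀ ℕ, n.degree ≤ K → n ∉ zerS t → Z n = 0)
    (hC : ∀ n : ι →₀ ℕ, n.degree ≤ K → n ∉ posS (-t) → C n = 0)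
    (e : EqK K T (A * Z * C)) : EqK K (Zp t T) Z := by
  obtain ⟨A', C', h, e'⟩ := Zp_spec t hT
  rw [e'] at e
  have sA : A ∈ supp B (upK K (posS t)) := by
    intro n hn; rw [mem_upK, not_or] at hn; exact hA n (by omega) hn.1
  have sZ : Z ∈ supp B (upK K (zerS t)) := by
    intro n hn; rw [mem_upK, not_or] at hn; exact hZ n (by omega) hn.1
  have sC : C ∈ supp B (upK K (posS (-t))) := by
    intro n hn; rw [mem_upK, not_or] at hn; exact hC n (by omega) hn.1
  have mo : ∀ {P Q : AddSubmonoid (ι →₀ ℕ)}, P ≤ Q → supp B (upK K P) ≤ supp B (upK K Q) := by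
    intro P Q h
    apply supp_mono
    rintro n (hn | hn)
    · exact Or.inl (h hn)
    · exact Or.inr hn
  have mo' : ∀ {P Q : AddSubmonoid (ι →₀ ℕ)}, P ≤ Q → supp B P ≤ supp B (upK K Q) := by
    intro P Q h
    apply supp_mono
    intro n hn
    exact Or.inl (h hn)
  have s1 : Zp t T * C' ∈ supp B (upK K (nnS (-t))) := (supp B _).mul_mem (mo' (zerS_le' t) h.hZ)
    (mo' (posS_le _) h.hC)
  have s2 : Z * C ∈ supp B (upK K (nnS (-t))) := (supp B _).mul_mem (mo (zerS_le' t) sZ)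
    (mo (posS_le _) sC)
  rw [mul_assoc, mul_assoc] at e
  obtain ⟨e1, e2⟩ := fac_unique (P := upK K (posS t)) (Q := upK K (nnS (-t))) (fun n hn h1 h2 => pos_nn_disj t n
    (h1.resolve_right (by omega)) (h2.resolve_right (by omega))) h.uA (h.uZ.mul h.uC) uA
    (uZ.mul uC) (mo' le_rfl h.hA) sA s1 s2 e
  obtain ⟨e3, e4⟩ := fac_unique (P := upK K (nnS t)) (Q := upK K (posS (-t))) (fun n hn h1 h2 => nn_pos_disj t n
    (h1.resolve_right (by omega)) (h2.resolve_right (by omega))) h.uZ h.uC uZ uC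
    (mo' (zerS_le t) h.hZ) (mo (zerS_le t) sZ) (mo' le_rfl h.hC) sC e2
  exact e3

/-- same signs in degree at most `K` -/
def SameSign (K : ℕ) (t t' : (ι →₀ ℕ) →+ ℚ) : Prop :=
  ∀ n : ι →₀ ℕ, n.degree ≤ K → (0 < t n ↔ 0 < t' n) ∧ (t n < 0 ↔ t' n < 0)

theorem Zp_sameSign {t t' : (ι →₀ ℕ) →+ ℚ} {K : ℕ} (h : SameSign K t t') {T : Alg B} (hT : Uni T) :
    EqK K (Zp t T) (Zp t' T) := by
  obtain ⟨A, C, hf, e⟩ := Zp_spec t' hT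
  refine Zp_uniqueK hT hf.uA hf.uZ hf.uC ?_ ?_ ?_ (by rw [← e]; exact EqK.refl _ _)
  · intro n hn h1
    apply hf.hA
    rw [mem_posS] at h1 ⊢
    rwa [← (h n hn).1]
  · intro n hn h1
    apply hf.hZ
    rw [mem_zerS] at h1 ⊢
    intro h2
    have := h n hn
    rw [h2] at this
    simp only [lt_self_iff_false, iff_false, not_lt] at this
    exact h1 (le_antisymm this.1 this.2)
  · intro n hn h1
    apply hf.hC
    rw [mem_posS, AddMonoidHom.neg_apply, neg_pos] at h1 ⊢
    rwa [← (h n hn).2]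

end PartThree

end Cluster


namespace Cluster

noncomputable section PartFour

/-- binomial coefficients with rational upper entry -/
def ch (x : ℚ) : ℕ → ℚ
  | 0 => 1
  | k + 1 => ch x k * (x - k) / (k + 1)

@[simp] theorem ch_zero (x : ℚ) : ch x 0 = 1 := rfl

theorem ch_succ (x : ℚ) (k : ℕ) : (k + 1 : ℚ) * ch x (k + 1) = (x - k) * ch x k := by
  rw [ch]; field_simp

@[simp] theorem ch_one (x : ℚ) : ch x 1 = x := by simp [ch]

theorem ch_add (x y : ℚ) (k : ℕ) :
    ch (x + y) k = ∑ p ∈ Finset.HasAntidiagonal.antidiagonal k, ch x p.1 * ch y p.2 := by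
  induction k with
  | zero => simp
  | succ k ih =>
    have hk : (k + 1 : ℚ) ≠ 0 := by positivity
    apply mul_left_cancel₀ hk
    rw [ch_succ, ih, Finset.mul_sum]
    have e1 : ∑ p ∈ Finset.HasAntidiagonal.antidiagonal (k + 1), (p.1 : ℚ) * (ch x p.1 * ch y p.2)
        = ∑ p ∈ Finset.HasAntidiagonal.antidiagonal k, (x - p.1) * ch x p.1 * ch y p.2 := by
      rw [Finset.Nat.sum_antidiagonal_succ]
      simp only [Nat.cast_zero, zero_mul, zero_add]
      refine Finset.sum_congr rfl fun p _ => ?_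
      rw [← ch_succ]; push_cast; ring
    have e2 : ∑ p ∈ Finset.HasAntidiagonal.antidiagonal (k + 1), (p.2 : ℚ) * (ch x p.1 * ch y p.2)
        = ∑ p ∈ Finset.HasAntidiagonal.antidiagonal k, (y - p.2) * ch x p.1 * ch y p.2 := by
      rw [Finset.Nat.sum_antidiagonal_succ']
      simp only [Nat.cast_zero, zero_mul, zero_add]
      refine Finset.sum_congr rfl fun p _ => ?_
      rw [mul_right_comm (y - _), ← ch_succ]; push_cast; ring
    have e3 : (k + 1 : ℚ) * ∑ p ∈ Finset.HasAntidiagonal.antidiagonal (k + 1), ch x p.1 * ch y p.2 =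
        ∑ p ∈ Finset.HasAntidiagonal.antidiagonal (k + 1), (p.1 : ℚ) * (ch x p.1 * ch y p.2) +
        ∑ p ∈ Finset.HasAntidiagonal.antidiagonal (k + 1), (p.2 : ℚ) * (ch x p.1 * ch y p.2) := by
      rw [Finset.mul_sum, ← Finset.sum_add_distrib]
      refine Finset.sum_congr rfl fun p hp => ?_
      rw [Finset.HasAntidiagonal.mem_antidiagonal] at hp
      rw [← add_mul]; congr 1; exact_mod_cast hp.symm
    rw [e3, e1, e2, ← Finset.sum_add_distrib]
    refine Finset.sum_congr rfl fun p hp => ?_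
    rw [Finset.HasAntidiagonal.mem_antidiagonal] at hp
    have : (k : ℚ) = p.1 + p.2 := by exact_mod_cast hp.symm
    rw [this]; ring

theorem ch_add_range (x y : ℚ) (k : ℕ) :
    ch (x + y) k = ∑ j ∈ Finset.range (k + 1), ch x j * ch y (k - j) := by
  rw [ch_add, Finset.Nat.sum_antidiagonal_eq_sum_range_succ_mk]

theorem ch_natCast (n k : ℕ) : ch n k = n.choose k := by
  induction k with
  | zero => simp
  | succ k ih =>
    have hk : (k + 1 : ℚ) ≠ 0 := by positivity
    apply mul_left_cancel₀ hk
    rw [ch_succ, ih]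
    have := Nat.choose_succ_right_eq n k
    by_cases h : k ≤ n
    · have h2 : (n.choose (k + 1) : ℚ) * (k + 1) = n.choose k * (n - k) := by
        rw [← Nat.cast_sub h]; exact_mod_cast this
      linarith
    · rw [Nat.choose_eq_zero_of_lt (by omega), Nat.choose_eq_zero_of_lt (by omega)]; simp

theorem ch_lt {n k : ℕ} (h : n < k) : ch n k = 0 := by
  rw [ch_natCast, Nat.choose_eq_zero_of_lt h]; simp

theorem ch_zero_left (k : ℕ) (hk : k ≠ 0) : ch 0 k = 0 := by
  have := ch_lt (n := 0) (k := k) (by omega)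
  simpa using this

theorem ch_pascal (x : ℚ) (k : ℕ) : ch (x + 1) (k + 1) = ch x (k + 1) + ch x k := by
  rw [ch_add, Finset.Nat.sum_antidiagonal_succ']
  rw [Finset.sum_eq_single (k, 0)]
  · simp
  · rintro ⟨a, b⟩ hab hne
    rw [Finset.HasAntidiagonal.mem_antidiagonal] at hab
    simp only at hab ⊢
    have hb : b ≠ 0 := by rintro rfl; simp at hab; exact hne (by simp [hab])
    have := ch_lt (n := 1) (k := b + 1) (by omega)
    rw [Nat.cast_one] at this
    rw [this]; ring
  · intro h; simp at h

theorem ch_int (z : ℤ) (k : ℕ) : ∃ y : ℤ, ch z k = y := by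
  induction k generalizing z with
  | zero => exact ⟨1, by simp⟩
  | succ k ih =>
    induction z using Int.induction_on with
    | zero => exact ⟨0, by rw [Int.cast_zero, ch_zero_left _ (by omega)]⟩
    | succ n h =>
      obtain ⟨y, hy⟩ := h
      obtain ⟨w, hw⟩ := ih n
      exact ⟨y + w, by push_cast at hy hw ⊢; rw [ch_pascal, hy, hw]⟩
    | pred n h =>
      obtain ⟨y, hy⟩ := h
      obtain ⟨w, hw⟩ := ih (-n - 1)
      refine ⟨y - w, ?_⟩
      have := ch_pascal ((-n - 1 : ℤ) : ℚ) k
      rw [hw] at this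
      rw [show (((-n - 1 : ℤ) : ℚ) + 1) = ((-n : ℤ) : ℚ) by push_cast; ring, hy] at this
      push_cast at this ⊢
      linarith

theorem ch_absorb (x : ℚ) (k : ℕ) : (k + 1 : ℚ) * ch x (k + 1) = x * ch (x - 1) k := by
  induction k with
  | zero => simp
  | succ k ih =>
    have h1 := ch_succ x (k + 1)
    have h2 := ch_succ (x - 1) k
    have hk : (k + 1 : ℚ) ≠ 0 := by positivity
    apply mul_left_cancel₀ hk
    push_cast at *
    calc (k + 1 : ℚ) * ((k + 1 + 1) * ch x (k + 1 + 1)) = (x - (k + 1)) * ((k + 1) * ch x (k + 1)) := by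
          rw [h1]; ring
      _ = x * ((x - 1 - k) * ch (x - 1) k) := by rw [ih]; ring
      _ = _ := by rw [← h2]; ring

theorem ch_rev (x : ℚ) (a b : ℕ) : ch x (a + b) * ((a + b).choose a : ℚ) = ch x a * ch (x - a) b := by
  induction b with
  | zero => simp
  | succ b ih =>
    have hk : (b + 1 : ℚ) ≠ 0 := by positivity
    apply mul_left_cancel₀ hk
    have h1 := ch_succ x (a + b)
    have h2 := ch_succ (x - a) b
    have h3 : ((a + b + 1).choose a : ℚ) * (b + 1) = (a + b + 1) * (a + b).choose a := by
      have := Nat.choose_mul_succ_eq (a + b) a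
      have e : a + b + 1 - a = b + 1 := by omega
      rw [e] at this
      have h4 : ((a + b).choose a : ℚ) * (a + b + 1) = (a + b + 1).choose a * (b + 1) := by
        exact_mod_cast this
      linarith
    push_cast at h1
    calc (b + 1 : ℚ) * (ch x (a + (b + 1)) * ((a + (b + 1)).choose a : ℚ))
        = ch x (a + b + 1) * (((a + b + 1).choose a : ℚ) * (b + 1)) := by rw [← add_assoc]; ring
      _ = ((a + b + 1) * ch x (a + b + 1)) * (a + b).choose a := by rw [h3]; ring
      _ = (x - (a + b)) * (ch x (a + b) * (a + b).choose a) := by rw [h1]; ring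
      _ = ch x a * ((x - a - b) * ch (x - a) b) := by rw [ih]; ring
      _ = _ := by rw [← h2]; ring

theorem ch_vand (N d : ℕ) (x : ℚ) :
    ∑ t ∈ Finset.range (min N d + 1), ch N t * ch x (d - t) = ch (N + x) d := by
  rw [ch_add_range]
  apply Finset.sum_subset
  · intro t; simp only [Finset.mem_range]; omega
  · intro t h1 h2
    simp only [Finset.mem_range] at h1 h2
    rw [ch_lt (by omega)]; ring

theorem penta_coeff (s u : ℚ) (p q : ℕ) :
    ∑ j ∈ Finset.range (min p q + 1), ch (u - p) (q - j) * (ch (s + u - p + j) j * ch s (p - j))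
      = ch (s + q) p * ch u q := by
  have step : ∀ j ∈ Finset.range (min p q + 1),
      ch (u - p) (q - j) * (ch (s + u - p + j) j * ch s (p - j)) =
      ∑ i ∈ Finset.range (j + 1), ch u i * ch s (p - i) * (ch (u - p) (q - j) * ch (p - i : ℕ) (j - i)) := by
    intro j hj
    simp only [Finset.mem_range] at hj
    rw [show s + u - p + j = u + (s - p + j) by ring, ch_add_range, Finset.sum_mul, Finset.mul_sum]
    refine Finset.sum_congr rfl fun i hi => ?_
    simp only [Finset.mem_range] at hi
    have := ch_rev s (p - j) (j - i)
    rw [show p - j + (j - i) = p - i by omega] at this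
    rw [show s - ((p - j : ℕ) : ℚ) = s - p + j by rw [Nat.cast_sub (by omega)]; ring] at this
    have e : ((p - i).choose (p - j) : ℚ) = ch (p - i : ℕ) (j - i) := by
      rw [ch_natCast, ← Nat.choose_symm (by omega)]
      congr 2; omega
    rw [e] at this
    calc _ = ch (u - p) (q - j) * ch u i * (ch s (p - j) * ch (s - p + j) (j - i)) := by ring
      _ = _ := by rw [← this]; ring
  rw [Finset.sum_congr rfl step]
  rw [Finset.sum_comm' (t' := Finset.range (min p q + 1)) (s' := fun i => Finset.Ico i (min p q + 1))
    (by intro a b; simp only [Finset.mem_range, Finset.mem_Ico]; omega)]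
  have step2 : ∀ i ∈ Finset.range (min p q + 1),
      ∑ j ∈ Finset.Ico i (min p q + 1), ch u i * ch s (p - i) * (ch (u - p) (q - j) * ch (p - i : ℕ) (j - i))
       = ch u q * (ch q i * ch s (p - i)) := by
    intro i hi
    simp only [Finset.mem_range] at hi
    rw [← Finset.mul_sum, Finset.sum_Ico_eq_sum_range]
    have : ∑ k ∈ Finset.range (min p q + 1 - i), ch (u - p) (q - (i + k)) * ch (p - i : ℕ) (i + k - i)
        = ch (u - i) (q - i) := by
      rw [show u - i = ((p - i : ℕ) : ℚ) + (u - p) by rw [Nat.cast_sub (by omega)]; ring, ← ch_vand]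
      rw [show min p q + 1 - i = min (p - i) (q - i) + 1 by omega]
      refine Finset.sum_congr rfl fun k hk => ?_
      rw [show q - (i + k) = q - i - k by omega, show i + k - i = k by omega]; ring
    rw [this]
    have h2 := ch_rev u i (q - i)
    rw [show i + (q - i) = q by omega] at h2
    rw [ch_natCast]
    calc _ = ch s (p - i) * (ch u i * ch (u - i) (q - i)) := by ring
      _ = _ := by rw [← h2]; ring
  rw [Finset.sum_congr rfl step2, ← Finset.mul_sum, min_comm, ch_vand]
  rw [add_comm (q : ℚ)]; ring

theorem ch_log (x : ℚ) (p : ℕ) : (p : ℚ) * ch x p =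
    x * ∑ j ∈ Finset.range p, (-1) ^ j * ch x (p - 1 - j) := by
  induction p with
  | zero => simp
  | succ p ih =>
    push_cast
    rw [ch_succ, Finset.sum_range_succ']
    simp only [pow_zero, Nat.add_sub_cancel, Nat.sub_zero]
    have : ∑ k ∈ Finset.range p, (-1 : ℚ) ^ (k + 1) * ch x (p - (k + 1)) =
        - ∑ j ∈ Finset.range p, (-1) ^ j * ch x (p - 1 - j) := by
      rw [← Finset.sum_neg_distrib]
      refine Finset.sum_congr rfl fun k _ => ?_
      rw [show p - (k + 1) = p - 1 - k by omega]; ring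
    rw [this, mul_add, mul_neg, ← ih]; ring

end PartFour

end Cluster


namespace Cluster

noncomputable section PartFive

variable {ι : Type} [Fintype ι] [DecidableEq ι] {B : Matrix ι ι ℤ}

/-- letters -/
def tl (B : Matrix ι ι ℤ) (a : ι →₀ ℕ) (c : ℚ) : Alg B :=
  ⟨fun k m => ∑ j ∈ Finset.range (k.degree + 1), if j • a = k then ch (c * pr a m) j else 0⟩

theorem deg_nsmul (j : ℕ) (a : ι →₀ ℕ) : (j • a).degree = j * a.degree := by
  rw [map_nsmul, smul_eq_mul]

theorem nsmul_inj {a : ι →₀ ℕ} (ha : a ≠ 0) {i j : ℕ} (h : i • a = j • a) : i = j := by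
  have h1 := congrArg Finsupp.degree h
  rw [deg_nsmul, deg_nsmul] at h1
  exact Nat.eq_of_mul_eq_mul_right (deg_pos ha) h1

theorem le_deg_nsmul {a : ι →₀ ℕ} (ha : a ≠ 0) (j : ℕ) : j ≤ (j • a).degree := by
  rw [deg_nsmul]; exact Nat.le_mul_of_pos_right _ (deg_pos ha)

theorem tl_eq {a : ι →₀ ℕ} (ha : a ≠ 0) (c : ℚ) {k : ι →₀ ℕ} {N : ℕ} (hN : k.degree ≤ N) (m : ι → ℚ) :
    tl B a c k m = ∑ j ∈ Finset.range (N + 1), if j • a = k then ch (c * pr a m) j else 0 := by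
  change ∑ j ∈ Finset.range (k.degree + 1), _ = _
  apply Finset.sum_subset
  · intro t; simp only [Finset.mem_range]; omega
  · intro t h1 h2
    simp only [Finset.mem_range] at h1 h2
    rw [if_neg]
    rintro rfl
    exact h2 (Nat.lt_succ_of_le (le_deg_nsmul ha t))

theorem tl_ap {a : ι →₀ ℕ} (ha : a ≠ 0) (c : ℚ) (j : ℕ) (m : ι → ℚ) :
    tl B a c (j • a) m = ch (c * pr a m) j := by
  rw [tl_eq ha c le_rfl, Finset.sum_eq_single j]
  · simp
  · intro i _ hi
    rw [if_neg fun h => hi (nsmul_inj ha h)]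
  · intro h
    exact absurd (Finset.mem_range.2 (Nat.lt_succ_of_le (le_deg_nsmul ha j))) h

theorem tl_not {a : ι →₀ ℕ} (c : ℚ) {k : ι →₀ ℕ} (h : ∀ j : ℕ, k ≠ j • a) : tl B a c k = 0 := by
  funext m
  change ∑ j ∈ Finset.range (k.degree + 1), _ = (0 : ℚ)
  exact Finset.sum_eq_zero fun j _ => if_neg fun e => h j e.symm

theorem tl_uni {a : ι →₀ ℕ} (ha : a ≠ 0) (c : ℚ) : Uni (tl B a c) := by
  funext m
  have := tl_ap (B := B) ha c 0 m
  rw [zero_smul] at this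
  rw [this]; simp

theorem tl_self {a : ι →₀ ℕ} (ha : a ≠ 0) (c : ℚ) (m : ι → ℚ) : tl B a c a m = c * pr a m := by
  have := tl_ap (B := B) ha c 1 m
  rwa [one_smul, ch_one] at this

theorem tl_mul [Skew B] {a : ι →₀ ℕ} (ha : a ≠ 0) (c : ℚ) (S : Alg B) {k : ι →₀ ℕ} {N : ℕ}
    (hN : k.degree ≤ N) (m : ι → ℚ) :
    (tl B a c * S) k m = ∑ j ∈ Finset.range (N + 1),
      if j • a ≤ k then ch (c * (pr a m + om B a k)) j * S (k - j • a) m else 0 := by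
  rw [mul_ap]
  have : ∀ p ∈ Finset.HasAntidiagonal.antidiagonal k, tl B a c p.1 (m + ps B p.2) * S p.2 m =
      ∑ j ∈ Finset.range (N + 1), if j • a = p.1 then ch (c * pr a (m + ps B p.2)) j * S p.2 m else 0 := by
    intro p hp
    have := deg_le_of_mem hp
    rw [tl_eq ha c (N := N) (by omega), Finset.sum_mul]
    refine Finset.sum_congr rfl fun j _ => ?_
    split_ifs <;> simp
  rw [Finset.sum_congr rfl this, Finset.sum_comm]
  refine Finset.sum_congr rfl fun j _ => ?_
  split_ifs with h
  · rw [Finset.sum_eq_single (j • a, k - j • a)]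
    · rw [if_pos rfl]
      congr 3
      rw [pr_add_right]
      congr 1
      have e : om B a k = om B a (j • a + (k - j • a)) := by rw [add_tsub_cancel_of_le h]
      rw [e, om_add_right, om_nsmul_right, om_self]; simp [om]
    · rintro ⟨x, y⟩ hp hne
      rw [if_neg]
      rintro rfl
      rw [Finset.HasAntidiagonal.mem_antidiagonal] at hp
      apply hne
      simp only [← hp, add_tsub_cancel_left]
    · intro hp
      rw [Finset.HasAntidiagonal.mem_antidiagonal] at hp
      exact absurd (add_tsub_cancel_of_le h) hp
  · apply Finset.sum_eq_zero
    rintro ⟨x, y⟩ hp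
    rw [if_neg]
    rintro rfl
    rw [Finset.HasAntidiagonal.mem_antidiagonal] at hp
    exact h (hp ▸ le_self_add)

theorem mul_tl [Skew B] {a : ι →₀ ℕ} (ha : a ≠ 0) (c : ℚ) (S : Alg B) {k : ι →₀ ℕ} {N : ℕ}
    (hN : k.degree ≤ N) (m : ι → ℚ) :
    (S * tl B a c) k m = ∑ j ∈ Finset.range (N + 1),
      if j • a ≤ k then ch (c * pr a m) j * S (k - j • a) (m + (j : ℚ) • ps B a) else 0 := by
  rw [mul_ap]
  have : ∀ p ∈ Finset.HasAntidiagonal.antidiagonal k, S p.1 (m + ps B p.2) * tl B a c p.2 m =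
      ∑ j ∈ Finset.range (N + 1), if j • a = p.2 then ch (c * pr a m) j * S p.1 (m + ps B p.2) else 0 := by
    intro p hp
    have := deg_le_of_mem hp
    rw [tl_eq ha c (N := N) (by omega), Finset.mul_sum]
    refine Finset.sum_congr rfl fun j _ => ?_
    split_ifs <;> ring
  rw [Finset.sum_congr rfl this, Finset.sum_comm]
  refine Finset.sum_congr rfl fun j _ => ?_
  split_ifs with h
  · rw [Finset.sum_eq_single (k - j • a, j • a)]
    · rw [if_pos rfl, ps_nsmul]
    · rintro ⟨x, y⟩ hp hne
      rw [if_neg]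
      rintro rfl
      rw [Finset.HasAntidiagonal.mem_antidiagonal] at hp
      apply hne
      simp only [← hp, add_tsub_cancel_right]
    · intro hp
      rw [Finset.HasAntidiagonal.mem_antidiagonal] at hp
      exact absurd (tsub_add_cancel_of_le h) hp
  · apply Finset.sum_eq_zero
    rintro ⟨x, y⟩ hp
    rw [if_neg]
    rintro rfl
    rw [Finset.HasAntidiagonal.mem_antidiagonal] at hp
    exact h (hp ▸ le_add_self)


theorem tl_comm [Skew B] {a b : ι →₀ ℕ} (ha : a ≠ 0) (hb : b ≠ 0) (c d : ℚ) (K : ℕ)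
    (h : om B a b = 0 ∨ K < a.degree + b.degree) :
    EqK K (tl B a c * tl B b d) (tl B b d * tl B a c) := by
  intro k hk
  funext m
  rw [tl_mul ha c _ le_rfl, mul_tl ha c _ le_rfl]
  refine Finset.sum_congr rfl fun j _ => ?_
  split_ifs with hj
  · by_cases hi : ∃ i : ℕ, k - j • a = i • b
    · obtain ⟨i, hi⟩ := hi
      have hk' : k = j • a + i • b := by rw [← hi, add_tsub_cancel_of_le hj]
      rw [hi, tl_ap hb, tl_ap hb, pr_add_right, pr_smul_right]
      have e1 : om B a k = i * om B a b := by
        rw [hk', om_add_right, om_nsmul_right, om_nsmul_right, om_self]; ring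
      have e2 : pr b (ps B a) = - om B a b := by rw [om_skew B a b, neg_neg]; rfl
      rw [e1, e2]
      rcases h with h | h
      · rw [h]; simp
      · by_cases hi0 : i = 0
        · subst hi0; simp
        by_cases hj0 : j = 0
        · subst hj0; simp
        exfalso
        have := congrArg Finsupp.degree hk'
        rw [map_add, deg_nsmul, deg_nsmul] at this
        have h1 : a.degree ≤ j * a.degree := Nat.le_mul_of_pos_left _ (by omega)
        have h2 : b.degree ≤ i * b.degree := Nat.le_mul_of_pos_left _ (by omega)
        omega
    · push Not at hi
      rw [tl_not d hi]; simp
  · rfl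

theorem tl_add [Skew B] {a : ι →₀ ℕ} (ha : a ≠ 0) (c d : ℚ) :
    tl B a c * tl B a d = tl B a (c + d) := by
  ext k m
  rw [tl_mul ha c _ le_rfl]
  by_cases hk : ∃ p : ℕ, k = p • a
  · obtain ⟨p, rfl⟩ := hk
    rw [tl_ap ha, add_mul, ch_add_range, om_nsmul_right, om_self]
    rw [← Finset.sum_subset (s₁ := Finset.range (p + 1))]
    · refine Finset.sum_congr rfl fun j hj => ?_
      rw [Finset.mem_range] at hj
      have e : p • a = j • a + (p - j) • a := by rw [← add_smul]; congr 1; omega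
      rw [if_pos (by rw [e]; exact le_self_add), e, add_tsub_cancel_left, tl_ap ha]
      simp
    · intro j; simp only [Finset.mem_range]; have := le_deg_nsmul ha p; omega
    · intro j _ hj
      rw [Finset.mem_range] at hj
      rw [if_neg]
      intro h
      have := Finsupp.degree_mono h
      rw [deg_nsmul, deg_nsmul] at this
      have := Nat.le_of_mul_le_mul_right this (deg_pos ha)
      omega
  · push Not at hk
    rw [tl_not _ hk]
    refine Finset.sum_eq_zero fun j _ => ?_
    split_ifs with h
    · rw [tl_not]
      · simp
      · intro i hi
        refine hk (j + i) ?_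
        rw [add_smul, ← hi, add_tsub_cancel_of_le h]
    · rfl

theorem tl_zero {a : ι →₀ ℕ} (ha : a ≠ 0) : tl B a 0 = 1 := by
  ext k m
  rw [one_ap]
  by_cases hk : ∃ p : ℕ, k = p • a
  · obtain ⟨p, rfl⟩ := hk
    rw [tl_ap ha, zero_mul]
    by_cases hp : p = 0
    · subst hp; simp
    · rw [ch_zero_left _ hp, if_neg]; simp [hp, ha]
  · push Not at hk
    rw [tl_not _ hk, if_neg]
    · rfl
    · intro h; exact hk 0 (by simp [h])

theorem tl_iv [Skew B] {a : ι →₀ ℕ} (ha : a ≠ 0) (c : ℚ) : iv (tl B a c) = tl B a (-c) :=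
  (tl_uni ha c).iv_eq (by rw [tl_add ha, add_neg_cancel, tl_zero ha])

theorem tl_npow [Skew B] {a : ι →₀ ℕ} (ha : a ≠ 0) (c : ℚ) (N : ℕ) : tl B a c ^ N = tl B a (N * c) := by
  induction N with
  | zero => simp [tl_zero ha]
  | succ N ih => rw [pow_succ, ih, tl_add ha]; congr 1; push_cast; ring

/-- the multiples of a vector -/
theorem tl_supp {a : ι →₀ ℕ} (c : ℚ) {P : AddSubmonoid (ι →₀ ℕ)} (h : a ∈ P) : tl B a c ∈ supp B P := by
  intro n hn
  apply tl_not
  rintro j rfl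
  exact hn (P.nsmul_mem h j)

theorem tl_large {a : ι →₀ ℕ} (ha : a ≠ 0) (c : ℚ) {K : ℕ} (h : K < a.degree) : EqK K (tl B a c) 1 := by
  intro n hn
  by_cases h0 : n = 0
  · subst h0; rw [(tl_uni ha c : Uni _), (uni_one : Uni (1 : Alg B))]
  · funext m
    rw [one_ap, if_neg h0, tl_not]
    · rfl
    · rintro j rfl
      have hj : j ≠ 0 := by rintro rfl; simp at h0
      rw [deg_nsmul] at hn
      have : a.degree ≤ j * a.degree := Nat.le_mul_of_pos_left _ (by omega)
      omega

/-- logarithm of a letter -/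
def lg (a : ι →₀ ℕ) (c : ℚ) (k : ι →₀ ℕ) : ℚ :=
  ∑ j ∈ Finset.range (k.degree + 1), if j • a = k then c * (-1) ^ (j + 1) / j else 0

theorem lg_ap {a : ι →₀ ℕ} (ha : a ≠ 0) (c : ℚ) (j : ℕ) : lg a c (j • a) = c * (-1) ^ (j + 1) / j := by
  rw [lg, Finset.sum_eq_single j]
  · simp
  · intro i _ hi
    rw [if_neg fun h => hi (nsmul_inj ha h)]
  · intro h
    exact absurd (Finset.mem_range.2 (Nat.lt_succ_of_le (le_deg_nsmul ha j))) h

theorem lg_self {a : ι →₀ ℕ} (ha : a ≠ 0) (c : ℚ) : lg a c a = c := by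
  have := lg_ap ha c 1
  rw [one_smul] at this
  rw [this]; norm_num

theorem lg_not {a : ι →₀ ℕ} (c : ℚ) {k : ι →₀ ℕ} (h : ∀ j : ℕ, k ≠ j • a) : lg a c k = 0 :=
  Finset.sum_eq_zero fun j _ => if_neg fun e => h j e.symm

theorem tl_Eu [Skew B] {a : ι →₀ ℕ} (ha : a ≠ 0) (c : ℚ) (l : (ι →₀ ℕ) →+ ℚ) :
    Eu l (tl B a c) = ham B (fun k => l a * lg a c k) * tl B a c := by
  ext k m
  rw [mul_tl ha c _ le_rfl, Eu_ap]
  by_cases hk : ∃ p : ℕ, k = p • a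
  · obtain ⟨p, rfl⟩ := hk
    rw [tl_ap ha, map_nsmul, nsmul_eq_mul]
    rw [← Finset.sum_subset (s₁ := Finset.range (p + 1))]
    · rw [Finset.sum_range_succ]
      have e0 : (if p • a ≤ p • a then ch (c * pr a m) p * (ham B fun k => l a * lg a c k)
          (p • a - p • a) (m + (p : ℚ) • ps B a) else 0) = 0 := by
        simp [ham_ap]
      rw [e0, add_zero]
      have h1 := ch_log (c * pr a m) p
      calc (p : ℚ) * l a * ch (c * pr a m) p = l a * (p * ch (c * pr a m) p) := by ring
        _ = _ := by
          rw [h1, ← Finset.sum_range_reflect, Finset.mul_sum, Finset.mul_sum]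
          refine Finset.sum_congr rfl fun j hj => ?_
          rw [Finset.mem_range] at hj
          have e : p • a = j • a + (p - j) • a := by rw [← add_smul]; congr 1; omega
          rw [if_pos (by rw [e]; exact le_self_add), e, add_tsub_cancel_left, ham_ap, lg_ap ha,
            pr_nsmul, pr_add_right, pr_smul_right]
          have e3 : pr a (ps B a) = 0 := om_self B a
          have e4 : ((p - j : ℕ) : ℚ) ≠ 0 := by
            have : p - j ≠ 0 := by omega
            exact_mod_cast this
          rw [e3, show p - 1 - (p - 1 - j) = j by omega,
            show p - j + 1 = (p - 1 - j) + 2 by omega, pow_add]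
          field_simp
          ring
    · intro j; simp only [Finset.mem_range]; have := le_deg_nsmul ha p; omega
    · intro j _ hj
      rw [Finset.mem_range] at hj
      rw [if_neg]
      intro h
      have := Finsupp.degree_mono h
      rw [deg_nsmul, deg_nsmul] at this
      have := Nat.le_of_mul_le_mul_right this (deg_pos ha)
      omega
  · push Not at hk
    rw [tl_not _ hk]
    symm
    simp only [Pi.zero_apply, mul_zero]
    refine Finset.sum_eq_zero fun j _ => ?_
    split_ifs with h
    · rw [ham_ap, lg_not]
      · simp
      · intro i hi
        refine hk (j + i) ?_
        rw [add_smul, ← hi, add_tsub_cancel_of_le h]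
    · rfl

theorem tl_gg [Skew B] {a : ι →₀ ℕ} (ha : a ≠ 0) (c : ℚ) : GG (tl B a c) :=
  GG.of (tl_uni ha c) (tl_Eu ha c _)

theorem xl_tl [Skew B] {a : ι →₀ ℕ} (ha : a ≠ 0) (c : ℚ) (l : (ι →₀ ℕ) →+ ℚ) {n : ι →₀ ℕ} (hn : n ≠ 0) :
    xl l (tl B a c) n = l a * lg a c n :=
  xl_eq (tl_uni ha c) (tl_Eu ha c l) hn

end PartFive

end Cluster


namespace Cluster

noncomputable section PartSix

variable {ι : Type} [Fintype ι] [DecidableEq ι] {B : Matrix ι ι ℤ}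

/-- the action of a letter on hamiltonians -/
def sh (B : Matrix ι ι ℤ) (a : ι →₀ ℕ) (c : ℚ) (u : (ι →₀ ℕ) → ℚ) (k : ι →₀ ℕ) : ℚ :=
  ∑ j ∈ Finset.range (k.degree + 1), if j • a ≤ k then ch (c * om B a k) j * u (k - j • a) else 0

theorem le_of_nsmul_le {a : ι →₀ ℕ} (ha : a ≠ 0) {j : ℕ} {k : ι →₀ ℕ} (h : j • a ≤ k) : j ≤ k.degree :=
  (le_deg_nsmul ha j).trans (Finsupp.degree_mono h)

theorem sh_eq {a : ι →₀ ℕ} (ha : a ≠ 0) (c : ℚ) (u : (ι →₀ ℕ) → ℚ) {k : ι →₀ ℕ} {N : ℕ} (hN : k.degree ≤ N) :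
    sh B a c u k = ∑ j ∈ Finset.range (N + 1),
      if j • a ≤ k then ch (c * om B a k) j * u (k - j • a) else 0 := by
  rw [sh]
  apply Finset.sum_subset
  · intro t; simp only [Finset.mem_range]; omega
  · intro t h1 h2
    simp only [Finset.mem_range] at h1 h2
    rw [if_neg]
    intro h
    exact h2 (Nat.lt_succ_of_le (le_of_nsmul_le ha h))

theorem ch_mean (c A W : ℚ) (s : ℕ) :
    (∑ i ∈ Finset.range (s + 1), (i : ℚ) * (ch (c * A) i * ch (c * W) (s - i))) * (A + W)
      = s * ch (c * A + c * W) s * A := by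
  cases s with
  | zero => simp
  | succ s =>
    rw [Finset.sum_range_succ']
    have : ∑ k ∈ Finset.range (s + 1), ((k + 1 : ℕ) : ℚ) * (ch (c * A) (k + 1) * ch (c * W) (s + 1 - (k + 1)))
        = c * A * ch (c * A - 1 + c * W) s := by
      rw [ch_add_range, Finset.mul_sum]
      refine Finset.sum_congr rfl fun k _ => ?_
      push_cast
      rw [← mul_assoc, ch_absorb]; ring
    rw [this]
    push_cast
    rw [ch_absorb, show c * A + c * W - 1 = c * A - 1 + c * W by ring]
    ring

theorem double_sum {a : ι →₀ ℕ} (ha : a ≠ 0) {k : ι →₀ ℕ} {N : ℕ} (hN : k.degree ≤ N) (g : ℕ → ℕ → ℚ) :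
    ∑ i ∈ Finset.range (N + 1), (∑ j ∈ Finset.range (N + 1), if (i + j) • a ≤ k then g i j else 0) =
    ∑ s ∈ Finset.range (N + 1), if s • a ≤ k then ∑ i ∈ Finset.range (s + 1), g i (s - i) else 0 := by
  have h1 : ∀ i ∈ Finset.range (N + 1), (∑ j ∈ Finset.range (N + 1), if (i + j) • a ≤ k then g i j else 0)
      = ∑ j ∈ Finset.range (N + 1 - i), if (i + j) • a ≤ k then g i j else 0 := by
    intro i _
    symm
    apply Finset.sum_subset
    · intro t; simp only [Finset.mem_range]; omega
    · intro t h1 h2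
      simp only [Finset.mem_range] at h1 h2
      rw [if_neg]
      intro h
      have := le_of_nsmul_le ha h
      omega
  rw [Finset.sum_congr rfl h1,
    ← Finset.sum_range_diag_flip (N + 1) (fun i j => if (i + j) • a ≤ k then g i j else 0)]
  refine Finset.sum_congr rfl fun s _ => ?_
  have : ∀ i ∈ Finset.range (s + 1), (if (i + (s - i)) • a ≤ k then g i (s - i) else 0) =
      if s • a ≤ k then g i (s - i) else 0 := by
    intro i hi
    rw [Finset.mem_range] at hi
    rw [show i + (s - i) = s by omega]
  rw [Finset.sum_congr rfl this]
  split_ifs <;> simp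

theorem om_sub_self [Skew B] {a k : ι →₀ ℕ} {i : ℕ} (h : i • a ≤ k) : om B a (k - i • a) = om B a k := by
  have e : om B a k = om B a (i • a + (k - i • a)) := by rw [add_tsub_cancel_of_le h]
  rw [e, om_add_right, om_nsmul_right, om_self]; ring

theorem tl_ham [Skew B] {a : ι →₀ ℕ} (ha : a ≠ 0) (c : ℚ) (u : (ι →₀ ℕ) → ℚ) :
    tl B a c * ham B u = ham B (sh B a c u) * tl B a c := by
  ext k m
  rw [tl_mul ha c _ le_rfl, mul_tl ha c _ le_rfl]
  have h1 : ∀ i ∈ Finset.range (k.degree + 1),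
      (if i • a ≤ k then ch (c * pr a m) i * ham B (sh B a c u) (k - i • a) (m + (i : ℚ) • ps B a) else 0) =
      ∑ j ∈ Finset.range (k.degree + 1), if (i + j) • a ≤ k then
        ch (c * pr a m) i * ch (c * om B a k) j * u (k - (i + j) • a) *
          (pr k m - i * (pr a m + om B a k)) else 0 := by
    intro i _
    split_ifs with h
    · have e : k = i • a + (k - i • a) := by rw [add_tsub_cancel_of_le h]
      have e1 : pr (k - i • a) (m + (i : ℚ) • ps B a) = pr k m - i * (pr a m + om B a k) := by
        rw [pr_add_right, pr_smul_right]
        have h2 : pr (k - i • a) (ps B a) = - om B a k := by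
          change om B (k - i • a) a = _
          rw [om_skew, om_sub_self h]
        have h3 : pr k m = i * pr a m + pr (k - i • a) m := by
          conv_lhs => rw [e]
          rw [pr_add, pr_nsmul]
        rw [h2, h3]; ring
      rw [ham_ap, e1, sh_eq ha c u (N := k.degree) (Finsupp.degree_mono tsub_le_self), om_sub_self h,
        Finset.sum_mul, Finset.mul_sum]
      refine Finset.sum_congr rfl fun j _ => ?_
      have e2 : (i + j) • a ≤ k ↔ j • a ≤ k - i • a := by
        rw [add_smul]
        constructor
        · intro h'; exact le_tsub_of_add_le_left h'
        · intro h'; rw [e]; exact add_le_add le_rfl h'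
      by_cases h4 : j • a ≤ k - i • a
      · rw [if_pos h4, if_pos (e2.2 h4), add_smul, tsub_add_eq_tsub_tsub]; ring
      · rw [if_neg h4, if_neg (mt e2.1 h4)]; ring
    · symm
      apply Finset.sum_eq_zero
      intro j _
      rw [if_neg]
      intro h'
      apply h
      rw [add_smul] at h'
      exact le_self_add.trans h'
  rw [Finset.sum_congr rfl h1, double_sum ha le_rfl]
  refine Finset.sum_congr rfl fun s _ => ?_
  split_ifs with h
  · have e : k = s • a + (k - s • a) := by rw [add_tsub_cancel_of_le h]
    have h3 : pr k m = s * pr a m + pr (k - s • a) m := by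
      conv_lhs => rw [e]
      rw [pr_add, pr_nsmul]
    have hm := ch_mean c (pr a m) (om B a k) s
    have hv := ch_add_range (c * pr a m) (c * om B a k) s
    have : ∀ i ∈ Finset.range (s + 1), ch (c * pr a m) i * ch (c * om B a k) (s - i) *
        u (k - (i + (s - i)) • a) * (pr k m - i * (pr a m + om B a k)) =
        u (k - s • a) * (pr k m * (ch (c * pr a m) i * ch (c * om B a k) (s - i)) -
         ((i : ℚ) * (ch (c * pr a m) i * ch (c * om B a k) (s - i))) * (pr a m + om B a k)) := by
      intro i hi
      rw [Finset.mem_range] at hi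
      rw [show i + (s - i) = s by omega]; ring
    rw [Finset.sum_congr rfl this, ← Finset.mul_sum, Finset.sum_sub_distrib, ← Finset.mul_sum,
      ← Finset.sum_mul, hm, ← hv, ham_ap, h3, mul_add c]
    ring
  · rfl

theorem Ad_tl [Skew B] {a : ι →₀ ℕ} (ha : a ≠ 0) (c : ℚ) (u : (ι →₀ ℕ) → ℚ) {n : ι →₀ ℕ} (hn : n ≠ 0) :
    Ad (tl B a c) u n = sh B a c u n := by
  apply ham_inj (B := B) hn
  rw [(tl_gg ha c).ham_Ad, tl_ham ha, mul_assoc, (tl_uni ha c).mul_iv, mul_one]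

theorem indep [Skew B] {a b : ι →₀ ℕ} (h : om B a b ≠ 0) {p q p' q' : ℕ}
    (e : p • a + q • b = p' • a + q' • b) : p = p' ∧ q = q' := by
  have h1 := congrArg (fun x => om B x b) e
  have h2 := congrArg (fun x => om B a x) e
  simp only [om_add, om_nsmul, om_self, om_add_right, om_nsmul_right, mul_zero, add_zero, zero_add] at h1 h2
  exact ⟨by exact_mod_cast mul_right_cancel₀ h h1, by exact_mod_cast mul_right_cancel₀ h h2⟩

theorem ne_zero_left {a b : ι →₀ ℕ} (h : om B a b ≠ 0) : a ≠ 0 := by rintro rfl; simp at h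
theorem ne_zero_right {a b : ι →₀ ℕ} (h : om B a b ≠ 0) : b ≠ 0 := by rintro rfl; simp at h

theorem tl_tl [Skew B] {a b : ι →₀ ℕ} (h : om B a b ≠ 0) (c d : ℚ) (p q : ℕ) (m : ι → ℚ) :
    (tl B a c * tl B b d) (p • a + q • b) m =
      ch (c * (pr a m + q * om B a b)) p * ch (d * pr b m) q := by
  have ha := ne_zero_left h
  have hb := ne_zero_right h
  rw [tl_mul ha c _ le_rfl, Finset.sum_eq_single p]
  · rw [if_pos le_self_add, add_tsub_cancel_left, tl_ap hb, om_add_right, om_nsmul_right, om_nsmul_right,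
      om_self]; ring_nf
  · intro j _ hj
    split_ifs with h1
    · rw [tl_not]
      · simp
      · intro i hi
        have : p • a + q • b = j • a + i • b := by rw [← hi, add_tsub_cancel_of_le h1]
        exact hj (indep h this).1.symm
    · rfl
  · intro h1
    exfalso; apply h1
    rw [Finset.mem_range, map_add, deg_nsmul]
    have := Nat.le_mul_of_pos_right p (deg_pos ha)
    omega

theorem tl_tl_not [Skew B] {a b : ι →₀ ℕ} (ha : a ≠ 0) (c d : ℚ) {k : ι →₀ ℕ}
    (h : ∀ p q : ℕ, k ≠ p • a + q • b) : (tl B a c * tl B b d) k = 0 := by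
  funext m
  rw [tl_mul ha c _ le_rfl]
  apply Finset.sum_eq_zero
  intro j _
  split_ifs with h1
  · rw [tl_not]
    · simp
    · intro i hi
      exact h j i (by rw [← hi, add_tsub_cancel_of_le h1])
  · rfl

theorem pentagon [Skew B] {a b : ι →₀ ℕ} {l : ℚ} (hl : om B a b = l) (h0 : l ≠ 0) :
    tl B a (1 / l) * tl B b (1 / l) = tl B b (1 / l) * (tl B (a + b) (1 / l) * tl B a (1 / l)) := by
  have h : om B a b ≠ 0 := by rw [hl]; exact h0
  have hba : om B b a = - l := by rw [om_skew, hl]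
  have ha := ne_zero_left h
  have hb := ne_zero_right h
  have h' : om B (a + b) a ≠ 0 := by rw [om_add, om_self, hba]; simpa using h0
  have hab := ne_zero_left h'
  ext k m
  rw [tl_mul hb _ _ le_rfl]
  by_cases hk : ∃ p q : ℕ, k = p • a + q • b
  · obtain ⟨p, q, rfl⟩ := hk
    rw [tl_tl h]
    have key : ∀ i ∈ Finset.range ((p • a + q • b).degree + 1), (if i • b ≤ p • a + q • b then
        ch (1 / l * (pr b m + om B b (p • a + q • b))) i *
          (tl B (a + b) (1 / l) * tl B a (1 / l)) (p • a + q • b - i • b) m else 0) =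
        if i ≤ q ∧ q - i ≤ p then ch (pr b m / l - p) i *
          (ch (pr a m / l + pr b m / l - p + (q - i : ℕ)) (q - i) * ch (pr a m / l) (p - (q - i))) else 0 := by
      intro i _
      have e1 : 1 / l * (pr b m + om B b (p • a + q • b)) = pr b m / l - p := by
        rw [om_add_right, om_nsmul_right, om_nsmul_right, om_self, hba]; field_simp; ring
      rw [e1]
      by_cases hi : i ≤ q ∧ q - i ≤ p
      · have e2 : p • a + q • b = i • b + ((q - i) • (a + b) + (p - (q - i)) • a) := by
          have e3 : p • a = (q - i) • a + (p - (q - i)) • a := by rw [← add_smul]; congr 1; omega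
          have e4 : q • b = i • b + (q - i) • b := by rw [← add_smul]; congr 1; omega
          rw [e3, e4, smul_add]; abel
        rw [if_pos hi, if_pos (by rw [e2]; exact le_self_add), e2, add_tsub_cancel_left, tl_tl h',
          om_add, om_self, hba, pr_add, Nat.cast_sub hi.2]
        congr 3
        · field_simp; ring
        · ring
      · rw [if_neg hi]
        split_ifs with h1
        · rw [tl_tl_not hab]
          · simp
          · intro x y hxy
            have : p • a + q • b = (x + y) • a + (i + x) • b := by
              rw [← add_tsub_cancel_of_le h1, hxy]; simp only [smul_add, add_smul]; abel
            have := indep h this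
            apply hi
            omega
        · rfl
    rw [Finset.sum_congr rfl key]
    have hs : (1 / l * (pr a m + q * om B a b)) = pr a m / l + q := by rw [hl]; field_simp
    have hu : 1 / l * pr b m = pr b m / l := by ring
    rw [hs, hu, ← penta_coeff]
    rw [← Finset.sum_filter]
    refine Finset.sum_nbij' (fun j => q - j) (fun i => q - i) ?_ ?_ ?_ ?_ ?_
    · intro j hj
      simp only [Finset.mem_range, Finset.mem_filter] at hj ⊢
      refine ⟨?_, by omega, by omega⟩
      rw [map_add, deg_nsmul, deg_nsmul]
      have := Nat.le_mul_of_pos_right q (deg_pos hb)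
      omega
    · intro i hi
      simp only [Finset.mem_range, Finset.mem_filter] at hi ⊢
      omega
    · intro j hj
      simp only [Finset.mem_range] at hj
      omega
    · intro i hi
      simp only [Finset.mem_filter] at hi
      omega
    · intro j hj
      simp only [Finset.mem_range] at hj
      rw [show q - (q - j) = j by omega]
  · push Not at hk
    rw [tl_tl_not ha _ _ hk]
    symm
    apply Finset.sum_eq_zero
    intro i _
    split_ifs with h1
    · rw [tl_tl_not hab]
      · simp
      · intro x y hxy
        apply hk (x + y) (i + x)
        rw [← add_tsub_cancel_of_le h1, hxy]; simp only [smul_add, add_smul]; abel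
    · rfl

end PartSix

end Cluster


namespace Cluster

noncomputable section PartSeven

variable {ι : Type} [Fintype ι] [DecidableEq ι] {B : Matrix ι ι ℤ}

/-- positive combinations of two vectors -/
def itv (a b : ι →₀ ℕ) : Set (ι →₀ ℕ) := {n | ∃ p q : ℕ, 0 < p ∧ 0 < q ∧ n = p • a + q • b}

/-- integral letters -/
def IntL (M : AddSubgroup (ι → ℚ)) (n : ι →₀ ℕ) (c : ℚ) : Prop := ∀ m ∈ M, ∃ z : ℤ, c * pr n m = z

/-- words in positive integral letters -/
def W (B : Matrix ι ι ℤ) (K : ℕ) (M : AddSubgroup (ι → ℚ)) (S : Set (ι →₀ ℕ)) : Submonoid (AlgK B K) :=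
  Submonoid.closure {x | ∃ n c, n ∈ S ∧ n ≠ 0 ∧ 0 < c ∧ IntL M n c ∧ x = q K (tl B n c)}

variable {K : ℕ} {M : AddSubgroup (ι → ℚ)}

theorem IntL.add {n : ι →₀ ℕ} {c d : ℚ} (h : IntL M n c) (h' : IntL M n d) : IntL M n (c + d) := by
  intro m hm
  obtain ⟨z, hz⟩ := h m hm
  obtain ⟨w, hw⟩ := h' m hm
  exact ⟨z + w, by rw [add_mul, hz, hw]; push_cast; rfl⟩

theorem IntL.neg {n : ι →₀ ℕ} {c : ℚ} (h : IntL M n c) : IntL M n (-c) := by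
  intro m hm
  obtain ⟨z, hz⟩ := h m hm
  exact ⟨-z, by rw [neg_mul, hz]; push_cast; rfl⟩

theorem IntL.zero (n : ι →₀ ℕ) : IntL M n 0 := fun m _ => ⟨0, by simp⟩

theorem W_letter [Skew B] {S : Set (ι →₀ ℕ)} {n : ι →₀ ℕ} {c : ℚ} (hn : n ∈ S) (h0 : n ≠ 0) (hc : 0 ≤ c)
    (hi : IntL M n c) : q K (tl B n c) ∈ W B K M S := by
  rcases hc.eq_or_lt with rfl | hc
  · rw [tl_zero h0, map_one]; exact one_mem _
  · exact Submonoid.subset_closure ⟨n, c, hn, h0, hc, hi, rfl⟩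

theorem W_mono {S S' : Set (ι →₀ ℕ)} (h : ∀ n ∈ S, n.degree ≤ K → n ∈ S') :
    W B K M S ≤ W B K M S' := by
  apply Submonoid.closure_le.2
  rintro x ⟨n, c, hn, h0, hc, hi, rfl⟩
  by_cases hd : n.degree ≤ K
  · exact Submonoid.subset_closure ⟨n, c, h n hn hd, h0, hc, hi, rfl⟩
  · rw [q_eq.2 (tl_large h0 c (by omega)), map_one]; exact one_mem _

/-- the exchange property -/
def SwapAt (B : Matrix ι ι ℤ) (K : ℕ) (M : AddSubgroup (ι → ℚ)) (a b : ι →₀ ℕ) : Prop :=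
  ∀ α β : ℚ, 0 < α → 0 < β → IntL M a α → IntL M b β →
    ∃ w ∈ W B K M (itv a b), q K (tl B a α) * q K (tl B b β) = q K (tl B b β) * w * q K (tl B a α)

theorem sort [Skew B] (f : (ι →₀ ℕ) →+ ℚ) (κ : ℚ) (hκ0 : 0 < κ) : ∀ (N : ℕ) (S : Finset (ι →₀ ℕ)), S.card = N →
    (∀ n ∈ S, n ≠ 0) →
    (∀ x ∈ S, ∀ y ∈ S, κ * om B x y = f x * dg ι y - f y * dg ι x) →
    (∀ x ∈ S, ∀ y ∈ S, 0 < om B x y → ∀ z ∈ itv x y, z.degree ≤ K → z ∈ S) →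
    (∀ x ∈ S, ∀ y ∈ S, 0 < om B x y → SwapAt B K M x y) →
    ∃ ord : List (ι →₀ ℕ), ord.Nodup ∧ (∀ n, n ∈ ord ↔ n ∈ S) ∧
      ord.Pairwise (fun x y => f x * dg ι y ≤ f y * dg ι x) ∧
      ∀ w ∈ W B K M S, ∃ c : (ι →₀ ℕ) → ℚ, (∀ n, 0 ≤ c n ∧ IntL M n (c n)) ∧
        w = q K ((ord.map fun n => tl B n (c n)).prod) := by
  intro N
  induction N with
  | zero =>
    intro S hN _ _ _ _
    rw [Finset.card_eq_zero] at hN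
    subst hN
    refine ⟨[], List.nodup_nil, by simp, List.Pairwise.nil, ?_⟩
    intro w hw
    refine ⟨fun _ => 0, fun n => ⟨le_rfl, IntL.zero n⟩, ?_⟩
    rw [W] at hw
    have : {x | ∃ n c, n ∈ ((∅ : Finset (ι →₀ ℕ)) : Set (ι →₀ ℕ)) ∧ n ≠ 0 ∧ 0 < c ∧ IntL M n c ∧ x = q K (tl B n c)} = ∅ := by
      ext x; simp
    rw [this, Submonoid.closure_empty, Submonoid.mem_bot] at hw
    rw [hw]; simp
  | succ N ih =>
    intro S hN h0 hκ hcl hsw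
    have hne : S.Nonempty := by rw [← Finset.card_pos]; omega
    obtain ⟨x, hx, hmax⟩ := Finset.exists_max_image S (fun n => f n / dg ι n) hne
    have hdp : ∀ n ∈ S, 0 < dg ι n := fun n hn => by rw [dg_ap]; exact_mod_cast deg_pos (h0 n hn)
    have hmax' : ∀ y ∈ S, f y * dg ι x ≤ f x * dg ι y := by
      intro y hy
      have := hmax y hy
      rwa [div_le_div_iff₀ (hdp y hy) (hdp x hx)] at this
    have hom : ∀ y ∈ S, 0 ≤ om B x y := by
      intro y hy
      have h1 := hκ x hx y hy
      have h2 := hmax' y hy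
      have : 0 ≤ κ * om B x y := by rw [h1]; linarith
      exact nonneg_of_mul_nonneg_right this hκ0
    obtain ⟨ord, o1, o2, o3, o4⟩ := ih (S.erase x) (by rw [Finset.card_erase_of_mem hx, hN]; rfl)
      (fun n hn => h0 n (Finset.mem_of_mem_erase hn))
      (fun y hy z hz => hκ y (Finset.mem_of_mem_erase hy) z (Finset.mem_of_mem_erase hz))
      (by
        intro y hy z hz hyz t ht htd
        refine Finset.mem_erase.2 ⟨?_, hcl y (Finset.mem_of_mem_erase hy) z (Finset.mem_of_mem_erase hz) hyz t ht htd⟩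
        rintro rfl
        obtain ⟨p, r, hp, hr, rfl⟩ := ht
        have h1 := hom y (Finset.mem_of_mem_erase hy)
        rw [om_add, om_nsmul, om_nsmul, om_self, om_skew B z y] at h1
        have : 0 < (r : ℚ) * om B y z := by positivity
        linarith)
      (fun y hy z hz => hsw y (Finset.mem_of_mem_erase hy) z (Finset.mem_of_mem_erase hz))
    refine ⟨ord ++ [x], ?_, ?_, ?_, ?_⟩
    · rw [List.nodup_append]
      refine ⟨o1, by simp, ?_⟩
      intro a ha b hb
      rw [List.mem_singleton] at hb
      subst hb
      rintro rfl
      have := (o2 a).1 ha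
      simp at this
    · intro n
      rw [List.mem_append, o2, List.mem_singleton, Finset.mem_erase]
      constructor
      · rintro (h | rfl)
        · exact h.2
        · exact hx
      · intro h
        by_cases hnx : n = x
        · exact Or.inr hnx
        · exact Or.inl ⟨hnx, h⟩
    · rw [List.pairwise_append]
      refine ⟨o3, by simp, ?_⟩
      intro a ha b hb
      rw [List.mem_singleton] at hb
      subst hb
      exact hmax' a (Finset.mem_of_mem_erase ((o2 a).1 ha))
    · have key : ∀ w ∈ W B K M S, ∃ u ∈ W B K M (S.erase x), ∃ d : ℚ, 0 ≤ d ∧ IntL M x d ∧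
          w = u * q K (tl B x d) := by
        intro w hw
        rw [W] at hw
        induction hw using Submonoid.closure_induction_right with
        | one => exact ⟨1, one_mem _, 0, le_rfl, IntL.zero x, by rw [tl_zero (h0 x hx)]; simp⟩
        | mul_right w hw y hy ihw =>
          obtain ⟨u, hu, d, hd, hdi, rfl⟩ := ihw
          obtain ⟨n, c, hn, hn0, hc, hci, rfl⟩ := hy
          by_cases hnx : n = x
          · subst hnx
            refine ⟨u, hu, d + c, by positivity, hdi.add hci, ?_⟩
            rw [mul_assoc, ← map_mul, tl_add hn0]
          have hns : n ∈ S.erase x := Finset.mem_erase.2 ⟨hnx, hn⟩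
          have hnw : q K (tl B n c) ∈ W B K M (S.erase x) := W_letter hns hn0 hc.le hci
          rcases hd.eq_or_lt with rfl | hd
          · refine ⟨u * q K (tl B n c), mul_mem hu hnw, 0, le_rfl, IntL.zero x, ?_⟩
            rw [tl_zero (h0 x hx)]; simp
          rcases (hom n hn).eq_or_lt with ho | ho
          · refine ⟨u * q K (tl B n c), mul_mem hu hnw, d, hd.le, hdi, ?_⟩
            rw [mul_assoc, mul_assoc, ← map_mul, ← map_mul,
              q_eq.2 (tl_comm (h0 x hx) hn0 d c K (Or.inl ho.symm))]
          · obtain ⟨v, hv, e⟩ := hsw x hx n hn ho d c hd hc hdi hci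
            refine ⟨u * (q K (tl B n c) * v), mul_mem hu (mul_mem hnw (W_mono ?_ hv)), d, hd.le, hdi, ?_⟩
            · intro t ht htd
              refine Finset.mem_coe.2 (Finset.mem_erase.2 ⟨?_, hcl x hx n hn ho t ht htd⟩)
              rintro rfl
              obtain ⟨p, r, hp, hr, e⟩ := ht
              have h1 := congrArg (fun z => om B t z) e
              simp only [om_add_right, om_nsmul_right, om_self] at h1
              have : 0 < (r : ℚ) * om B t n := by positivity
              linarith
            · rw [mul_assoc, e]; noncomm_ring
      intro w hw
      obtain ⟨u, hu, d, hd, hdi, rfl⟩ := key w hw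
      obtain ⟨c, hc, rfl⟩ := o4 u hu
      refine ⟨Function.update c x d, ?_, ?_⟩
      · intro n
        by_cases hnx : n = x
        · subst hnx; simp [hd, hdi]
        · rw [Function.update_of_ne hnx]; exact hc n
      · rw [List.map_append, List.prod_append, map_mul]
        congr 2
        · congr 1
          apply List.map_congr_left
          intro n hn
          rw [Function.update_of_ne]
          rintro rfl
          have := (o2 n).1 hn
          simp at this
        · simp

/-- integral elements -/
def IntA (B : Matrix ι ι ℤ) (K : ℕ) (M : AddSubgroup (ι → ℚ)) : Submonoid (Alg B) where
  carrier := {T | (∀ n : ι →₀ ℕ, n.degree ≤ K → ps B n ∉ M → T n = 0) ∧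
    ∀ n : ι →₀ ℕ, n.degree ≤ K → ∀ m ∈ M, ∃ z : ℤ, T n m = z}
  one_mem' := by
    refine ⟨?_, ?_⟩
    · intro n _ h
      have : n ≠ 0 := by rintro rfl; exact h (by simp)
      funext m; simp [one_ap, this]
    · intro n _ m _
      by_cases h : n = 0
      · exact ⟨1, by simp [one_ap, h]⟩
      · exact ⟨0, by simp [one_ap, h]⟩
  mul_mem' := by
    rintro S T ⟨hS, hS'⟩ ⟨hT, hT'⟩
    refine ⟨?_, ?_⟩
    · intro n hn h
      funext m
      rw [mul_ap]
      apply Finset.sum_eq_zero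
      intro p hp
      have hd := deg_le_of_mem hp
      rw [Finset.HasAntidiagonal.mem_antidiagonal] at hp
      by_cases h1 : ps B p.1 ∈ M
      · have h2 : ps B p.2 ∉ M := by
          intro h2; apply h; rw [← hp, ps_add]; exact M.add_mem h1 h2
        rw [hT p.2 (by omega) h2]; simp
      · rw [hS p.1 (by omega) h1]; simp
    · intro n hn m hm
      rw [mul_ap]
      have : ∀ p ∈ Finset.HasAntidiagonal.antidiagonal n, ∃ z : ℤ, S p.1 (m + ps B p.2) * T p.2 m = z := by
        intro p hp
        have hd := deg_le_of_mem hp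
        by_cases h2 : ps B p.2 ∈ M
        · obtain ⟨z, hz⟩ := hS' p.1 (by omega) (m + ps B p.2) (M.add_mem hm h2)
          obtain ⟨w, hw⟩ := hT' p.2 (by omega) m hm
          exact ⟨z * w, by rw [hz, hw]; push_cast; rfl⟩
        · exact ⟨0, by rw [hT p.2 (by omega) h2]; simp⟩
      choose! z hz using this
      exact ⟨∑ p ∈ Finset.HasAntidiagonal.antidiagonal n, z p, by
        rw [Finset.sum_congr rfl hz]; push_cast; rfl⟩

theorem IntA.congr {S T : Alg B} (h : EqK K S T) (hS : S ∈ IntA B K M) : T ∈ IntA B K M :=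
  ⟨fun n hn h' => by rw [← h n hn]; exact hS.1 n hn h', fun n hn => by rw [← h n hn]; exact hS.2 n hn⟩

theorem tl_intA {n : ι →₀ ℕ} (h0 : n ≠ 0) {c : ℚ} (hp : ps B n ∈ M) (h : IntL M n c) :
    tl B n c ∈ IntA B K M := by
  refine ⟨?_, ?_⟩
  · intro k _ hk
    apply tl_not
    rintro j rfl
    apply hk
    rw [ps_nsmul]
    have := M.nsmul_mem hp j
    rwa [← Nat.cast_smul_eq_nsmul ℚ] at this
  · intro k _ m hm
    by_cases hk : ∃ p : ℕ, k = p • n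
    · obtain ⟨p, rfl⟩ := hk
      rw [tl_ap h0]
      obtain ⟨z, hz⟩ := h m hm
      rw [hz]
      exact ch_int z p
    · push Not at hk
      exact ⟨0, by rw [tl_not _ hk]; simp⟩

theorem il_aux {n0 : ι →₀ ℕ} (hn0 : n0 ≠ 0) (c : (ι →₀ ℕ) → ℚ) (l : List (ι →₀ ℕ)) (hl : ∀ n ∈ l, n ≠ 0) :
    Uni ((l.map fun n => tl B n (c n)).prod) ∧
    Uni ((l.map fun n => tl B n (if n.degree < n0.degree then c n else 0)).prod) ∧
    (∀ k : ι →₀ ℕ, k.degree < n0.degree → ((l.map fun n => tl B n (c n)).prod) k =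
      ((l.map fun n => tl B n (if n.degree < n0.degree then c n else 0)).prod) k) ∧
    ∀ m, ((l.map fun n => tl B n (c n)).prod) n0 m =
      ((l.map fun n => tl B n (if n.degree < n0.degree then c n else 0)).prod) n0 m +
      (l.count n0) * (c n0 * pr n0 m) := by
  induction l with
  | nil => exact ⟨uni_one, uni_one, fun _ _ => rfl, fun m => by simp⟩
  | cons x l ih =>
    obtain ⟨u1, u2, h1, h2⟩ := ih fun n hn => hl n (List.mem_cons_of_mem _ hn)
    have hx : x ≠ 0 := hl x List.mem_cons_self
    simp only [List.map_cons, List.prod_cons]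
    have hlow : ∀ k : ι →₀ ℕ, k.degree < n0.degree →
        tl B x (c x) k = tl B x (if x.degree < n0.degree then c x else 0) k := by
      intro k hk
      split_ifs with h
      · rfl
      · rw [tl_zero hx]
        exact tl_large hx (c x) (K := n0.degree - 1) (by have := deg_pos hn0; omega) k (by omega)
    have htop : ∀ m, tl B x (c x) n0 m = tl B x (if x.degree < n0.degree then c x else 0) n0 m +
        (if x = n0 then c n0 * pr n0 m else 0) := by
      intro m
      split_ifs with h h' h'
      · subst h'; omega
      · ring
      · subst h'; rw [tl_self hx, tl_zero hx, one_ap, if_neg hx]; ring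
      · rw [tl_zero hx, one_ap, if_neg hn0, tl_not]
        · simp
        · rintro j rfl
          rw [deg_nsmul] at h
          have hj0 : j ≠ 0 := by rintro rfl; simp at hn0
          have hj1 : j ≠ 1 := by rintro rfl; simp at h'
          have := deg_pos hx
          have : 2 * x.degree ≤ j * x.degree := Nat.mul_le_mul_right _ (by omega)
          omega
    refine ⟨(tl_uni hx _).mul u1, (tl_uni hx _).mul u2, ?_, ?_⟩
    · intro k hk
      have e1 : EqK k.degree (tl B x (c x)) (tl B x (if x.degree < n0.degree then c x else 0)) :=
        fun n hn => hlow n (by omega)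
      have e2 : EqK k.degree ((l.map fun n => tl B n (c n)).prod)
        ((l.map fun n => tl B n (if n.degree < n0.degree then c n else 0)).prod) :=
        fun n hn => h1 n (by omega)
      exact e1.mul e2 k le_rfl
    · intro m
      rw [mul_mid _ _ hn0, mul_mid _ _ hn0, (tl_uni hx _).ap, (tl_uni hx _).ap, u1.ap, u2.ap, h2, htop,
        mid_congr hlow h1, List.count_cons]
      simp only [beq_iff_eq]
      split_ifs <;> push_cast <;> ring

theorem il {ord : List (ι →₀ ℕ)} (hnd : ord.Nodup) (c : (ι →₀ ℕ) → ℚ) (h0 : ∀ n ∈ ord, n ≠ 0)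
    (hp : ∀ n ∈ ord, ps B n ∈ M) (hint : (ord.map fun n => tl B n (c n)).prod ∈ IntA B K M) :
    ∀ n ∈ ord, n.degree ≤ K → IntL M n (c n) := by
  have key : ∀ d, ∀ n ∈ ord, n.degree < d → n.degree ≤ K → IntL M n (c n) := by
    intro d
    induction d with
    | zero => intro n _ h; omega
    | succ d ih =>
      intro n hn hd hK m hm
      obtain ⟨u1, u2, h1, h2⟩ := il_aux (B := B) (h0 n hn) c ord h0
      have e := h2 m
      rw [List.count_eq_one_of_mem hnd hn] at e
      have : (ord.map fun k => tl B k (if k.degree < n.degree then c k else 0)).prod ∈ IntA B K M := by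
        apply Submonoid.list_prod_mem
        intro x hx
        rw [List.mem_map] at hx
        obtain ⟨k, hk, rfl⟩ := hx
        apply tl_intA (h0 k hk) (hp k hk)
        split_ifs with h
        · exact ih k hk (by omega) (by omega)
        · exact IntL.zero k
      obtain ⟨z, hz⟩ := hint.2 n hK m hm
      obtain ⟨w, hw⟩ := this.2 n hK m hm
      refine ⟨z - w, ?_⟩
      rw [hz, hw] at e
      push_cast at e ⊢
      linarith
  exact fun n hn hK => key (n.degree + 1) n hn (Nat.lt_succ_self _) hK

theorem itv_mono {a b x y : ι →₀ ℕ} (hx : ∃ p r : ℕ, 0 < p ∧ x = p • a + r • b)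
    (hy : ∃ p r : ℕ, 0 < r ∧ y = p • a + r • b) : itv x y ⊆ itv a b := by
  rintro z ⟨s, t, hs, ht, rfl⟩
  obtain ⟨p, r, hp, rfl⟩ := hx
  obtain ⟨p', r', hp', rfl⟩ := hy
  refine ⟨s * p + t * p', s * r + t * r', by positivity, by positivity, ?_⟩
  simp only [smul_add, add_smul, mul_smul]; abel

theorem swap [Skew B] : ∀ (D : ℕ) (a b : ι →₀ ℕ) (M : AddSubgroup (ι → ℚ)), K + 1 ≤ a.degree + b.degree + D →
    0 < om B a b → ps B a ∈ M → ps B b ∈ M → SwapAt B K M a b := by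
  intro D
  induction D with
  | zero =>
    intro a b M hD hab _ _ α β _ _ _ _
    refine ⟨1, one_mem _, ?_⟩
    rw [mul_one, ← map_mul, ← map_mul]
    exact q_eq.2 (tl_comm (ne_zero_left hab.ne') (ne_zero_right hab.ne') α β K (Or.inr (by omega)))
  | succ D ih =>
    intro a b M hD hab hMa hMb α β hα hβ hαi hβi
    obtain ⟨l, hl⟩ : ∃ l, om B a b = l := ⟨_, rfl⟩
    have hl0 : 0 < l := hl ▸ hab
    have hba : om B b a = -l := by rw [om_skew, hl]
    have ha := ne_zero_left hab.ne'
    have hb := ne_zero_right hab.ne'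
    have hda := deg_pos ha
    have hdb := deg_pos hb
    let M1 : AddSubgroup (ι → ℚ) :=
      { carrier := {m | (∃ z : ℤ, 1 / l * pr a m = z) ∧ ∃ z : ℤ, 1 / l * pr b m = z}
        zero_mem' := ⟨⟨0, by simp [pr]⟩, ⟨0, by simp [pr]⟩⟩
        add_mem' := by
          rintro m m' ⟨⟨z, hz⟩, ⟨w, hw⟩⟩ ⟨⟨z', hz'⟩, ⟨w', hw'⟩⟩
          refine ⟨⟨z + z', ?_⟩, ⟨w + w', ?_⟩⟩
          · rw [pr_add_right, mul_add, hz, hz']; push_cast; rfl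
          · rw [pr_add_right, mul_add, hw, hw']; push_cast; rfl
        neg_mem' := by
          rintro m ⟨⟨z, hz⟩, ⟨w, hw⟩⟩
          refine ⟨⟨-z, ?_⟩, ⟨-w, ?_⟩⟩
          · rw [← neg_one_smul ℚ m, pr_smul_right]; push_cast; rw [← hz]; ring
          · rw [← neg_one_smul ℚ m, pr_smul_right]; push_cast; rw [← hw]; ring }
    have hM1a : ps B a ∈ M1 := by
      refine ⟨⟨0, ?_⟩, ⟨-1, ?_⟩⟩
      · change _ * om B a a = _
        rw [om_self]; simp
      · change _ * om B b a = _
        rw [hba]; field_simp; simp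
    have hM1b : ps B b ∈ M1 := by
      refine ⟨⟨1, ?_⟩, ⟨0, ?_⟩⟩
      · change _ * om B a b = _
        rw [hl]; field_simp; simp
      · change _ * om B b b = _
        rw [om_self]; simp
    have hM1 : ∀ p r : ℕ, ps B (p • a + r • b) ∈ M1 := by
      intro p r
      rw [ps_add, ps_nsmul, ps_nsmul, Nat.cast_smul_eq_nsmul, Nat.cast_smul_eq_nsmul]
      exact M1.add_mem (M1.nsmul_mem hM1a p) (M1.nsmul_mem hM1b r)
    have ia : IntL M1 a (1 / l) := fun m hm => hm.1
    have ib : IntL M1 b (1 / l) := fun m hm => hm.2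
    have iab : IntL M1 (a + b) (1 / l) := by
      intro m hm
      obtain ⟨z, hz⟩ := hm.1
      obtain ⟨w, hw⟩ := hm.2
      exact ⟨z + w, by rw [pr_add, mul_add, hz, hw]; push_cast; rfl⟩
    have hlp : 0 < 1 / l := by positivity
    have hdeg : ∀ p r : ℕ, 0 < p → 0 < r → a.degree + b.degree ≤ (p • a + r • b).degree := by
      intro p r hp hr
      rw [map_add, deg_nsmul, deg_nsmul]
      exact add_le_add (Nat.le_mul_of_pos_left _ hp) (Nat.le_mul_of_pos_left _ hr)
    set La := q K (tl B a (1 / l)) with hLa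
    set Lb := q K (tl B b (1 / l)) with hLb
    have lem1 : ∀ v ∈ W B K M1 (itv a b), ∃ v' ∈ W B K M1 (itv a b), v * Lb = Lb * v' := by
      intro v hv
      rw [W] at hv
      induction hv using Submonoid.closure_induction with
      | one => exact ⟨1, one_mem _, by simp⟩
      | mem x hx =>
        obtain ⟨n, c, hn, hn0, hc, hci, rfl⟩ := hx
        obtain ⟨p, r, hp, hr, rfl⟩ := id hn
        have hd := hdeg p r hp hr
        obtain ⟨w, hw, e⟩ := ih (p • a + r • b) b M1 (by omega)
          (by rw [om_add, om_nsmul, om_nsmul, om_self, hl]; simp; positivity) (hM1 p r) hM1b c (1 / l) hc hlp hci ib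
        refine ⟨w * q K (tl B (p • a + r • b) c), mul_mem (W_mono (fun n hn _ =>
          itv_mono ⟨p, r, hp, rfl⟩ ⟨0, 1, one_pos, by simp⟩ hn) hw) (W_letter hn hn0 hc.le hci), ?_⟩
        rw [e, mul_assoc]
      | mul x y _ _ hx hy =>
        obtain ⟨x', hx', ex⟩ := hx
        obtain ⟨y', hy', ey⟩ := hy
        exact ⟨x' * y', mul_mem hx' hy', by rw [mul_assoc, ey, ← mul_assoc, ex, mul_assoc]⟩
    have lem2 : ∀ v ∈ W B K M1 (itv a b), ∃ v' ∈ W B K M1 (itv a b), La * v = v' * La := by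
      intro v hv
      rw [W] at hv
      induction hv using Submonoid.closure_induction with
      | one => exact ⟨1, one_mem _, by simp⟩
      | mem x hx =>
        obtain ⟨n, c, hn, hn0, hc, hci, rfl⟩ := hx
        obtain ⟨p, r, hp, hr, rfl⟩ := id hn
        have hd := hdeg p r hp hr
        obtain ⟨w, hw, e⟩ := ih a (p • a + r • b) M1 (by omega)
          (by rw [om_add_right, om_nsmul_right, om_nsmul_right, om_self, hl]; simp; positivity) hM1a (hM1 p r)
            (1 / l) c hlp hc ia hci
        exact ⟨q K (tl B (p • a + r • b) c) * w, mul_mem (W_letter hn hn0 hc.le hci) (W_mono (fun n hn _ =>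
          itv_mono ⟨1, 0, one_pos, by simp⟩ ⟨p, r, hr, rfl⟩ hn) hw), e⟩
      | mul x y _ _ hx hy =>
        obtain ⟨x', hx', ex⟩ := hx
        obtain ⟨y', hy', ey⟩ := hy
        exact ⟨x' * y', mul_mem hx' hy', by rw [← mul_assoc, ex, mul_assoc, ey, mul_assoc]⟩
    have hpent : La * Lb = Lb * (q K (tl B (a + b) (1 / l)) * La) := by
      rw [hLa, hLb, ← map_mul, ← map_mul, ← map_mul, pentagon hl hl0.ne']
    have hab1 : q K (tl B (a + b) (1 / l)) ∈ W B K M1 (itv a b) :=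
      W_letter ⟨1, 1, one_pos, one_pos, by simp⟩ (by
        intro h
        have := congrArg Finsupp.degree h
        rw [map_add, map_zero] at this
        omega) hlp.le iab
    have st1 : ∀ j : ℕ, ∃ v ∈ W B K M1 (itv a b), La * Lb ^ j = Lb ^ j * v * La := by
      intro j
      induction j with
      | zero => exact ⟨1, one_mem _, by simp⟩
      | succ j ihj =>
        obtain ⟨v, hv, e⟩ := ihj
        obtain ⟨v', hv', e'⟩ := lem1 v hv
        refine ⟨v' * q K (tl B (a + b) (1 / l)), mul_mem hv' hab1, ?_⟩
        calc La * Lb ^ (j + 1) = La * Lb ^ j * Lb := by rw [pow_succ, mul_assoc]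
          _ = Lb ^ j * v * (La * Lb) := by rw [e, mul_assoc]
          _ = Lb ^ j * (v * Lb) * (q K (tl B (a + b) (1 / l)) * La) := by
            rw [hpent]; simp only [mul_assoc]
          _ = _ := by rw [e', pow_succ]; simp only [mul_assoc]
    have st2 : ∀ i j : ℕ, ∃ v ∈ W B K M1 (itv a b), La ^ i * Lb ^ j = Lb ^ j * v * La ^ i := by
      intro i j
      obtain ⟨v1, hv1, e1⟩ := st1 j
      induction i with
      | zero => exact ⟨1, one_mem _, by simp⟩
      | succ i ihi =>
        obtain ⟨v, hv, e⟩ := ihi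
        obtain ⟨v', hv', e'⟩ := lem2 v hv
        refine ⟨v1 * v', mul_mem hv1 hv', ?_⟩
        calc La ^ (i + 1) * Lb ^ j = La * (La ^ i * Lb ^ j) := by rw [pow_succ', mul_assoc]
          _ = (La * Lb ^ j) * v * La ^ i := by rw [e]; simp only [mul_assoc]
          _ = Lb ^ j * v1 * (La * v) * La ^ i := by rw [e1]; simp only [mul_assoc]
          _ = _ := by rw [e', pow_succ']; simp only [mul_assoc]
    obtain ⟨i, hi⟩ : ∃ i : ℕ, (i : ℚ) * (1 / l) = α := by
      obtain ⟨z, hz⟩ := hαi _ hMb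
      change α * om B a b = z at hz
      rw [hl] at hz
      have hz0 : 0 ≤ z := by
        have : (0 : ℚ) < z := by rw [← hz]; positivity
        exact_mod_cast this.le
      obtain ⟨i, rfl⟩ := Int.eq_ofNat_of_zero_le hz0
      refine ⟨i, ?_⟩
      push_cast at hz
      rw [← hz]; field_simp
    obtain ⟨j, hj⟩ : ∃ j : ℕ, (j : ℚ) * (1 / l) = β := by
      obtain ⟨z, hz⟩ := hβi _ hMa
      change β * om B b a = z at hz
      rw [hba] at hz
      have hz0 : 0 ≤ -z := by
        have : (0 : ℚ) < -z := by rw [← hz]; have := mul_pos hβ hl0; linarith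
        exact_mod_cast this.le
      obtain ⟨i, hi⟩ := Int.eq_ofNat_of_zero_le hz0
      refine ⟨i, ?_⟩
      have : (i : ℚ) = -z := by exact_mod_cast hi.symm
      rw [this, ← hz]; field_simp
    obtain ⟨v, hv, e⟩ := st2 i j
    have eLa : La ^ i = q K (tl B a α) := by rw [hLa, ← map_pow, tl_npow ha, hi]
    have eLb : Lb ^ j = q K (tl B b β) := by rw [hLb, ← map_pow, tl_npow hb, hj]
    rw [eLa, eLb] at e
    refine ⟨v, ?_, e⟩
    classical
    obtain ⟨ord, o1, o2, o3, o4⟩ := sort (B := B) (K := K) (M := M1)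
      (⟨⟨fun x => om B x b, by simp⟩, fun x y => om_add B x y b⟩) (dg ι b)
      (by rw [dg_ap]; exact_mod_cast hdb) _ ((le_deg ι K).filter (· ∈ itv a b)) rfl
      (by
        intro n hn
        rw [Finset.mem_filter] at hn
        obtain ⟨p, r, hp, hr, rfl⟩ := hn.2
        have := hdeg p r hp hr
        exact ne_zero_of_deg (by omega))
      (by
        intro x hx y hy
        rw [Finset.mem_filter] at hx hy
        obtain ⟨p, r, hp, hr, rfl⟩ := hx.2
        obtain ⟨p', r', hp', hr', rfl⟩ := hy.2
        change _ = om B (p • a + r • b) b * _ - om B (p' • a + r' • b) b * _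
        simp only [om_add, om_add_right, om_nsmul, om_nsmul_right, om_self, hl, hba, map_add, map_nsmul,
          nsmul_eq_mul]
        ring)
      (by
        intro x hx y hy hxy z hz hzd
        rw [Finset.mem_filter] at hx hy ⊢
        obtain ⟨p, r, hp, hr, hx⟩ := hx.2
        obtain ⟨p', r', hp', hr', hy⟩ := hy.2
        exact ⟨mem_le_deg.2 hzd, itv_mono ⟨p, r, hp, hx⟩ ⟨p', r', hr', hy⟩ hz⟩)
      (by
        intro x hx y hy hxy
        rw [Finset.mem_filter] at hx hy
        obtain ⟨p, r, hp, hr, rfl⟩ := hx.2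
        obtain ⟨p', r', hp', hr', rfl⟩ := hy.2
        have h1 := hdeg p r hp hr
        have h2 := hdeg p' r' hp' hr'
        exact ih _ _ _ (by omega) hxy (hM1 _ _) (hM1 _ _))
    obtain ⟨c, hc, rfl⟩ := o4 v (W_mono (fun n hn hd => by simp [mem_le_deg, hn, hd]) hv)
    have hmem : ∀ n ∈ ord, n ∈ itv a b ∧ n ≠ 0 ∧ ps B n ∈ M ∧ n.degree ≤ K := by
      intro n hn
      rw [o2, Finset.mem_filter] at hn
      refine ⟨hn.2, ?_, ?_, mem_le_deg.1 hn.1⟩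
      · obtain ⟨p, r, hp, hr, rfl⟩ := hn.2
        have := hdeg p r hp hr
        exact ne_zero_of_deg (by omega)
      · obtain ⟨p, r, hp, hr, rfl⟩ := hn.2
        rw [ps_add, ps_nsmul, ps_nsmul, Nat.cast_smul_eq_nsmul, Nat.cast_smul_eq_nsmul]
        exact M.add_mem (M.nsmul_mem hMa p) (M.nsmul_mem hMb r)
    have hint : (ord.map fun n => tl B n (c n)).prod ∈ IntA B K M := by
      have e2 : EqK K (tl B b (-β) * tl B a α * tl B b β * tl B a (-α)) ((ord.map fun n => tl B n (c n)).prod) := by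
        have hb1 : q K (tl B b (-β)) * q K (tl B b β) = 1 := by
          rw [← map_mul, tl_add hb, neg_add_cancel, tl_zero hb, map_one]
        have ha1 : q K (tl B a α) * q K (tl B a (-α)) = 1 := by
          rw [← map_mul, tl_add ha, add_neg_cancel, tl_zero ha, map_one]
        rw [← q_eq, map_mul, map_mul, map_mul, mul_assoc (q K (tl B b (-β))), e, mul_assoc, mul_assoc, mul_assoc,
          ha1, mul_one, ← mul_assoc, hb1, one_mul]
      exact IntA.congr e2 (mul_mem (mul_mem (mul_mem (tl_intA hb hMb hβi.neg) (tl_intA ha hMa hαi))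
        (tl_intA hb hMb hβi)) (tl_intA ha hMa hαi.neg))
    have hil := il o1 c (fun n hn => (hmem n hn).2.1) (fun n hn => (hmem n hn).2.2.1) hint
    rw [map_list_prod]
    apply Submonoid.list_prod_mem
    intro x hx
    rw [List.map_map, List.mem_map] at hx
    obtain ⟨n, hn, rfl⟩ := hx
    obtain ⟨h1, h2, h3, h4⟩ := hmem n hn
    exact W_letter h1 h2 (hc n).1 (hil n hn h4)

end PartSeven

end Cluster


namespace Cluster

noncomputable section PartEight

variable {ι : Type} [Fintype ι] [DecidableEq ι] {B : Matrix ι ι ℤ}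

/-- pairing on the right with a fixed exponent -/
def th (B : Matrix ι ι ℤ) (n : ι →₀ ℕ) : (ι →₀ ℕ) →+ ℚ where
  toFun x := om B x n
  map_zero' := om_zero B n
  map_add' a b := om_add B a b n

theorem th_ap (n x : ι →₀ ℕ) : th B n x = om B x n := rfl

/-- basis exponents -/
abbrev bs (i : ι) : ι →₀ ℕ := Finsupp.single i 1

theorem bs_ne (i : ι) : bs i ≠ 0 := by simp [bs]

/-- the incoming data -/
def del (n : ι →₀ ℕ) : ℚ := ∑ i : ι, lg (bs i) 1 n

/-- the element with standard incoming data -/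
def Inc (B : Matrix ι ι ℤ) (g : Alg B) : Prop :=
  GG g ∧ ∀ n : ι →₀ ℕ, n ≠ 0 → xl (dg ι) (Zp (th B n) g) n = del n

theorem Zp_shift [Skew B] {S T : Alg B} (hS : Uni S) (hT : Uni T) (t : (ι →₀ ℕ) →+ ℚ) {n : ι →₀ ℕ} (h0 : n ≠ 0)
    (ht : t n = 0) (h : ∀ a : ι →₀ ℕ, a.degree < n.degree → S a = T a) (m : ι → ℚ) :
    S n m - T n m = Zp t S n m - Zp t T n m := by
  obtain ⟨A, C, hf, e⟩ := Zp_spec t hS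
  obtain ⟨A', C', hf', e'⟩ := Zp_spec t hT
  have hd := deg_pos h0
  have hE : EqK (n.degree - 1) S T := fun a ha => h a (by omega)
  have hu := fac3_unique hf hf' (K := n.degree - 1) (by rw [← e, ← e']; exact hE)
  have nA : n ∉ posS t := by rw [mem_posS]; simp [h0, ht]
  have nC : n ∉ posS (-t) := by rw [mem_posS]; simp [h0, ht]
  have low : ∀ {X Y : Alg B}, EqK (n.degree - 1) X Y → ∀ a : ι →₀ ℕ, a.degree < n.degree → X a = Y a :=
    fun hXY a ha => hXY a (by omega)
  have f1 : S n m = Zp t S n m + mid A (Zp t S) n m + mid (A * Zp t S) C n m := by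
    conv_lhs => rw [e]
    rw [mul_mid _ _ h0, mul_mid _ _ h0, hf.hA n nA, hf.hC n nC, hf.uA.ap, hf.uC.ap]
    simp
  have f2 : T n m = Zp t T n m + mid A' (Zp t T) n m + mid (A' * Zp t T) C' n m := by
    conv_lhs => rw [e']
    rw [mul_mid _ _ h0, mul_mid _ _ h0, hf'.hA n nA, hf'.hC n nC, hf'.uA.ap, hf'.uC.ap]
    simp
  rw [f1, f2, mid_congr (low hu.1) (low hu.2.1), mid_congr (low (hu.1.mul hu.2.1)) (low hu.2.2)]
  ring

theorem xl_shift [Skew B] {S T : Alg B} (hS : GG S) (hT : GG T) (t : (ι →₀ ℕ) →+ ℚ) {n : ι →₀ ℕ} (h0 : n ≠ 0)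
    (ht : t n = 0) (h : ∀ a : ι →₀ ℕ, a.degree < n.degree → S a = T a) :
    xl (dg ι) S n - xl (dg ι) T n = xl (dg ι) (Zp t S) n - xl (dg ι) (Zp t T) n := by
  obtain ⟨m, hm⟩ := exists_pr_ne h0
  have hd := deg_pos h0
  have e1 := LL hS hT h0 h m
  have e2 := LL (hS.Zp t) (hT.Zp t) h0 (fun a ha =>
    Zp_congr hS.uni hT.uni (K := n.degree - 1) (fun a ha => h a (by omega)) a (by omega)) m
  rw [← Zp_shift hS.uni hT.uni t h0 ht h m, e1] at e2
  exact mul_right_cancel₀ hm e2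

theorem exists_inc (B : Matrix ι ι ℤ) [Skew B] : ∃ g, Inc B g := by
  classical
  choose ex hu hE using fun x : (ι →₀ ℕ) → ℚ => exists_expo (B := B) x
  let cut : ((ι →₀ ℕ) → ℚ) → ℕ → (ι →₀ ℕ) → ℚ := fun x d a => if a.degree < d then x a else 0
  obtain ⟨x, hx⟩ := exists_rec (V := ℚ)
    (fun x n => del n - xl (dg ι) (Zp (th B n) (ex (cut x n.degree))) n) (by
      intro S T n h
      have : cut S n.degree = cut T n.degree := by
        funext a
        simp only [cut]
        split_ifs with ha
        · exact h a ha
        · rfl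
      simp only [this])
  refine ⟨ex x, GG.of (hu x) (hE x), fun n h0 => ?_⟩
  have hd := deg_pos h0
  have key := xl_shift (GG.of (hu x) (hE x)) (GG.of (hu (cut x n.degree)) (hE _)) (th B n) h0
    (by rw [th_ap, om_self]) (fun a ha => expo_unique (hu _) (hu _) (hE _) (hE _) (n.degree - 1) (by
      intro b _ hb
      simp only [cut]
      rw [if_pos (by omega)]) a (by omega))
  rw [xl_eq (hu x) (hE x) h0, xl_eq (hu _) (hE _) h0] at key
  have h2 := hx n
  simp only [cut, lt_irrefl, if_false] at key
  simp only [cut] at h2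
  linarith

theorem inc_unique [Skew B] {g g' : Alg B} (h : Inc B g) (h' : Inc B g') : g = g' := by
  have key : ∀ d, ∀ n : ι →₀ ℕ, n.degree < d → n ≠ 0 → xl (dg ι) g n = xl (dg ι) g' n := by
    intro d
    induction d with
    | zero => intro n hn; omega
    | succ d ih =>
      intro n hn h0
      have hd := deg_pos h0
      have e : EqK (n.degree - 1) g g' := eqK_of_xl h.1 h'.1 fun a ha0 ha => ih a (by omega) ha0
      have := xl_shift h.1 h'.1 (th B n) h0 (by rw [th_ap, om_self]) (fun a ha => e a (by omega))
      rw [h.2 n h0, h'.2 n h0] at this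
      linarith
  exact eq_of_xl h.1 h'.1 fun n h0 => key (n.degree + 1) n (by omega) h0

end PartEight

end Cluster


namespace Cluster

noncomputable section PartNine

variable {ι : Type} [Fintype ι] [DecidableEq ι] {B : Matrix ι ι ℤ}

/-- integral vectors -/
def M0 (ι : Type) : AddSubgroup (ι → ℚ) where
  carrier := {m | ∀ i, ∃ z : ℤ, m i = z}
  zero_mem' := fun _ => ⟨0, by simp⟩
  add_mem' := by
    intro a b ha hb i
    obtain ⟨x, hx⟩ := ha i
    obtain ⟨y, hy⟩ := hb i
    exact ⟨x + y, by simp [hx, hy]⟩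
  neg_mem' := by
    intro a ha i
    obtain ⟨x, hx⟩ := ha i
    exact ⟨-x, by simp [hx]⟩

theorem ps_M0 (n : ι →₀ ℕ) : ps B n ∈ M0 ι := by
  intro i
  exact ⟨∑ j, B i j * (n j : ℤ), by simp [ps]⟩

theorem intL_one (n : ι →₀ ℕ) : IntL (M0 ι) n 1 := by
  intro m hm
  choose z hz using hm
  exact ⟨∑ i, (n i : ℤ) * z i, by simp [pr, hz]⟩

/-- words in the big algebra -/
def WA (B : Matrix ι ι ℤ) (S : Set (ι →₀ ℕ)) : Submonoid (Alg B) :=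
  Submonoid.closure {x | ∃ n c, n ∈ S ∧ n ≠ 0 ∧ 0 < c ∧ IntL (M0 ι) n c ∧ x = tl B n c}

theorem W_map (K : ℕ) (S : Set (ι →₀ ℕ)) : (WA B S).map (q K).toMonoidHom = W B K (M0 ι) S := by
  rw [WA, W, MonoidHom.map_mclosure]
  congr 1
  ext x
  constructor
  · rintro ⟨y, ⟨n, c, h1, h2, h3, h4, rfl⟩, rfl⟩
    exact ⟨n, c, h1, h2, h3, h4, rfl⟩
  · rintro ⟨n, c, h1, h2, h3, h4, rfl⟩
    exact ⟨_, ⟨n, c, h1, h2, h3, h4, rfl⟩, rfl⟩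

theorem W_lift {K : ℕ} {S : Set (ι →₀ ℕ)} {T : Alg B} (h : q K T ∈ W B K (M0 ι) S) :
    ∃ T' ∈ WA B S, EqK K T T' := by
  rw [← W_map] at h
  obtain ⟨T', h1, h2⟩ := h
  exact ⟨T', h1, q_eq.1 h2.symm⟩

theorem W_of {K : ℕ} {S : Set (ι →₀ ℕ)} {T : Alg B} (h : T ∈ WA B S) : q K T ∈ W B K (M0 ι) S := by
  rw [← W_map]; exact ⟨T, h, rfl⟩

theorem WA_prop [Skew B] {S : Set (ι →₀ ℕ)} {P : AddSubmonoid (ι →₀ ℕ)} (hP : ∀ n ∈ S, n ∈ P) {T : Alg B}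
    (h : T ∈ WA B S) : Uni T ∧ T ∈ supp B P := by
  rw [WA] at h
  induction h using Submonoid.closure_induction with
  | one => exact ⟨uni_one, one_mem _⟩
  | mem x hx =>
    obtain ⟨n, c, h1, h2, h3, h4, rfl⟩ := hx
    exact ⟨tl_uni h2 c, tl_supp c (hP n h1)⟩
  | mul x y _ _ hx hy => exact ⟨hx.1.mul hy.1, mul_mem hx.2 hy.2⟩

theorem small (F : List (ℚ × ℚ)) : ∃ ε : ℚ, 0 < ε ∧ ∀ p ∈ F, (0 < p.1 → 0 < p.1 + ε * p.2) ∧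
    (p.1 < 0 → p.1 + ε * p.2 < 0) := by
  suffices h : ∃ E : ℚ, 0 < E ∧ ∀ ε : ℚ, 0 < ε → ε ≤ E → ∀ p ∈ F, (0 < p.1 → 0 < p.1 + ε * p.2) ∧
      (p.1 < 0 → p.1 + ε * p.2 < 0) by
    obtain ⟨E, h0, h⟩ := h
    exact ⟨E, h0, h E h0 le_rfl⟩
  induction F with
  | nil => exact ⟨1, one_pos, by simp⟩
  | cons p F ih =>
    obtain ⟨E, h0, h⟩ := ih
    by_cases hp : p.1 = 0
    · refine ⟨E, h0, fun ε e1 e2 p' hp' => ?_⟩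
      rcases List.mem_cons.1 hp' with rfl | h'
      · simp [hp]
      · exact h ε e1 e2 p' h'
    · have hp1 : 0 < |p.1| := abs_pos.2 hp
      have hp2 : 0 < |p.2| + 1 := by positivity
      refine ⟨min E (|p.1| / (2 * (|p.2| + 1))), lt_min h0 (by positivity), fun ε e1 e2 p' hp' => ?_⟩
      rcases List.mem_cons.1 hp' with rfl | h'
      · have e3 : ε * (|p'.2| + 1) ≤ |p'.1| / 2 := by
          have := e2.trans (min_le_right _ _)
          rw [le_div_iff₀ (by positivity)] at this
          linarith
        have e4 : |ε * p'.2| < |p'.1| := by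
          rw [abs_mul, abs_of_pos e1]
          nlinarith
        rw [abs_lt] at e4
        constructor
        · intro hh; rw [abs_of_pos hh] at e4; linarith
        · intro hh; rw [abs_of_neg hh] at e4; linarith
      · exact h ε e1 (e2.trans (min_le_left _ _)) p' h'

/-- lexicographic signs -/
def Lex (K : ℕ) (t1 t2 t : (ι →₀ ℕ) →+ ℚ) : Prop := ∀ n : ι →₀ ℕ, n.degree ≤ K →
  (0 < t1 n → 0 < t n) ∧ (t1 n < 0 → t n < 0) ∧
    (t1 n = 0 → (0 < t2 n → 0 < t n) ∧ (t2 n < 0 → t n < 0) ∧ (t2 n = 0 → t n = 0))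

theorem exists_lex (K : ℕ) (t1 t2 : (ι →₀ ℕ) →+ ℚ) : ∃ t, Lex K t1 t2 t := by
  obtain ⟨ε, h0, h⟩ := small ((le_deg ι K).toList.map fun n => (t1 n, t2 n))
  refine ⟨t1 + ε • t2, fun n hn => ?_⟩
  have h' := h (t1 n, t2 n) (List.mem_map.2 ⟨n, by simpa [mem_le_deg] using hn, rfl⟩)
  simp only [AddMonoidHom.add_apply, AddMonoidHom.smul_apply, smul_eq_mul]
  refine ⟨h'.1, h'.2, fun e => ?_⟩
  rw [e]
  refine ⟨fun e => by positivity, fun e => ?_, fun e => by simp [e]⟩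
  have := mul_neg_of_pos_of_neg h0 e
  linarith

theorem lex_Zp {K : ℕ} {t1 t2 t : (ι →₀ ℕ) →+ ℚ} (h : Lex K t1 t2 t) {T : Alg B} (hT : Uni T) :
    EqK K (Zp t T) (Zp t2 (Zp t1 T)) := by
  obtain ⟨A, C, hf, e⟩ := Zp_spec t1 hT
  obtain ⟨A2, C2, hf2, e2⟩ := Zp_spec t2 hf.uZ
  obtain ⟨s1, s2, s3⟩ := fac3_supp hf2 (R := zerS t1) (by rw [← e2]; exact hf.hZ)
  have cv : ∀ {P : AddSubmonoid (ι →₀ ℕ)} {X : Alg B}, X ∈ supp B (upK K P) →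
      ∀ n : ι →₀ ℕ, n.degree ≤ K → n ∉ P → X n = 0 := by
    intro P X hX n hn hP
    exact hX n (by rw [mem_upK]; push Not; exact ⟨hP, hn⟩)
  have mk : ∀ {R P : AddSubmonoid (ι →₀ ℕ)} {X : Alg B}, X ∈ supp B R → 
      (∀ n : ι →₀ ℕ, n.degree ≤ K → X n ≠ 0 → n ∈ R → n ∈ P) → X ∈ supp B (upK K P) := by
    intro R P X hX hRP n hn
    rw [mem_upK] at hn
    push Not at hn
    by_contra hne
    have : n ∈ R := by by_contra hh; exact hne (hX n hh)
    exact hn.1 (hRP n hn.2 hne this)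
  have z1 : ∀ {X : Alg B}, X ∈ supp B (zerS t1) → ∀ n, X n ≠ 0 → t1 n = 0 := by
    intro X hX n hn
    by_contra hh
    exact hn (hX n hh)
  refine Zp_uniqueK hT (hf.uA.mul hf2.uA) hf2.uZ (hf2.uC.mul hf.uC) (A := A * A2) (C := C2 * C)
    (cv (mul_mem (mk hf.hA ?_) (mk hf2.hA ?_))) (cv (mk hf2.hZ ?_)) (cv (mul_mem (mk hf2.hC ?_) (mk hf.hC ?_))) ?_
  · intro n hn _ h1
    rcases h1 with h1 | h1
    · exact Or.inl h1
    · exact Or.inr ((h n hn).1 h1)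
  · intro n hn hne h1
    rcases h1 with h1 | h1
    · exact Or.inl h1
    · exact Or.inr (((h n hn).2.2 (z1 s1 n hne)).1 h1)
  · intro n hn hne h1
    exact ((h n hn).2.2 (z1 s2 n hne)).2.2 h1
  · intro n hn hne h1
    rcases h1 with h1 | h1
    · exact Or.inl h1
    · right
      simp only [AddMonoidHom.neg_apply, Left.neg_pos_iff] at h1 ⊢
      exact ((h n hn).2.2 (z1 s3 n hne)).2.1 h1
  · intro n hn _ h1
    rcases h1 with h1 | h1
    · exact Or.inl h1
    · right
      simp only [AddMonoidHom.neg_apply, Left.neg_pos_iff] at h1 ⊢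
      exact (h n hn).2.1 h1
  · have : T = A * A2 * Zp t2 (Zp t1 T) * (C2 * C) := by
      conv_lhs => rw [e, e2]
      simp only [mul_assoc]
    rw [← this]
    exact EqK.refl _ _

/-- signs up to a degree, for a factorization -/
theorem fac_uniqueK {t : (ι →₀ ℕ) →+ ℚ} {K : ℕ} {A Z C A' Z' C' : Alg B} (h : Fac t A Z C)
    (uA : Uni A') (uZ : Uni Z') (uC : Uni C')
    (hA : ∀ n : ι →₀ ℕ, n.degree ≤ K → n ∉ posS t → A' n = 0)
    (hG : ∀ n : ι →₀ ℕ, n.degree ≤ K → n ∉ nnS (-t) → (Z' * C') n = 0)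
    (e : EqK K (A * Z * C) (A' * (Z' * C'))) : EqK K A A' := by
  refine (fac_unique (P := upK K (posS t)) (Q := upK K (nnS (-t))) (F := A) (G := Z * C) (F' := A')
    (G' := Z' * C') ?_ h.uA (h.uZ.mul h.uC) uA (uZ.mul uC) ?_ ?_ ?_ ?_ ?_).1
  · intro n hn h1 h2
    rw [mem_upK] at h1 h2
    exact pos_nn_disj t n (h1.resolve_right (by omega)) (h2.resolve_right (by omega))
  · exact supp_mono (fun n hn => Or.inl hn) h.hA
  · intro n hn
    rw [mem_upK] at hn
    push Not at hn
    exact hA n hn.2 hn.1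
  · exact mul_mem (supp_mono (fun n hn => Or.inl (zerS_le' t hn)) h.hZ)
      (supp_mono (fun n hn => Or.inl (posS_le _ hn)) h.hC)
  · intro n hn
    rw [mem_upK] at hn
    push Not at hn
    exact hG n hn.2 hn.1
  · rw [← mul_assoc]; exact e

theorem fac_uniqueK' {t : (ι →₀ ℕ) →+ ℚ} {K : ℕ} {A Z C A' Z' C' : Alg B} (h : Fac t A Z C)
    (uA : Uni A') (uZ : Uni Z') (uC : Uni C')
    (hG : ∀ n : ι →₀ ℕ, n.degree ≤ K → n ∉ nnS t → (A' * Z') n = 0)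
    (hC : ∀ n : ι →₀ ℕ, n.degree ≤ K → n ∉ posS (-t) → C' n = 0)
    (e : EqK K (A * Z * C) (A' * Z' * C')) : EqK K C C' := by
  refine (fac_unique (P := upK K (nnS t)) (Q := upK K (posS (-t))) (F := A * Z) (G := C) (F' := A' * Z')
    (G' := C') ?_ (h.uA.mul h.uZ) h.uC (uA.mul uZ) uC ?_ ?_ ?_ ?_ e).2
  · intro n hn h1 h2
    rw [mem_upK] at h1 h2
    exact nn_pos_disj t n (h1.resolve_right (by omega)) (h2.resolve_right (by omega))
  · exact mul_mem (supp_mono (fun n hn => Or.inl (posS_le t hn)) h.hA)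
      (supp_mono (fun n hn => Or.inl (zerS_le _ hn)) h.hZ)
  · intro n hn
    rw [mem_upK] at hn
    push Not at hn
    exact hG n hn.2 hn.1
  · exact supp_mono (fun n hn => Or.inl hn) h.hC
  · intro n hn
    rw [mem_upK] at hn
    push Not at hn
    exact hC n hn.2 hn.1

/-- slopes -/
def slp (K : ℕ) (κ : (ι →₀ ℕ) →+ ℚ) : Finset ℚ := (le_deg ι K).image fun n => κ n / dg ι n

theorem slp_mem {K : ℕ} (κ : (ι →₀ ℕ) →+ ℚ) {n : ι →₀ ℕ} (hn : n.degree ≤ K) : κ n / dg ι n ∈ slp K κ :=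
  Finset.mem_image.2 ⟨n, mem_le_deg.2 hn, rfl⟩

theorem sl_ap (κ : (ι →₀ ℕ) →+ ℚ) (μ : ℚ) (n : ι →₀ ℕ) : (κ - μ • dg ι) n = κ n - μ * dg ι n := by
  simp

theorem slope_pos [Skew B] {K : ℕ} (κ : (ι →₀ ℕ) →+ ℚ) {h : Alg B} (hh : Uni h) (S : Set (ι →₀ ℕ))
    (hS : ∀ μ : ℚ, q K (Zp (κ - μ • dg ι) h) ∈ W B K (M0 ι) {n | n ∈ S ∧ κ n = μ * dg ι n}) :
    ∀ (N : ℕ) (μ : ℚ), ((slp K κ).filter (μ < ·)).card = N → ∀ A Z C : Alg B, Fac (κ - μ • dg ι) A Z C →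
      h = A * Z * C → q K A ∈ W B K (M0 ι) {n | n ∈ S ∧ μ * dg ι n < κ n} := by
  intro N
  induction N using Nat.strong_induction_on with
  | _ N ih =>
    intro μ hN A Z C hf e
    by_cases hne : ((slp K κ).filter (μ < ·)).Nonempty
    · set μ1 := ((slp K κ).filter (μ < ·)).min' hne with hμ1
      have m1 : μ1 ∈ (slp K κ).filter (μ < ·) := Finset.min'_mem _ _
      have m1' := (Finset.mem_filter.1 m1).2
      obtain ⟨A1, C1, hf1, e1⟩ := Zp_spec (κ - μ1 • dg ι) hh
      have i1 := ih _ (by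
        rw [← hN]
        apply Finset.card_lt_card
        refine ⟨fun x hx => ?_, fun hx => ?_⟩
        · rw [Finset.mem_filter] at hx ⊢
          exact ⟨hx.1, m1'.trans hx.2⟩
        · have := hx m1
          simp at this) μ1 rfl A1 _ C1 hf1 e1
      have dpos : ∀ n : ι →₀ ℕ, n ≠ 0 → 0 < dg ι n := fun n hn => by
        rw [dg_ap]; exact_mod_cast deg_pos hn
      have key : EqK K A (A1 * Zp (κ - μ1 • dg ι) h) := by
        refine fac_uniqueK hf (hf1.uA.mul hf1.uZ) uni_one hf1.uC (Z' := 1) ?_ ?_ ?_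
        · have : A1 * Zp (κ - μ1 • dg ι) h ∈ supp B (posS (κ - μ • dg ι)) := by
            refine mul_mem (supp_mono ?_ hf1.hA) (supp_mono ?_ hf1.hZ)
            · intro n hn
              by_cases h0 : n = 0
              · exact Or.inl h0
              · right
                have := hn.resolve_left h0
                rw [sl_ap] at this ⊢
                have := mul_lt_mul_of_pos_right m1' (dpos n h0)
                linarith
            · intro n hn
              by_cases h0 : n = 0
              · exact Or.inl h0
              · right
                rw [mem_zerS, sl_ap] at hn
                rw [sl_ap]
                have := mul_lt_mul_of_pos_right m1' (dpos n h0)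
                linarith
          intro n _ hn
          exact this n hn
        · intro n hd hn
          rw [one_mul]
          apply hf1.hC
          intro hc
          apply hn
          by_cases h0 : n = 0
          · rw [h0]; exact zero_mem _
          · have := hc.resolve_left h0
            rw [AddMonoidHom.neg_apply, sl_ap] at this
            rw [mem_nnS, AddMonoidHom.neg_apply, sl_ap]
            by_contra hlt
            push Not at hlt
            have hp := dpos n h0
            have h1 : μ < κ n / dg ι n := by rw [lt_div_iff₀ hp]; linarith
            have h2 : μ1 ≤ κ n / dg ι n := Finset.min'_le _ _ (Finset.mem_filter.2 ⟨slp_mem κ hd, h1⟩)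
            rw [le_div_iff₀ hp] at h2
            linarith
        · rw [one_mul, ← e, ← e1]; exact EqK.refl _ _
      rw [q_eq.2 key, map_mul]
      refine mul_mem (W_mono ?_ i1) ?_
      · rintro n ⟨h1, h2⟩ _
        refine ⟨h1, lt_of_le_of_lt (mul_le_mul_of_nonneg_right m1'.le ?_) h2⟩
        rw [dg_ap]; positivity
      · rw [W, ← W]
        obtain ⟨T', hT', hE⟩ := W_lift (hS μ1)
        rw [q_eq.2 hE]
        refine W_of ?_
        rw [WA] at hT' ⊢
        refine Submonoid.closure_mono ?_ hT'
        rintro x ⟨n, c, ⟨h1, h2⟩, h3, h4, h5, rfl⟩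
        refine ⟨n, c, ⟨h1, ?_⟩, h3, h4, h5, rfl⟩
        rw [h2]
        exact mul_lt_mul_of_pos_right m1' (dpos n h3)
    · have : EqK K A 1 := by
        intro n hn
        by_cases h0 : n = 0
        · rw [h0]; funext m; rw [hf.uA.ap]; simp [one_ap]
        · rw [hf.hA n]
          · funext m; simp [one_ap, h0]
          · intro hp
            have := hp.resolve_left h0
            rw [sl_ap] at this
            apply hne
            refine ⟨κ n / dg ι n, Finset.mem_filter.2 ⟨slp_mem κ hn, ?_⟩⟩
            rw [lt_div_iff₀ (by rw [dg_ap]; exact_mod_cast deg_pos h0)]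
            linarith
      rw [q_eq.2 this, map_one]
      exact one_mem _

theorem slope_neg [Skew B] {K : ℕ} (κ : (ι →₀ ℕ) →+ ℚ) {h : Alg B} (hh : Uni h) (S : Set (ι →₀ ℕ))
    (hS : ∀ μ : ℚ, q K (Zp (κ - μ • dg ι) h) ∈ W B K (M0 ι) {n | n ∈ S ∧ κ n = μ * dg ι n}) :
    ∀ (N : ℕ) (μ : ℚ), ((slp K κ).filter (· < μ)).card = N → ∀ A Z C : Alg B, Fac (κ - μ • dg ι) A Z C →
      h = A * Z * C → q K C ∈ W B K (M0 ι) {n | n ∈ S ∧ κ n < μ * dg ι n} := by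
  intro N
  induction N using Nat.strong_induction_on with
  | _ N ih =>
    intro μ hN A Z C hf e
    by_cases hne : ((slp K κ).filter (· < μ)).Nonempty
    · set μ1 := ((slp K κ).filter (· < μ)).max' hne with hμ1
      have m1 : μ1 ∈ (slp K κ).filter (· < μ) := Finset.max'_mem _ _
      have m1' := (Finset.mem_filter.1 m1).2
      obtain ⟨A1, C1, hf1, e1⟩ := Zp_spec (κ - μ1 • dg ι) hh
      have i1 := ih _ (by
        rw [← hN]
        apply Finset.card_lt_card
        refine ⟨fun x hx => ?_, fun hx => ?_⟩
        · rw [Finset.mem_filter] at hx ⊢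
          exact ⟨hx.1, hx.2.trans m1'⟩
        · have := hx m1
          simp at this) μ1 rfl A1 _ C1 hf1 e1
      have dpos : ∀ n : ι →₀ ℕ, n ≠ 0 → 0 < dg ι n := fun n hn => by
        rw [dg_ap]; exact_mod_cast deg_pos hn
      have key : EqK K C (Zp (κ - μ1 • dg ι) h * C1) := by
        refine fac_uniqueK' hf hf1.uA uni_one (hf1.uZ.mul hf1.uC) (Z' := 1) ?_ ?_ ?_
        · intro n hd hn
          rw [mul_one]
          apply hf1.hA
          intro hc
          apply hn
          by_cases h0 : n = 0
          · rw [h0]; exact zero_mem _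
          · have := hc.resolve_left h0
            rw [sl_ap] at this
            rw [mem_nnS, sl_ap]
            by_contra hlt
            push Not at hlt
            have hp := dpos n h0
            have h1 : κ n / dg ι n < μ := by rw [div_lt_iff₀ hp]; linarith
            have h2 : κ n / dg ι n ≤ μ1 := Finset.le_max' _ _ (Finset.mem_filter.2 ⟨slp_mem κ hd, h1⟩)
            rw [div_le_iff₀ hp] at h2
            linarith
        · have : Zp (κ - μ1 • dg ι) h * C1 ∈ supp B (posS (-(κ - μ • dg ι))) := by
            refine mul_mem (supp_mono ?_ hf1.hZ) (supp_mono ?_ hf1.hC)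
            · intro n hn
              by_cases h0 : n = 0
              · exact Or.inl h0
              · right
                rw [mem_zerS, sl_ap] at hn
                rw [AddMonoidHom.neg_apply, sl_ap]
                have := mul_lt_mul_of_pos_right m1' (dpos n h0)
                linarith
            · intro n hn
              by_cases h0 : n = 0
              · exact Or.inl h0
              · right
                have := hn.resolve_left h0
                rw [AddMonoidHom.neg_apply, sl_ap] at this ⊢
                have := mul_lt_mul_of_pos_right m1' (dpos n h0)
                linarith
          intro n _ hn
          exact this n hn
        · rw [mul_one, ← e, ← mul_assoc, ← e1]; exact EqK.refl _ _
      rw [q_eq.2 key, map_mul]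
      refine mul_mem ?_ (W_mono ?_ i1)
      · obtain ⟨T', hT', hE⟩ := W_lift (hS μ1)
        rw [q_eq.2 hE]
        refine W_of ?_
        rw [WA] at hT' ⊢
        refine Submonoid.closure_mono ?_ hT'
        rintro x ⟨n, c, ⟨h1, h2⟩, h3, h4, h5, rfl⟩
        refine ⟨n, c, ⟨h1, ?_⟩, h3, h4, h5, rfl⟩
        rw [h2]
        exact mul_lt_mul_of_pos_right m1' (dpos n h3)
      · rintro n ⟨h1, h2⟩ _
        refine ⟨h1, lt_of_lt_of_le h2 (mul_le_mul_of_nonneg_right m1'.le ?_)⟩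
        rw [dg_ap]; positivity
    · have : EqK K C 1 := by
        intro n hn
        by_cases h0 : n = 0
        · rw [h0]; funext m; rw [hf.uC.ap]; simp [one_ap]
        · rw [hf.hC n]
          · funext m; simp [one_ap, h0]
          · intro hp
            have := hp.resolve_left h0
            rw [AddMonoidHom.neg_apply, sl_ap] at this
            apply hne
            refine ⟨κ n / dg ι n, Finset.mem_filter.2 ⟨slp_mem κ hn, ?_⟩⟩
            rw [div_lt_iff₀ (by rw [dg_ap]; exact_mod_cast deg_pos h0)]
            linarith
      rw [q_eq.2 this, map_one]
      exact one_mem _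

theorem list_split (f : (ι →₀ ℕ) → ℚ) (F : (ι →₀ ℕ) → Alg B) (l : List (ι →₀ ℕ)) (hl : ∀ n ∈ l, n ≠ 0)
    (hp : l.Pairwise (fun x y => f x * dg ι y ≤ f y * dg ι x)) :
    (l.map F).prod = ((l.filter (f · < 0)).map F).prod * ((l.filter (f · = 0)).map F).prod *
      ((l.filter (0 < f ·)).map F).prod := by
  induction l with
  | nil => simp
  | cons x l ih =>
    rw [List.pairwise_cons] at hp
    have ih' := ih (fun n hn => hl n (List.mem_cons_of_mem _ hn)) hp.2
    have dpos : ∀ n : ι →₀ ℕ, n ≠ 0 → 0 < dg ι n := fun n hn => by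
      rw [dg_ap]; exact_mod_cast deg_pos hn
    have hx := dpos x (hl x List.mem_cons_self)
    have hd : ∀ y ∈ l, 0 < dg ι y := fun y hy => dpos y (hl y (List.mem_cons_of_mem _ hy))
    rcases lt_trichotomy (f x) 0 with h | h | h
    · rw [List.filter_cons_of_pos (by simpa using h), List.filter_cons_of_neg (by simpa using h.ne),
        List.filter_cons_of_neg (by simpa using h.le), List.map_cons, List.prod_cons, ih', List.map_cons,
        List.prod_cons]
      simp only [mul_assoc]
    · have e1 : l.filter (f · < 0) = [] := by
        rw [List.filter_eq_nil_iff]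
        intro y hy
        have h1 := hp.1 y hy
        rw [h, zero_mul] at h1
        have : 0 ≤ f y := nonneg_of_mul_nonneg_left h1 hx
        simpa using this
      rw [List.filter_cons_of_neg (by simp [h]), List.filter_cons_of_pos (by simpa using h),
        List.filter_cons_of_neg (by simp [h]), List.map_cons, List.prod_cons, ih', e1, List.map_cons,
        List.prod_cons]
      simp [mul_assoc]
    · have e0 : ∀ y ∈ l, 0 < f y := by
        intro y hy
        have h1 := hp.1 y hy
        have h2 : 0 < f x * dg ι y := mul_pos h (hd y hy)
        exact pos_of_mul_pos_left (h2.trans_le h1) hx.le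
      have e1 : l.filter (f · < 0) = [] := by
        rw [List.filter_eq_nil_iff]
        intro y hy
        simpa using (e0 y hy).le
      have e2 : l.filter (f · = 0) = [] := by
        rw [List.filter_eq_nil_iff]
        intro y hy
        simpa using (e0 y hy).ne'
      rw [List.filter_cons_of_neg (by simpa using h.le), List.filter_cons_of_neg (by simpa using h.ne'),
        List.filter_cons_of_pos (by simpa using h), List.map_cons, List.prod_cons, ih', e1, e2, List.map_cons,
        List.prod_cons]
      simp

end PartNine

end Cluster


namespace Cluster

noncomputable section PartTen

variable {ι : Type} [Fintype ι] [DecidableEq ι] {B : Matrix ι ι ℤ}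

theorem dg_pos {n : ι →₀ ℕ} (hn : n ≠ 0) : 0 < dg ι n := by
  rw [dg_ap]; exact_mod_cast deg_pos hn

theorem dg_sum (n : ι →₀ ℕ) : dg ι n = pr n (fun _ => 1) := by
  rw [dg_ap, pr, Finsupp.degree_eq_sum]; push_cast; simp

/-- parallel exponents -/
def Par (a b : ι →₀ ℕ) : Prop := b.degree • a = a.degree • b

theorem Par.ap {a b : ι →₀ ℕ} (h : Par a b) (t : (ι →₀ ℕ) →+ ℚ) : dg ι b * t a = dg ι a * t b := by
  have := congrArg t h
  simpa [map_nsmul, dg_ap] using this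

theorem Par.zero {a b : ι →₀ ℕ} (h : Par a b) (hb : b ≠ 0) (t : (ι →₀ ℕ) →+ ℚ) (e : t b = 0) : t a = 0 := by
  have := h.ap t
  rw [e, mul_zero] at this
  exact (mul_eq_zero.1 this).resolve_left (dg_ne hb)

theorem Par.symm {a b : ι →₀ ℕ} (h : Par a b) : Par b a := Eq.symm h

theorem Par.trans' {x y n : ι →₀ ℕ} (hn : n ≠ 0) (hx : Par x n) (hy : Par y n) : Par x y := by
  have hd := deg_pos hn
  refine Finsupp.ext fun i => ?_
  have h1 := DFunLike.congr_fun hx i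
  have h2 := DFunLike.congr_fun hy i
  simp only [Finsupp.smul_apply, smul_eq_mul] at *
  apply Nat.eq_of_mul_eq_mul_left hd
  calc _ = y.degree * (n.degree * x i) := by ring
    _ = x.degree * (n.degree * y i) := by rw [h1, h2]; ring
    _ = _ := by ring

theorem Par.of_nsmul {a n : ι →₀ ℕ} {j : ℕ} (hj : 0 < j) (h : Par (j • a) n) : Par a n := by
  refine Finsupp.ext fun i => ?_
  have h1 := DFunLike.congr_fun h i
  rw [deg_nsmul] at h1
  simp only [Finsupp.smul_apply, smul_eq_mul] at *
  apply Nat.eq_of_mul_eq_mul_left hj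
  linarith

/-- functional given by a vector -/
def prH (m : ι → ℚ) : (ι →₀ ℕ) →+ ℚ where
  toFun n := pr n m
  map_zero' := by simp [pr]
  map_add' a b := pr_add a b m

/-- linear forms on functionals -/
def fm (p : ℚ × (ι →₀ ℕ) × ℚ × (ι →₀ ℕ)) (t : (ι →₀ ℕ) →+ ℚ) : ℚ := p.1 * t p.2.1 + p.2.2.1 * t p.2.2.2

theorem fm_add (p : ℚ × (ι →₀ ℕ) × ℚ × (ι →₀ ℕ)) (t y : (ι →₀ ℕ) →+ ℚ) (ε : ℚ) :
    fm p (t + ε • y) = fm p t + ε * fm p y := by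
  simp only [fm, AddMonoidHom.add_apply, AddMonoidHom.smul_apply, smul_eq_mul]; ring

theorem vec_gen {n0 : ι →₀ ℕ} (h0 : n0 ≠ 0) (c1 c2 : ℚ) (n1 n2 : ι →₀ ℕ)
    (h : ∀ y : (ι →₀ ℕ) →+ ℚ, y n0 = 0 → fm (c1, n1, c2, n2) y = 0) :
    ∃ c : ℚ, ∀ i, c1 * n1 i + c2 * n2 i = c * n0 i := by
  obtain ⟨i, hi⟩ := Finsupp.ne_iff.1 h0
  have hi' : (n0 i : ℚ) ≠ 0 := by exact_mod_cast hi
  refine ⟨(c1 * n1 i + c2 * n2 i) / n0 i, fun j => ?_⟩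
  have sg : ∀ (n : ι →₀ ℕ) (j : ι) (c : ℚ), pr n (Pi.single j c) = n j * c := by
    intro n j c
    rw [pr, Finset.sum_eq_single j]
    · simp
    · intro b _ hb; simp [hb]
    · simp
  have := h (prH (Pi.single j (1:ℚ) + Pi.single i (-((n0 j : ℚ) / (n0 i : ℚ))) : ι → ℚ)) (by
    change pr _ _ = 0
    rw [pr_add_right, sg, sg]; field_simp; ring)
  simp only [fm] at this
  change c1 * pr n1 _ + c2 * pr n2 _ = 0 at this
  rw [pr_add_right, pr_add_right, sg, sg, sg, sg] at this
  field_simp at this ⊢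
  linarith

theorem perturb (n0 : ι →₀ ℕ) (F : List (ℚ × (ι →₀ ℕ) × ℚ × (ι →₀ ℕ))) (t0 : (ι →₀ ℕ) →+ ℚ) (ht0 : t0 n0 = 0) :
    ∀ V : List (ℚ × (ι →₀ ℕ) × ℚ × (ι →₀ ℕ)), (∀ p ∈ V, ∃ y : (ι →₀ ℕ) →+ ℚ, y n0 = 0 ∧ fm p y ≠ 0) →
      ∃ t : (ι →₀ ℕ) →+ ℚ, t n0 = 0 ∧ (∀ p ∈ V, fm p t ≠ 0) ∧
        ∀ p ∈ F, (0 < fm p t0 → 0 < fm p t) ∧ (fm p t0 < 0 → fm p t < 0) := by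
  intro V
  induction V with
  | nil => exact fun _ => ⟨t0, ht0, by simp, fun p _ => ⟨id, id⟩⟩
  | cons p V ih =>
    intro hV
    obtain ⟨t, h1, h2, h3⟩ := ih fun p hp => hV p (List.mem_cons_of_mem _ hp)
    by_cases hp : fm p t = 0
    · obtain ⟨y, hy0, hy⟩ := hV p List.mem_cons_self
      obtain ⟨ε, e0, he⟩ := small ((F ++ V).map fun p => (fm p t, fm p y))
      have he' : ∀ p ∈ F ++ V, (0 < fm p t → 0 < fm p (t + ε • y)) ∧ (fm p t < 0 → fm p (t + ε • y) < 0) := by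
        intro p hp
        rw [fm_add]
        exact he _ (List.mem_map.2 ⟨p, hp, rfl⟩)
      refine ⟨t + ε • y, by simp [h1, hy0], ?_, ?_⟩
      · intro p' hp'
        rcases List.mem_cons.1 hp' with rfl | h'
        · rw [fm_add, hp, zero_add]; exact mul_ne_zero e0.ne' hy
        · have := he' p' (List.mem_append_right _ h')
          rcases lt_or_gt_of_ne (h2 p' h') with hh | hh
          · exact (this.2 hh).ne
          · exact (this.1 hh).ne'
      · intro p' hp'
        have := he' p' (List.mem_append_left _ hp')
        exact ⟨fun hh => this.1 ((h3 p' hp').1 hh), fun hh => this.2 ((h3 p' hp').2 hh)⟩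
    · refine ⟨t, h1, ?_, h3⟩
      intro p' hp'
      rcases List.mem_cons.1 hp' with rfl | h'
      · exact hp
      · exact h2 p' h'

/-- generic context -/
structure Ctx (B : Matrix ι ι ℤ) (d : ℕ) (n0 : ι →₀ ℕ) (Q : (ι →₀ ℕ) →+ ℚ) : Prop where
  h0 : n0 ≠ 0
  hQ : Q n0 = 0
  g1 : ∀ n : ι →₀ ℕ, n.degree ≤ d → n ≠ 0 → Q n = 0 → Par n n0
  g2 : ∀ x y : ι →₀ ℕ, x.degree ≤ d → y.degree ≤ d → th B n0 y * Q x - th B n0 x * Q y = 0 →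
    ∃ c : ℚ, ∀ i, th B n0 y * x i - th B n0 x * y i = c * n0 i

theorem generic (B : Matrix ι ι ℤ) (d : ℕ) {n0 : ι →₀ ℕ} (h0 : n0 ≠ 0) (t : (ι →₀ ℕ) →+ ℚ) (ht : t n0 = 0)
    (hp : ∀ n : ι →₀ ℕ, n.degree ≤ d → n ≠ 0 → t n = 0 → Par n n0) :
    ∃ Q, SameSign d t Q ∧ Ctx B d n0 Q := by
  classical
  let V0 : List (ℚ × (ι →₀ ℕ) × ℚ × (ι →₀ ℕ)) := (le_deg ι d ×ˢ le_deg ι d).toList.map fun p =>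
    (th B n0 p.2, p.1, -th B n0 p.1, p.2)
  obtain ⟨Q, h1, h2, h3⟩ := perturb n0 ((le_deg ι d).toList.map fun n => (1, n, 0, n)) t ht
    (V0.filter fun p => ∃ y : (ι →₀ ℕ) →+ ℚ, y n0 = 0 ∧ fm p y ≠ 0) (by
      intro p hp
      simpa using (List.mem_filter.1 hp).2)
  have h3' : ∀ n : ι →₀ ℕ, n.degree ≤ d → (0 < t n → 0 < Q n) ∧ (t n < 0 → Q n < 0) := by
    intro n hn
    have := h3 (1, n, 0, n) (List.mem_map.2 ⟨n, by simpa [mem_le_deg] using hn, rfl⟩)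
    simpa [fm] using this
  have h4 : ∀ n : ι →₀ ℕ, n.degree ≤ d → t n = 0 → Q n = 0 := by
    intro n hn e
    by_cases hn0 : n = 0
    · simp [hn0]
    · exact (hp n hn hn0 e).zero h0 Q h1
  have hs : SameSign d t Q := by
    intro n hn
    have a := h3' n hn
    have b := h4 n hn
    rcases lt_trichotomy (t n) 0 with h | h | h
    · have := a.2 h
      exact ⟨⟨fun _ => by linarith, fun _ => by linarith⟩, ⟨fun _ => this, fun _ => h⟩⟩
    · rw [b h, h]; simp
    · have := a.1 h
      exact ⟨⟨fun _ => by linarith, fun _ => by linarith⟩, ⟨fun _ => by linarith, fun _ => by linarith⟩⟩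
  refine ⟨Q, hs, h0, h1, ?_, ?_⟩
  · intro n hn hn0 e
    apply hp n hn hn0
    have := hs n hn
    rw [e] at this
    simp only [lt_irrefl, iff_false, not_lt] at this
    exact le_antisymm this.1 this.2
  · intro x y hx hy e
    obtain ⟨c, hc⟩ := vec_gen h0 (th B n0 y) (-th B n0 x) x y (by
      by_contra hcon
      push Not at hcon
      apply h2 (th B n0 y, x, -th B n0 x, y)
      · rw [List.mem_filter]
        refine ⟨List.mem_map.2 ⟨(x, y), ?_, rfl⟩, by simpa using hcon⟩
        simp [mem_le_deg, hx, hy]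
      · simp only [fm]
        linarith)
    exact ⟨c, fun i => by rw [← hc i]; ring⟩

/-- the path of functionals -/
def path (B : Matrix ι ι ℤ) (n0 : ι →₀ ℕ) (Q : (ι →₀ ℕ) →+ ℚ) (s : ℚ) : (ι →₀ ℕ) →+ ℚ :=
  th B n0 + s • (Q - th B n0)

theorem path_ap (n0 : ι →₀ ℕ) (Q : (ι →₀ ℕ) →+ ℚ) (s : ℚ) (n : ι →₀ ℕ) :
    path B n0 Q s n = th B n0 n + s * (Q n - th B n0 n) := by
  simp [path]

theorem Ctx.P0 [Skew B] {d : ℕ} {n0 : ι →₀ ℕ} {Q : (ι →₀ ℕ) →+ ℚ} (cx : Ctx B d n0 Q) {n : ι →₀ ℕ}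
    (hn : n.degree ≤ d) (e : Q n = 0) : th B n0 n = 0 := by
  by_cases h : n = 0
  · simp [h]
  · exact (cx.g1 n hn h e).zero cx.h0 _ (by rw [th_ap, om_self])

theorem W_mono' {K : ℕ} {M : AddSubgroup (ι → ℚ)} {S S' : Set (ι →₀ ℕ)}
    (h : ∀ n ∈ S, n ≠ 0 → n.degree ≤ K → n ∈ S') : W B K M S ≤ W B K M S' := by
  have : W B K M S ≤ W B K M {n | n ∈ S ∧ n ≠ 0} := by
    rw [W, W]
    apply Submonoid.closure_mono
    rintro x ⟨n, c, h1, h2, h3⟩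
    exact ⟨n, c, ⟨h1, h2⟩, h2, h3⟩
  exact this.trans (W_mono fun n hn hd => h n hn.1 hn.2 hd)

theorem th_par [Skew B] {n n0 : ι →₀ ℕ} (h : Par n n0) (hn : n ≠ 0) (h0 : n0 ≠ 0) (K : ℕ) :
    SameSign K (th B n) (th B n0) := by
  intro x _
  have e : dg ι n0 * om B x n = dg ι n * om B x n0 := by
    have := congrArg (om B x) h
    simpa [om_nsmul_right, dg_ap] using this
  have p1 := dg_pos hn
  have p2 := dg_pos h0
  rw [th_ap, th_ap]
  constructor
  · rw [← mul_pos_iff_of_pos_left p2, e, mul_pos_iff_of_pos_left p1]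
  · constructor
    · intro h
      by_contra hc
      push Not at hc
      have h1 := mul_neg_of_pos_of_neg p2 h
      have h2 := mul_nonneg p1.le hc
      linarith
    · intro h
      by_contra hc
      push Not at hc
      have h1 := mul_neg_of_pos_of_neg p1 h
      have h2 := mul_nonneg p2.le hc
      linarith

theorem start [Skew B] {d : ℕ} {n0 : ι →₀ ℕ} {Q : (ι →₀ ℕ) →+ ℚ} (cx : Ctx B d n0 Q) {g : Alg B} (hg : Inc B g) :
    q d (Zp (Q - th B n0) (Zp (path B n0 Q 0) g)) ∈ W B d (M0 ι) {n | Q n = 0} := by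
  have e0 : path B n0 Q 0 = th B n0 := by simp [path]
  rw [e0]
  set h := Zp (th B n0) g with hh
  have gh : GG h := hg.1.Zp _
  have sh : h ∈ supp B (zerS (th B n0)) := Zp_mem _ hg.1.uni
  set t := Zp (Q - th B n0) h with ht
  have gt : GG t := gh.Zp _
  have v0 : ∀ n : ι →₀ ℕ, n ≠ 0 → n.degree ≤ d → Q n ≠ 0 → xl (dg ι) t n = 0 := by
    intro n hn hd hq
    by_cases hP : th B n0 n = 0
    · refine xl_mem gt (Zp_mem _ gh.uni) _ n ?_
      rw [mem_zerS]; simpa [hP] using hq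
    · exact xl_mem gt (Zp_supp _ gh.uni sh) _ n hP
  have v1 : ∀ n : ι →₀ ℕ, n ≠ 0 → n.degree ≤ d → Q n = 0 → xl (dg ι) t n = del n := by
    intro n hn hd hq
    have hpar := cx.g1 n hd hn hq
    rw [← hg.2 n hn]
    have e1 : xl (dg ι) (Zp (th B n) g) n = xl (dg ι) h n :=
      xl_congr (Zp_sameSign (th_par hpar hn cx.h0 n.degree) hg.1.uni) (Zp_uni _ hg.1.uni) (Zp_uni _ hg.1.uni) _ n le_rfl
    rw [e1]
    obtain ⟨A, C, hf, e⟩ := Zp_spec (Q - th B n0) gh.uni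
    obtain ⟨s1, s2, s3⟩ := fac3_supp hf (R := zerS (th B n0)) (by rw [← e]; exact sh)
    obtain ⟨g1, g2, g3⟩ := fac3_gg hf (by rw [← e]; exact gh)
    have hc : ∀ a ∈ zerS (th B n0), om B a n = 0 := by
      intro a ha
      rw [mem_zerS, th_ap] at ha
      have e : dg ι n0 * om B a n = dg ι n * om B a n0 := by
        have := congrArg (om B a) hpar
        simpa [om_nsmul_right, dg_ap] using this
      rw [ha, mul_zero] at e
      exact (mul_eq_zero.1 e).resolve_left (dg_ne cx.h0)
    have hP : th B n0 n = 0 := cx.P0 hd hq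
    conv_rhs => rw [e]
    rw [xl_mul_central (g1.mul g2) g3 (mul_mem s1 s2) s3 _ hn hc, xl_mul_central g1 g2 s1 s2 _ hn hc,
      xl_mem g1 hf.hA _ n (by rw [mem_posS]; simp [hn, hP, hq]),
      xl_mem g3 hf.hC _ n (by rw [mem_posS]; simp [hn, hP, hq])]
    simp [ht]
  by_cases hi : ∃ i : ι, Par (bs i) n0
  · obtain ⟨i, hi⟩ := hi
    have hQi : Q (bs i) = 0 := hi.zero cx.h0 Q cx.hQ
    have : EqK d t (tl B (bs i) 1) := by
      refine eqK_of_xl gt (tl_gg (bs_ne i) 1) fun n hn hd => ?_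
      rw [xl_tl (bs_ne i) 1 _ hn]
      have e1 : dg ι (bs i) = 1 := by simp [dg_ap, bs]
      rw [e1, one_mul]
      by_cases hq : Q n = 0
      · rw [v1 n hn hd hq, del]
        have hpar : Par n (bs i) := Par.trans' cx.h0 (cx.g1 n hd hn hq) hi
        have hn' : n = n.degree • bs i := by
          have := hpar
          rw [Par] at this
          simpa [bs] using this
        rw [Finset.sum_eq_single i]
        · intro j _ hj
          apply lg_not
          intro k hk
          have h1 := DFunLike.congr_fun hn' i
          have h2 := DFunLike.congr_fun hk i
          simp only [bs, Finsupp.smul_apply, Finsupp.single_eq_same, smul_eq_mul, mul_one,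
            Finsupp.single_apply, if_neg hj, mul_zero] at h1 h2
          have := deg_pos hn
          omega
        · simp
      · rw [v0 n hn hd hq, lg_not]
        intro j hj
        apply hq
        rw [hj, map_nsmul, hQi, smul_zero]
    rw [q_eq.2 this]
    exact W_letter hQi (bs_ne i) zero_le_one (intL_one _)
  · have : EqK d t 1 := by
      refine eqK_of_xl gt gg_one fun n hn hd => ?_
      have e1 : xl (dg ι) (1 : Alg B) n = 0 := by
        have := xl_eq (B := B) uni_one (l := dg ι) (x := 0) (by
          rw [Eu_one, mul_one]; ext n m; simp [ham_ap]) hn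
        simpa using this
      rw [e1]
      by_cases hq : Q n = 0
      · rw [v1 n hn hd hq, del]
        apply Finset.sum_eq_zero
        intro i _
        apply lg_not
        intro j hj
        apply hi
        refine ⟨i, Par.of_nsmul (j := j) ?_ ?_⟩
        · rcases Nat.eq_zero_or_pos j with h | h
          · rw [h, zero_smul] at hj; exact absurd hj hn
          · exact h
        · rw [← hj]; exact cx.g1 n hd hn hq
      · exact v0 n hn hd hq
    rw [q_eq.2 this, map_one]
    exact one_mem _

theorem step_path [Skew B] {d : ℕ} {n0 : ι →₀ ℕ} {Q : (ι →₀ ℕ) →+ ℚ} (cx : Ctx B d n0 Q) {g : Alg B} (hg : GG g)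
    {s' s : ℚ} (hs : s' < s) (hnc : ∀ n : ι →₀ ℕ, n.degree ≤ d → Q n ≠ 0 → ∀ r, s' < r → r < s → path B n0 Q r n ≠ 0) :
    EqK d (Zp (Q - th B n0) (Zp (path B n0 Q s') g)) (Zp (-(Q - th B n0)) (Zp (path B n0 Q s) g)) := by
  set r := (s' + s) / 2 with hr
  have r1 : s' < r := by rw [hr]; linarith
  have r2 : r < s := by rw [hr]; linarith
  have key : ∀ n : ι →₀ ℕ, n.degree ≤ d → Q n ≠ 0 → ∀ u v : ℚ, s' ≤ u → u ≤ s → s' < v → v < s →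
      path B n0 Q u n * path B n0 Q v n < 0 → False := by
    intro n hn hq u v u1 u2 v1 v2 hm
    -- the root of the affine function lies between
    set P := th B n0 n
    set D := Q n - P with hD
    have eu : path B n0 Q u n = P + u * D := path_ap _ _ _ _
    have ev : path B n0 Q v n = P + v * D := path_ap _ _ _ _
    have hD0 : D ≠ 0 := by
      intro h
      rw [eu, ev, h] at hm
      nlinarith [sq_nonneg P]
    rw [eu, ev] at hm
    have hroot : path B n0 Q (-P / D) n = 0 := by
      rw [path_ap]
      change P + -P / D * D = 0
      field_simp; ring
    set w := -P / D with hw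
    have hP : P = -w * D := by rw [hw]; field_simp
    have hm' : (u - w) * (v - w) < 0 := by
      have : (P + u * D) * (P + v * D) = (u - w) * (v - w) * D ^ 2 := by rw [hP]; ring
      rw [this] at hm
      have hD2 : 0 < D ^ 2 := by positivity
      by_contra hc
      push Not at hc
      nlinarith
    have w1 : s' < w := by
      by_contra hc
      push Not at hc
      have := mul_nonneg (by linarith : 0 ≤ u - w) (by linarith : 0 ≤ v - w)
      linarith
    have w2 : w < s := by
      by_contra hc
      push Not at hc
      have := mul_nonneg_of_nonpos_of_nonpos (by linarith : u - w ≤ 0) (by linarith : v - w ≤ 0)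
      linarith
    exact hnc n hn hq w w1 w2 hroot
  have l1 : Lex d (path B n0 Q s') (Q - th B n0) (path B n0 Q r) := by
    intro n hn
    by_cases hq : Q n = 0
    · have hP := cx.P0 hn hq
      simp [path_ap, hP, hq]
    have hz := hnc n hn hq r r1 r2
    have hk := key n hn hq s' r le_rfl hs.le r1 r2
    refine ⟨fun h => ?_, fun h => ?_, fun h => ?_⟩
    · rcases lt_or_gt_of_ne hz with h' | h'
      · exact (hk (mul_neg_of_pos_of_neg h h')).elim
      · exact h'
    · rcases lt_or_gt_of_ne hz with h' | h'
      · exact h'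
      · exact (hk (mul_neg_of_neg_of_pos h h')).elim
    · have e : path B n0 Q r n = (r - s') * (Q - th B n0) n := by
        rw [path_ap] at h ⊢
        simp only [AddMonoidHom.sub_apply]
        linarith
      rw [e]
      have hp : 0 < r - s' := by linarith
      exact ⟨fun h => mul_pos hp h, fun h => mul_neg_of_pos_of_neg hp h, fun h => by rw [h, mul_zero]⟩
  have l2 : Lex d (path B n0 Q s) (-(Q - th B n0)) (path B n0 Q r) := by
    intro n hn
    by_cases hq : Q n = 0
    · have hP := cx.P0 hn hq
      simp [path_ap, hP, hq]
    have hz := hnc n hn hq r r1 r2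
    have hk := key n hn hq s r hs.le le_rfl r1 r2
    refine ⟨fun h => ?_, fun h => ?_, fun h => ?_⟩
    · rcases lt_or_gt_of_ne hz with h' | h'
      · exact (hk (mul_neg_of_pos_of_neg h h')).elim
      · exact h'
    · rcases lt_or_gt_of_ne hz with h' | h'
      · exact h'
      · exact (hk (mul_neg_of_neg_of_pos h h')).elim
    · have e : path B n0 Q r n = (s - r) * (-(Q - th B n0)) n := by
        rw [path_ap] at h ⊢
        simp only [AddMonoidHom.sub_apply, AddMonoidHom.neg_apply]
        linarith
      rw [e]
      have hp : 0 < s - r := by linarith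
      exact ⟨fun h => mul_pos hp h, fun h => mul_neg_of_pos_of_neg hp h, fun h => by rw [h, mul_zero]⟩
  exact (lex_Zp l1 hg.uni).symm.trans (lex_Zp l2 hg.uni)

/-- the positivity property -/
def Pos (B : Matrix ι ι ℤ) (g : Alg B) (K : ℕ) : Prop := ∀ t : (ι →₀ ℕ) →+ ℚ,
  (∀ x y : ι →₀ ℕ, x.degree ≤ K → y.degree ≤ K → x ≠ 0 → y ≠ 0 → t x = 0 → t y = 0 → Par x y) →
    q K (Zp t g) ∈ W B K (M0 ι) {n | t n = 0}

end PartTen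

end Cluster


namespace Cluster

noncomputable section PartEleven

variable {ι : Type} [Fintype ι] [DecidableEq ι] {B : Matrix ι ι ℤ}

theorem list_supp [Skew B] {P : AddSubmonoid (ι →₀ ℕ)} (c : (ι →₀ ℕ) → ℚ) (l : List (ι →₀ ℕ))
    (hl : ∀ n ∈ l, n ≠ 0 ∧ n ∈ P) :
    Uni ((l.map fun n => tl B n (c n)).prod) ∧ (l.map fun n => tl B n (c n)).prod ∈ supp B P := by
  induction l with
  | nil => exact ⟨uni_one, one_mem _⟩
  | cons a l ih =>
    obtain ⟨h1, h2⟩ := ih fun n hn => hl n (List.mem_cons_of_mem _ hn)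
    obtain ⟨h3, h4⟩ := hl a List.mem_cons_self
    rw [List.map_cons, List.prod_cons]
    exact ⟨(tl_uni h3 _).mul h1, mul_mem (tl_supp _ h4) h2⟩

theorem list_W [Skew B] {K : ℕ} {S : Set (ι →₀ ℕ)} (c : (ι →₀ ℕ) → ℚ) (hc : ∀ n, 0 ≤ c n ∧ IntL (M0 ι) n (c n))
    (l : List (ι →₀ ℕ)) (hl : ∀ n ∈ l, n ≠ 0 ∧ n ∈ S) :
    q K ((l.map fun n => tl B n (c n)).prod) ∈ W B K (M0 ι) S := by
  induction l with
  | nil => simp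
  | cons a l ih =>
    have h1 := ih fun n hn => hl n (List.mem_cons_of_mem _ hn)
    obtain ⟨h3, h4⟩ := hl a List.mem_cons_self
    rw [List.map_cons, List.prod_cons, map_mul]
    exact mul_mem (W_letter h4 h3 (hc a).1 (hc a).2) h1

theorem absorb {d : ℕ} {X Y Z E1 E3 : Alg B} (hX : Uni X) (hY : Uni Y) (hZ : Uni (Z + E3))
    (h1 : ∀ a : ι →₀ ℕ, a.degree < d → E1 a = 0) (h3 : ∀ a : ι →₀ ℕ, a.degree < d → E3 a = 0) :
    EqK d ((X + E1) * Y * (Z + E3)) (X * Y * Z + E1 + E3) := by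
  have e : (X + E1) * Y * (Z + E3) = X * Y * Z + E1 * (Y * (Z + E3)) + (X * Y) * E3 := by noncomm_ring
  intro n hn
  have a1 := (mul_low (hY.mul hZ) d h1 hn).2
  have a3 := (mul_low (hX.mul hY) d h3 hn).1
  funext m
  rw [e]
  simp only [add_ap, a1, a3]

theorem Ctx.omEq [Skew B] {d : ℕ} {n0 : ι →₀ ℕ} {Q : (ι →₀ ℕ) →+ ℚ} (cx : Ctx B d n0 Q) {s : ℚ} (hs0 : 0 < s)
    {x y : ι →₀ ℕ} (hx : x.degree ≤ d) (hy : y.degree ≤ d) (x0 : x ≠ 0) (y0 : y ≠ 0)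
    (ex : path B n0 Q s x = 0) (ey : path B n0 Q s y = 0) :
    (∃ c : ℚ, (∀ i, th B n0 y * x i - th B n0 x * y i = c * n0 i) ∧
      th B n0 y * dg ι x - th B n0 x * dg ι y = c * dg ι n0) ∧
      dg ι n0 * om B x y = th B n0 x * dg ι y - th B n0 y * dg ι x := by
  rw [path_ap] at ex ey
  obtain ⟨c, hc⟩ := cx.g2 x y hx hy (by
    have : s * (th B n0 y * Q x - th B n0 x * Q y) = 0 := by linear_combination th B n0 y * ex - th B n0 x * ey
    exact (mul_eq_zero.1 this).resolve_left hs0.ne')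
  have hp : ∀ m : ι → ℚ, th B n0 y * pr x m - th B n0 x * pr y m = c * pr n0 m := by
    intro m
    simp only [pr, Finset.mul_sum]
    rw [← Finset.sum_sub_distrib]
    refine Finset.sum_congr rfl fun i _ => ?_
    linear_combination m i * hc i
  have hd : th B n0 y * dg ι x - th B n0 x * dg ι y = c * dg ι n0 := by
    rw [dg_sum x, dg_sum y, dg_sum n0]; exact hp _
  refine ⟨⟨c, hc, hd⟩, ?_⟩
  have p0 := dg_pos cx.h0
  have hy' := hp (ps B y)
  have hx' := hp (ps B x)
  change th B n0 y * om B x y - th B n0 x * om B y y = c * om B n0 y at hy'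
  change th B n0 y * om B x x - th B n0 x * om B y x = c * om B n0 x at hx'
  rw [om_self, om_skew B n0 y, ← th_ap (B := B) n0 y] at hy'
  rw [om_self, om_skew B n0 x, ← th_ap (B := B) n0 x, om_skew B y x] at hx'
  by_cases hPy : th B n0 y = 0
  · by_cases hPx : th B n0 x = 0
    · have hQx : Q x = 0 := by
        rw [hPx] at ex
        have : s * Q x = 0 := by linarith
        exact (mul_eq_zero.1 this).resolve_left hs0.ne'
      have hpar := cx.g1 x hx x0 hQx
      have e := hpar.ap (th B y)
      rw [th_ap, th_ap, om_skew B n0 y, ← th_ap (B := B) n0 y, hPy] at e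
      rw [e, hPx, hPy]; ring
    · have : om B x y = -c := by
        have : th B n0 x * (om B x y + c) = 0 := by linear_combination hx'
        have := (mul_eq_zero.1 this).resolve_left hPx
        linarith
      rw [this]; linarith
  · have : om B x y = -c := by
      have : th B n0 y * (om B x y + c) = 0 := by linear_combination hy'
      have := (mul_eq_zero.1 this).resolve_left hPy
      linarith
    rw [this]; linarith

theorem Ctx.par [Skew B] {d : ℕ} {n0 : ι →₀ ℕ} {Q : (ι →₀ ℕ) →+ ℚ} (cx : Ctx B d n0 Q) {s : ℚ} (hs0 : 0 < s)
    {x y : ι →₀ ℕ} (hx : x.degree ≤ d) (hy : y.degree ≤ d) (x0 : x ≠ 0) (y0 : y ≠ 0)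
    (ex : path B n0 Q s x = 0) (ey : path B n0 Q s y = 0) {μ : ℚ} (kx : -(Q - th B n0) x = μ * dg ι x)
    (ky : -(Q - th B n0) y = μ * dg ι y) : Par x y := by
  obtain ⟨⟨c, hc, hd⟩, -⟩ := cx.omEq hs0 hx hy x0 y0 ex ey
  rw [path_ap] at ex ey
  simp only [AddMonoidHom.sub_apply] at kx ky
  have hPx : th B n0 x = s * μ * dg ι x := by linear_combination ex + s * kx
  have hPy : th B n0 y = s * μ * dg ι y := by linear_combination ey + s * ky
  by_cases hz : s * μ = 0
  · rw [hz, zero_mul] at hPx hPy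
    have hQx : Q x = 0 := by
      rw [hPx] at ex
      have : s * Q x = 0 := by linarith
      exact (mul_eq_zero.1 this).resolve_left hs0.ne'
    have hQy : Q y = 0 := by
      rw [hPy] at ey
      have : s * Q y = 0 := by linarith
      exact (mul_eq_zero.1 this).resolve_left hs0.ne'
    exact Par.trans' cx.h0 (cx.g1 x hx x0 hQx) (cx.g1 y hy y0 hQy)
  · have c0 : c = 0 := by
      have : c * dg ι n0 = 0 := by rw [← hd, hPx, hPy]; ring
      exact (mul_eq_zero.1 this).resolve_right (dg_ne cx.h0)
    refine Finsupp.ext fun i => ?_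
    have h1 := hc i
    rw [c0, zero_mul, hPx, hPy, dg_ap, dg_ap] at h1
    have : s * μ * ((y.degree : ℚ) * x i - x.degree * y i) = 0 := by linear_combination h1
    have h2 := (mul_eq_zero.1 this).resolve_left hz
    have h3 : (y.degree : ℚ) * x i = x.degree * y i := by linarith
    simp only [Finsupp.smul_apply, smul_eq_mul]
    exact_mod_cast h3

theorem joint [Skew B] {d : ℕ} {n0 : ι →₀ ℕ} {Q : (ι →₀ ℕ) →+ ℚ} (cx : Ctx B (d + 1) n0 Q) {g : Alg B} (hg : GG g)
    (IH : Pos B g d) {s : ℚ} (hs0 : 0 < s)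
    (hF : q (d + 1) (Zp (-(Q - th B n0)) (Zp (path B n0 Q s) g)) ∈ W B (d + 1) (M0 ι) {n | Q n = 0}) :
    q (d + 1) (Zp (Q - th B n0) (Zp (path B n0 Q s) g)) ∈ W B (d + 1) (M0 ι) {n | Q n = 0} := by
  classical
  set δ := Q - th B n0 with hδ
  set h := Zp (path B n0 Q s) g with hh
  have gh : GG h := hg.Zp _
  have pd : ∀ n, path B n0 Q s n = th B n0 n + s * δ n := by
    intro n; rw [path_ap, hδ]; simp
  have hS : ∀ μ : ℚ, q d (Zp (-δ - μ • dg ι) h) ∈ W B d (M0 ι) {n | n ∈ {n | path B n0 Q s n = 0} ∧ (-δ) n = μ * dg ι n} := by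
    intro μ
    obtain ⟨t, ht⟩ := exists_lex d (path B n0 Q s) (-δ - μ • dg ι)
    have hz : ∀ n : ι →₀ ℕ, n.degree ≤ d → t n = 0 → path B n0 Q s n = 0 ∧ (-δ) n = μ * dg ι n := by
      intro n hn e
      obtain ⟨a1, a2, a3⟩ := ht n hn
      have e1 : path B n0 Q s n = 0 := by
        rcases lt_trichotomy (path B n0 Q s n) 0 with h' | h' | h'
        · exact absurd (a2 h') (by rw [e]; exact lt_irrefl _)
        · exact h'
        · exact absurd (a1 h') (by rw [e]; exact lt_irrefl _)
      obtain ⟨b1, b2, b3⟩ := a3 e1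
      refine ⟨e1, ?_⟩
      rw [sl_ap] at b1 b2
      rcases lt_trichotomy ((-δ) n - μ * dg ι n) 0 with h' | h' | h'
      · exact absurd (b2 h') (by rw [e]; exact lt_irrefl _)
      · linarith
      · exact absurd (b1 h') (by rw [e]; exact lt_irrefl _)
    rw [← q_eq.2 (lex_Zp ht hg.uni)]
    refine W_mono' (S := {n | t n = 0}) ?_ (IH t ?_)
    · intro n hn _ hd
      exact hz n hd hn
    · intro x y hx hy x0 y0 ex ey
      obtain ⟨a1, a2⟩ := hz x hx ex
      obtain ⟨b1, b2⟩ := hz y hy ey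
      exact cx.par hs0 (by omega) (by omega) x0 y0 a1 b1 a2 b2
  obtain ⟨A, C, hf, e⟩ := Zp_spec (-δ) gh.uni
  set Z := Zp (-δ) h with hZ
  have hf0 : Fac (-δ - (0 : ℚ) • dg ι) A Z C := by rw [zero_smul, sub_zero]; exact hf
  have hA := slope_pos (-δ) gh.uni _ hS _ 0 rfl A Z C hf0 e
  have hC := slope_neg (-δ) gh.uni _ hS _ 0 rfl A Z C hf0 e
  obtain ⟨a, ha, eA⟩ := W_lift hA
  obtain ⟨c, hc, eC⟩ := W_lift hC
  have hZ' : q (d + 1) Z ∈ W B (d + 1) (M0 ι) {n | path B n0 Q s n = 0 ∧ Q n = 0} := by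
    refine W_mono' ?_ hF
    intro n hn _ hd
    have hn' : Q n = 0 := hn
    have hP := cx.P0 hd hn'
    exact ⟨by rw [path_ap, hP, hn']; ring, hn⟩
  obtain ⟨z, hz, eZ⟩ := W_lift hZ'
  have ma : a ∈ supp B (posS (-δ)) ∧ Uni a := by
    have := WA_prop (P := posS (-δ)) (fun n hn => by
      rw [mem_posS]; right; simpa using hn.2) ha
    exact ⟨this.2, this.1⟩
  have mc : c ∈ supp B (posS δ) ∧ Uni c := by
    have := WA_prop (P := posS δ) (fun n hn => by
      rw [mem_posS]; right; simpa using hn.2) hc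
    exact ⟨this.2, this.1⟩
  have uz : Uni z := (WA_prop (P := ⊤) (fun _ _ => AddSubmonoid.mem_top _) hz).1
  -- sorting
  let S : Finset (ι →₀ ℕ) := (le_deg ι (d + 1)).filter fun n => n ≠ 0 ∧ path B n0 Q s n = 0
  have mS : ∀ n, n ∈ S ↔ n.degree ≤ d + 1 ∧ n ≠ 0 ∧ path B n0 Q s n = 0 := by
    intro n; simp only [S, Finset.mem_filter, mem_le_deg]
  have hw : q (d + 1) (a * z * c) ∈ W B (d + 1) (M0 ι) (S : Set (ι →₀ ℕ)) := by
    rw [map_mul, map_mul]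
    refine mul_mem (mul_mem (W_mono' ?_ (W_of ha)) (W_mono' ?_ (W_of hz))) (W_mono' ?_ (W_of hc))
    · intro n hn n0 hd; exact (mS n).2 ⟨hd, n0, hn.1⟩
    · intro n hn n0 hd; exact (mS n).2 ⟨hd, n0, hn.1⟩
    · intro n hn n0 hd; exact (mS n).2 ⟨hd, n0, hn.1⟩
  obtain ⟨ord, o1, o2, o3, o4⟩ := sort (B := B) (K := d + 1) (M := M0 ι) (th B n0) (dg ι n0) (dg_pos cx.h0) S.card S rfl
    (fun n hn => ((mS n).1 hn).2.1)
    (fun x hx y hy => by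
      obtain ⟨x1, x2, x3⟩ := (mS x).1 hx
      obtain ⟨y1, y2, y3⟩ := (mS y).1 hy
      exact (cx.omEq hs0 x1 y1 x2 y2 x3 y3).2)
    (fun x hx y hy _ w hw hd => by
      obtain ⟨x1, x2, x3⟩ := (mS x).1 hx
      obtain ⟨y1, y2, y3⟩ := (mS y).1 hy
      obtain ⟨p, r, p0, r0, rfl⟩ := hw
      refine (mS _).2 ⟨hd, ?_, ?_⟩
      · apply ne_zero_of_deg
        rw [map_add, deg_nsmul]
        have := Nat.mul_pos p0 (deg_pos x2)
        omega
      · rw [map_add, map_nsmul, map_nsmul, x3, y3]; simp)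
    (fun x hx y hy hxy => swap (d + 2) x y (M0 ι) (by omega) hxy (ps_M0 x) (ps_M0 y))
  obtain ⟨cc, hcc, ecc⟩ := o4 _ hw
  rw [q_eq] at ecc
  have oS : ∀ n ∈ ord, n.degree ≤ d + 1 ∧ n ≠ 0 ∧ path B n0 Q s n = 0 := fun n hn => (mS n).1 ((o2 n).1 hn)
  rw [list_split (th B n0) (fun n => tl B n (cc n)) ord (fun n hn => (oS n hn).2.1) o3] at ecc
  set s1 := ((ord.filter (th B n0 · < 0)).map fun n => tl B n (cc n)).prod
  set s2 := ((ord.filter (th B n0 · = 0)).map fun n => tl B n (cc n)).prod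
  set s3 := ((ord.filter (0 < th B n0 ·)).map fun n => tl B n (cc n)).prod
  have m1 : Uni s1 ∧ s1 ∈ supp B (posS δ) := by
    refine list_supp cc _ fun n hn => ?_
    rw [List.mem_filter] at hn
    obtain ⟨h1, h2, h3⟩ := oS n hn.1
    have h4 : th B n0 n < 0 := by simpa using hn.2
    rw [pd] at h3
    refine ⟨h2, mem_posS.2 (Or.inr ?_)⟩
    by_contra hcon
    push Not at hcon
    have := mul_nonpos_of_nonneg_of_nonpos hs0.le hcon
    linarith
  have m2 : Uni s2 ∧ s2 ∈ supp B (zerS δ) := by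
    refine list_supp cc _ fun n hn => ?_
    rw [List.mem_filter] at hn
    obtain ⟨h1, h2, h3⟩ := oS n hn.1
    have h4 : th B n0 n = 0 := by simpa using hn.2
    rw [pd, h4, zero_add] at h3
    exact ⟨h2, mem_zerS.2 ((mul_eq_zero.1 h3).resolve_left hs0.ne')⟩
  have m3 : Uni s3 ∧ s3 ∈ supp B (posS (-δ)) := by
    refine list_supp cc _ fun n hn => ?_
    rw [List.mem_filter] at hn
    obtain ⟨h1, h2, h3⟩ := oS n hn.1
    have h4 : 0 < th B n0 n := by simpa using hn.2
    rw [pd] at h3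
    refine ⟨h2, mem_posS.2 (Or.inr ?_)⟩
    rw [AddMonoidHom.neg_apply]
    by_contra hcon
    push Not at hcon
    have := mul_nonneg hs0.le (by linarith : 0 ≤ δ n)
    linarith
  have w2 : q (d + 1) s2 ∈ W B (d + 1) (M0 ι) {n | Q n = 0} := by
    refine list_W cc hcc _ fun n hn => ?_
    rw [List.mem_filter] at hn
    obtain ⟨h1, h2, h3⟩ := oS n hn.1
    have h4 : th B n0 n = 0 := by simpa using hn.2
    rw [path_ap, h4, zero_add, sub_zero] at h3
    exact ⟨h2, (mul_eq_zero.1 h3).resolve_left hs0.ne'⟩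
  have lA : ∀ x : ι →₀ ℕ, x.degree < d + 1 → (A - a) x = 0 := by
    intro x hx; funext m; simp [eA x (by omega)]
  have lC : ∀ x : ι →₀ ℕ, x.degree < d + 1 → (C - c) x = 0 := by
    intro x hx; funext m; simp [eC x (by omega)]
  have uni_add : ∀ {X E : Alg B}, Uni X → (∀ x : ι →₀ ℕ, x.degree < d + 1 → E x = 0) → Uni (X + E) := by
    intro X E hX hE
    show (X + E) 0 = 1
    funext m
    rw [add_ap, hX.ap, hE 0 (by simp)]; simp
  have eh : EqK (d + 1) h ((s1 + (C - c)) * s2 * (s3 + (A - a))) := by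
    have k1 : EqK (d + 1) h ((a + (A - a)) * z * (c + (C - c))) := by
      rw [e, add_sub_cancel, add_sub_cancel]
      exact ((EqK.refl _ _).mul eZ).mul (EqK.refl _ _)
    have k2 := absorb ma.2 uz (uni_add mc.2 lC) lA lC
    have k3 := absorb m1.1 m2.1 (uni_add m3.1 lA) lC lA
    refine k1.trans (k2.trans (EqK.trans ?_ k3.symm))
    intro n hn
    funext m
    simp only [add_ap, ecc n hn]
    ring
  have := Zp_uniqueK (t := δ) gh.uni (K := d + 1) (uni_add m1.1 lC) m2.1 (uni_add m3.1 lA)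
    (fun n _ hn => by
      have h1 := mem_supp.1 m1.2 n hn
      have h2 := mem_supp.1 mc.1 n hn
      have hC' := hf.hC
      rw [neg_neg] at hC'
      have h3 := mem_supp.1 hC' n hn
      funext m; simp [h1, h2, h3])
    (fun n _ hn => mem_supp.1 m2.2 n hn)
    (fun n _ hn => by
      have h1 := mem_supp.1 m3.2 n hn
      have h2 := mem_supp.1 ma.1 n hn
      have h3 := mem_supp.1 hf.hA n hn
      funext m; simp [h1, h2, h3]) eh
  rw [q_eq.2 this]
  exact w2

theorem posit [Skew B] {g : Alg B} (hg : Inc B g) : ∀ d, Pos B g d := by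
  classical
  intro d
  induction d with
  | zero =>
    intro t _
    have : EqK 0 (Zp t g) 1 := by
      intro n hn
      have : n = 0 := by
        by_contra h
        have := deg_pos h
        omega
      rw [this]
      exact (Zp_uni t hg.1.uni).trans uni_one.symm
    rw [q_eq.2 this, map_one]
    exact one_mem _
  | succ d IH =>
    intro t ht
    by_cases hz : ∃ n0 : ι →₀ ℕ, n0 ≠ 0 ∧ n0.degree ≤ d + 1 ∧ t n0 = 0
    swap
    · have : EqK (d + 1) (Zp t g) 1 := by
        intro n hn
        by_cases h : n = 0
        · rw [h]
          exact (Zp_uni t hg.1.uni).trans uni_one.symm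
        · push Not at hz
          rw [mem_supp.1 (Zp_mem t hg.1.uni) n (by rw [mem_zerS]; exact hz n h hn)]
          funext m; simp [one_ap, h]
      rw [q_eq.2 this, map_one]
      exact one_mem _
    obtain ⟨n0, h0, hd0, e0⟩ := hz
    obtain ⟨Q, hQ, cx⟩ := generic B (d + 1) h0 t e0 fun n hn hn0 e => ht n n0 hn hd0 hn0 h0 e e0
    let crit : Finset ℚ := (le_deg ι (d + 1)).image fun n => -th B n0 n / (Q n - th B n0 n)
    have hcrit : ∀ n : ι →₀ ℕ, n.degree ≤ d + 1 → Q n ≠ 0 → ∀ r, path B n0 Q r n = 0 → r ∈ crit := by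
      intro n hn hq r hr
      rw [path_ap] at hr
      refine Finset.mem_image.2 ⟨n, mem_le_deg.2 hn, ?_⟩
      have : Q n - th B n0 n ≠ 0 := by
        intro h
        rw [h, mul_zero, add_zero] at hr
        rw [hr, sub_zero] at h
        exact hq h
      rw [div_eq_iff this]; linarith
    have key : ∀ N : ℕ, ∀ s : ℚ, 0 < s → (crit.filter fun r => 0 < r ∧ r < s).card = N →
        q (d + 1) (Zp (-(Q - th B n0)) (Zp (path B n0 Q s) g)) ∈ W B (d + 1) (M0 ι) {n | Q n = 0} := by
      intro N
      induction N using Nat.strong_induction_on with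
      | _ N ih =>
        intro s hs hN
        by_cases hem : (crit.filter fun r => 0 < r ∧ r < s).Nonempty
        · set s' := (crit.filter fun r => 0 < r ∧ r < s).max' hem with hs'
          have hm := Finset.max'_mem _ hem
          rw [← hs', Finset.mem_filter] at hm
          have f1 := ih (crit.filter fun r => 0 < r ∧ r < s').card (by
            rw [← hN]
            apply Finset.card_lt_card
            refine ⟨fun r hr => ?_, fun hcon => ?_⟩
            · rw [Finset.mem_filter] at hr ⊢
              exact ⟨hr.1, hr.2.1, hr.2.2.trans hm.2.2⟩
            · have := hcon (Finset.mem_filter.2 hm)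
              rw [Finset.mem_filter] at this
              exact lt_irrefl _ this.2.2) s' hm.2.1 rfl
          have f2 := joint cx hg.1 IH hm.2.1 f1
          rw [← q_eq.2 (step_path cx hg.1 hm.2.2 ?_)]
          · exact f2
          · intro n hn hq r h1 h2 h3
            have h4 := hcrit n hn hq r h3
            have := Finset.le_max' (crit.filter fun r => 0 < r ∧ r < s) r
              (Finset.mem_filter.2 ⟨h4, hm.2.1.trans h1, h2⟩)
            linarith
        · rw [← q_eq.2 (step_path cx hg.1 hs ?_)]
          · exact start cx hg
          · intro n hn hq r h1 h2 h3
            exact hem ⟨r, Finset.mem_filter.2 ⟨hcrit n hn hq r h3, h1, h2⟩⟩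
    have k1 := key _ 1 one_pos rfl
    have e1 : path B n0 Q 1 = Q := by simp [path]
    rw [e1] at k1
    have e2 : EqK (d + 1) (Zp (-(Q - th B n0)) (Zp Q g)) (Zp Q g) := by
      refine Zp_uniqueK (Zp_uni _ hg.1.uni) uni_one (Zp_uni _ hg.1.uni) uni_one ?_ ?_ ?_ ?_
      · intro n _ hn
        have : n ≠ 0 := by rintro rfl; exact hn (AddSubmonoid.zero_mem _)
        funext m; simp [one_ap, this]
      · intro n hd hn
        apply mem_supp.1 (Zp_mem Q hg.1.uni)
        rw [mem_zerS] at hn ⊢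
        intro hq
        apply hn
        simp [hq, cx.P0 hd hq]
      · intro n _ hn
        have : n ≠ 0 := by rintro rfl; exact hn (AddSubmonoid.zero_mem _)
        funext m; simp [one_ap, this]
      · rw [one_mul, mul_one]; exact EqK.refl _ _
    rw [q_eq.2 e2, ← q_eq.2 (Zp_sameSign hQ hg.1.uni)] at k1
    refine W_mono' ?_ k1
    intro n hn _ hd
    have hn' : Q n = 0 := hn
    have := hQ n hd
    rw [hn'] at this
    simp only [lt_irrefl, iff_false, not_lt] at this
    exact le_antisymm this.1 this.2

end PartEleven

end Cluster


namespace Cluster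

noncomputable section PartTwelve

variable {ι : Type} [Fintype ι] [DecidableEq ι] {B : Matrix ι ι ℤ}

theorem mul_vanish {S T : Alg B} {n : ι →₀ ℕ} (h : ∀ a b, a + b = n → S a = 0 ∨ T b = 0) : (S * T) n = 0 := by
  funext m
  rw [mul_ap]
  refine Finset.sum_eq_zero fun p hp => ?_
  rw [Finset.HasAntidiagonal.mem_antidiagonal] at hp
  rcases h p.1 p.2 hp with h | h <;> simp [h]

theorem conj_pos {t : (ι →₀ ℕ) →+ ℚ} {S S' C : Alg B} (hS : S ∈ supp B (zerS t)) (hS' : S' ∈ supp B (zerS t))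
    (e : S * S' = 1) (uC : Uni C) (hC : C ∈ supp B (posS t)) : S * C * S' ∈ supp B (posS t) := by
  have hN : ∀ n, ¬ 0 < t n → (C - 1) n = 0 := by
    intro n hn
    funext m
    by_cases h : n = 0
    · subst h; simp [uC.ap, one_ap]
    · rw [sub_ap, mem_supp.1 hC n (by rw [mem_posS]; tauto)]; simp [one_ap, h]
  have h1 : ∀ n, ¬ 0 < t n → (S * (C - 1)) n = 0 := by
    intro n hn
    apply mul_vanish
    intro a b hab
    by_cases ha : t a = 0
    · right; apply hN; rw [← hab, map_add, ha, zero_add] at hn; exact hn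
    · left; exact mem_supp.1 hS a (by rwa [mem_zerS])
  have h2 : ∀ n, ¬ 0 < t n → (S * (C - 1) * S') n = 0 := by
    intro n hn
    apply mul_vanish
    intro a b hab
    by_cases hb : t b = 0
    · left; apply h1; rw [← hab, map_add, hb, add_zero] at hn; exact hn
    · right; exact mem_supp.1 hS' b (by rwa [mem_zerS])
  have e2 : S * C * S' = 1 + S * (C - 1) * S' := by
    rw [mul_sub, sub_mul, mul_one, e]; abel
  rw [mem_supp]
  intro n hn
  rw [mem_posS, not_or] at hn
  funext m
  rw [e2, add_ap, h2 n hn.2]; simp [one_ap, hn.1]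

theorem zerS_neg (t : (ι →₀ ℕ) →+ ℚ) : zerS (-t) = zerS t := by
  ext n; simp [mem_zerS]

theorem Zp_mul_zer {t : (ι →₀ ℕ) →+ ℚ} {X Z : Alg B} (hX : Uni X) (hZ : Uni Z) (mZ : Z ∈ supp B (zerS t)) :
    Zp t (X * Z) = Zp t X * Z := by
  obtain ⟨A, C, hf, e⟩ := Zp_spec t hX
  refine Zp_eq (A := A) (C := iv Z * C * Z) ⟨hf.uA, hf.uZ.mul hZ, (hZ.iv.mul hf.uC).mul hZ, hf.hA, mul_mem hf.hZ mZ, ?_⟩ ?_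
  · rw [← zerS_neg] at mZ
    exact conj_pos (iv_mem_supp hZ mZ) mZ hZ.iv_mul hf.uC hf.hC
  · conv_lhs => rw [e]
    calc A * Zp t X * C * Z = A * Zp t X * (1 * C * Z) := by noncomm_ring
      _ = A * Zp t X * (Z * iv Z * C * Z) := by rw [hZ.mul_iv]
      _ = _ := by noncomm_ring

theorem Zp_zer_mul {t : (ι →₀ ℕ) →+ ℚ} {X Z : Alg B} (hX : Uni X) (hZ : Uni Z) (mZ : Z ∈ supp B (zerS t)) :
    Zp t (Z * X) = Z * Zp t X := by
  obtain ⟨A, C, hf, e⟩ := Zp_spec t hX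
  refine Zp_eq (A := Z * A * iv Z) (C := C) ⟨(hZ.mul hf.uA).mul hZ.iv, hZ.mul hf.uZ, hf.uC, ?_, mul_mem mZ hf.hZ, hf.hC⟩ ?_
  · exact conj_pos mZ (iv_mem_supp hZ mZ) hZ.mul_iv hf.uA hf.hA
  · conv_lhs => rw [e]
    calc Z * (A * Zp t X * C) = Z * A * 1 * Zp t X * C := by noncomm_ring
      _ = Z * A * (iv Z * Z) * Zp t X * C := by rw [hZ.iv_mul]
      _ = _ := by noncomm_ring

theorem Zp_mul_neg {t : (ι →₀ ℕ) →+ ℚ} {X Z : Alg B} (hX : Uni X) (hZ : Uni Z) (mZ : Z ∈ supp B (posS (-t))) :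
    Zp t (X * Z) = Zp t X := by
  obtain ⟨A, C, hf, e⟩ := Zp_spec t hX
  refine Zp_eq (A := A) (C := C * Z) ⟨hf.uA, hf.uZ, hf.uC.mul hZ, hf.hA, hf.hZ, mul_mem hf.hC mZ⟩ ?_
  conv_lhs => rw [e]
  noncomm_ring

theorem Zp_pos_mul {t : (ι →₀ ℕ) →+ ℚ} {X Z : Alg B} (hX : Uni X) (hZ : Uni Z) (mZ : Z ∈ supp B (posS t)) :
    Zp t (Z * X) = Zp t X := by
  obtain ⟨A, C, hf, e⟩ := Zp_spec t hX
  refine Zp_eq (A := Z * A) (C := C) ⟨hZ.mul hf.uA, hf.uZ, hf.uC, mul_mem mZ hf.hA, hf.hZ, hf.hC⟩ ?_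
  conv_lhs => rw [e]
  noncomm_ring

theorem zer_central {n a : ι →₀ ℕ} (h : a ∈ zerS (th B n)) : om B a n = 0 := by
  rwa [mem_zerS, th_ap] at h

/-- changing the derivation -/
theorem xl_switch [Skew B] {Z : Alg B} (hZ : GG Z) {n : ι →₀ ℕ} (hn : n ≠ 0) (mZ : Z ∈ supp B (zerS (th B n)))
    (l l' : (ι →₀ ℕ) →+ ℚ) : l n * xl l' Z n = l' n * xl l Z n := by
  have e1 := hZ.El l
  have e2 := hZ.El l'
  set x := xl l Z
  set x' := xl l' Z
  have Eh : ∀ (l : (ι →₀ ℕ) →+ ℚ) (x : (ι →₀ ℕ) → ℚ), Eu l (ham B x) = ham B (fun n => l n * x n) := by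
    intro l x; ext n m; simp only [Eu_ap, ham_ap]; ring
  have c1 : Eu l (Eu l' Z) = (ham B (fun n => l n * x' n) + ham B x' * ham B x) * Z := by
    rw [e2, Eu_mul, e1, Eh]; noncomm_ring
  have c2 : Eu l' (Eu l Z) = (ham B (fun n => l' n * x n) + ham B x * ham B x') * Z := by
    rw [e1, Eu_mul, e2, Eh]; noncomm_ring
  rw [Eu_comm, c2] at c1
  have c3 := hZ.uni.cancel_right c1
  have c4 : ham B (fun n => l n * x' n) = ham B ((fun n => l' n * x n) + br B x x') := by
    rw [ham_add, ← ham_br]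
    have := c3.symm
    rw [← sub_eq_zero] at this ⊢
    rw [← this]; abel
  have c5 := ham_inj hn (congrArg (fun T : Alg B => T n) c4)
  rw [c5, Pi.add_apply, add_eq_left, br]
  refine Finset.sum_eq_zero fun p hp => ?_
  rw [Finset.HasAntidiagonal.mem_antidiagonal] at hp
  by_cases h1 : p.1 ∈ zerS (th B n)
  · have := zer_central h1
    rw [← hp, om_add_right, om_self, zero_add] at this
    rw [this]; ring
  · have : x p.1 = 0 := xl_mem hZ mZ l _ h1
    rw [this]; ring

theorem indec_mul {R : AddSubmonoid (ι →₀ ℕ)} {n : ι →₀ ℕ} (hn : n ≠ 0)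
    (hR : ∀ a ∈ R, ∀ b ∈ R, a + b = n → a = 0 ∨ b = 0) {S T : Alg B} (hS : S ∈ supp B R) (hT : T ∈ supp B R) (m : ι → ℚ) :
    (S * T) n m = S n m * T 0 m + S 0 (m + ps B n) * T n m := by
  rw [mul_mid S T hn m, add_eq_left, mid]
  refine Finset.sum_eq_zero fun p hp => ?_
  rw [Finset.mem_filter, Finset.HasAntidiagonal.mem_antidiagonal] at hp
  by_cases h1 : p.1 ∈ R
  · by_cases h2 : p.2 ∈ R
    · rcases hR _ h1 _ h2 hp.1 with h | h
      · exact absurd h hp.2.1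
      · exact absurd h hp.2.2
    · rw [mem_supp.1 hT _ h2]; simp
  · rw [mem_supp.1 hS _ h1]; simp

theorem indec_xl [Skew B] {R : AddSubmonoid (ι →₀ ℕ)} {n : ι →₀ ℕ} (hn : n ≠ 0)
    (hR : ∀ a ∈ R, ∀ b ∈ R, a + b = n → a = 0 ∨ b = 0) {S : Alg B} (hS : S ∈ supp B R) (gS : GG S)
    (l : (ι →₀ ℕ) →+ ℚ) (m : ι → ℚ) : l n * S n m = xl l S n * pr n m := by
  have h := congrArg (fun T : Alg B => T n m) (gS.El l)
  simp only [Eu_ap] at h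
  rw [h, indec_mul hn hR (ham_mem fun a ha => xl_mem gS hS l a ha) hS, gS.uni.ap, ham_zero_ap, ham_ap]
  simp

theorem indec_add [Skew B] {R : AddSubmonoid (ι →₀ ℕ)} {n : ι →₀ ℕ} (hn : n ≠ 0)
    (hR : ∀ a ∈ R, ∀ b ∈ R, a + b = n → a = 0 ∨ b = 0) {S T : Alg B} (hS : S ∈ supp B R) (gS : GG S)
    (hT : T ∈ supp B R) (gT : GG T) (l : (ι →₀ ℕ) →+ ℚ) : xl l (S * T) n = xl l S n + xl l T n := by
  obtain ⟨m, hm⟩ := exists_pr_ne hn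
  have h1 := indec_xl hn hR hS gS l m
  have h2 := indec_xl hn hR hT gT l m
  have h3 := indec_xl hn hR (mul_mem hS hT) (gS.mul gT) l m
  rw [indec_mul hn hR hS hT, gT.uni.ap, gS.uni.ap] at h3
  apply mul_right_cancel₀ hm
  rw [← h3, add_mul, ← h1, ← h2]; ring

/-- indecomposable exponents: the logarithm is seen by the central factor -/
theorem indec_Zp [Skew B] {R : AddSubmonoid (ι →₀ ℕ)} {n : ι →₀ ℕ} (hn : n ≠ 0)
    (hR : ∀ a ∈ R, ∀ b ∈ R, a + b = n → a = 0 ∨ b = 0) {S : Alg B} (hS : S ∈ supp B R) (gS : GG S)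
    (l : (ι →₀ ℕ) →+ ℚ) (t : (ι →₀ ℕ) →+ ℚ) (ht : t n = 0) : xl l S n = xl l (Zp t S) n := by
  obtain ⟨A, C, hf, e⟩ := Zp_spec t gS.uni
  obtain ⟨s1, s2, s3⟩ := fac3_supp hf (R := R) (by rw [← e]; exact hS)
  obtain ⟨g1, g2, g3⟩ := fac3_gg hf (by rw [← e]; exact gS)
  conv_lhs => rw [e]
  rw [indec_add hn hR (mul_mem s1 s2) (g1.mul g2) s3 g3, indec_add hn hR s1 g1 s2 g2,
    xl_mem g1 hf.hA _ n (by rw [mem_posS]; simp [hn, ht]), xl_mem g3 hf.hC _ n (by rw [mem_posS]; simp [hn, ht])]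
  ring

theorem lg_om [Skew B] {k : ι} {n : ι →₀ ℕ} (h : om B (bs k) n ≠ 0) : lg (bs k) 1 n = 0 := by
  apply lg_not
  rintro j rfl
  apply h
  rw [om_nsmul_right, om_self, mul_zero]

theorem tl_zer {k : ι} {n : ι →₀ ℕ} (h : om B (bs k) n = 0) (c : ℚ) : tl B (bs k) c ∈ supp B (zerS (th B n)) := by
  apply tl_supp; rwa [mem_zerS, th_ap]

theorem dgbs (k : ι) : dg ι (bs k) = 1 := by simp [dg_ap, bs]

theorem inc_left [Skew B] {k : ι} {X : Alg B} (hX : GG X) {n : ι →₀ ℕ} (hn : n ≠ 0) (h : 0 ≤ om B (bs k) n) :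
    xl (dg ι) (Zp (th B n) (tl B (bs k) 1 * X)) n = xl (dg ι) (Zp (th B n) X) n + lg (bs k) 1 n := by
  rcases h.eq_or_lt with h | h
  · rw [Zp_zer_mul hX.uni (tl_uni (bs_ne k) 1) (tl_zer h.symm 1),
      xl_mul_central (tl_gg (bs_ne k) 1) (hX.Zp _) (tl_zer h.symm 1) (Zp_mem _ hX.uni) _ hn (fun a ha => zer_central ha),
      xl_tl (bs_ne k) 1 _ hn, dgbs]; ring
  · rw [Zp_pos_mul hX.uni (tl_uni (bs_ne k) 1) (tl_supp _ (mem_posS.2 (Or.inr (by rwa [th_ap])))), lg_om h.ne', add_zero]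

theorem inc_right [Skew B] {k : ι} {X : Alg B} (hX : GG X) {n : ι →₀ ℕ} (hn : n ≠ 0) (h : om B (bs k) n ≤ 0) :
    xl (dg ι) (Zp (th B n) (X * tl B (bs k) 1)) n = xl (dg ι) (Zp (th B n) X) n + lg (bs k) 1 n := by
  rcases h.eq_or_lt with h | h
  · rw [Zp_mul_zer hX.uni (tl_uni (bs_ne k) 1) (tl_zer h 1),
      xl_mul_central (hX.Zp _) (tl_gg (bs_ne k) 1) (Zp_mem _ hX.uni) (tl_zer h 1) _ hn (fun a ha => zer_central ha),
      xl_tl (bs_ne k) 1 _ hn, dgbs]; ring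
  · rw [Zp_mul_neg hX.uni (tl_uni (bs_ne k) 1) (tl_supp _ (mem_posS.2 (Or.inr (by
      rw [AddMonoidHom.neg_apply, th_ap]; linarith)))), lg_om h.ne, add_zero]

/-- coordinate functionals -/
def ev (i : ι) : (ι →₀ ℕ) →+ ℚ where
  toFun n := n i
  map_zero' := by simp
  map_add' a b := by simp

theorem ev_ap (i : ι) (n : ι →₀ ℕ) : ev i n = n i := rfl

/-- degree away from k -/
def dk (k : ι) : (ι →₀ ℕ) →+ ℚ := dg ι - ev k

theorem dk_ap (k : ι) (n : ι →₀ ℕ) : dk k n = ∑ i ∈ Finset.univ.erase k, (n i : ℚ) := by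
  rw [dk, AddMonoidHom.sub_apply, dg_ap, ev_ap, Finsupp.degree_eq_sum, ← Finset.add_sum_erase _ _ (Finset.mem_univ k)]
  push_cast; ring

theorem dk_nonneg (k : ι) (n : ι →₀ ℕ) : 0 ≤ dk k n := by
  rw [dk_ap]; positivity

theorem dk_zero {k : ι} {n : ι →₀ ℕ} (h : dk k n = 0) : n = n k • bs k := by
  rw [dk_ap, Finset.sum_eq_zero_iff_of_nonneg (fun _ _ => by positivity)] at h
  ext i
  by_cases hi : i = k
  · subst hi; simp
  · have := h i (by simp [hi])
    have h2 : n i = 0 := by exact_mod_cast this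
    rw [h2]; simp [Finsupp.single_apply, Ne.symm hi]

theorem dk_bs (k : ι) : dk k (bs k) = 0 := by
  rw [dk, AddMonoidHom.sub_apply, dgbs, ev_ap]; simp

theorem dk_nsmul (k : ι) (j : ℕ) : dk k (j • bs k) = 0 := by rw [map_nsmul, dk_bs, smul_zero]

theorem dk_neg_bot (k : ι) : posS (-dk k) = ⊥ := by
  ext n
  rw [mem_posS, AddSubmonoid.mem_bot, AddMonoidHom.neg_apply]
  have := dk_nonneg k n
  constructor
  · rintro (h | h)
    · exact h
    · linarith
  · exact Or.inl

theorem supp_bot {T : Alg B} (u : Uni T) (h : T ∈ supp B ⊥) : T = 1 := by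
  ext n m
  by_cases hn : n = 0
  · subst hn; simp [u.ap, one_ap]
  · rw [mem_supp.1 h n (by rwa [AddSubmonoid.mem_bot])]; simp [one_ap, hn]

theorem del_k {k : ι} {n : ι →₀ ℕ} (hn : n ≠ 0) (h : dk k n = 0) : del n = lg (bs k) 1 n := by
  rw [del, Finset.sum_eq_single k]
  · intro i _ hi
    apply lg_not
    rintro j rfl
    rw [map_nsmul, dk, AddMonoidHom.sub_apply, dgbs, ev_ap] at h
    simp [hi] at h
    exact hn (by rw [h, zero_smul])
  · simp

theorem zer_eq [Skew B] {k : ι} {X Z : Alg B} (hX : GG X) (mX : X ∈ supp B (posS (dk k))) (hZ : GG Z)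
    (mZ : Z ∈ supp B (zerS (dk k))) (h : Inc B (X * Z) ∨ Inc B (Z * X)) : Z = tl B (bs k) 1 := by
  refine eq_of_xl hZ (tl_gg (bs_ne k) 1) fun n hn => ?_
  rw [xl_tl (bs_ne k) 1 _ hn, dgbs, one_mul]
  by_cases hd : dk k n = 0
  · rw [← del_k hn hd]
    have hle : zerS (dk k) ≤ zerS (th B n) := by
      intro a ha
      rw [mem_zerS] at ha ⊢
      rw [dk_zero ha, dk_zero hd, th_ap, om_nsmul, om_nsmul_right, om_self]; ring
    have mZ' := supp_mono (B := B) hle mZ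
    have z : xl (dg ι) (Zp (th B n) X) n = 0 := by
      refine xl_mem (hX.Zp _) (Zp_supp _ hX.uni mX) _ n ?_
      rw [mem_posS, hd]; simp [hn]
    rcases h with h | h
    · have := h.2 n hn
      rw [Zp_mul_zer hX.uni hZ.uni mZ', xl_mul_central (hX.Zp _) hZ (Zp_mem _ hX.uni) mZ' _ hn
        (fun a ha => zer_central ha), z, zero_add] at this
      exact this
    · have := h.2 n hn
      rw [Zp_zer_mul hX.uni hZ.uni mZ', xl_mul_central hZ (hX.Zp _) mZ' (Zp_mem _ hX.uni) _ hn
        (fun a ha => zer_central ha), z, add_zero] at this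
      exact this
  · rw [xl_mem hZ mZ _ n (by rwa [mem_zerS]), lg_not]
    rintro j rfl
    exact hd (dk_nsmul k j)

theorem split_right [Skew B] (k : ι) {g : Alg B} (hg : Inc B g) :
    ∃ h, GG h ∧ h ∈ supp B (posS (dk k)) ∧ g = h * tl B (bs k) 1 := by
  obtain ⟨A, C, hf, e⟩ := Zp_spec (dk k) hg.1.uni
  have hC : C = 1 := supp_bot hf.uC (by rw [← dk_neg_bot k]; exact hf.hC)
  obtain ⟨g1, g2, g3⟩ := fac3_gg hf (by rw [← e]; exact hg.1)
  rw [hC, mul_one] at e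
  have := zer_eq g1 hf.hA g2 hf.hZ (Or.inl (by rw [← e]; exact hg))
  exact ⟨A, g1, hf.hA, by rw [← this]; exact e⟩

theorem split_left [Skew B] (k : ι) {g : Alg B} (hg : Inc B g) :
    ∃ h, GG h ∧ h ∈ supp B (posS (dk k)) ∧ g = tl B (bs k) 1 * h := by
  obtain ⟨A, C, hf, e⟩ := Zp_spec (-dk k) hg.1.uni
  have hA : A = 1 := supp_bot hf.uA (by rw [← dk_neg_bot k]; exact hf.hA)
  obtain ⟨g1, g2, g3⟩ := fac3_gg hf (by rw [← e]; exact hg.1)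
  rw [hA, one_mul] at e
  have mC := hf.hC
  rw [neg_neg] at mC
  have mZ := hf.hZ
  rw [zerS_neg] at mZ
  have := zer_eq g3 mC g2 mZ (Or.inr (by rw [← e]; exact hg))
  exact ⟨C, g3, mC, by rw [← this]; exact e⟩

end PartTwelve

end Cluster


namespace Cluster

noncomputable section PartThirteen
variable {ι : Type} [Fintype ι] [DecidableEq ι] {B : Matrix ι ι ℤ}

/-- The linear form with natural coefficients `c`. -/
def bt (c : ι → ℕ) (n : ι →₀ ℕ) : ℕ := ∑ i, c i * n i

theorem bt_add (c : ι → ℕ) (a b : ι →₀ ℕ) : bt c (a + b) = bt c a + bt c b := by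
  simp [bt, mul_add, Finset.sum_add_distrib]

theorem bt_zero (c : ι → ℕ) : bt c 0 = 0 := by simp [bt]

/-- The half space `n k ≤ bt c n`. -/
def LS (k : ι) (c : ι → ℕ) : AddSubmonoid (ι →₀ ℕ) where
  carrier := {n | n k ≤ bt c n}
  zero_mem' := by simp [bt]
  add_mem' := by
    intro a b ha hb
    simp only [Set.mem_ofPred_eq] at *
    rw [bt_add, Finsupp.add_apply]; omega

theorem mem_LS {k : ι} {c : ι → ℕ} {n : ι →₀ ℕ} : n ∈ LS k c ↔ n k ≤ bt c n := Iff.rfl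

/-- Positive part of row `k`. -/
def cp (B : Matrix ι ι ℤ) (k i : ι) : ℕ := (B k i).toNat
/-- Negative part of row `k`. -/
def cm (B : Matrix ι ι ℤ) (k i : ι) : ℕ := (-B k i).toNat

theorem Skew.diag [h : Skew B] (k : ι) : B k k = 0 := by have := h.skew k k; omega

theorem cp_self [Skew B] (k : ι) : cp B k k = 0 := by simp [cp, Skew.diag]
theorem cm_self [Skew B] (k : ι) : cm B k k = 0 := by simp [cm, Skew.diag]

theorem om_bs (k : ι) (n : ι →₀ ℕ) : om B (bs k) n = (bt (cp B k) n : ℚ) - bt (cm B k) n := by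
  have h1 : ∀ m, pr (bs k) m = m k := by
    intro m
    rw [pr, Finset.sum_eq_single k]
    · simp
    · intro b _ hb; simp [bs, Finsupp.single_apply, Ne.symm hb]
    · simp
  rw [om, h1, ps, bt, bt]
  push_cast
  rw [← Finset.sum_sub_distrib]
  refine Finset.sum_congr rfl fun i _ => ?_
  have : (B k i : ℚ) = ((cp B k i : ℕ) : ℚ) - (cm B k i : ℕ) := by
    have h : B k i = (cp B k i : ℤ) - cm B k i := by unfold cp cm; omega
    exact_mod_cast congrArg (Int.cast : ℤ → ℚ) h
  rw [this]; ring

theorem bt_sub {k : ι} {c : ι → ℕ} (hc : c k = 0) {n : ι →₀ ℕ} {j : ℕ} (h : j • bs k ≤ n) :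
    bt c (n - j • bs k) = bt c n := by
  have : bt c (j • bs k) = 0 := by
    refine Finset.sum_eq_zero fun i _ => ?_
    by_cases e : i = k
    · rw [e, hc, zero_mul]
    · simp [Finsupp.single_apply, Ne.symm e]
  conv_rhs => rw [← tsub_add_cancel_of_le h, bt_add, this]
  rfl

theorem dk_sub {k : ι} {n : ι →₀ ℕ} {j : ℕ} (h : j • bs k ≤ n) : dk k (n - j • bs k) = dk k n := by
  conv_rhs => rw [← tsub_add_cancel_of_le h, map_add, dk_nsmul, add_zero]

theorem le_bs {k : ι} {n : ι →₀ ℕ} {j : ℕ} : j • bs k ≤ n ↔ j ≤ n k := by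
  constructor
  · intro h; simpa using h k
  · intro h i
    by_cases e : i = k
    · subst e; simpa using h
    · simp [Finsupp.single_apply, Ne.symm e]

theorem sub_bs {k : ι} {n : ι →₀ ℕ} {j : ℕ} : (n - j • bs k) k = n k - j := by simp

theorem dk_nat (k : ι) (n : ι →₀ ℕ) : ∃ N : ℕ, dk k n = N :=
  ⟨∑ i ∈ Finset.univ.erase k, n i, by rw [dk_ap]; push_cast; rfl⟩

theorem mem_of_l {T : Alg B} (hT : Uni T) {l : (ι →₀ ℕ) →+ ℚ} {x : (ι →₀ ℕ) → ℚ} (e : Eu l T = ham B x * T)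
    {P Q : AddSubmonoid (ι →₀ ℕ)} (hQ : ∀ n ∈ Q, l n = 0 → n = 0) (mT : T ∈ supp B Q) (hx : ∀ n, n ∉ P → x n = 0) :
    T ∈ supp B P := by
  rw [mem_supp]
  have key : ∀ d : ℕ, ∀ n : ι →₀ ℕ, n.degree < d → n ∉ P → T n = 0 := by
    intro d
    induction d with
    | zero => intro n hn; omega
    | succ d ih =>
      intro n hn hP
      by_cases hnQ : n ∈ Q
      swap
      · exact mem_supp.1 mT n hnQ
      have hl : l n ≠ 0 := fun h => hP ((hQ n hnQ h) ▸ P.zero_mem)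
      funext m
      have h := congrArg (fun T : Alg B => T n m) e
      simp only [Eu_ap] at h
      have h2 : (ham B x * T) n m = 0 := by
        rw [mul_ap]
        refine Finset.sum_eq_zero fun p hp => ?_
        have hd := deg_le_of_mem hp
        rw [Finset.HasAntidiagonal.mem_antidiagonal] at hp
        by_cases h1 : p.1 ∈ P
        · by_cases h0 : p.1 = 0
          · rw [h0, ham_zero_ap]; simp
          · have := deg_pos h0
            rw [ih p.2 (by omega) (fun h2 => hP (hp ▸ P.add_mem h1 h2))]; simp
        · rw [ham_ap, hx _ h1]; ring
      rw [h2] at h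
      exact (mul_eq_zero.1 h).resolve_left hl
  exact fun n hn => key (n.degree + 1) n (by omega) hn

theorem posS_l {l : (ι →₀ ℕ) →+ ℚ} (n : ι →₀ ℕ) (h : n ∈ posS l) (h0 : l n = 0) : n = 0 := by
  rcases mem_posS.1 h with h | h
  · exact h
  · rw [h0] at h; exact absurd h (lt_irrefl _)

theorem supp_step [Skew B] {k : ι} {c : ι → ℕ} {X : Alg B} (hX : GG X) (mX : X ∈ supp B (posS (dk k))) {n : ι →₀ ℕ}
    (hn : n ≠ 0) (hL : n ∉ LS k c) (hlow : ∀ a, dk k a < dk k n → a ∉ LS k c → xl (dk k) X a = 0)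
    (h0 : xl (dg ι) (Zp (th B n) X) n = 0) : xl (dk k) X n = 0 := by
  let R : AddSubmonoid (ι →₀ ℕ) :=
    { carrier := {a | a = 0 ∨ (0 < dk k a ∧ (a ∈ LS k c ∨ dk k n ≤ dk k a))}
      zero_mem' := Or.inl rfl
      add_mem' := by
        rintro a b (rfl | ⟨ha, ha'⟩) (rfl | ⟨hb, hb'⟩)
        · left; simp
        · right; simpa using ⟨hb, hb'⟩
        · right; simpa using ⟨ha, ha'⟩
        · right
          rw [map_add]
          refine ⟨add_pos ha hb, ?_⟩
          rcases ha' with ha' | ha'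
          · rcases hb' with hb' | hb'
            · exact Or.inl (add_mem ha' hb')
            · right; linarith
          · right; linarith }
  have mR : ∀ a, a ∈ R ↔ a = 0 ∨ (0 < dk k a ∧ (a ∈ LS k c ∨ dk k n ≤ dk k a)) := fun a => Iff.rfl
  have hXR : X ∈ supp B R := by
    refine mem_of_l hX.uni (hX.El (dk k)) posS_l mX ?_
    intro a ha
    rw [mR] at ha
    push Not at ha
    obtain ⟨h1, h2⟩ := ha
    by_cases hp : 0 < dk k a
    · exact hlow a (h2 hp).2 (h2 hp).1
    · refine xl_mem hX mX _ _ ?_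
      rw [mem_posS]; tauto
  have hind : ∀ a ∈ R, ∀ b ∈ R, a + b = n → a = 0 ∨ b = 0 := by
    intro a ha b hb hab
    rw [mR] at ha hb
    rcases ha with ha | ⟨ha, ha'⟩
    · exact Or.inl ha
    rcases hb with hb | ⟨hb, hb'⟩
    · exact Or.inr hb
    have hs : dk k a + dk k b = dk k n := by rw [← map_add, hab]
    rcases ha' with ha' | ha'
    · rcases hb' with hb' | hb'
      · exact absurd (hab ▸ add_mem ha' hb') hL
      · linarith
    · linarith
  rw [indec_Zp hn hind hXR hX (dk k) (th B n) (by rw [th_ap, om_self])]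
  have := xl_switch (hX.Zp (th B n)) hn (Zp_mem _ hX.uni) (dg ι) (dk k)
  rw [h0, mul_zero] at this
  exact (mul_eq_zero.1 this).resolve_left (dg_ne hn)

theorem del_zero {k : ι} {n : ι →₀ ℕ} (hk : n k ≠ 0) (hd : dk k n ≠ 0) : del n = 0 ∧ ∀ i, lg (bs i) 1 n = 0 := by
  have h : ∀ i, lg (bs i) 1 n = 0 := by
    intro i
    refine lg_not 1 fun j hj => ?_
    by_cases e : i = k
    · subst e; exact hd (by rw [hj, dk_nsmul])
    · apply hk; rw [hj]; simp [Finsupp.single_apply, e]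
  exact ⟨Finset.sum_eq_zero fun i _ => h i, h⟩

theorem conj_xl [Skew B] {k : ι} {c : ℚ} {S T : Alg B} (hS : GG S) (hT : GG T)
    (e : S * tl B (bs k) c = tl B (bs k) c * T) {l : (ι →₀ ℕ) →+ ℚ} (hl : l (bs k) = 0) {n : ι →₀ ℕ} (hn : n ≠ 0) :
    xl l S n = sh B (bs k) c (xl l T) n := by
  have h0 : Eu l (tl B (bs k) c) = 0 := by
    rw [tl_Eu (bs_ne k), hl]
    have : (fun n : ι →₀ ℕ => (0:ℚ) * lg (bs k) c n) = 0 := by funext; simp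
    rw [this]
    have : ham B 0 = 0 := by ext; simp [ham_ap]
    rw [this, zero_mul]
  have h1 := congrArg (Eu l) e
  rw [Eu_mul, Eu_mul, h0, mul_zero, zero_mul, add_zero, zero_add, hT.El l, ← mul_assoc, tl_ham (bs_ne k), mul_assoc,
    ← e, ← mul_assoc] at h1
  exact xl_eq hS.uni ((tl_uni (bs_ne k) c).cancel_right h1) hn

theorem conj_flip [Skew B] {k : ι} {S T : Alg B} (e : S * tl B (bs k) 1 = tl B (bs k) 1 * T) :
    T * tl B (bs k) (-1) = tl B (bs k) (-1) * S := by
  have h1 : tl B (bs k) 1 * tl B (bs k) (-1) = 1 := by rw [tl_add (bs_ne k)]; simp [tl_zero (bs_ne k)]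
  have h2 : tl B (bs k) (-1) * tl B (bs k) 1 = 1 := by rw [tl_add (bs_ne k)]; simp [tl_zero (bs_ne k)]
  apply (tl_uni (bs_ne k) 1 : Uni (tl B (bs k) 1)).cancel_left
  rw [← mul_assoc, ← e, mul_assoc, h1, ← mul_assoc, h1]; simp

/-- Support of the two halves. -/
theorem half_supp [Skew B] {k : ι} {h h' : Alg B} (gh : GG h) (gh' : GG h') (mh : h ∈ supp B (posS (dk k)))
    (mh' : h' ∈ supp B (posS (dk k))) (e : h * tl B (bs k) 1 = tl B (bs k) 1 * h')
    (hI : Inc B (h * tl B (bs k) 1)) (n : ι →₀ ℕ) :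
    (n ∉ LS k (cp B k) → xl (dk k) h n = 0) ∧ (n ∉ LS k (cm B k) → xl (dk k) h' n = 0) := by
  have key : ∀ N : ℕ, ∀ n, dk k n < N →
    (n ∉ LS k (cp B k) → xl (dk k) h n = 0) ∧ (n ∉ LS k (cm B k) → xl (dk k) h' n = 0) := by
    intro N
    induction N with
    | zero => intro n hn; have := dk_nonneg k n; simp at hn; linarith
    | succ N ih =>
      have low : ∀ a n : ι →₀ ℕ, dk k n < (N + 1 : ℕ) → dk k a < dk k n → dk k a < N := by
        intro a n h1 h2
        obtain ⟨x, hx⟩ := dk_nat k a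
        obtain ⟨y, hy⟩ := dk_nat k n
        rw [hy] at h1 h2; rw [hx] at h2 ⊢
        norm_cast at *; omega
      have zero : ∀ (X : Alg B) (n : ι →₀ ℕ), GG X → X ∈ supp B (posS (dk k)) → dk k n = 0 → xl (dk k) X n = 0 := by
        intro X n gX mX h0
        by_cases hn : n = 0
        · rw [hn, xl_zero]
        · refine xl_mem gX mX _ _ ?_
          rw [mem_posS, h0]; simp [hn]
      have A : ∀ n, dk k n < (N + 1 : ℕ) → om B (bs k) n ≤ 0 → n ∉ LS k (cp B k) → xl (dk k) h n = 0 := by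
        intro n hN hw hL
        by_cases h0 : dk k n = 0
        · exact zero h n gh mh h0
        have hn : n ≠ 0 := fun h => h0 (by rw [h, map_zero])
        have hk : n k ≠ 0 := by rw [mem_LS] at hL; omega
        obtain ⟨d1, d2⟩ := del_zero hk h0
        refine supp_step gh mh hn hL (fun a ha => (ih a (low a n hN ha)).1) ?_
        have := inc_right gh hn hw
        rw [hI.2 n hn, d1, d2, add_zero] at this
        exact this.symm
      have A' : ∀ n, dk k n < (N + 1 : ℕ) → 0 ≤ om B (bs k) n → n ∉ LS k (cm B k) → xl (dk k) h' n = 0 := by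
        intro n hN hw hL
        by_cases h0 : dk k n = 0
        · exact zero h' n gh' mh' h0
        have hn : n ≠ 0 := fun h => h0 (by rw [h, map_zero])
        have hk : n k ≠ 0 := by rw [mem_LS] at hL; omega
        obtain ⟨d1, d2⟩ := del_zero hk h0
        refine supp_step gh' mh' hn hL (fun a ha => (ih a (low a n hN ha)).2) ?_
        have := inc_left gh' hn hw
        rw [← e, hI.2 n hn, d1, d2, add_zero] at this
        exact this.symm
      have lb : dk k (bs k) = 0 := dk_bs k
      intro n hN
      by_cases hn : n = 0
      · rw [hn]; simp [xl_zero]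
      rcases le_total (om B (bs k) n) 0 with hw | hw
      · refine ⟨A n hN hw, fun hL => ?_⟩
        rw [conj_xl gh' gh (conj_flip e) lb hn, sh]
        refine Finset.sum_eq_zero fun j _ => ?_
        split_ifs with hj
        swap
        · rfl
        rw [mem_LS] at hL
        by_cases hjk : bt (cm B k) n - bt (cp B k) n < j
        · have : (-1 * om B (bs k) n : ℚ) = ((bt (cm B k) n - bt (cp B k) n : ℕ) : ℚ) := by
            rw [om_bs] at hw ⊢
            rw [Nat.cast_sub (by exact_mod_cast (sub_nonpos.1 hw))]; ring
          rw [this, ch_lt hjk, zero_mul]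
        · rw [A (n - j • bs k) (by rw [dk_sub hj]; exact hN) (by rw [om_sub_self hj]; exact hw), mul_zero]
          rw [mem_LS, bt_sub (cp_self k) hj, sub_bs]
          rw [om_bs] at hw
          have : bt (cp B k) n ≤ bt (cm B k) n := by exact_mod_cast (sub_nonpos.1 hw)
          omega
      · refine ⟨fun hL => ?_, A' n hN hw⟩
        rw [conj_xl gh gh' e lb hn, sh]
        refine Finset.sum_eq_zero fun j _ => ?_
        split_ifs with hj
        swap
        · rfl
        rw [mem_LS] at hL
        by_cases hjk : bt (cp B k) n - bt (cm B k) n < j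
        · have : (1 * om B (bs k) n : ℚ) = ((bt (cp B k) n - bt (cm B k) n : ℕ) : ℚ) := by
            rw [om_bs] at hw ⊢
            rw [Nat.cast_sub (by exact_mod_cast (sub_nonneg.1 hw))]; ring
          rw [this, ch_lt hjk, zero_mul]
        · rw [A' (n - j • bs k) (by rw [dk_sub hj]; exact hN) (by rw [om_sub_self hj]; exact hw), mul_zero]
          rw [mem_LS, bt_sub (cm_self k) hj, sub_bs]
          rw [om_bs] at hw
          have : bt (cm B k) n ≤ bt (cp B k) n := by exact_mod_cast (sub_nonneg.1 hw)
          omega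
  obtain ⟨N, hN⟩ := dk_nat k n
  exact key (N + 1) n (by rw [hN]; push_cast; linarith)

theorem half_mem [Skew B] {k : ι} {h h' : Alg B} (gh : GG h) (gh' : GG h') (mh : h ∈ supp B (posS (dk k)))
    (mh' : h' ∈ supp B (posS (dk k))) (e : h * tl B (bs k) 1 = tl B (bs k) 1 * h')
    (hI : Inc B (h * tl B (bs k) 1)) : h ∈ supp B (LS k (cp B k)) ∧ h' ∈ supp B (LS k (cm B k)) :=
  ⟨mem_of_l gh.uni (gh.El (dk k)) posS_l mh fun n => (half_supp gh gh' mh mh' e hI n).1,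
    mem_of_l gh'.uni (gh'.El (dk k)) posS_l mh' fun n => (half_supp gh gh' mh mh' e hI n).2⟩

end PartThirteen

end Cluster


namespace Cluster

noncomputable section PartFourteen
variable {ι : Type} [Fintype ι] [DecidableEq ι] {B B' : Matrix ι ι ℤ}

/-- The piecewise linear change of degree. -/
def sg (k : ι) (c : ι → ℕ) (n : ι →₀ ℕ) : ι →₀ ℕ := n.update k (bt c n - n k)

/-- The dual change. -/
def ta (k : ι) (c : ι → ℕ) (m : ι → ℚ) : ι → ℚ := fun i => if i = k then - m k else m i + c i * m k

/-- Abstract matrix mutation. -/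
structure Mt (B B' : Matrix ι ι ℤ) (k : ι) (c : ι → ℕ) : Prop where
  ck : c k = 0
  hik : ∀ i, B' i k = - B i k
  hkj : ∀ j, B' k j = - B k j
  hij : ∀ i j, i ≠ k → j ≠ k → B' i j = B i j + c j * B i k + c i * B k j

theorem sg_k (k : ι) (c : ι → ℕ) (n : ι →₀ ℕ) : sg k c n k = bt c n - n k := by simp [sg]

theorem sg_i {k i : ι} (h : i ≠ k) (c : ι → ℕ) (n : ι →₀ ℕ) : sg k c n i = n i := by
  simp [sg, h]

theorem bt_congr {k : ι} {c : ι → ℕ} (hc : c k = 0) {a b : ι →₀ ℕ} (h : ∀ i, i ≠ k → a i = b i) : bt c a = bt c b := by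
  refine Finset.sum_congr rfl fun i _ => ?_
  by_cases e : i = k
  · rw [e, hc]; simp
  · rw [h i e]

theorem bt_sg {k : ι} {c : ι → ℕ} (hc : c k = 0) (n : ι →₀ ℕ) : bt c (sg k c n) = bt c n :=
  bt_congr hc fun i h => sg_i h c n

theorem sg_mem {k : ι} {c : ι → ℕ} (hc : c k = 0) (n : ι →₀ ℕ) : sg k c n ∈ LS k c := by
  rw [mem_LS, bt_sg hc, sg_k]; omega

theorem sg_sg {k : ι} {c : ι → ℕ} (hc : c k = 0) {n : ι →₀ ℕ} (h : n ∈ LS k c) : sg k c (sg k c n) = n := by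
  ext i
  by_cases e : i = k
  · rw [e, sg_k, bt_sg hc, sg_k]; rw [mem_LS] at h; omega
  · rw [sg_i e, sg_i e]

theorem sg_zero (k : ι) (c : ι → ℕ) : sg k c 0 = 0 := by
  ext i
  by_cases e : i = k
  · rw [e, sg_k, bt_zero]; simp
  · rw [sg_i e]

theorem sg_add {k : ι} {c : ι → ℕ} {a b : ι →₀ ℕ} (ha : a ∈ LS k c) (hb : b ∈ LS k c) :
    sg k c (a + b) = sg k c a + sg k c b := by
  rw [mem_LS] at ha hb
  ext i
  by_cases e : i = k
  · rw [e, Finsupp.add_apply, sg_k, sg_k, sg_k, bt_add, Finsupp.add_apply]; omega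
  · rw [Finsupp.add_apply, sg_i e, sg_i e, sg_i e, Finsupp.add_apply]

theorem sg_eq_zero {k : ι} {c : ι → ℕ} (hc : c k = 0) {n : ι →₀ ℕ} (h : n ∈ LS k c) : sg k c n = 0 ↔ n = 0 := by
  constructor
  · intro e; rw [← sg_sg hc h, e, sg_zero]
  · rintro rfl; exact sg_zero k c

theorem ta_add (k : ι) (c : ι → ℕ) (m m' : ι → ℚ) : ta k c (m + m') = ta k c m + ta k c m' := by
  funext i
  simp only [ta, Pi.add_apply]
  split_ifs <;> ring

theorem ta_ta {k : ι} {c : ι → ℕ} (hc : c k = 0) (m : ι → ℚ) : ta k c (ta k c m) = m := by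
  funext i
  simp only [ta, if_true]
  split_ifs with h
  · rw [h]; ring
  · ring

theorem sg_cast {k : ι} {c : ι → ℕ} {n : ι →₀ ℕ} (h : n ∈ LS k c) (i : ι) :
    (sg k c n i : ℚ) = n i + if i = k then (bt c n - 2 * n k : ℚ) else 0 := by
  by_cases e : i = k
  · rw [e, sg_k, Nat.cast_sub (mem_LS.1 h), if_pos rfl]; ring
  · rw [sg_i e, if_neg e, add_zero]

theorem bt_cast (c : ι → ℕ) (n : ι →₀ ℕ) : (bt c n : ℚ) = ∑ i, (c i : ℚ) * n i := by
  rw [bt]; push_cast; rfl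

theorem pr_ta {k : ι} {c : ι → ℕ} (hc : c k = 0) {n : ι →₀ ℕ} (h : n ∈ LS k c) (m : ι → ℚ) :
    pr n (ta k c m) = pr (sg k c n) m := by
  have h1 : pr (sg k c n) m = pr n m + (bt c n - 2 * n k) * m k := by
    simp only [pr, sg_cast h, add_mul, Finset.sum_add_distrib, ite_mul, zero_mul]
    simp
  have h2 : ∀ i, ta k c m i = m i + c i * m k + if i = k then - 2 * m k else 0 := by
    intro i
    simp only [ta]
    split_ifs with e
    · rw [e, hc]; push_cast; ring
    · ring
  rw [h1, pr, bt_cast]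
  simp only [h2, mul_add, Finset.sum_add_distrib, mul_ite, mul_zero]
  rw [Finset.sum_ite_eq' Finset.univ k, if_pos (Finset.mem_univ k), pr, sub_mul, Finset.sum_mul, add_assoc]
  congr 1
  rw [sub_eq_add_neg]
  congr 1
  · exact Finset.sum_congr rfl fun i _ => by ring
  · ring

theorem ps_ta [Skew B] {k : ι} {c : ι → ℕ} (M : Mt B B' k c) {n : ι →₀ ℕ} (h : n ∈ LS k c) :
    ps B' n = ta k c (ps B (sg k c n)) := by
  have h1 : ∀ i, ps B (sg k c n) i = ps B n i + B i k * (bt c n - 2 * n k) := by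
    intro i
    simp only [ps, sg_cast h, mul_add, Finset.sum_add_distrib, mul_ite, mul_zero]
    rw [Finset.sum_ite_eq' Finset.univ k, if_pos (Finset.mem_univ k)]
  have hd : B k k = 0 := Skew.diag k
  funext i
  simp only [ta]
  rw [h1 k, h1 i, hd]
  split_ifs with e
  · rw [e]
    simp only [ps, M.hkj]
    push_cast
    simp
  · have h2 : ∀ j, (B' i j : ℚ) = B i j + c j * B i k + c i * B k j + if j = k then - 2 * (B i k : ℚ) else 0 := by
      intro j
      split_ifs with e'
      · rw [e', M.hik, M.ck, hd]; push_cast; ring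
      · rw [M.hij i j e e']; push_cast; ring
    simp only [ps, h2, add_mul, Finset.sum_add_distrib, ite_mul, zero_mul]
    rw [Finset.sum_ite_eq' Finset.univ k, if_pos (Finset.mem_univ k), bt_cast]
    have h3 : ∑ j, (c j : ℚ) * B i k * n j = B i k * ∑ j, (c j : ℚ) * n j := by
      rw [Finset.mul_sum]; exact Finset.sum_congr rfl fun i _ => by ring
    have h4 : ∑ j, (c i : ℚ) * B k j * n j = c i * ∑ j, (B k j : ℚ) * n j := by
      rw [Finset.mul_sum]; exact Finset.sum_congr rfl fun i _ => by ring
    rw [h3, h4]; push_cast; ring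

theorem om_sg [Skew B] {k : ι} {c : ι → ℕ} (M : Mt B B' k c) {a n : ι →₀ ℕ} (ha : a ∈ LS k c) (h : n ∈ LS k c) :
    om B' a n = om B (sg k c a) (sg k c n) := by
  rw [om, ps_ta M h, pr_ta M.ck ha, om]

/-- Transport of an element of the algebra. -/
def RR (k : ι) (c : ι → ℕ) (B' : Matrix ι ι ℤ) (T : Alg B) : Alg B' :=
  ⟨fun n m => if n k ≤ bt c n then T (sg k c n) (ta k c m) else 0⟩

theorem RR_of {k : ι} {c : ι → ℕ} (T : Alg B) {n : ι →₀ ℕ} (h : n ∈ LS k c) (m : ι → ℚ) :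
    RR k c B' T n m = T (sg k c n) (ta k c m) := if_pos h

theorem RR_not {k : ι} {c : ι → ℕ} (T : Alg B) {n : ι →₀ ℕ} (h : n ∉ LS k c) (m : ι → ℚ) :
    RR k c B' T n m = 0 := if_neg h

theorem RR_mem {k : ι} {c : ι → ℕ} (T : Alg B) : RR k c B' T ∈ supp B' (LS k c) :=
  mem_supp.2 fun _ hn => funext fun m => RR_not T hn m

theorem RR_supp {k : ι} {c : ι → ℕ} {T : Alg B} {P P' : AddSubmonoid (ι →₀ ℕ)} (hT : T ∈ supp B P)
    (h : ∀ n ∈ LS k c, sg k c n ∈ P → n ∈ P') : RR k c B' T ∈ supp B' P' := by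
  refine mem_supp.2 fun n hn => funext fun m => ?_
  by_cases hL : n ∈ LS k c
  · rw [RR_of T hL, mem_supp.1 hT _ (fun h' => hn (h n hL h'))]; rfl
  · exact RR_not T hL m

theorem RR_uni {k : ι} {c : ι → ℕ} {T : Alg B} (h : Uni T) : Uni (RR k c B' T) := by
  funext m
  rw [RR_of T (zero_mem _), sg_zero, h.ap]; rfl

theorem RR_mul [Skew B] {k : ι} {c : ι → ℕ} (M : Mt B B' k c) {S T : Alg B} (hS : S ∈ supp B (LS k c))
    (hT : T ∈ supp B (LS k c)) : RR k c B' (S * T) = RR k c B' S * RR k c B' T := by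
  ext n m
  rw [mul_ap]
  by_cases hn : n ∈ LS k c
  swap
  · rw [RR_not _ hn]
    refine (Finset.sum_eq_zero fun p hp => ?_).symm
    rw [Finset.HasAntidiagonal.mem_antidiagonal] at hp
    by_cases h1 : p.1 ∈ LS k c
    · by_cases h2 : p.2 ∈ LS k c
      · exact absurd (hp ▸ add_mem h1 h2) hn
      · rw [RR_not _ h2, mul_zero]
    · rw [RR_not _ h1, zero_mul]
  rw [RR_of _ hn, mul_ap]
  classical
  rw [← Finset.sum_filter_of_ne (p := fun p => p.1 ∈ LS k c ∧ p.2 ∈ LS k c),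
    ← Finset.sum_filter_of_ne (s := Finset.HasAntidiagonal.antidiagonal n) (p := fun p => p.1 ∈ LS k c ∧ p.2 ∈ LS k c)]
  · refine Finset.sum_nbij' (fun p => (sg k c p.1, sg k c p.2)) (fun p => (sg k c p.1, sg k c p.2)) ?_ ?_ ?_ ?_ ?_
    · intro p hp
      rw [Finset.mem_filter, Finset.HasAntidiagonal.mem_antidiagonal] at hp ⊢
      refine ⟨?_, sg_mem M.ck _, sg_mem M.ck _⟩
      rw [← sg_add hp.2.1 hp.2.2, hp.1, sg_sg M.ck hn]
    · intro p hp
      rw [Finset.mem_filter, Finset.HasAntidiagonal.mem_antidiagonal] at hp ⊢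
      refine ⟨?_, sg_mem M.ck _, sg_mem M.ck _⟩
      rw [← sg_add hp.2.1 hp.2.2, hp.1]
    · intro p hp
      rw [Finset.mem_filter] at hp
      simp only [sg_sg M.ck hp.2.1, sg_sg M.ck hp.2.2]
    · intro p hp
      rw [Finset.mem_filter] at hp
      simp only [sg_sg M.ck hp.2.1, sg_sg M.ck hp.2.2]
    · intro p hp
      rw [Finset.mem_filter] at hp
      simp only
      rw [RR_of _ (sg_mem M.ck _), RR_of _ (sg_mem M.ck _), sg_sg M.ck hp.2.1, sg_sg M.ck hp.2.2, ta_add,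
        ps_ta M (sg_mem M.ck _), sg_sg M.ck hp.2.2, ta_ta M.ck]
  · intro p _ hp
    refine ⟨?_, ?_⟩
    · by_contra h; exact hp (by rw [RR_not _ h, zero_mul])
    · by_contra h; exact hp (by rw [RR_not _ h, mul_zero])
  · intro p _ hp
    refine ⟨?_, ?_⟩
    · by_contra h; exact hp (by rw [mem_supp.1 hS _ h]; simp)
    · by_contra h; exact hp (by rw [mem_supp.1 hT _ h]; simp)

/-- Transport of coefficient functions. -/
def rx (k : ι) (c : ι → ℕ) (x : (ι →₀ ℕ) → ℚ) (n : ι →₀ ℕ) : ℚ := if n k ≤ bt c n then x (sg k c n) else 0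

theorem rx_of {k : ι} {c : ι → ℕ} (x : (ι →₀ ℕ) → ℚ) {n : ι →₀ ℕ} (h : n ∈ LS k c) : rx k c x n = x (sg k c n) := if_pos h
theorem rx_not {k : ι} {c : ι → ℕ} (x : (ι →₀ ℕ) → ℚ) {n : ι →₀ ℕ} (h : n ∉ LS k c) : rx k c x n = 0 := if_neg h

theorem RR_ham {k : ι} {c : ι → ℕ} (hc : c k = 0) (x : (ι →₀ ℕ) → ℚ) :
    RR k c B' (ham B x) = ham B' (rx k c x) := by
  ext n m
  rw [ham_ap]
  by_cases hn : n ∈ LS k c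
  · rw [RR_of _ hn, rx_of _ hn, ham_ap, ← pr_ta hc hn, ta_ta hc]
  · rw [RR_not _ hn, rx_not _ hn, zero_mul]

theorem RR_Eu {k : ι} {c : ι → ℕ} {l : (ι →₀ ℕ) →+ ℚ} (hl : ∀ n, l (sg k c n) = l n) (T : Alg B) :
    RR k c B' (Eu l T) = Eu l (RR k c B' T) := by
  ext n m
  rw [Eu_ap]
  by_cases hn : n ∈ LS k c
  · rw [RR_of _ hn, RR_of _ hn, Eu_ap, hl]
  · rw [RR_not _ hn, RR_not _ hn, mul_zero]

theorem dk_sg (k : ι) (c : ι → ℕ) (n : ι →₀ ℕ) : dk k (sg k c n) = dk k n := by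
  rw [dk_ap, dk_ap]
  refine Finset.sum_congr rfl fun i hi => ?_
  rw [sg_i (Finset.ne_of_mem_erase hi)]

theorem ev_sg {k o : ι} (h : o ≠ k) (c : ι → ℕ) (n : ι →₀ ℕ) : ev o (sg k c n) = ev o n := by
  rw [ev_ap, ev_ap, sg_i h]

theorem LS_dk {k : ι} {c : ι → ℕ} (hc : c k = 0) (n : ι →₀ ℕ) (hn : n ∈ LS k c) (h : dk k n = 0) : n = 0 := by
  have e := dk_zero h
  have : bt c n = 0 := by
    rw [bt_congr hc (b := 0), bt_zero]
    intro i hi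
    rw [e]; simp [Finsupp.single_apply, Ne.symm hi]
  rw [mem_LS, this] at hn
  rw [e, Nat.le_zero.1 hn, zero_smul]

theorem RR_El [Skew B] {k : ι} {c : ι → ℕ} (M : Mt B B' k c) {h : Alg B} (gh : GG h) (mh : h ∈ supp B (LS k c))
    {l : (ι →₀ ℕ) →+ ℚ} (hl : ∀ n, l (sg k c n) = l n) :
    Eu l (RR k c B' h) = ham B' (rx k c (xl l h)) * RR k c B' h := by
  rw [← RR_Eu hl, gh.El l, RR_mul M (ham_mem fun a ha => xl_mem gh mh l a ha) mh, RR_ham M.ck]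

theorem RR_gg [Skew B] [Skew B'] {k : ι} {c : ι → ℕ} (M : Mt B B' k c) {h : Alg B} (gh : GG h) (mh : h ∈ supp B (LS k c)) :
    GG (RR k c B' h) :=
  GG.of_l (RR_uni gh.uni) (RR_El M gh mh (dk_sg k c)) (LS_dk M.ck) (RR_mem h)

theorem RR_xl [Skew B] {k : ι} {c : ι → ℕ} (M : Mt B B' k c) {h : Alg B} (gh : GG h) (mh : h ∈ supp B (LS k c))
    {l : (ι →₀ ℕ) →+ ℚ} (hl : ∀ n, l (sg k c n) = l n) {n : ι →₀ ℕ} (hn : n ≠ 0) :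
    xl l (RR k c B' h) n = rx k c (xl l h) n :=
  xl_eq (RR_uni gh.uni) (RR_El M gh mh hl) hn

theorem RR_Zp [Skew B] {k : ι} {c : ι → ℕ} (M : Mt B B' k c) {h : Alg B} (gh : Uni h) (mh : h ∈ supp B (LS k c))
    {n : ι →₀ ℕ} (hn : n ∈ LS k c) : Zp (th B' n) (RR k c B' h) = RR k c B' (Zp (th B (sg k c n)) h) := by
  obtain ⟨A, C, hf, e⟩ := Zp_spec (th B (sg k c n)) gh
  obtain ⟨sA, sZ, sC⟩ := fac3_supp hf (R := LS k c) (by rw [← e]; exact mh)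
  refine Zp_eq (A := RR k c B' A) (C := RR k c B' C) ⟨RR_uni hf.uA, RR_uni hf.uZ, RR_uni hf.uC, ?_, ?_, ?_⟩ ?_
  · refine RR_supp hf.hA fun a ha h => ?_
    rw [mem_posS, sg_eq_zero M.ck ha, th_ap, ← om_sg M ha hn] at h
    exact mem_posS.2 h
  · refine RR_supp hf.hZ fun a ha h => ?_
    rw [mem_zerS, th_ap, ← om_sg M ha hn] at h
    exact mem_zerS.2 h
  · refine RR_supp hf.hC fun a ha h => ?_
    rw [mem_posS, sg_eq_zero M.ck ha, AddMonoidHom.neg_apply, th_ap, ← om_sg M ha hn] at h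
    exact mem_posS.2 h
  · conv_lhs => rw [e]
    rw [RR_mul M (mul_mem sA sZ) sC, RR_mul M sA sZ]

theorem RR_inc [Skew B] [Skew B'] {k : ι} {c : ι → ℕ} (M : Mt B B' k c) {h : Alg B} (gh : GG h)
    (mh : h ∈ supp B (LS k c)) {n : ι →₀ ℕ} (h0 : n ≠ 0) (hn : n ∈ LS k c) :
    dg ι (sg k c n) * xl (dg ι) (Zp (th B' n) (RR k c B' h)) n =
      dg ι n * xl (dg ι) (Zp (th B (sg k c n)) h) (sg k c n) := by
  have g1 := (RR_gg M gh mh).Zp (th B' n)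
  have g2 := gh.Zp (th B (sg k c n))
  have hs : sg k c n ≠ 0 := fun e => h0 ((sg_eq_zero M.ck hn).1 e)
  have hd : dk k n ≠ 0 := fun e => h0 (LS_dk M.ck n hn e)
  have e1 := xl_switch g1 h0 (Zp_mem _ (RR_uni gh.uni)) (dg ι) (dk k)
  have e2 := xl_switch g2 hs (Zp_mem _ gh.uni) (dg ι) (dk k)
  have e3 : xl (dk k) (Zp (th B' n) (RR k c B' h)) n = xl (dk k) (Zp (th B (sg k c n)) h) (sg k c n) := by
    rw [RR_Zp M gh.uni mh hn, RR_xl M g2 (Zp_supp _ gh.uni mh) (dk_sg k c) h0, rx_of _ hn]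
  rw [dk_sg] at e2
  rw [e3] at e1
  apply mul_left_cancel₀ hd
  linear_combination (dg ι n) * e2 - (dg ι (sg k c n)) * e1

theorem RR_inc_not [Skew B] [Skew B'] {k : ι} {c : ι → ℕ} (M : Mt B B' k c) {h : Alg B} (gh : GG h)
    (mh : h ∈ supp B (LS k c)) {n : ι →₀ ℕ} (hn : n ∉ LS k c) (t : (ι →₀ ℕ) →+ ℚ) :
    xl (dg ι) (Zp t (RR k c B' h)) n = 0 :=
  xl_mem ((RR_gg M gh mh).Zp t) (Zp_supp t (RR_uni gh.uni) (RR_mem h)) _ _ hn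

end PartFourteen

end Cluster


namespace Cluster

noncomputable section PartFifteen
variable {ι : Type} [Fintype ι] [DecidableEq ι] {B B' : Matrix ι ι ℤ}

theorem sum_cut {f : ℕ → ℚ} {N : ℕ} (t : ℕ) (hf : ∀ j, N < j → f j = 0) :
    ∑ j ∈ Finset.range (t + 1), f j = ∑ j ∈ Finset.range (N + 1), if j ≤ t then f j else 0 := by
  have h1 : ∑ j ∈ Finset.range (t + 1), f j = ∑ j ∈ Finset.range (t + 1), if j ≤ t then f j else 0 :=
    Finset.sum_congr rfl fun j hj => by rw [if_pos (by rw [Finset.mem_range] at hj; omega)]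
  rw [h1]
  rw [Finset.sum_subset (Finset.range_mono (Nat.le_max_left (t + 1) (N + 1))),
    Finset.sum_subset (Finset.range_mono (Nat.le_max_right (t + 1) (N + 1)))]
  · intro j _ hj
    rw [Finset.mem_range] at hj
    rw [hf j (by omega)]; simp
  · intro j _ hj
    rw [Finset.mem_range] at hj
    rw [if_neg (by omega)]

theorem rev_id {U V : ℕ → ℚ} {b N : ℕ} (hV : ∀ t, V t = ∑ j ∈ Finset.range (t + 1), ch N j * U (t - j))
    (hU : ∀ t, b < t → U t = 0) (t : ℕ) :
    ∑ j ∈ Finset.range (t + 1), ch N j * (if t - j ≤ b then U (b - (t - j)) else 0) =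
      if t ≤ b + N then V (b + N - t) else 0 := by
  have hz : ∀ j, N < j → ch N j = 0 := fun j h => ch_lt h
  rw [sum_cut (N := N) t (fun j h => by rw [hz j h, zero_mul])]
  have h1 : (if t ≤ b + N then V (b + N - t) else 0) =
      ∑ i ∈ Finset.range (N + 1), ch N i * (if i + t ≤ b + N then U (b + N - t - i) else 0) := by
    split_ifs with h
    · rw [hV, sum_cut (N := N) _ (fun j h => by rw [hz j h, zero_mul])]
      refine Finset.sum_congr rfl fun i _ => ?_
      by_cases hi : i + t ≤ b + N
      · rw [if_pos hi, if_pos (by omega)]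
      · rw [if_neg hi, if_neg (by omega), mul_zero]
    · symm
      refine Finset.sum_eq_zero fun i _ => ?_
      rw [if_neg (by omega), mul_zero]
  rw [h1, ← Finset.sum_range_reflect]
  refine Finset.sum_congr rfl fun i hi => ?_
  rw [Finset.mem_range] at hi
  have e1 : N + 1 - 1 - i = N - i := by omega
  rw [e1]
  have e2 : ch (N : ℚ) (N - i) = ch N i := by
    rw [ch_natCast, ch_natCast, Nat.choose_symm (by omega)]
  rw [e2]
  by_cases hc : i + t ≤ b + N
  · rw [if_pos hc]
    by_cases hj : N - i ≤ t
    · rw [if_pos hj, if_pos (by omega)]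
      congr 2; omega
    · rw [if_neg hj, hU _ (by omega), mul_zero]
  · rw [if_neg hc]
    split_ifs <;> first | omega | simp

theorem sh_k (k : ι) (c : ℚ) (u : (ι →₀ ℕ) → ℚ) (n : ι →₀ ℕ) :
    sh B (bs k) c u n = ∑ j ∈ Finset.range (n k + 1), ch (c * om B (bs k) n) j * u (n.update k (n k - j)) := by
  have hle : n k ≤ n.degree := by
    have := le_of_nsmul_le (bs_ne k) (le_bs.2 (le_refl (n k)))
    exact this
  have hsub : ∀ j, n - j • bs k = n.update k (n k - j) := by
    intro j; ext i
    by_cases e : i = k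
    · subst e; simp
    · simp [Finsupp.single_apply, e, Ne.symm e]
  rw [sh, ← Finset.sum_subset (Finset.range_mono (Nat.succ_le_succ hle))]
  · refine Finset.sum_congr rfl fun j hj => ?_
    rw [Finset.mem_range] at hj
    rw [if_pos (le_bs.2 (by omega)), hsub]
  · intro j _ hj
    rw [Finset.mem_range] at hj
    rw [if_neg (fun h => hj (by have := le_bs.1 h; omega))]

theorem sh_zero (a : ι →₀ ℕ) (ha : a ≠ 0) (c : ℚ) (u : (ι →₀ ℕ) → ℚ) : sh B a c u 0 = u 0 := by
  rw [sh]; simp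

theorem om_upd [Skew B] (k : ι) (n p : ι →₀ ℕ) (h : ∀ i, i ≠ k → n i = p i) : om B (bs k) n = om B (bs k) p := by
  rw [om_bs, om_bs, bt_congr (cp_self k) h, bt_congr (cm_self k) h]

theorem upd_i (k : ι) (n : ι →₀ ℕ) (t : ℕ) (i : ι) (h : i ≠ k) : n.update k t i = n i := by
  simp [h]

theorem upd_upd (k : ι) (n : ι →₀ ℕ) (t s : ℕ) : (n.update k t).update k s = n.update k s := by
  ext i
  by_cases e : i = k
  · subst e; simp
  · simp [e]

theorem sh_rx [Skew B] [Skew B'] {k : ι} {c c' : ι → ℕ} (hc : c k = 0) (hc' : c' k = 0) {d : ℚ} {u u' : (ι →₀ ℕ) → ℚ}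
    (hu : ∀ n, u' n = sh B (bs k) (-d) u n) (hL : ∀ n, n ∉ LS k c → u n = 0) (n : ι →₀ ℕ)
    {N : ℕ} (hN : -d * om B (bs k) n = N) (hb : bt c' n = bt c n + N) (hom : om B' (bs k) n = - om B (bs k) n) :
    sh B' (bs k) d (rx k c u) n = rx k c' u' n := by
  have e0 : ∀ t, om B (bs k) (n.update k t) = om B (bs k) n := fun t => om_upd k _ _ (upd_i k n t)
  have hV : ∀ t, u' (n.update k t) = ∑ j ∈ Finset.range (t + 1), ch N j * u (n.update k (t - j)) := by
    intro t
    rw [hu, sh_k, e0, hN]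
    refine Finset.sum_congr (by simp) fun j _ => ?_
    rw [upd_upd]; simp
  have hU : ∀ t, bt c n < t → u (n.update k t) = 0 := by
    intro t ht
    apply hL
    rw [mem_LS, bt_congr hc (upd_i k n t)]
    simp; omega
  have key := rev_id (U := fun t => u (n.update k t)) (V := fun t => u' (n.update k t)) hV hU (n k)
  rw [rx, sg, hb, ← key, sh_k, hom]
  refine Finset.sum_congr rfl fun j _ => ?_
  have : d * - om B (bs k) n = N := by rw [← hN]; ring
  rw [this, rx, sg, upd_upd, bt_congr hc (upd_i k n _)]
  simp

theorem sh_sh [Skew B] {a : ι →₀ ℕ} (ha : a ≠ 0) (c : ℚ) (u : (ι →₀ ℕ) → ℚ) (n : ι →₀ ℕ) :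
    sh B a c (sh B a (-c) u) n = u n := by
  by_cases hn : n = 0
  · rw [hn, sh_zero a ha, sh_zero a ha]
  have h1 := tl_ham (B := B) ha (-c) u
  have h2 := tl_ham (B := B) ha c (sh B a (-c) u)
  have h3 : tl B a c * tl B a (-c) = 1 := by rw [tl_add ha, add_neg_cancel, tl_zero ha]
  have h4 : ham B (sh B a c (sh B a (-c) u)) = ham B u := by
    apply (tl_uni ha c : Uni (tl B a c)).cancel_right
    apply (tl_uni ha (-c) : Uni (tl B a (-c))).cancel_right
    rw [← h2, mul_assoc, mul_assoc, ← h1, ← mul_assoc, h3]; simp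
  exact ham_inj hn (congrArg (fun T : Alg B => T n) h4)

theorem eq_of_l {S T : Alg B} (hS : Uni S) (hT : Uni T) {l : (ι →₀ ℕ) →+ ℚ} {x y : (ι →₀ ℕ) → ℚ}
    (e : Eu l S = ham B x * S) (e' : Eu l T = ham B y * T) (hxy : ∀ n, n ≠ 0 → x n = y n)
    (h0 : ∀ n, l n = 0 → S n = T n) : S = T := by
  have key : ∀ d : ℕ, ∀ n : ι →₀ ℕ, n.degree < d → S n = T n := by
    intro d
    induction d with
    | zero => intro n hn; omega
    | succ d ih =>
      intro n hn
      by_cases hl : l n = 0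
      · exact h0 n hl
      funext m
      have h1 := congrArg (fun T : Alg B => T n m) e
      have h2 := congrArg (fun T : Alg B => T n m) e'
      simp only [Eu_ap] at h1 h2
      have h3 : (ham B x * S) n m = (ham B y * T) n m := by
        rw [mul_ap, mul_ap]
        refine Finset.sum_congr rfl fun p hp => ?_
        have hd := deg_le_of_mem hp
        by_cases h0 : p.1 = 0
        · rw [h0, ham_zero_ap, ham_zero_ap]; simp
        · have := deg_pos h0
          rw [ih p.2 (by omega), ham_ap, ham_ap, hxy _ h0]
      rw [← h1, ← h2] at h3
      exact mul_left_cancel₀ hl h3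
  ext n m
  rw [key (n.degree + 1) n (by omega)]

theorem tl_dk_mul {k : ι} {X : Alg B} (hX : Uni X) {P : AddSubmonoid (ι →₀ ℕ)} (hP : ∀ n ∈ P, dk k n = 0 → n = 0)
    (mX : X ∈ supp B P) (Y : Alg B) {n : ι →₀ ℕ} (hn : dk k n = 0) : (Y * X) n = Y n ∧ (X * Y) n = Y n := by
  have hs : ∀ p ∈ Finset.HasAntidiagonal.antidiagonal n, dk k p.1 = 0 ∧ dk k p.2 = 0 := by
    intro p hp
    rw [Finset.HasAntidiagonal.mem_antidiagonal] at hp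
    rw [← hp, map_add] at hn
    have h1 := dk_nonneg k p.1
    have h2 := dk_nonneg k p.2
    constructor <;> linarith
  have hz : ∀ a, dk k a = 0 → a ≠ 0 → X a = 0 := fun a h h' => mem_supp.1 mX a fun hm => h' (hP a hm h)
  constructor
  · funext m
    rw [mul_ap, Finset.sum_eq_single (n, 0)]
    · simp [hX.ap]
    · intro p hp hne
      have : p.2 ≠ 0 := by
        intro h
        rw [Finset.HasAntidiagonal.mem_antidiagonal, h, add_zero] at hp
        exact hne (Prod.ext hp h)
      rw [hz p.2 (hs p hp).2 this]; simp
    · intro h; exact absurd (by simp [Finset.HasAntidiagonal.mem_antidiagonal]) h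
  · funext m
    rw [mul_ap, Finset.sum_eq_single (0, n)]
    · simp [hX.ap]
    · intro p hp hne
      have : p.1 ≠ 0 := by
        intro h
        rw [Finset.HasAntidiagonal.mem_antidiagonal, h, zero_add] at hp
        exact hne (Prod.ext h hp)
      rw [hz p.1 (hs p hp).1 this]; simp
    · intro h; exact absurd (by simp [Finset.HasAntidiagonal.mem_antidiagonal]) h

theorem Eu_tl [Skew B] {k : ι} (c : ℚ) {l : (ι →₀ ℕ) →+ ℚ} (hl : l (bs k) = 0) : Eu l (tl B (bs k) c) = 0 := by
  rw [tl_Eu (bs_ne k), hl]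
  have : (fun n : ι →₀ ℕ => (0:ℚ) * lg (bs k) c n) = 0 := by funext; simp
  rw [this]
  have : ham B 0 = 0 := by ext; simp [ham_ap]
  rw [this, zero_mul]

theorem Eu_tl_mul [Skew B] {k : ι} (c : ℚ) {l : (ι →₀ ℕ) →+ ℚ} (hl : l (bs k) = 0) {X : Alg B} {x : (ι →₀ ℕ) → ℚ}
    (e : Eu l X = ham B x * X) :
    Eu l (tl B (bs k) c * X) = ham B (sh B (bs k) c x) * (tl B (bs k) c * X) := by
  rw [Eu_mul, Eu_tl c hl, zero_mul, zero_add, e, ← mul_assoc, tl_ham (bs_ne k), mul_assoc]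

theorem Eu_mul_tl [Skew B] {k : ι} (c : ℚ) {l : (ι →₀ ℕ) →+ ℚ} (hl : l (bs k) = 0) {X : Alg B} {x : (ι →₀ ℕ) → ℚ}
    (e : Eu l X = ham B x * X) :
    Eu l (X * tl B (bs k) c) = ham B x * (X * tl B (bs k) c) := by
  rw [Eu_mul, Eu_tl c hl, mul_zero, add_zero, e, mul_assoc]

theorem Mt.om {k : ι} {c : ι → ℕ} (M : Mt B B' k c) (n : ι →₀ ℕ) : om B' (bs k) n = - om B (bs k) n := by
  have h1 : cp B' k = cm B k := by funext i; simp [cp, cm, M.hkj]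
  have h2 : cm B' k = cp B k := by funext i; simp [cp, cm, M.hkj]
  rw [om_bs, om_bs, h1, h2]; ring

theorem conj_xl' [Skew B] {k : ι} {c : ℚ} {S T : Alg B} (hS : GG S) (hT : GG T)
    (e : S * tl B (bs k) c = tl B (bs k) c * T) {l : (ι →₀ ℕ) →+ ℚ} (hl : l (bs k) = 0) (n : ι →₀ ℕ) :
    xl l S n = sh B (bs k) c (xl l T) n := by
  by_cases hn : n = 0
  · rw [hn, xl_zero, sh_zero _ (bs_ne k), xl_zero]
  · exact conj_xl hS hT e hl hn

theorem RR_comm [Skew B] [Skew B'] {k : ι} (M : Mt B B' k (cp B k)) (M' : Mt B B' k (cm B k)) {h h' : Alg B}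
    (gh : GG h) (gh' : GG h')
    (mh : h ∈ supp B (LS k (cp B k))) (mh' : h' ∈ supp B (LS k (cm B k)))
    (e : h * tl B (bs k) 1 = tl B (bs k) 1 * h') :
    tl B' (bs k) 1 * RR k (cp B k) B' h = RR k (cm B k) B' h' * tl B' (bs k) 1 := by
  have g1 := RR_gg M gh mh
  have g2 := RR_gg M' gh' mh'
  have gt : GG (tl B' (bs k) 1) := tl_gg (bs_ne k) 1
  have lb : dk k (bs k) = 0 := dk_bs k
  refine eq_of_l (gt.uni.mul g1.uni) (g2.uni.mul gt.uni) (Eu_tl_mul 1 lb (RR_El M gh mh (dk_sg k _)))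
    (Eu_mul_tl 1 lb (RR_El M' gh' mh' (dk_sg k _))) ?_ ?_
  · intro n hn
    have hu : ∀ n, xl (dk k) h' n = sh B (bs k) (-1) (xl (dk k) h) n := fun n => conj_xl' gh' gh (conj_flip e) lb n
    have hu' : ∀ n, xl (dk k) h n = sh B (bs k) (- -1) (xl (dk k) h') n := fun n => by
      rw [neg_neg]; exact conj_xl' gh gh' e lb n
    rcases le_total (om B (bs k) n) 0 with hw | hw
    · have hle : bt (cp B k) n ≤ bt (cm B k) n := by rw [om_bs] at hw; exact_mod_cast (sub_nonpos.1 hw)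
      refine sh_rx (cp_self k) (cm_self k) hu (xl_mem gh mh _) n (N := bt (cm B k) n - bt (cp B k) n) ?_ ?_ (M.om n)
      · rw [om_bs, Nat.cast_sub hle]; ring
      · omega
    · have hle : bt (cm B k) n ≤ bt (cp B k) n := by rw [om_bs] at hw; exact_mod_cast (sub_nonneg.1 hw)
      have hs : ∀ p : ι →₀ ℕ, (∀ i, i ≠ k → p i = n i) → sh B' (bs k) (-1) (rx k (cm B k) (xl (dk k) h')) p =
          rx k (cp B k) (xl (dk k) h) p := by
        intro p hp
        have b1 := bt_congr (cp_self (B := B) k) hp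
        have b2 := bt_congr (cm_self (B := B) k) hp
        refine sh_rx (cm_self k) (cp_self k) hu' (xl_mem gh' mh' _) p (N := bt (cp B k) n - bt (cm B k) n) ?_ ?_ (M.om p)
        · rw [om_bs, b1, b2, Nat.cast_sub hle]; ring
        · omega
      rw [← sh_sh (B := B') (bs_ne k) 1 (rx k (cm B k) (xl (dk k) h')) n, sh_k, sh_k]
      refine Finset.sum_congr rfl fun j _ => ?_
      rw [hs _ (upd_i k n _)]
  · intro n hn
    rw [(tl_dk_mul g1.uni (LS_dk M.ck) (RR_mem h) _ hn).1, (tl_dk_mul g2.uni (LS_dk M'.ck) (RR_mem h') _ hn).2]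

theorem del_ne {n : ι →₀ ℕ} (h : del n ≠ 0) : ∃ (i : ι) (j : ℕ), n = j • bs i := by
  by_contra hc
  push Not at hc
  exact h (Finset.sum_eq_zero fun i _ => lg_not 1 (hc i))

theorem inc_core [Skew B] [Skew B'] {k : ι} {c : ι → ℕ} (M : Mt B B' k c) {X : Alg B} (gX : GG X)
    (mX : X ∈ supp B (LS k c)) {n : ι →₀ ℕ} (hn : n ≠ 0)
    (h1 : ∀ p, p ≠ 0 → dk k p ≠ 0 → om B (bs k) p = om B (bs k) n → xl (dg ι) (Zp (th B p) X) p = del p)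
    (h2 : ∀ (i : ι) (j : ℕ) (p : ι →₀ ℕ), p = j • bs i → om B (bs k) p = om B (bs k) n → bt c p = 0) :
    xl (dg ι) (Zp (th B' n) (RR k c B' X)) n + lg (bs k) 1 n = del n := by
  by_cases hL : n ∈ LS k c
  swap
  · rw [RR_inc_not M gX mX hL, zero_add]
    by_cases hd : dk k n = 0
    · exact (del_k hn hd).symm
    · rw [mem_LS] at hL
      obtain ⟨d1, d2⟩ := del_zero (k := k) (n := n) (by omega) hd
      rw [d1, d2]
  have hd : dk k n ≠ 0 := fun h => hn (LS_dk M.ck n hL h)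
  have hl : lg (bs k) 1 n = 0 := lg_not 1 fun j hj => hd (by rw [hj, dk_nsmul])
  rw [hl, add_zero]
  have hp0 : sg k c n ≠ 0 := fun h => hn ((sg_eq_zero M.ck hL).1 h)
  have hom : om B (bs k) (sg k c n) = om B (bs k) n := om_upd k _ _ fun i hi => sg_i hi c n
  have key := RR_inc M gX mX hn hL
  rw [h1 _ hp0 (by rw [dk_sg]; exact hd) hom] at key
  by_cases hz : bt c n = 0
  · have : sg k c n = n := by
      ext i
      by_cases e : i = k
      · rw [e, sg_k, hz]; rw [mem_LS, hz] at hL; omega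
      · exact sg_i e c n
    rw [this] at key
    exact mul_left_cancel₀ (dg_ne hn) key
  · have d1 : del n = 0 := by
      by_contra h
      obtain ⟨i, j, e⟩ := del_ne h
      exact hz (h2 i j n e rfl)
    have d2 : del (sg k c n) = 0 := by
      by_contra h
      obtain ⟨i, j, e⟩ := del_ne h
      exact hz (by rw [← bt_sg M.ck]; exact h2 i j _ e hom)
    rw [d1]
    rw [d2, mul_zero] at key
    exact (mul_eq_zero.1 key).resolve_left (dg_ne hp0)

theorem bt_bs (c : ι → ℕ) (i : ι) (j : ℕ) : bt c (j • bs i) = c i * j := by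
  rw [bt, Finset.sum_eq_single i]
  · simp
  · intro b _ hb; simp [Finsupp.single_apply, Ne.symm hb]
  · simp

theorem bt_vanish {k i : ι} {j : ℕ} (h : om B (bs k) (j • bs i) ≤ 0) : bt (cp B k) (j • bs i) = 0 := by
  rw [om_bs, sub_nonpos, Nat.cast_le] at h
  rw [bt_bs, bt_bs] at h
  rw [bt_bs]
  unfold cp cm at *
  rcases le_total (B k i) 0 with h1 | h1
  · rw [Int.toNat_of_nonpos h1, zero_mul]
  · have : (-B k i).toNat = 0 := Int.toNat_of_nonpos (by omega)
    rw [this] at h; omega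

theorem bt_vanish' {k i : ι} {j : ℕ} (h : 0 ≤ om B (bs k) (j • bs i)) : bt (cm B k) (j • bs i) = 0 := by
  rw [om_bs, sub_nonneg, Nat.cast_le] at h
  rw [bt_bs, bt_bs] at h
  rw [bt_bs]
  unfold cp cm at *
  rcases le_total 0 (B k i) with h1 | h1
  · rw [Int.toNat_of_nonpos (by omega : -B k i ≤ 0), zero_mul]
  · have : (B k i).toNat = 0 := Int.toNat_of_nonpos (by omega)
    rw [this] at h; omega

/-- The mutation theorem. -/
theorem mut_main [Skew B] [Skew B'] {k o : ι} (ho : o ≠ k) (M : Mt B B' k (cp B k)) (M' : Mt B B' k (cm B k))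
    {g : Alg B} {g' : Alg B'} (hg : Inc B g) (hg' : Inc B' g') :
    (∀ n, n ∉ LS k (cp B k) → xl (ev o) g n = 0) ∧
    ∀ n, xl (ev o) g' n = sh B' (bs k) 1 (rx k (cp B k) (xl (ev o) g)) n := by
  obtain ⟨h, gh, mh0, e1⟩ := split_right k hg
  obtain ⟨h', gh', mh0', e2⟩ := split_left k hg
  have e : h * tl B (bs k) 1 = tl B (bs k) 1 * h' := by rw [← e1, e2]
  obtain ⟨mh, mh'⟩ := half_mem gh gh' mh0 mh0' e (e1 ▸ hg)
  have gR := RR_gg M gh mh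
  have gR' := RR_gg M' gh' mh'
  have gt : GG (tl B' (bs k) 1) := tl_gg (bs_ne k) 1
  have hc := RR_comm M M' gh gh' mh mh' e
  have hI : Inc B' (tl B' (bs k) 1 * RR k (cp B k) B' h) := by
    refine ⟨gt.mul gR, fun n hn => ?_⟩
    have lz : ∀ p : ι →₀ ℕ, dk k p ≠ 0 → lg (bs k) 1 p = 0 := fun p hd =>
      lg_not 1 fun j hj => hd (by rw [hj, dk_nsmul])
    rcases le_total 0 (om B' (bs k) n) with hw | hw
    · rw [inc_left gR hn hw]
      rw [M.om] at hw
      refine inc_core M gh mh hn ?_ ?_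
      · intro p hp hd ho
        have := inc_right gh hp (by rw [ho]; linarith)
        rw [← e1, hg.2 p hp, lz p hd, add_zero] at this
        exact this.symm
      · rintro i j p rfl ho
        exact bt_vanish (by rw [ho]; linarith)
    · rw [hc, inc_right gR' hn hw]
      rw [M.om] at hw
      refine inc_core M' gh' mh' hn ?_ ?_
      · intro p hp hd ho
        have := inc_left gh' hp (by rw [ho]; linarith)
        rw [← e2, hg.2 p hp, lz p hd, add_zero] at this
        exact this.symm
      · rintro i j p rfl ho
        exact bt_vanish' (by rw [ho]; linarith)
  have eg : g' = tl B' (bs k) 1 * RR k (cp B k) B' h := inc_unique hg' hI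
  have lb : ev o (bs k) = 0 := by rw [ev_ap]; simp [Finsupp.single_apply, Ne.symm ho]
  have hgx : xl (ev o) g = xl (ev o) h := by
    funext n
    by_cases hn : n = 0
    · rw [hn, xl_zero, xl_zero]
    · refine xl_eq hg.1.uni ?_ hn
      rw [e1]
      exact Eu_mul_tl 1 lb (gh.El _)
  refine ⟨fun n hn => by rw [hgx]; exact xl_mem gh mh _ n hn, fun n => ?_⟩
  rw [hgx]
  by_cases hn : n = 0
  · rw [hn, xl_zero, sh_zero _ (bs_ne k), rx_of _ (zero_mem _), sg_zero, xl_zero]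
  · refine xl_eq hg'.1.uni ?_ hn
    rw [eg]
    exact Eu_tl_mul 1 lb (RR_El M gh mh (ev_sg ho _))

end PartFifteen

end Cluster


namespace Cluster

noncomputable section Part16

variable {ι : Type} [Fintype ι] [DecidableEq ι] {B : Matrix ι ι ℤ}

theorem lvl_mul {o : ι} {X Y : Alg B} (uX : Uni X) (mX : X ∈ supp B (posS (ev o)))
    (hY : ∀ a : ι →₀ ℕ, a o = 0 → Y a = 0) {n : ι →₀ ℕ} (hn : n o ≤ 1) :
    (X * Y) n = Y n ∧ (Y * X) n = Y n := by
  have key : ∀ a b : ι →₀ ℕ, a + b = n → a ≠ 0 → X a = 0 ∨ b o = 0 := by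
    intro a b hab ha
    by_cases hao : a o = 0
    · left
      refine mem_supp.1 mX a ?_
      rw [mem_posS]
      rintro (h | h)
      · exact ha h
      · rw [ev_ap, hao] at h; simp at h
    · right
      have : a o + b o = n o := by rw [← hab]; rfl
      omega
  constructor
  · funext m
    rw [mul_ap, Finset.sum_eq_single (0, n)]
    · rw [uX.ap, one_mul]
    · rintro ⟨a, b⟩ hp hne
      rw [Finset.HasAntidiagonal.mem_antidiagonal] at hp
      have ha : a ≠ 0 := by
        rintro rfl
        apply hne
        simp at hp
        rw [hp]
      rcases key a b hp ha with h | h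
      · simp [h]
      · simp [hY b h]
    · intro h
      exact absurd (Finset.HasAntidiagonal.mem_antidiagonal.2 (by simp)) h
  · funext m
    rw [mul_ap, Finset.sum_eq_single (n, 0)]
    · simp [uX.ap]
    · rintro ⟨b, a⟩ hp hne
      rw [Finset.HasAntidiagonal.mem_antidiagonal] at hp
      have ha : a ≠ 0 := by
        rintro rfl
        apply hne
        simp at hp
        rw [hp]
      rcases key a b (by rw [add_comm]; exact hp) ha with h | h
      · simp [h]
      · simp [hY b h]
    · intro h
      exact absurd (Finset.HasAntidiagonal.mem_antidiagonal.2 (by simp)) h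

theorem xl_lvl0 [Skew B] {o : ι} {T : Alg B} (hT : GG T) {a : ι →₀ ℕ} (ha : a o = 0) : xl (ev o) T a = 0 := by
  by_cases h0 : a = 0
  · rw [h0, xl_zero]
  have e : ham B (xl (ev o) T) = Eu (ev o) T * iv T := by
    rw [hT.El (ev o), mul_assoc, hT.uni.mul_iv, mul_one]
  have z : ham B (xl (ev o) T) a = ham B (fun _ => 0) a := by
    rw [e]
    funext m
    rw [mul_ap, ham_ap, zero_mul]
    refine Finset.sum_eq_zero fun p hp => ?_
    rw [Finset.HasAntidiagonal.mem_antidiagonal] at hp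
    have : p.1 o + p.2 o = a o := by rw [← hp]; rfl
    rw [Eu_ap, ev_ap, show p.1 o = 0 by omega]
    simp
  exact ham_inj h0 z

theorem xl_lvl1 [Skew B] {o : ι} {S T : Alg B} (hS : GG S) (hT : GG T) (mS : S ∈ supp B (posS (ev o)))
    {n : ι →₀ ℕ} (hn : n o = 1) : xl (ev o) (S * T) n = xl (ev o) S n + xl (ev o) T n := by
  have h0 : n ≠ 0 := by rintro rfl; simp at hn
  rw [xl_mul hS hT, Pi.add_apply]
  congr 1
  have hy : ∀ a : ι →₀ ℕ, a o = 0 → ham B (xl (ev o) T) a = 0 := by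
    intro a ha
    funext m
    rw [ham_ap, xl_lvl0 hT ha]; simp
  have hm := iv_mem_supp hS.uni mS
  have h2 : ∀ a : ι →₀ ℕ, a o ≤ 1 → (ham B (xl (ev o) T) * iv S) a = ham B (xl (ev o) T) a :=
    fun a ha => (lvl_mul hS.uni.iv hm hy ha).2
  have h3 : (S * (ham B (xl (ev o) T) * iv S)) n = (ham B (xl (ev o) T) * iv S) n :=
    (lvl_mul hS.uni mS (fun a ha => by rw [h2 a (by omega), hy a ha]) hn.le).1
  apply ham_inj (B := B) h0
  rw [hS.ham_Ad, mul_assoc, h3, h2 n hn.le]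

/-- base case -/
theorem base_xl [Skew B] {o : ι} (hB : ∀ j, 0 ≤ B o j) {g : Alg B} (hg : Inc B g) {n : ι →₀ ℕ} (hn : n ≠ 0) :
    xl (ev o) g n = lg (bs o) 1 n := by
  obtain ⟨f, gf, mf, rfl⟩ := split_left o hg
  have hom : ∀ a : ι →₀ ℕ, 0 ≤ om B (bs o) a := by
    intro a
    rw [om_bs]
    have : bt (cm B o) a = 0 := by
      rw [bt]
      refine Finset.sum_eq_zero fun i _ => ?_
      rw [cm, Int.toNat_of_nonpos (by have := hB i; omega), zero_mul]
    rw [this]; simp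
  have key : ∀ d : ℕ, ∀ a : ι →₀ ℕ, a.degree = d → a o ≠ 0 → xl (dg ι) f a = 0 := by
    intro d
    induction d using Nat.strong_induction_on with
    | _ d ih =>
      intro a had hao
      have ha : a ≠ 0 := by rintro rfl; simp at hao
      have hd := deg_pos ha
      have hR : ∀ x ∈ upK (d - 1) (zerS (ev o)), ∀ y ∈ upK (d - 1) (zerS (ev o)), x + y = a → x = 0 ∨ y = 0 := by
        intro x hx y hy e
        have e1 : x.degree + y.degree = d := by rw [← map_add, e, had]
        rw [mem_upK, mem_zerS, ev_ap] at hx hy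
        by_contra hc
        push Not at hc
        have := deg_pos hc.1
        have := deg_pos hc.2
        have e2 : x o + y o = a o := by rw [← e]; rfl
        rcases hx with hx | hx
        · rcases hy with hy | hy
          · have : x o = 0 := by exact_mod_cast hx
            have : y o = 0 := by exact_mod_cast hy
            omega
          · omega
        · omega
      have mR : f ∈ supp B (upK (d - 1) (zerS (ev o))) := by
        refine mem_of_xl gf fun x hx => ?_
        rw [mem_upK, mem_zerS, ev_ap] at hx
        push Not at hx
        exact ih x.degree (by omega) x rfl (by exact_mod_cast hx.1)
      rw [indec_Zp ha hR mR gf (dg ι) (th B a) (by rw [th_ap, om_self])]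
      have h1 := inc_left gf ha (hom a)
      rw [hg.2 a ha] at h1
      have h2 : del a = lg (bs o) 1 a := by
        by_cases hd : dk o a = 0
        · exact del_k ha hd
        · rw [(del_zero hao hd).1, (del_zero hao hd).2]
      linarith
  have mf0 : f ∈ supp B (zerS (ev o)) := by
    refine mem_of_xl gf fun a ha => key _ a rfl ?_
    rw [mem_zerS, ev_ap] at ha
    exact_mod_cast ha
  have hE : Eu (ev o) f = 0 := by
    ext a m
    rw [Eu_ap, zero_ap]
    by_cases ha : a ∈ zerS (ev o)
    · rw [mem_zerS] at ha; rw [ha, zero_mul]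
    · rw [mem_supp.1 mf0 a ha]; simp
  have e : Eu (ev o) (tl B (bs o) 1 * f) = ham B (fun k => ev o (bs o) * lg (bs o) 1 k) * (tl B (bs o) 1 * f) := by
    rw [Eu_mul, hE, mul_zero, add_zero, tl_Eu (bs_ne o), mul_assoc]
  rw [xl_eq hg.1.uni e hn, ev_ap]
  simp

theorem t_sum (t : (ι →₀ ℕ) →+ ℚ) (a : ι →₀ ℕ) : t a = ∑ i, (a i : ℚ) * t (bs i) := by
  have : a = ∑ i, a i • bs i := by
    ext j
    simp [Finsupp.finsetSum_apply, Finsupp.single_apply]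
  conv_lhs => rw [this]
  rw [map_sum]
  exact Finset.sum_congr rfl fun i _ => by rw [map_nsmul, nsmul_eq_mul]

theorem exists_t (o : ι) {n : ι →₀ ℕ} (hn : n o = 1) : ∃ t : (ι →₀ ℕ) →+ ℚ, t n = 0 ∧
    (∀ x : ι →₀ ℕ, x.degree ≤ n.degree → x ≠ 0 → t x = 0 → Par x n) ∧
    ∀ a : ι →₀ ℕ, a ≠ 0 → 0 ≤ t a → a o ≠ 0 := by
  classical
  have h0 : n ≠ 0 := by rintro rfl; simp at hn
  obtain ⟨t, h1, h2, h3⟩ := perturb n ((Finset.univ.erase o).toList.map fun i : ι => (1, bs i, 0, bs i))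
    (-dk o + dk o n • ev o) (by simp [ev_ap, hn])
    (((le_deg ι n.degree).toList.map fun x => (1, x, 0, x)).filter
      fun p => ∃ y : (ι →₀ ℕ) →+ ℚ, y n = 0 ∧ fm p y ≠ 0) (by
      intro p hp
      simpa using (List.mem_filter.1 hp).2)
  refine ⟨t, h1, ?_, ?_⟩
  · intro x hx hx0 e
    obtain ⟨c, hc⟩ := vec_gen h0 1 0 x x (by
      by_contra hcon
      push Not at hcon
      apply h2 (1, x, 0, x)
      · rw [List.mem_filter]
        refine ⟨List.mem_map.2 ⟨x, ?_, rfl⟩, by simpa using hcon⟩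
        simp [mem_le_deg, hx]
      · simp [fm, e])
    have hc' : ∀ i, (x i : ℚ) = c * n i := fun i => by rw [← hc i]; ring
    have hd : dg ι x = c * dg ι n := by
      rw [dg_sum, dg_sum, pr, pr, Finset.mul_sum]
      exact Finset.sum_congr rfl fun i _ => by rw [hc' i]; ring
    rw [dg_ap, dg_ap] at hd
    rw [Par]
    ext i
    have : ((n.degree * x i : ℕ) : ℚ) = ((x.degree * n i : ℕ) : ℚ) := by
      push_cast
      rw [hc' i, hd]; ring
    simpa using (by exact_mod_cast this : n.degree * x i = x.degree * n i)
  · intro a ha hta hao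
    have hneg : ∀ i, i ≠ o → t (bs i) < 0 := by
      intro i hi
      have := (h3 (1, bs i, 0, bs i) (List.mem_map.2 ⟨i, by simpa using hi, rfl⟩)).2
      simp only [fm, one_mul, zero_mul, add_zero] at this
      apply this
      simp [ev_ap, hi, dk, dgbs, Finsupp.single_apply]
    have : t a < 0 := by
      rw [t_sum]
      obtain ⟨i, hi⟩ : ∃ i, a i ≠ 0 := by
        by_contra hc
        push Not at hc
        exact ha (Finsupp.ext hc)
      have hio : i ≠ o := by rintro rfl; exact hi hao
      refine Finset.sum_neg' (fun j _ => ?_) ⟨i, Finset.mem_univ _, ?_⟩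
      · by_cases hj : j = o
        · rw [hj, hao]; simp
        · exact mul_nonpos_of_nonneg_of_nonpos (by positivity) (hneg j hj).le
      · exact mul_neg_of_pos_of_neg (by positivity) (hneg i hio)
    linarith

/-- positivity of the level-one logarithm -/
theorem xl_nonneg [Skew B] {o : ι} {g : Alg B} (hg : Inc B g) {n : ι →₀ ℕ} (hn : n o = 1) :
    0 ≤ xl (ev o) g n := by
  have h0 : n ≠ 0 := by rintro rfl; simp at hn
  obtain ⟨t, h1, h2, h3⟩ := exists_t o hn
  obtain ⟨A, C, hF, e⟩ := Zp_spec t hg.1.uni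
  have hGG := fac3_gg hF (e ▸ hg.1)
  have hle : ∀ x : ι →₀ ℕ, 0 ≤ t x → x ∈ posS (ev o) := by
    intro x hx
    rw [mem_posS, ev_ap]
    by_cases hx0 : x = 0
    · exact Or.inl hx0
    · right
      have := h3 x hx0 hx
      have : 0 < x o := Nat.pos_of_ne_zero this
      exact_mod_cast this
  have mA : A ∈ supp B (posS (ev o)) := by
    refine supp_mono ?_ hF.hA
    intro x hx
    exact hle x (posS_le t hx)
  have mZ : Zp t g ∈ supp B (posS (ev o)) := by
    refine supp_mono ?_ hF.hZ
    intro x hx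
    exact hle x (zerS_le t hx)
  rw [e, xl_lvl1 (hGG.1.mul hGG.2.1) hGG.2.2 (mul_mem mA mZ) hn, xl_lvl1 hGG.1 hGG.2.1 mA hn,
    xl_mem hGG.1 hF.hA _ n (by rw [mem_posS, h1]; simp [h0]),
    xl_mem hGG.2.2 hF.hC _ n (by rw [mem_posS, AddMonoidHom.neg_apply, h1]; simp [h0]), zero_add, add_zero]
  obtain ⟨T, hT, eT⟩ := W_lift (posit hg n.degree t fun x y hx hy hx0 hy0 ex ey =>
    (h2 x hx hx0 ex).trans' h0 (h2 y hy hy0 ey))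
  have key : GG T ∧ T ∈ supp B (posS (ev o)) ∧ 0 ≤ xl (ev o) T n := by
    clear eT
    rw [WA] at hT
    induction hT using Submonoid.closure_induction with
    | one =>
      refine ⟨gg_one, one_mem _, ?_⟩
      rw [xl_mem gg_one (P := ⊥) (one_mem _) _ n (by simpa using h0)]
    | mem x hx =>
      obtain ⟨a, c, ha, ha0, hc, -, rfl⟩ := hx
      have hao : a o ≠ 0 := h3 a ha0 (le_of_eq ha.symm)
      refine ⟨tl_gg ha0 c, tl_supp c (hle a (le_of_eq ha.symm)), ?_⟩
      rw [xl_tl ha0 c _ h0]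
      by_cases hj : ∃ j : ℕ, n = j • a
      · obtain ⟨j, rfl⟩ := hj
        have : j = 1 := by
          simp only [Finsupp.smul_apply, smul_eq_mul] at hn
          exact Nat.eq_one_of_mul_eq_one_right hn
        subst this
        rw [one_smul, lg_self ha0, ev_ap]
        positivity
      · push Not at hj
        rw [lg_not c hj, mul_zero]
    | mul x y _ _ hx hy =>
      refine ⟨hx.1.mul hy.1, mul_mem hx.2.1 hy.2.1, ?_⟩
      rw [xl_lvl1 hx.1 hy.1 hx.2.1 hn]
      exact add_nonneg hx.2.2 hy.2.2
  rw [xl_congr eT hF.uZ key.1.uni _ n le_rfl]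
  exact key.2.2

end Part16
end Cluster


namespace Cluster

noncomputable section Part17

variable {K : Type} [Field K] [CharZero K]

theorem ser_one_add (b : ℕ) : (1 + PowerSeries.X : PowerSeries ℚ) ^ b = PowerSeries.mk (fun j => ch b j) := by
  ext j
  rw [PowerSeries.coeff_mk, ch_natCast]
  have := Polynomial.coeff_one_add_X_pow ℚ b j
  rw [← this, ← Polynomial.coeff_coe]
  simp

theorem ser_poly (f : ℕ → ℚ) (N : ℕ) (h : ∀ t, N < t → f t = 0) :
    ((∑ t ∈ Finset.range (N + 1), Polynomial.monomial t (f t) : Polynomial ℚ) : PowerSeries ℚ)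
      = PowerSeries.mk f := by
  ext j
  rw [Polynomial.coeff_coe, PowerSeries.coeff_mk, Polynomial.finsetSum_coeff]
  simp only [Polynomial.coeff_monomial]
  rw [Finset.sum_ite_eq']
  split_ifs with hj
  · rfl
  · rw [h j (by simpa using hj)]

theorem sum_trunc (f : ℕ → K) {N M : ℕ} (hN : ∀ t, N < t → f t = 0) (hM : ∀ t, M < t → f t = 0) :
    ∑ t ∈ Finset.range (N + 1), f t = ∑ t ∈ Finset.range (M + 1), f t := by
  have key : ∀ L, (∀ t, L < t → f t = 0) → ∑ t ∈ Finset.range (L + 1), f t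
      = ∑ t ∈ Finset.range (max N M + L + 1), f t := by
    intro L hL
    refine Finset.sum_subset (fun x hx => ?_) fun x _ hx => ?_
    · rw [Finset.mem_range] at *; omega
    · rw [Finset.mem_range] at hx; exact hL x (by omega)
  have h2 : ∑ t ∈ Finset.range (max N M + N + 1), f t = ∑ t ∈ Finset.range (max N M + M + 1), f t := by
    rcases le_total N M with h | h
    · refine Finset.sum_subset (fun x hx => ?_) fun x _ hx => ?_
      · rw [Finset.mem_range] at *; omega
      · rw [Finset.mem_range] at hx; exact hN x (by omega)
    · symm
      refine Finset.sum_subset (fun x hx => ?_) fun x _ hx => ?_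
      · rw [Finset.mem_range] at *; omega
      · rw [Finset.mem_range] at hx; exact hN x (by omega)
  rw [key N hN, key M hM, h2]

theorem poly_fib {U A : ℕ → ℚ} {bp bm N : ℕ} (hU : ∀ t, bp < t → U t = 0) (hUN : ∀ t, N < t → U t = 0)
    (hAN : ∀ t, N < t → A t = 0)
    (h : ∀ t, A t = ∑ j ∈ Finset.range (t + 1), ch ((bm : ℚ) - bp) j *
      (if t - j ≤ bp then U (bp - (t - j)) else 0)) {y : K} (hy : y ≠ 0) :
    (∑ t ∈ Finset.range (N + 1), (A t : K) * y ^ t) * (1 + y) ^ bp =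
      (1 + y) ^ bm * (y ^ bp * ∑ t ∈ Finset.range (N + 1), (U t : K) * (y⁻¹) ^ t) := by
  set R : ℕ → ℚ := fun t => if t ≤ bp then U (bp - t) else 0 with hR
  have hRb : ∀ t, bp < t → R t = 0 := fun t ht => by simp [hR, not_le.2 ht]
  have s1 : PowerSeries.mk A = PowerSeries.mk (fun j => ch ((bm : ℚ) - bp) j) * PowerSeries.mk R := by
    ext t
    rw [PowerSeries.coeff_mk, PowerSeries.coeff_mul, h t,
      Finset.Nat.sum_antidiagonal_eq_sum_range_succ_mk]
    simp [hR]
  have s2 : PowerSeries.mk (fun j => ch ((bm : ℚ) - bp) j) * (1 + PowerSeries.X : PowerSeries ℚ) ^ bp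
      = (1 + PowerSeries.X : PowerSeries ℚ) ^ bm := by
    rw [ser_one_add, ser_one_add]
    ext t
    rw [PowerSeries.coeff_mul, PowerSeries.coeff_mk]
    have := ch_add ((bm : ℚ) - bp) bp t
    rw [sub_add_cancel] at this
    rw [this]
    simp
  have s3 : (∑ t ∈ Finset.range (N + 1), Polynomial.monomial t (A t) : Polynomial ℚ) * (1 + Polynomial.X) ^ bp
      = (1 + Polynomial.X) ^ bm * ∑ t ∈ Finset.range (bp + 1), Polynomial.monomial t (R t) := by
    apply Polynomial.coe_injective ℚ
    rw [Polynomial.coe_mul, Polynomial.coe_mul, ser_poly A N hAN, ser_poly R bp hRb]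
    simp only [Polynomial.coe_pow, Polynomial.coe_add, Polynomial.coe_one, Polynomial.coe_X]
    rw [s1, mul_right_comm, s2]
  have s4 := congrArg (Polynomial.eval₂ (Rat.castHom K) y) s3
  simp only [Polynomial.eval₂_mul, Polynomial.eval₂_pow, Polynomial.eval₂_add, Polynomial.eval₂_one,
    Polynomial.eval₂_X, Polynomial.eval₂_finsetSum, Polynomial.eval₂_monomial, Rat.coe_castHom] at s4
  rw [s4]
  congr 1
  rw [sum_trunc (fun t => (U t : K) * (y⁻¹) ^ t) (M := bp) (fun t ht => by rw [hUN t ht]; simp)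
    (fun t ht => by rw [hU t ht]; simp), Finset.mul_sum, ← Finset.sum_range_reflect]
  refine Finset.sum_congr rfl fun t ht => ?_
  rw [Finset.mem_range] at ht
  have e1 : bp + 1 - 1 - t = bp - t := by omega
  have e2 : bp - (bp - t) = t := by omega
  rw [e1]
  simp only [hR]
  rw [if_pos (by omega), e2, inv_pow, show y ^ bp = y ^ (bp - t) * y ^ t by rw [← pow_add]; congr 1; omega]
  field_simp

end Part17

noncomputable section Part17b

variable {ι : Type} [Fintype ι] [DecidableEq ι] {B B' : Matrix ι ι ℤ}

/-- mutation for a general index set -/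
def mB (C : Matrix ι ι ℤ) (k : ι) : Matrix ι ι ℤ := fun i j =>
  if i = k ∨ j = k then -C i j
  else C i j + (if C i k < 0 then -1 else 1) * max (C i k * C k j) 0

theorem mB_core (x y : ℤ) : (if x < 0 then -1 else 1) * max (x * y) 0 = (y.toNat : ℤ) * x + ((-x).toNat : ℤ) * y ∧
    (if x < 0 then -1 else 1) * max (x * y) 0 = ((-y).toNat : ℤ) * x + (x.toNat : ℤ) * y := by
  rcases lt_or_ge x 0 with hx | hx <;> rcases lt_or_ge y 0 with hy | hy
  · rw [if_pos hx, max_eq_left (mul_nonneg_of_nonpos_of_nonpos hx.le hy.le), Int.toNat_of_nonpos hy.le,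
      Int.toNat_of_nonneg (by omega : 0 ≤ -x), Int.toNat_of_nonneg (by omega : 0 ≤ -y), Int.toNat_of_nonpos hx.le]
    constructor <;> push_cast <;> ring
  · rw [if_pos hx, max_eq_right (mul_nonpos_of_nonpos_of_nonneg hx.le hy), Int.toNat_of_nonneg hy,
      Int.toNat_of_nonneg (by omega : 0 ≤ -x), Int.toNat_of_nonpos (by omega : -y ≤ 0), Int.toNat_of_nonpos hx.le]
    constructor <;> push_cast <;> ring
  · rw [if_neg (not_lt.2 hx), max_eq_right (mul_nonpos_of_nonneg_of_nonpos hx hy.le), Int.toNat_of_nonpos hy.le,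
      Int.toNat_of_nonpos (by omega : -x ≤ 0), Int.toNat_of_nonneg (by omega : 0 ≤ -y), Int.toNat_of_nonneg hx]
    constructor <;> push_cast <;> ring
  · rw [if_neg (not_lt.2 hx), max_eq_left (mul_nonneg hx hy), Int.toNat_of_nonneg hy,
      Int.toNat_of_nonpos (by omega : -x ≤ 0), Int.toNat_of_nonpos (by omega : -y ≤ 0), Int.toNat_of_nonneg hx]
    constructor <;> push_cast <;> ring

theorem mB_cp (C : Matrix ι ι ℤ) [Skew C] (k : ι) : Mt C (mB C k) k (cp C k) where
  ck := cp_self k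
  hik i := by simp [mB]
  hkj j := by simp [mB]
  hij i j hi hj := by
    have := (mB_core (C i k) (C k j)).1
    rw [mB, if_neg (by tauto), this, cp, cp, Skew.skew (B := C) k i]
    ring

theorem mB_cm (C : Matrix ι ι ℤ) [Skew C] (k : ι) : Mt C (mB C k) k (cm C k) where
  ck := cm_self k
  hik i := by simp [mB]
  hkj j := by simp [mB]
  hij i j hi hj := by
    have := (mB_core (C i k) (C k j)).2
    rw [mB, if_neg (by tauto), this, cm, cm, Skew.skew (B := C) k i]
    ring_nf

theorem Mt.symm {k : ι} {c : ι → ℕ} (M : Mt B B' k c) : Mt B' B k c where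
  ck := M.ck
  hik i := by rw [M.hik]; ring
  hkj i := by rw [M.hkj]; ring
  hij i j hi hj := by rw [M.hij i j hi hj, M.hik, M.hkj]; ring

theorem Mt.cp_eq {k : ι} {c : ι → ℕ} (M : Mt B B' k c) : cp B' k = cm B k := by
  funext i; rw [cp, cm, M.hkj]

theorem Mt.cm_eq {k : ι} {c : ι → ℕ} (M : Mt B B' k c) : cm B' k = cp B k := by
  funext i; rw [cp, cm, M.hkj, neg_neg]

instance mB_skew (C : Matrix ι ι ℤ) [Skew C] (k : ι) : Skew (mB C k) where
  skew i j := by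
    have M := mB_cp C k
    by_cases hi : i = k
    · subst hi; rw [M.hkj, M.hik, Skew.skew (B := C) j i]; ring
    · by_cases hj : j = k
      · subst hj; rw [M.hkj, M.hik, Skew.skew (B := C) i j]
      · rw [M.hij i j hi hj, M.hij j i hj hi, Skew.skew (B := C) j i, Skew.skew (B := C) j k,
          Skew.skew (B := C) k i]
        ring

theorem mB_mB (C : Matrix ι ι ℤ) [Skew C] (k : ι) : mB (mB C k) k = C := by
  have M := (mB_cm C k).symm
  have M' := mB_cp (mB C k) k
  rw [(mB_cm C k).cp_eq] at M'
  ext i j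
  by_cases hi : i = k
  · subst hi; rw [M.hkj, M'.hkj]
  · by_cases hj : j = k
    · subst hj; rw [M.hik, M'.hik]
    · rw [M'.hij i j hi hj, M.hij i j hi hj]

end Part17b
end Cluster


namespace Cluster

noncomputable section Part18

variable {K : Type} [Field K] [CharZero K]
variable {J : Type} [Fintype J] [DecidableEq J] {C C' : Matrix (Option J) (Option J) ℤ}

/-- exponents -/
def ex (C : Matrix (Option J) (Option J) ℤ) (n : Option J →₀ ℕ) (j : J) : ℤ := - ∑ i, C (some j) i * n i

/-- monomials -/
def mon (C : Matrix (Option J) (Option J) ℤ) (u : J → K) (n : Option J →₀ ℕ) : K := ∏ j, u j ^ ex C n j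

/-- the exchange ratio -/
def yh (C : Matrix (Option J) (Option J) ℤ) (u : J → K) (k : J) : K := ∏ j, u j ^ (-C (some j) (some k))

theorem ex_upd (n : Option J →₀ ℕ) (k : J) (hk : n (some k) = 0) (t : ℕ) (j : J) :
    ex C (n.update (some k) t) j = ex C n j + (-C (some j) (some k)) * t := by
  rw [ex, ex]
  have e : ∀ i, (C (some j) i * ((n.update (some k) t) i : ℕ) : ℤ) = C (some j) i * n i +
      if i = some k then C (some j) (some k) * (t : ℤ) else 0 := by
    intro i
    by_cases hi : i = some k
    · subst hi; simp [hk]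
    · rw [upd_i _ _ _ _ hi, if_neg hi, add_zero]
  rw [Finset.sum_congr rfl fun i _ => e i, Finset.sum_add_distrib, Finset.sum_ite_eq' Finset.univ (some k)]
  simp
  ring

theorem mon_upd {u : J → K} (hu : ∀ j, u j ≠ 0) (n : Option J →₀ ℕ) (k : J) (hk : n (some k) = 0) (t : ℕ) :
    mon C u (n.update (some k) t) = mon C u n * yh C u k ^ t := by
  rw [mon, mon, yh, ← Finset.prod_pow, ← Finset.prod_mul_distrib]
  refine Finset.prod_congr rfl fun j _ => ?_
  rw [ex_upd n k hk, zpow_add₀ (hu j), zpow_mul, zpow_natCast]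

theorem ex_k (n : Option J →₀ ℕ) (k : J) : ex C n k = (bt (cm C (some k)) n : ℤ) - bt (cp C (some k)) n := by
  have h1 := om_bs (B := C) (some k) n
  have h2 : om C (bs (some k)) n = -(ex C n k : ℚ) := by
    rw [om, pr, Finset.sum_eq_single (some k)]
    · simp [ps, ex]
    · intro i _ hi
      rw [Finsupp.single_eq_of_ne hi]; simp
    · simp
  have h3 : (ex C n k : ℚ) = ((bt (cm C (some k)) n : ℤ) - bt (cp C (some k)) n : ℤ) := by
    push_cast
    linarith
  exact_mod_cast h3

theorem yh_mut [Skew C] [Skew C'] {k : J} {c : Option J → ℕ} (M : Mt C' C (some k) c) {u : J → K} (x : K) :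
    yh C' (Function.update u k x) k = (yh C u k)⁻¹ := by
  rw [yh, yh, ← Finset.prod_inv_distrib]
  refine Finset.prod_congr rfl fun j _ => ?_
  by_cases hj : j = k
  · subst hj
    rw [Skew.diag (B := C') (some j), Skew.diag (B := C) (some j)]; simp
  · rw [Function.update_of_ne hj, M.hik, neg_neg, zpow_neg]

theorem mon_mut [Skew C] [Skew C'] {k : J} (M : Mt C' C (some k) (cp C' (some k))) {u : J → K} (hu : ∀ j, u j ≠ 0)
    {x : K} (hx0 : 1 + yh C u k ≠ 0) (hx : x = (∏ j, u j ^ cp C' (some k) (some j)) * (1 + yh C u k) / u k)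
    (n : Option J →₀ ℕ) (hn : n (some k) = 0) :
    mon C u n * (yh C u k ^ bt (cp C' (some k)) n) * (1 + yh C u k) ^ bt (cm C' (some k)) n =
      mon C' (Function.update u k x) n * (1 + yh C u k) ^ bt (cp C' (some k)) n := by
  set c := cp C' (some k) with hc
  set y := yh C u k with hy
  set bp := bt c n with hbp
  set bm := bt (cm C' (some k)) n with hbm
  have hyne : y ≠ 0 := by
    rw [hy, yh]
    exact Finset.prod_ne_zero_iff.2 fun j _ => zpow_ne_zero _ (hu j)
  have exC' : ex C' n k = (bm : ℤ) - bp := ex_k n k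
  have exC : ex C n k = (bp : ℤ) - bm := by
    rw [ex_k, M.cp_eq, M.cm_eq]
  have hP : (∏ j, u j ^ c (some j)) ≠ 0 := Finset.prod_ne_zero_iff.2 fun j _ => pow_ne_zero _ (hu j)
  have e1 : mon C' (Function.update u k x) n = (∏ j, u j ^ (if j = k then (bp : ℤ) - bm else ex C' n j)) *
      ((∏ j, u j ^ c (some j)) * (1 + y)) ^ ((bm : ℤ) - bp) := by
    rw [mon, ← Finset.mul_prod_erase _ _ (Finset.mem_univ k),
      ← Finset.mul_prod_erase Finset.univ (fun j => u j ^ (if j = k then (bp : ℤ) - bm else ex C' n j)) (Finset.mem_univ k)]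
    have : ∏ j ∈ Finset.univ.erase k, Function.update u k x j ^ ex C' n j =
        ∏ j ∈ Finset.univ.erase k, u j ^ (if j = k then (bp : ℤ) - bm else ex C' n j) := by
      refine Finset.prod_congr rfl fun j hj => ?_
      have hj := Finset.ne_of_mem_erase hj
      rw [Function.update_of_ne hj, if_neg hj]
    rw [this, Function.update_self, if_pos rfl, exC', hx, div_zpow, show (bp : ℤ) - bm = -((bm : ℤ) - bp) by ring,
      zpow_neg, div_eq_mul_inv]
    ring
  have e2 : ∀ j, ex C n j = (if j = k then (bp : ℤ) - bm else ex C' n j) + (c (some j) : ℤ) * ((bm : ℤ) - bp)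
      + (-C (some j) (some k)) * (-(bp : ℤ)) := by
    intro j
    by_cases hj : j = k
    · subst hj
      rw [if_pos rfl, exC, M.ck, Skew.diag (B := C) (some j)]; simp
    · rw [if_neg hj, ← exC', ex, ex, ex]
      have hbp' : (bp : ℤ) = ∑ i, (c i : ℤ) * n i := by rw [hbp, bt]; push_cast; rfl
      rw [hbp', M.hik]
      simp only [mul_neg, neg_neg, neg_mul, Finset.mul_sum]
      rw [← Finset.sum_neg_distrib, ← Finset.sum_neg_distrib, ← Finset.sum_neg_distrib, ← Finset.sum_neg_distrib, ← Finset.sum_add_distrib,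
        ← Finset.sum_add_distrib]
      refine Finset.sum_congr rfl fun i _ => ?_
      by_cases hi : i = some k
      · subst hi; rw [hn]; simp
      · rw [M.hij (some j) i (by simpa using hj) hi]; ring
  have e3 : mon C u n = (∏ j, u j ^ (if j = k then (bp : ℤ) - bm else ex C' n j)) *
      (∏ j, u j ^ c (some j)) ^ ((bm : ℤ) - bp) * y ^ (-(bp : ℤ)) := by
    rw [mon, hy, yh, ← Finset.prod_zpow, ← Finset.prod_zpow, ← Finset.prod_mul_distrib, ← Finset.prod_mul_distrib]
    refine Finset.prod_congr rfl fun j _ => ?_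
    rw [e2 j, zpow_add₀ (hu j), zpow_add₀ (hu j), zpow_mul, zpow_natCast, zpow_mul]
  rw [e1, e3, mul_zpow, zpow_sub₀ hx0, zpow_natCast, zpow_natCast, zpow_neg, zpow_natCast]
  field_simp

/-- the box -/
def box (J : Type) [Fintype J] [DecidableEq J] (N : ℕ) : Finset (Option J →₀ ℕ) :=
  (Finset.Iic (Finsupp.equivFunOnFinite.symm fun _ => N)).filter fun n => n none = 1

theorem mem_box {N : ℕ} {n : Option J →₀ ℕ} : n ∈ box J N ↔ (∀ i, n i ≤ N) ∧ n none = 1 := by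
  rw [box, Finset.mem_filter, Finset.mem_Iic, Finsupp.le_def]
  simp

theorem box_fib (k : J) (N : ℕ) (f : (Option J →₀ ℕ) → K) :
    ∑ n ∈ box J N, f n = ∑ n ∈ (box J N).filter (fun n => n (some k) = 0),
      ∑ t ∈ Finset.range (N + 1), f (n.update (some k) t) := by
  rw [← Finset.sum_product']
  refine Finset.sum_nbij' (fun n => (n.update (some k) 0, n (some k))) (fun p => p.1.update (some k) p.2)
    ?_ ?_ ?_ ?_ ?_
  · intro n hn
    rw [mem_box] at hn
    rw [Finset.mem_product, Finset.mem_filter, mem_box, Finset.mem_range]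
    refine ⟨⟨⟨fun i => ?_, ?_⟩, ?_⟩, ?_⟩
    · by_cases hi : i = some k
      · subst hi; simp
      · rw [upd_i _ _ _ _ hi]; exact hn.1 i
    · rw [upd_i _ _ _ _ (by simp)]; exact hn.2
    · simp
    · have := hn.1 (some k); simp only; omega
  · rintro ⟨n, t⟩ hp
    rw [Finset.mem_product, Finset.mem_filter, mem_box, Finset.mem_range] at hp
    simp only at hp ⊢
    rw [mem_box]
    refine ⟨fun i => ?_, ?_⟩
    · by_cases hi : i = some k
      · subst hi; simp; omega
      · rw [upd_i _ _ _ _ hi]; exact hp.1.1.1 i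
    · rw [upd_i _ _ _ _ (by simp)]; exact hp.1.1.2
  · intro n hn
    simp only
    rw [upd_upd]
    simp
  · rintro ⟨n, t⟩ hp
    rw [Finset.mem_product, Finset.mem_filter, mem_box, Finset.mem_range] at hp
    simp only at hp ⊢
    rw [upd_upd, ← hp.1.2]
    simp
  · intro n hn
    simp only
    rw [upd_upd]
    simp

/-- boundedness of the support -/
def Bd (a : (Option J →₀ ℕ) → ℚ) (N : ℕ) : Prop := ∀ n, n none = 1 → a n ≠ 0 → n ∈ box J N

/-- the Laurent sum -/
def Sm (C : Matrix (Option J) (Option J) ℤ) (a : (Option J →₀ ℕ) → ℚ) (u : J → K) (N : ℕ) : K :=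
  ∑ n ∈ box J N, (a n : K) * mon C u n

theorem box_mono {N N' : ℕ} (h : N ≤ N') : box J N ⊆ box J N' := by
  intro n hn
  rw [mem_box] at *
  exact ⟨fun i => (hn.1 i).trans h, hn.2⟩

theorem Sm_mono {a : (Option J →₀ ℕ) → ℚ} {N N' : ℕ} (hb : Bd a N) (h : N ≤ N') (u : J → K) :
    Sm C a u N = Sm C a u N' := by
  refine Finset.sum_subset (box_mono h) fun n hn hn' => ?_
  have : a n = 0 := by
    by_contra hc
    exact hn' (hb n (mem_box.1 hn).2 hc)
  rw [this]; simp

theorem Sm_mut [Skew C] [Skew C'] {k : J} (M : Mt C' C (some k) (cp C' (some k)))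
    {a a' : (Option J →₀ ℕ) → ℚ} (hL : ∀ n, n ∉ LS (some k) (cp C' (some k)) → a n = 0)
    (ha : ∀ n, a' n = sh C (bs (some k)) 1 (rx (some k) (cp C' (some k)) a) n)
    {N : ℕ} (hb : Bd a N) (hb' : Bd a' N) {u : J → K} (hu : ∀ j, u j ≠ 0)
    {x : K} (hx0 : 1 + yh C u k ≠ 0) (hx : x = (∏ j, u j ^ cp C' (some k) (some j)) * (1 + yh C u k) / u k) :
    Sm C' a (Function.update u k x) N = Sm C a' u N := by
  have hyne : yh C u k ≠ 0 := by
    rw [yh]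
    exact Finset.prod_ne_zero_iff.2 fun j _ => zpow_ne_zero _ (hu j)
  have hxne : x ≠ 0 := by
    rw [hx]
    exact div_ne_zero (mul_ne_zero (Finset.prod_ne_zero_iff.2 fun j _ => pow_ne_zero _ (hu j)) hx0) (hu k)
  have hv : ∀ j, Function.update u k x j ≠ 0 := by
    intro j
    by_cases hj : j = k
    · subst hj; simpa using hxne
    · rw [Function.update_of_ne hj]; exact hu j
  rw [Sm, Sm, box_fib k, box_fib k]
  refine Finset.sum_congr rfl fun n hn => ?_
  rw [Finset.mem_filter, mem_box] at hn
  obtain ⟨⟨hn1, hn2⟩, hnk⟩ := hn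
  have hbt : ∀ (c : Option J → ℕ), c (some k) = 0 → ∀ t, bt c (n.update (some k) t) = bt c n := fun c hc t =>
    bt_congr hc fun i hi => upd_i _ _ _ _ hi
  have hlv : ∀ t, (n.update (some k) t) none = 1 := fun t => by rw [upd_i _ _ _ _ (by simp)]; exact hn2
  have hz : ∀ (b : (Option J →₀ ℕ) → ℚ), Bd b N → ∀ t, N < t → b (n.update (some k) t) = 0 := by
    intro b hb t ht
    by_contra hc
    have := (mem_box.1 (hb _ (hlv t) hc)).1 (some k)
    simp at this
    omega
  have key := poly_fib (K := K) (U := fun t => a (n.update (some k) t)) (A := fun t => a' (n.update (some k) t))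
    (bp := bt (cp C' (some k)) n) (bm := bt (cm C' (some k)) n) (N := N) (by
      intro t ht
      apply hL
      rw [mem_LS, hbt _ M.ck]
      simpa using ht) (hz a hb) (hz a' hb') (by
      intro t
      rw [ha, sh_k]
      rw [show (n.update (some k) t) (some k) = t by simp]
      refine Finset.sum_congr rfl fun j _ => ?_
      congr 1
      · congr 1
        rw [one_mul, om_bs, M.cp_eq, M.cm_eq, hbt _ M.ck, hbt _ (cm_self _)]
      · rw [upd_upd, rx, hbt _ M.ck, sg, upd_upd, hbt _ M.ck]
        simp) hyne
  have m1 : ∀ t, mon C u (n.update (some k) t) = mon C u n * yh C u k ^ t := mon_upd hu n k hnk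
  have m2 : ∀ t, mon C' (Function.update u k x) (n.update (some k) t) =
      mon C' (Function.update u k x) n * ((yh C u k)⁻¹) ^ t := by
    intro t
    rw [mon_upd hv n k hnk, yh_mut M]
  have m3 := mon_mut M hu hx0 hx n hnk
  simp only [m1, m2]
  have l : ∀ (b : ℕ → K) (w z : K), ∑ t ∈ Finset.range (N + 1), b t * (w * z ^ t) =
      w * ∑ t ∈ Finset.range (N + 1), b t * z ^ t := by
    intro b w z
    rw [Finset.mul_sum]
    exact Finset.sum_congr rfl fun t _ => by ring
  rw [l, l]
  have hp1 := pow_ne_zero (bt (cp C' (some k)) n) hx0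
  apply mul_right_cancel₀ hp1
  rw [mul_assoc (mon C u n), key]
  linear_combination (-(∑ t ∈ Finset.range (N + 1), (a (n.update (some k) t) : K) * (yh C u k)⁻¹ ^ t)) * m3

theorem Bd_mut [Skew C] {k : J} {c c' : Option J → ℕ} (hc' : c' (some k) = 0)
    {a a' : (Option J →₀ ℕ) → ℚ} (hL : ∀ n, n ∉ LS (some k) c' → a' n = 0)
    (ha : ∀ n, a' n = sh C (bs (some k)) 1 (rx (some k) c a) n)
    {N : ℕ} (hb : Bd a N) : Bd a' (N + ∑ i, c' i * N) := by
  intro n hn hne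
  have hi : ∀ i, i ≠ some k → n i ≤ N := by
    rw [ha, sh_k] at hne
    obtain ⟨j, -, hj⟩ := Finset.exists_ne_zero_of_sum_ne_zero hne
    have hj := right_ne_zero_of_mul hj
    rw [rx] at hj
    split_ifs at hj with h
    · intro i hi
      have := (mem_box.1 (hb _ (by rw [sg_i (by simp), upd_i _ _ _ _ (by simp)]; exact hn) hj)).1 i
      rwa [sg_i hi, upd_i _ _ _ _ hi] at this
    · exact absurd rfl hj
  rw [mem_box]
  refine ⟨fun i => ?_, hn⟩
  by_cases hik : i = some k
  · subst hik
    have h1 : n (some k) ≤ bt c' n := by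
      by_contra hc
      exact hne (hL n (by rw [mem_LS]; exact hc))
    have h2 : bt c' n ≤ ∑ i, c' i * N := by
      rw [bt]
      refine Finset.sum_le_sum fun i _ => ?_
      by_cases hik : i = some k
      · subst hik; rw [hc']; simp
      · exact Nat.mul_le_mul_left _ (hi i hik)
    omega
  · have := hi i hik
    omega

theorem int_mut {k : J} {c : Option J → ℕ} {a a' : (Option J →₀ ℕ) → ℚ}
    (ha : ∀ n, a' n = sh C (bs (some k)) 1 (rx (some k) c a) n)
    (h : ∀ n, n none = 1 → ∃ z : ℤ, a n = z) (n : Option J →₀ ℕ) (hn : n none = 1) : ∃ z : ℤ, a' n = z := by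
  have t1 : ∀ j : ℕ, ∃ z : ℤ, ch (1 * om C (bs (some k)) n) j * rx (some k) c a (n.update (some k) (n (some k) - j)) = z := by
    intro j
    have e : (1 * om C (bs (some k)) n) = (((bt (cp C (some k)) n : ℤ) - bt (cm C (some k)) n : ℤ) : ℚ) := by
      rw [om_bs]; push_cast; ring
    obtain ⟨y, hy⟩ := ch_int ((bt (cp C (some k)) n : ℤ) - bt (cm C (some k)) n) j
    rw [e, hy, rx]
    split_ifs with h'
    · obtain ⟨z, hz⟩ := h (sg (some k) c (n.update (some k) (n (some k) - j)))
        (by rw [sg_i (by simp), upd_i _ _ _ _ (by simp)]; exact hn)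
      exact ⟨y * z, by rw [hz]; push_cast; ring⟩
    · exact ⟨0, by simp⟩
  choose z hz using t1
  refine ⟨∑ j ∈ Finset.range (n (some k) + 1), z j, ?_⟩
  rw [ha, sh_k, Int.cast_sum]
  exact Finset.sum_congr rfl fun j _ => hz j

end Part18
end Cluster


namespace Cluster

noncomputable section Part19

variable {r : ℕ}

/-- rational functions with a subtraction-free shadow: positive at the all-ones point -/
def Ps (r : ℕ) (x : F r) : Prop := ∃ p q : MvPolynomial (Fin r) ℚ, 0 < MvPolynomial.eval (fun _ => (1 : ℚ)) p ∧
  0 < MvPolynomial.eval (fun _ => (1 : ℚ)) q ∧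
  x = algebraMap (MvPolynomial (Fin r) ℚ) (F r) p / algebraMap (MvPolynomial (Fin r) ℚ) (F r) q

theorem am_ne {p : MvPolynomial (Fin r) ℚ} (h : 0 < MvPolynomial.eval (fun _ => (1 : ℚ)) p) :
    algebraMap (MvPolynomial (Fin r) ℚ) (F r) p ≠ 0 := by
  intro h0
  rw [map_eq_zero_iff _ (IsFractionRing.injective (MvPolynomial (Fin r) ℚ) (F r))] at h0
  rw [h0] at h
  simp at h

theorem Ps.ne {x : F r} (h : Ps r x) : x ≠ 0 := by
  obtain ⟨p, q, hp, hq, rfl⟩ := h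
  exact div_ne_zero (am_ne hp) (am_ne hq)

theorem Ps.one : Ps r 1 := ⟨1, 1, by simp, by simp, by simp⟩

theorem Ps.X (i : Fin r) : Ps r (Xvar r i) := ⟨MvPolynomial.X i, 1, by simp, by simp, by simp [Xvar]⟩

theorem Ps.mul {x y : F r} (hx : Ps r x) (hy : Ps r y) : Ps r (x * y) := by
  obtain ⟨p, q, hp, hq, rfl⟩ := hx
  obtain ⟨p', q', hp', hq', rfl⟩ := hy
  refine ⟨p * p', q * q', ?_, ?_, ?_⟩
  · rw [map_mul]; positivity
  · rw [map_mul]; positivity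
  · rw [map_mul, map_mul, div_mul_div_comm]

theorem Ps.inv {x : F r} (hx : Ps r x) : Ps r x⁻¹ := by
  obtain ⟨p, q, hp, hq, rfl⟩ := hx
  exact ⟨q, p, hq, hp, by rw [inv_div]⟩

theorem Ps.add {x y : F r} (hx : Ps r x) (hy : Ps r y) : Ps r (x + y) := by
  obtain ⟨p, q, hp, hq, rfl⟩ := hx
  obtain ⟨p', q', hp', hq', rfl⟩ := hy
  refine ⟨p * q' + q * p', q * q', ?_, ?_, ?_⟩
  · rw [map_add, map_mul, map_mul]; positivity
  · rw [map_mul]; positivity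
  · rw [map_add, map_mul, map_mul, map_mul, div_add_div _ _ (am_ne hq) (am_ne hq')]

theorem Ps.pow {x : F r} (hx : Ps r x) (n : ℕ) : Ps r (x ^ n) := by
  induction n with
  | zero => rw [pow_zero]; exact Ps.one
  | succ n ih => rw [pow_succ]; exact ih.mul hx

theorem Ps.zpow {x : F r} (hx : Ps r x) (n : ℤ) : Ps r (x ^ n) := by
  cases n with
  | ofNat n => rw [Int.ofNat_eq_natCast, zpow_natCast]; exact hx.pow n
  | negSucc n => rw [zpow_negSucc]; exact (hx.pow _).inv

theorem Ps.prod {α : Type} (s : Finset α) (f : α → F r) (h : ∀ i ∈ s, Ps r (f i)) : Ps r (∏ i ∈ s, f i) :=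
  Finset.prod_induction f (Ps r) (fun _ _ => Ps.mul) Ps.one h

/-- one mutation step -/
def stp (r : ℕ) (p : (Fin r → F r) × Matrix (Fin r) (Fin r) ℤ) (k : Fin r) :
    (Fin r → F r) × Matrix (Fin r) (Fin r) ℤ := (mutateU r p.1 p.2 k, mutateB r p.2 k)

theorem seed_list {B0 B : Matrix (Fin r) (Fin r) ℤ} {u : Fin r → F r} (h : IsSeed r B0 u B) :
    ∃ ks : List (Fin r), (u, B) = ks.foldl (stp r) (Xvar r, B0) := by
  induction h with
  | init => exact ⟨[], rfl⟩
  | mutate k h ih =>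
    obtain ⟨ks, e⟩ := ih
    refine ⟨ks ++ [k], ?_⟩
    rw [List.foldl_append, ← e]
    rfl

theorem Ps_mutVar {u : Fin r → F r} (hu : ∀ j, Ps r (u j)) (B : Matrix (Fin r) (Fin r) ℤ) (k : Fin r) :
    Ps r (mutateVar r u B k) := by
  rw [mutateVar, div_eq_mul_inv]
  exact ((Ps.prod _ _ fun i _ => (hu i).pow _).add (Ps.prod _ _ fun i _ => (hu i).pow _)).mul (hu k).inv

theorem Ps_mutU {u : Fin r → F r} (hu : ∀ j, Ps r (u j)) (B : Matrix (Fin r) (Fin r) ℤ) (k j : Fin r) :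
    Ps r (mutateU r u B k j) := by
  rw [mutateU]
  by_cases hj : j = k
  · subst hj; rw [Function.update_self]; exact Ps_mutVar hu B j
  · rw [Function.update_of_ne hj]; exact hu j

theorem Ps_yh {u : Fin r → F r} (hu : ∀ j, Ps r (u j)) (C : Matrix (Option (Fin r)) (Option (Fin r)) ℤ) (k : Fin r) :
    Ps r (yh C u k) := Ps.prod _ _ fun j _ => (hu j).zpow _

theorem mutVar_eq {u : Fin r → F r} (hu : ∀ j, Ps r (u j)) {B : Matrix (Fin r) (Fin r) ℤ}
    {C C' : Matrix (Option (Fin r)) (Option (Fin r)) ℤ} (k : Fin r) [Skew C'] [Skew C]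
    {c : Option (Fin r) → ℕ} (M : Mt C' C (some k) c) (hC : ∀ a b, C (some a) (some b) = B a b) :
    mutateVar r u B k = (∏ j, u j ^ cp C' (some k) (some j)) * (1 + yh C u k) / u k := by
  have hc : ∀ j, cp C' (some k) (some j) = (B j k).toNat := by
    intro j
    rw [← M.cm_eq, cm, ← hC, Skew.skew (B := C) (some j) (some k)]
  rw [mutateVar, mul_add, mul_one]
  congr 1
  congr 1
  · rw [Finset.prod_filter]
    refine Finset.prod_congr rfl fun j _ => ?_
    rw [hc]
    split_ifs with h
    · rfl
    · rw [Int.toNat_of_nonpos (by omega), pow_zero]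
  · rw [yh, ← Finset.prod_mul_distrib, Finset.prod_filter]
    refine Finset.prod_congr rfl fun j _ => ?_
    rw [hc, hC, ← zpow_natCast (u j) (B j k).toNat, ← zpow_add₀ (hu j).ne, Int.toNat_eq_max]
    split_ifs with h
    · rw [← zpow_natCast]
      congr 1
      omega
    · rw [show max (B j k) 0 + -B j k = 0 by omega, zpow_zero]

/-- extended matrix at the start -/
def Bex (B : Matrix (Fin r) (Fin r) ℤ) (i : Fin r) : Matrix (Option (Fin r)) (Option (Fin r)) ℤ
  | some a, some b => B a b
  | some a, none => if a = i then -1 else 0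
  | none, some b => if b = i then 1 else 0
  | none, none => 0

instance Bex_skew (B : Matrix (Fin r) (Fin r) ℤ) (i : Fin r) [h : Skew B] : Skew (Bex B i) where
  skew a b := by
    rcases a with _ | a <;> rcases b with _ | b
    · simp [Bex]
    · simp only [Bex]; split_ifs <;> simp
    · simp only [Bex]; split_ifs <;> simp
    · exact h.skew a b

theorem bs_lg {C : Matrix (Option (Fin r)) (Option (Fin r)) ℤ} [Skew C] (hC : ∀ j, 0 ≤ C none j) {g : Alg C} (hg : Inc C g)
    (n : Option (Fin r) →₀ ℕ) (hn : n none = 1) : xl (ev none) g n = if n = bs none then 1 else 0 := by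
  have h0 : n ≠ 0 := by rintro rfl; simp at hn
  rw [base_xl hC hg h0]
  split_ifs with h
  · rw [h, lg_self (bs_ne _)]
  · refine lg_not _ fun j hj => h ?_
    have : j = 1 := by
      have := hn
      rw [hj] at this
      simpa using this
    rw [hj, this, one_smul]

theorem mon_bs (B : Matrix (Fin r) (Fin r) ℤ) (i : Fin r) (u : Fin r → F r) : mon (Bex B i) u (bs none) = u i := by
  have e : ∀ j, ex (Bex B i) (bs none) j = if j = i then 1 else 0 := by
    intro j
    rw [ex, Finset.sum_eq_single none]
    · simp only [Bex]; split_ifs <;> simp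
    · intro b _ hb; rw [Finsupp.single_eq_of_ne hb]; simp
    · simp
  rw [mon, Finset.prod_eq_single i]
  · rw [e, if_pos rfl, zpow_one]
  · intro j _ hj; rw [e, if_neg hj, zpow_zero]
  · simp

theorem claim (i : Fin r) (ks : List (Fin r)) : ∀ (B : Matrix (Fin r) (Fin r) ℤ), Skew B →
    ∃ (C : Matrix (Option (Fin r)) (Option (Fin r)) ℤ) (_ : Skew C) (g : Alg C) (N : ℕ),
      (∀ a b, C (some a) (some b) = B a b) ∧ Inc C g ∧
      (∀ n, n none = 1 → ∃ z : ℤ, xl (ev none) g n = z) ∧ Bd (xl (ev none) g) N ∧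
      ∀ u : Fin r → F r, (∀ j, Ps r (u j)) → (ks.foldl (stp r) (u, B)).1 i = Sm C (xl (ev none) g) u N := by
  induction ks with
  | nil =>
    intro B hB
    obtain ⟨g, hg⟩ := exists_inc (Bex B i)
    have hx := bs_lg (C := Bex B i) (by
      intro j
      rcases j with _ | j
      · simp [Bex]
      · simp only [Bex]; split_ifs <;> simp) hg
    have hbd : Bd (xl (ev none) g) 1 := by
      intro n hn hne
      rw [hx n hn] at hne
      have : n = bs none := by
        by_contra hc
        rw [if_neg hc] at hne
        exact hne rfl
      rw [mem_box]
      refine ⟨fun j => ?_, hn⟩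
      rw [this, Finsupp.single_apply]
      split_ifs <;> simp
    refine ⟨Bex B i, inferInstance, g, 1, fun a b => rfl, hg, fun n hn => ?_, hbd, fun u hu => ?_⟩
    · rw [hx n hn]
      split_ifs
      · exact ⟨1, by simp⟩
      · exact ⟨0, by simp⟩
    · rw [List.foldl_nil, Sm, Finset.sum_eq_single (bs none)]
      · rw [hx _ (by simp), if_pos rfl, mon_bs]; simp
      · intro n hn hne
        rw [hx n (mem_box.1 hn).2, if_neg hne]; simp
      · intro hn
        have : xl (ev none) g (bs none) = 0 := by
          by_contra hc
          exact hn (hbd _ (by simp) hc)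
        rw [this]; simp
  | cons k ks ih =>
    intro B hB
    obtain ⟨C', hC', g', N, hr, hg', hint, hbd, hS⟩ := ih (mB B k) (mB_skew B k)
    have M := mB_cp C' (some k)
    have M' := mB_cm C' (some k)
    obtain ⟨g, hg⟩ := exists_inc (mB C' (some k))
    obtain ⟨hL, ha⟩ := mut_main (o := none) (by simp) M M' hg' hg
    have N1 := M'.symm
    have N2 := M.symm
    rw [← M.cp_eq] at N1
    rw [← M.cm_eq] at N2
    obtain ⟨hL', -⟩ := mut_main (o := none) (by simp) N1 N2 hg hg'
    have hb' := Bd_mut (cp_self (some k)) hL' ha hbd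
    set N' := N + ∑ i, cp (mB C' (some k)) (some k) i * N
    have hNN : N ≤ N' := Nat.le_add_right _ _
    have hres : ∀ a b, mB C' (some k) (some a) (some b) = B a b := by
      intro a b
      have h1 : mB C' (some k) (some a) (some b) = mB (mB B k) k a b := by
        simp only [mB, Option.some.injEq, hr]
      rw [h1, mB_mB]
    refine ⟨mB C' (some k), mB_skew _ _, g, N', hres, hg, int_mut ha hint, hb', fun u hu => ?_⟩
    rw [List.foldl_cons]
    have e : stp r (u, B) k = (mutateU r u B k, mB B k) := rfl
    rw [e, hS _ (Ps_mutU hu B k), Sm_mono hbd hNN, mutateU]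
    have hbN : Bd (xl (ev none) g') N' := fun n hn hne => box_mono hNN (hbd n hn hne)
    exact Sm_mut M hL ha hbN hb' (fun j => (hu j).ne) (Ps.one.add (Ps_yh hu _ k)).ne (mutVar_eq hu k M hres)

theorem main_pos (B0 : Matrix (Fin r) (Fin r) ℤ) (hB0 : ∀ i j, B0 i j = -B0 j i)
    (v : F r) (hv : IsClusterVariable r B0 v) :
    v ∈ Subsemiring.closure
      (Set.range (Xvar r) ∪ Set.range fun i => (Xvar r i)⁻¹) := by
  obtain ⟨u, B, hs, i, rfl⟩ := hv
  obtain ⟨ks, hks⟩ := seed_list hs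
  obtain ⟨C, hC, g, N, -, hg, hint, -, hS⟩ := claim i ks B0 ⟨hB0⟩
  have := hS (Xvar r) Ps.X
  rw [← hks] at this
  change u i = _ at this
  rw [this, Sm]
  refine Subsemiring.sum_mem _ fun n hn => Subsemiring.mul_mem _ ?_ ?_
  · have hn1 := (mem_box.1 hn).2
    obtain ⟨z, hz⟩ := hint n hn1
    have h0 := xl_nonneg hg hn1
    rw [hz] at h0 ⊢
    obtain ⟨m, rfl⟩ := Int.eq_ofNat_of_zero_le (by exact_mod_cast h0 : 0 ≤ z)
    push_cast
    exact natCast_mem _ m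
  · rw [mon]
    refine Subsemiring.prod_mem _ fun j _ => ?_
    have h1 : Xvar r j ∈ Subsemiring.closure (Set.range (Xvar r) ∪ Set.range fun i => (Xvar r i)⁻¹) :=
      Subsemiring.subset_closure (Or.inl ⟨j, rfl⟩)
    have h2 : (Xvar r j)⁻¹ ∈ Subsemiring.closure (Set.range (Xvar r) ∪ Set.range fun i => (Xvar r i)⁻¹) :=
      Subsemiring.subset_closure (Or.inr ⟨j, rfl⟩)
    cases ex C n j with
    | ofNat m => rw [Int.ofNat_eq_natCast, zpow_natCast]; exact Subsemiring.pow_mem _ h1 m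
    | negSucc m => rw [zpow_negSucc, ← inv_pow]; exact Subsemiring.pow_mem _ h2 _

end Part19
end Cluster


/-- **Positivity, Lee–Schiffler.** Assume the initial exchange
matrix `B0` is skew-symmetric. Then every cluster variable obtained from the
initial seed `((X_1, …, X_r), B0)` by a finite sequence of mutations lies in
`ℤ_{≥0}[X_1^{±1}, …, X_r^{±1}]`, the subsemiring of `F` generated by the `X_i`
and their inverses. -/
theorem positivity_of_cluster_variables (r : ℕ) (hr : 1 ≤ r)
    (B0 : Matrix (Fin r) (Fin r) ℤ) (hB0 : ∀ i j, B0 i j = -B0 j i)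
    (v : F r) (hv : IsClusterVariable r B0 v) :
    v ∈ Subsemiring.closure
      (Set.range (Xvar r) ∪ Set.range fun i => (Xvar r i)⁻¹) := by
  exact main_pos B0 hB0 v hv
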